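/- (Yoccoz) If the irrational number α satisfies condition H, then every orientation-preserving analytic diffeomorphism f of the circle with rotation number ρ(f) = α is analytically linearizable: there exists an analytic circle diffeomorphism h with h∘f = T_α∘h. -/

import Mathlib

open Filter Topology

/-- `ρ` is the rotation (translation) number of the lift `F`. -/
def IsRotNumber (F : ℝ → ℝ) (ρ : ℝ) : Prop :=
  ∀ x : ℝ, Tendsto (fun n : ℕ => (F^[n] x - x) / (n : ℝ)) atTop (𝓝 ρ)

/-- Iterates of the Gauss map `G(x) = {1/x}`, starting from the fractional part of `α`:
`α₀ = {α}`, `α_{n+1} = {1/α_n}`. -/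
noncomputable def gaussIter (α : ℝ) : ℕ → ℝ
  | 0 => Int.fract α
  | n + 1 => Int.fract (gaussIter α n)⁻¹

/-- The `(n+1)`-st partial quotient `a_{n+1} = ⌊1/α_n⌋` of the continued fraction of `α`. -/
noncomputable def cfa (α : ℝ) (n : ℕ) : ℕ := ⌊(gaussIter α n)⁻¹⌋₊

/-- The denominators `q_n` of the convergents of `α`: `q₀ = 1`, `q₁ = a₁`,
`q_{n+2} = a_{n+2} q_{n+1} + q_n`. -/
noncomputable def qden (α : ℝ) : ℕ → ℕ
  | 0 => 1
  | 1 => cfa α 0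
  | n + 2 => cfa α (n + 1) * qden α (n + 1) + qden α n

/-- The Brjuno condition: `Σ_n log(q_{n+1})/q_n < ∞`. -/
def IsBrjuno (α : ℝ) : Prop :=
  Summable fun n : ℕ => Real.log (qden α (n + 1)) / (qden α n : ℝ)

/-- The Brjuno function `B(α) = Σ_{n≥0} (α₀ ⋯ α_{n-1}) log(1/α_n)` (with values in
`[0,∞]`), the `1`-periodic solution of `B(x) = x B({1/x}) + log(1/x)` on `(0,1)`;
`α` is a Brjuno number iff `B(α) < ∞`. -/
noncomputable def brjunoFunction (α : ℝ) : ENNReal :=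
  ∑' n : ℕ, ENNReal.ofReal
    ((∏ k ∈ Finset.range n, gaussIter α k) * Real.log (gaussIter α n)⁻¹)

/-- Yoccoz's function `𝓡_α`: `𝓡_α(r) = α⁻¹ (r - log α⁻¹ + 1)` for `r ≥ log α⁻¹`,
and `𝓡_α(r) = e^r` for `r ≤ log α⁻¹`. -/
noncomputable def Rcal (α r : ℝ) : ℝ :=
  if Real.log α⁻¹ ≤ r then α⁻¹ * (r - Real.log α⁻¹ + 1) else Real.exp r

/-- The sequence `R_n(α)`: `R_0(α) = 0`, `R_{n+1}(α) = 𝓡_{α_n}(R_n(α))` where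
`α_n = Gⁿ(α)` are the Gauss iterates. -/
noncomputable def Rseq (α : ℝ) : ℕ → ℝ
  | 0 => 0
  | n + 1 => Rcal (gaussIter α n) (Rseq α n)

/-- Yoccoz's condition `𝓗`: `α` is a Brjuno number and for every `m` there is a `k ≥ 0`
with `R_k(α_m) ≥ B(α_{m+k})`. -/
def SatisfiesCondH (α : ℝ) : Prop :=
  IsBrjuno α ∧ ∀ m : ℕ, ∃ k : ℕ,
    brjunoFunction (gaussIter α (m + k)) ≤ ENNReal.ofReal (Rseq (gaussIter α m) k)

/-- (A lift of) an orientation-preserving analytic circle diffeomorphism extending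
holomorphically and injectively to the strip `T_ν = {|Im z| ≤ ν}/ℤ`. -/
structure AnalyticCircleDiffeo (ν : ℝ) where
  toFun : ℂ → ℂ
  diffOn : DifferentiableOn ℂ toFun {z : ℂ | |z.im| ≤ ν}
  injOn : Set.InjOn toFun {z : ℂ | |z.im| ≤ ν}
  real_toFun : ∀ x : ℝ, (toFun x).im = 0
  map_add_one : ∀ z, toFun (z + 1) = toFun z + 1
  strictMono_real : StrictMono fun x : ℝ => (toFun x).re

namespace CircleLin

open MeasureTheory ComplexConjugate

/-- the function `sin (π w / 2)` -/
noncomputable def sn (w : ℂ) : ℂ := Complex.sin (Real.pi / 2 * w)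

/-- the kernel `(π / 2) cot (π w / 2)` -/
noncomputable def kap (w : ℂ) : ℂ :=
  (Real.pi / 2 : ℂ) * (Complex.cos (Real.pi / 2 * w) / Complex.sin (Real.pi / 2 * w))

/-- points uniformly far from the poles of `kap` -/
def Reg (w : ℂ) : Prop := (1 / 20 ≤ |w.re| ∧ |w.re| ≤ 39 / 20) ∨ 1 / 4 ≤ |w.im|

lemma norm_sin_sq (x y : ℝ) :
    ‖Complex.sin (x + y * Complex.I)‖ ^ 2 = Real.sin x ^ 2 + Real.sinh y ^ 2 := by
  rw [Complex.sin_add_mul_I, ← Complex.normSq_eq_norm_sq, ← Complex.ofReal_sin,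
    ← Complex.ofReal_cosh, ← Complex.ofReal_cos, ← Complex.ofReal_sinh, Complex.normSq_apply]
  simp only [Complex.add_re, Complex.add_im, Complex.sub_re, Complex.sub_im, Complex.mul_re, Complex.mul_im, Complex.ofReal_re,
    Complex.ofReal_im, Complex.I_re, Complex.I_im]
  have h1 := Real.cosh_sq y
  have h2 := Real.sin_sq_add_cos_sq x
  have : Real.cos x ^ 2 = 1 - Real.sin x ^ 2 := by linarith
  linear_combination Real.sin x ^ 2 * h1 + Real.sinh y ^ 2 * this

lemma norm_cos_sq (x y : ℝ) :
    ‖Complex.cos (x + y * Complex.I)‖ ^ 2 = Real.cos x ^ 2 + Real.sinh y ^ 2 := by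
  rw [Complex.cos_add_mul_I, ← Complex.normSq_eq_norm_sq, ← Complex.ofReal_sin,
    ← Complex.ofReal_cosh, ← Complex.ofReal_cos, ← Complex.ofReal_sinh, Complex.normSq_apply]
  simp only [Complex.add_re, Complex.add_im, Complex.sub_re, Complex.sub_im, Complex.mul_re, Complex.mul_im, Complex.ofReal_re,
    Complex.ofReal_im, Complex.I_re, Complex.I_im]
  have h1 := Real.cosh_sq y
  have h2 := Real.sin_sq_add_cos_sq x
  have : Real.sin x ^ 2 = 1 - Real.cos x ^ 2 := by linarith
  linear_combination Real.cos x ^ 2 * h1 + Real.sinh y ^ 2 * this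

lemma half_pi_mul (w : ℂ) : (Real.pi / 2 * w : ℂ) =
    ((Real.pi / 2 * w.re : ℝ) : ℂ) + ((Real.pi / 2 * w.im : ℝ) : ℂ) * Complex.I := by
  apply Complex.ext <;> simp

lemma sq_le_sinh_sq (y : ℝ) : y ^ 2 ≤ Real.sinh y ^ 2 := by
  rcases le_total 0 y with h | h
  · exact pow_le_pow_left₀ h (Real.self_le_sinh_iff.2 h) 2
  · have := Real.sinh_le_self_iff.2 h
    nlinarith

lemma norm_sn_sq (w : ℂ) :
    ‖sn w‖ ^ 2 = Real.sin (Real.pi / 2 * w.re) ^ 2 + Real.sinh (Real.pi / 2 * w.im) ^ 2 := by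
  rw [sn, half_pi_mul, norm_sin_sq]

lemma Reg.le_norm_sn_sq {w : ℂ} (h : Reg w) : 1 + w.im ^ 2 ≤ 400 * ‖sn w‖ ^ 2 := by
  rw [norm_sn_sq]
  have hs := sq_le_sinh_sq (Real.pi / 2 * w.im)
  have hpi := Real.pi_gt_three
  have hs' : w.im ^ 2 ≤ Real.sinh (Real.pi / 2 * w.im) ^ 2 := by
    refine le_trans ?_ hs
    rw [mul_pow]
    nlinarith [sq_nonneg w.im, show 1 ≤ (Real.pi / 2) ^ 2 by nlinarith]
  rcases h with ⟨h1, h2⟩ | h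
  · have key : 1 / 20 ≤ Real.sin (Real.pi / 2 * |w.re|) := by
      rcases le_total |w.re| 1 with h3 | h3
      · have := Real.mul_le_sin (x := Real.pi / 2 * |w.re|) (by positivity) (by nlinarith)
        have e : 2 / Real.pi * (Real.pi / 2 * |w.re|) = |w.re| := by field_simp
        linarith
      · have := Real.mul_le_sin (x := Real.pi - Real.pi / 2 * |w.re|) (by nlinarith) (by nlinarith)
        rw [Real.sin_pi_sub] at this
        have e : 2 / Real.pi * (Real.pi - Real.pi / 2 * |w.re|) = 2 - |w.re| := by field_simp
        linarith
    have e : Real.sin (Real.pi / 2 * w.re) ^ 2 = Real.sin (Real.pi / 2 * |w.re|) ^ 2 := by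
      rcases abs_cases w.re with ⟨h, _⟩ | ⟨h, _⟩
      · rw [h]
      · rw [h, mul_neg, Real.sin_neg, neg_sq]
    rw [e]
    nlinarith
  · have : 1 / 16 ≤ w.im ^ 2 := by rw [← sq_abs]; nlinarith
    nlinarith [sq_nonneg (Real.sin (Real.pi / 2 * w.re))]

lemma Reg.sn_ne {w : ℂ} (h : Reg w) : sn w ≠ 0 := by
  intro h0
  have := h.le_norm_sn_sq
  rw [h0] at this
  simp at this
  nlinarith [sq_nonneg w.im]

lemma kap_sub {w v : ℂ} (hw : sn w ≠ 0) (hv : sn v ≠ 0) :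
    kap w - kap v = (Real.pi / 2 : ℂ) * (sn (v - w) / (sn w * sn v)) := by
  unfold kap sn at *
  rw [mul_sub, Complex.sin_sub, ← mul_sub]
  generalize Complex.sin (Real.pi / 2 * w) = a at *
  generalize Complex.sin (Real.pi / 2 * v) = b at *
  congr 1
  field_simp

lemma kap_add_two (w : ℂ) : kap (w + 2) = kap w := by
  unfold kap
  rw [show (Real.pi / 2 * (w + 2) : ℂ) = Real.pi / 2 * w + Real.pi by ring, Complex.sin_add_pi,
    Complex.cos_add_pi, neg_div_neg_eq]

lemma norm_cos_le (w : ℂ) : ‖Complex.cos w‖ ≤ Real.exp ‖w‖ := by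
  rw [Complex.cos, norm_div]
  have h1 : ‖Complex.exp (w * Complex.I)‖ ≤ Real.exp ‖w‖ := by
    refine (Complex.norm_exp_le_exp_norm _).trans ?_
    simp
  have h2 : ‖Complex.exp (-w * Complex.I)‖ ≤ Real.exp ‖w‖ := by
    refine (Complex.norm_exp_le_exp_norm _).trans ?_
    simp
  have := norm_add_le (Complex.exp (w * Complex.I)) (Complex.exp (-w * Complex.I))
  rw [Complex.norm_ofNat]
  linarith

lemma norm_sn_le : ∃ C : ℝ, 0 < C ∧ ∀ w : ℂ, ‖w‖ ≤ 3 → ‖sn w‖ ≤ C * ‖w‖ := by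
  refine ⟨Real.exp 6 * 2, by positivity, fun w hw => ?_⟩
  have hc : Convex ℝ (Metric.closedBall (0 : ℂ) 6) := convex_closedBall _ _
  have hpi := Real.pi_lt_four
  have hpi0 := Real.pi_pos
  have hn : ‖(Real.pi / 2 * w : ℂ)‖ ≤ 2 * ‖w‖ := by
    rw [norm_mul]
    have : ‖(Real.pi / 2 : ℂ)‖ = Real.pi / 2 := by
      rw [norm_div, Complex.norm_real, Real.norm_eq_abs, abs_of_pos hpi0]; simp
    rw [this]
    exact mul_le_mul_of_nonneg_right (by linarith) (norm_nonneg _)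
  have := hc.norm_image_sub_le_of_norm_deriv_le (𝕜 := ℂ) (f := Complex.sin) (C := Real.exp 6)
    (x := 0) (y := Real.pi / 2 * w)
    (fun x _ => Complex.differentiable_sin x) (fun x hx => by
      rw [Complex.deriv_sin]
      refine (norm_cos_le x).trans (Real.exp_le_exp.2 ?_)
      simpa using hx) (by simp) (by simp only [mem_closedBall_zero_iff]; linarith)
  simp only [Complex.sin_zero, sub_zero] at this
  unfold sn
  refine this.trans ?_
  rw [mul_assoc]
  exact mul_le_mul_of_nonneg_left hn (Real.exp_pos _).le

lemma kap_sub_le : ∃ C : ℝ, 0 < C ∧ ∀ (w v : ℂ) (y : ℝ), Reg w → Reg v → |w.im - y| ≤ 1 →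
    |v.im - y| ≤ 1 → ‖w - v‖ ≤ 3 → ‖kap w - kap v‖ ≤ C * ‖w - v‖ / (1 + y ^ 2) := by
  obtain ⟨C, hC, h⟩ := norm_sn_le
  refine ⟨2 * C * 1200, by positivity, fun w v y hw hv hwy hvy hwv => ?_⟩
  rw [kap_sub hw.sn_ne hv.sn_ne, norm_mul (_ / _), norm_div (sn _), norm_mul (sn _)]
  have hpi := Real.pi_lt_four
  have hpi0 := Real.pi_pos
  have e : ‖(Real.pi / 2 : ℂ)‖ = Real.pi / 2 := by
    rw [norm_div, Complex.norm_real, Real.norm_eq_abs, abs_of_pos hpi0]; simp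
  have key : ∀ u : ℂ, Reg u → |u.im - y| ≤ 1 → Real.sqrt ((1 + y ^ 2) / 1200) ≤ ‖sn u‖ := by
    intro u hu huy
    rw [Real.sqrt_le_left (norm_nonneg _)]
    have := hu.le_norm_sn_sq
    have h1 : y ^ 2 ≤ 2 * u.im ^ 2 + 2 := by
      have : (u.im - y) ^ 2 ≤ 1 := by rw [← sq_abs]; nlinarith [abs_nonneg (u.im - y)]
      nlinarith [sq_nonneg (2 * u.im - y)]
    nlinarith [sq_nonneg u.im]
  have h1 := key w hw hwy
  have h2 := key v hv hvy
  have h3 : (1 + y ^ 2) / 1200 ≤ ‖sn w‖ * ‖sn v‖ := by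
    calc (1 + y ^ 2) / 1200 = Real.sqrt ((1 + y ^ 2) / 1200) * Real.sqrt ((1 + y ^ 2) / 1200) := by
          rw [Real.mul_self_sqrt (by positivity)]
      _ ≤ _ := mul_le_mul h1 h2 (Real.sqrt_nonneg _) (norm_nonneg _)
  have h4 := h (v - w) (by rwa [norm_sub_rev])
  rw [norm_sub_rev v w] at h4
  have hp : 0 < (1 + y ^ 2) / 1200 := by positivity
  calc ‖(Real.pi / 2 : ℂ)‖ * (‖sn (v - w)‖ / (‖sn w‖ * ‖sn v‖))
      ≤ 2 * ((C * ‖w - v‖) / ((1 + y ^ 2) / 1200)) := by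
        rw [e]
        gcongr
        linarith
    _ = _ := by field_simp

lemma kap_le : ∀ w : ℂ, Reg w → ‖kap w‖ ≤ 80 := by
  intro w hw
  have hpi := Real.pi_lt_four
  have hpi0 := Real.pi_pos
  have e : ‖(Real.pi / 2 : ℂ)‖ = Real.pi / 2 := by
    rw [norm_div, Complex.norm_real, Real.norm_eq_abs, abs_of_pos hpi0]; simp
  have h1 := hw.le_norm_sn_sq
  have h0 : 0 < ‖sn w‖ := norm_pos_iff.2 hw.sn_ne
  have h2 : ‖Complex.cos (Real.pi / 2 * w)‖ ^ 2 ≤ (21 * ‖sn w‖) ^ 2 := by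
    have h3 := norm_sn_sq w
    rw [half_pi_mul, norm_cos_sq]
    nlinarith [Real.cos_sq_le_one (Real.pi / 2 * w.re), sq_nonneg w.im,
      sq_nonneg (Real.sin (Real.pi / 2 * w.re))]
  have h3 : ‖Complex.cos (Real.pi / 2 * w)‖ ≤ 21 * ‖sn w‖ := by
    exact le_of_abs_le (abs_le_of_sq_le_sq h2 (by positivity))
  unfold kap
  rw [norm_mul (_ / _), norm_div (Complex.cos _), e]
  have h4 : ‖Complex.cos (Real.pi / 2 * w)‖ / ‖Complex.sin (Real.pi / 2 * w)‖ ≤ 21 := by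
    exact (div_le_iff₀ h0).2 h3
  nlinarith [show 0 ≤ ‖Complex.cos (Real.pi / 2 * w)‖ / ‖Complex.sin (Real.pi / 2 * w)‖ by positivity]

lemma sn_zero : sn 0 = 0 := by simp [sn]

lemma differentiable_sn : Differentiable ℂ sn := by
  unfold sn
  fun_prop

lemma sn_ne_zero {w : ℂ} (hw : ‖w‖ < 2) (h0 : w ≠ 0) : sn w ≠ 0 := by
  intro h
  have h1 := norm_sn_sq w
  rw [h, norm_zero] at h1
  have h2 := sq_le_sinh_sq (Real.pi / 2 * w.im)
  have hpi := Real.pi_pos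
  have h3 : Real.pi / 2 * w.im = 0 := by
    have : (Real.pi / 2 * w.im) ^ 2 = 0 := by
      nlinarith [sq_nonneg (Real.sin (Real.pi / 2 * w.re)), sq_nonneg (Real.pi / 2 * w.im)]
    exact pow_eq_zero_iff (two_ne_zero) |>.1 this
  rw [h3] at h1
  have h4 : Real.sin (Real.pi / 2 * w.re) = 0 := by
    simp at h1
    exact (pow_eq_zero_iff two_ne_zero).1 h1.symm
  have hre := (Complex.abs_re_le_norm w).trans_lt hw
  rw [abs_lt] at hre
  have h5 := (Real.sin_eq_zero_iff_of_lt_of_lt (by nlinarith) (by nlinarith)).1 h4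
  apply h0
  apply Complex.ext
  · rcases mul_eq_zero.1 h5 with h | h
    · linarith
    · simpa using h
  · rcases mul_eq_zero.1 h3 with h | h
    · linarith
    · simpa using h

lemma kap_expansion : ∃ lam : ℂ → ℂ, ∃ C : ℝ, 0 < C ∧ (∀ w, w ≠ 0 → kap w = 1 / w + lam w) ∧
    (∀ w, ‖w‖ ≤ 1 → ‖lam w‖ ≤ C) ∧
    (∀ w v, ‖w‖ ≤ 1 → ‖v‖ ≤ 1 → ‖lam w - lam v‖ ≤ C * ‖w - v‖) ∧
    DifferentiableOn ℂ lam (Metric.ball 0 2) := by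
  have hB : Metric.ball (0 : ℂ) 2 ∈ 𝓝 (0 : ℂ) := Metric.ball_mem_nhds _ (by norm_num)
  set S : ℂ → ℂ := dslope sn 0 with hS
  have hSd : DifferentiableOn ℂ S (Metric.ball 0 2) :=
    (Complex.differentiableOn_dslope hB).2 differentiable_sn.differentiableOn
  have hd0 : HasDerivAt sn (Real.pi / 2 : ℂ) 0 := by
    unfold sn
    have h1 : HasDerivAt (fun w : ℂ => (Real.pi / 2 : ℂ) * w) (Real.pi / 2 : ℂ) 0 := by
      simpa using (hasDerivAt_id (0 : ℂ)).const_mul (Real.pi / 2 : ℂ)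
    have := h1.csin
    simpa using this
  have hpi : (Real.pi / 2 : ℂ) ≠ 0 := by
    simp [Real.pi_ne_zero]
  have hS0 : S 0 = Real.pi / 2 := by rw [hS, dslope_same, hd0.deriv]
  have hSw : ∀ w, w ≠ 0 → S w = sn w / w := by
    intro w hw
    rw [hS, dslope_of_ne _ hw, slope_def_field, sn_zero, sub_zero, sub_zero]
  have hSne : ∀ w ∈ Metric.ball (0 : ℂ) 2, S w ≠ 0 := by
    intro w hw
    by_cases h : w = 0
    · rw [h, hS0]; exact hpi
    · rw [hSw w h]
      exact div_ne_zero (sn_ne_zero (by simpa using hw) h) h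
  set χ : ℂ → ℂ := fun w => (Real.pi / 2 : ℂ) * (Complex.cos (Real.pi / 2 * w) / S w) with hχ
  have hχd : DifferentiableOn ℂ χ (Metric.ball 0 2) := by
    rw [hχ]
    apply DifferentiableOn.const_mul
    apply DifferentiableOn.div _ hSd hSne
    apply Differentiable.differentiableOn
    fun_prop
  have hχ0 : χ 0 = 1 := by
    simp only [hχ, hS0, mul_zero, Complex.cos_zero]
    field_simp
  set lam := dslope χ 0 with hlam
  have hld : DifferentiableOn ℂ lam (Metric.ball 0 2) := (Complex.differentiableOn_dslope hB).2 hχd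
  have hsub : Metric.closedBall (0 : ℂ) 1 ⊆ Metric.ball 0 2 :=
    Metric.closedBall_subset_ball (by norm_num)
  have hcomp : IsCompact (Metric.closedBall (0 : ℂ) 1) := isCompact_closedBall _ _
  obtain ⟨C1, hC1⟩ := hcomp.exists_bound_of_continuousOn (hld.continuousOn.mono hsub)
  obtain ⟨C2, hC2⟩ := hcomp.exists_bound_of_continuousOn
    ((hld.deriv Metric.isOpen_ball).continuousOn.mono hsub)
  refine ⟨lam, max 1 (max C1 C2), by positivity, ?_, ?_, ?_, hld⟩
  · intro w hw
    rw [hlam, dslope_of_ne _ hw, slope_def_field, hχ0, sub_zero]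
    simp only [hχ, hSw w hw]
    unfold kap sn
    by_cases hs : Complex.sin (Real.pi / 2 * w) = 0
    · rw [hs]; simp
      field_simp; simp
    · field_simp
      ring
  · intro w hw
    exact (hC1 w (by simpa using hw)).trans (by simp)
  · intro w v hw hv
    have := (convex_closedBall (0 : ℂ) 1).norm_image_sub_le_of_norm_deriv_le (𝕜 := ℂ) (f := lam)
      (C := max 1 (max C1 C2)) (x := v) (y := w)
      (fun x hx => hld.differentiableAt (Metric.isOpen_ball.mem_nhds (hsub hx)))
      (fun x hx => (hC2 x hx).trans (by simp)) (by simpa using hv) (by simpa using hw)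
    exact this

/-- `ψ` is holomorphic and bounded by `ε` on the rectangle `|Re z| < 2`, `|Im z| < H`. -/
structure Small (ψ : ℂ → ℂ) (ε H : ℝ) : Prop where
  diff : DifferentiableOn ℂ ψ {z : ℂ | |z.re| < 2 ∧ |z.im| < H}
  bound : ∀ z : ℂ, |z.re| < 2 → |z.im| < H → ‖ψ z‖ ≤ ε

lemma isOpen_rect (a b : ℝ) : IsOpen {z : ℂ | |z.re| < a ∧ |z.im| < b} := by
  apply IsOpen.inter
  · exact isOpen_lt (Complex.continuous_re.abs) continuous_const
  · exact isOpen_lt (Complex.continuous_im.abs) continuous_const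

lemma convex_crect (a b : ℝ) : Convex ℝ {z : ℂ | |z.re| ≤ a ∧ |z.im| ≤ b} := by
  intro x hx y hy s t hs ht hst
  simp only [Set.mem_ofPred_eq, abs_le, Complex.add_re, Complex.add_im, Complex.real_smul,
    Complex.mul_re, Complex.mul_im, Complex.ofReal_re, Complex.ofReal_im, zero_mul, sub_zero,
    add_zero] at *
  have : t = 1 - s := by linarith
  subst this
  refine ⟨⟨?_, ?_⟩, ?_, ?_⟩ <;> nlinarith

lemma abs_re_le_of_mem {z w : ℂ} {r : ℝ} (h : ‖w - z‖ ≤ r) : |w.re| ≤ |z.re| + r := by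
  have := (Complex.abs_re_le_norm (w - z)).trans h
  rw [Complex.sub_re, abs_le] at this
  rcases abs_cases w.re with h | h <;> rcases abs_cases z.re with h' | h' <;> linarith

lemma abs_im_le_of_mem {z w : ℂ} {r : ℝ} (h : ‖w - z‖ ≤ r) : |w.im| ≤ |z.im| + r := by
  have := (Complex.abs_im_le_norm (w - z)).trans h
  rw [Complex.sub_im, abs_le] at this
  rcases abs_cases w.im with h | h <;> rcases abs_cases z.im with h' | h' <;> linarith

namespace Small

variable {ψ : ℂ → ℂ} {ε H : ℝ}

lemma differentiableAt (h : Small ψ ε H) {z : ℂ} (h1 : |z.re| < 2) (h2 : |z.im| < H) :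
    DifferentiableAt ℂ ψ z :=
  h.diff.differentiableAt ((isOpen_rect 2 H).mem_nhds ⟨h1, h2⟩)

lemma deriv_le (h : Small ψ ε H) {z : ℂ} (h1 : |z.re| < 3 / 2) (h2 : |z.im| < H - 1 / 2) :
    ‖deriv ψ z‖ ≤ 2 * ε := by
  have := Complex.norm_deriv_le_of_forall_mem_sphere_norm_le (c := z) (R := 1 / 2) (C := ε)
    (f := ψ) (by norm_num) ?_ ?_
  · linarith
  · apply DifferentiableOn.diffContOnCl
    rw [closure_ball _ (by norm_num)]
    refine h.diff.mono fun w hw => ?_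
    rw [mem_closedBall_iff_norm] at hw
    have h3 := abs_re_le_of_mem hw
    have h4 := abs_im_le_of_mem hw
    exact ⟨by linarith, by linarith⟩
  · intro w hw
    rw [mem_sphere_iff_norm] at hw
    have h3 := abs_re_le_of_mem hw.le
    have h4 := abs_im_le_of_mem hw.le
    exact h.bound _ (by linarith) (by linarith)

lemma small_deriv (h : Small ψ ε H) {z : ℂ} (h1 : |z.re| ≤ 1) (h2 : |z.im| ≤ H - 1) :
    ‖deriv (deriv ψ) z‖ ≤ 8 * ε := by
  have := Complex.norm_deriv_le_of_forall_mem_sphere_norm_le (c := z) (R := 1 / 4) (C := 2 * ε)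
    (f := deriv ψ) (by norm_num) ?_ ?_
  · linarith
  · apply DifferentiableOn.diffContOnCl
    rw [closure_ball _ (by norm_num)]
    refine (h.diff.deriv (isOpen_rect 2 H)).mono fun w hw => ?_
    rw [mem_closedBall_iff_norm] at hw
    have h3 := abs_re_le_of_mem hw
    have h4 := abs_im_le_of_mem hw
    exact ⟨by linarith, by linarith⟩
  · intro w hw
    rw [mem_sphere_iff_norm] at hw
    have h3 := abs_re_le_of_mem hw.le
    have h4 := abs_im_le_of_mem hw.le
    exact h.deriv_le (by linarith) (by linarith)

lemma sub_le (h : Small ψ ε H) {z w : ℂ} (h1 : |z.re| ≤ 1) (h2 : |z.im| ≤ H - 1)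
    (h3 : |w.re| ≤ 1) (h4 : |w.im| ≤ H - 1) : ‖ψ z - ψ w‖ ≤ 2 * ε * ‖z - w‖ := by
  refine (convex_crect 1 (H - 1)).norm_image_sub_le_of_norm_deriv_le (𝕜 := ℂ) (f := ψ)
    (fun x hx => h.differentiableAt ?_ ?_) (fun x hx => h.deriv_le ?_ ?_) ⟨h3, h4⟩ ⟨h1, h2⟩
  · linarith [hx.1]
  · linarith [hx.2]
  · linarith [hx.1]
  · linarith [hx.2]

lemma taylor_le (h : Small ψ ε H) {z w : ℂ} (h1 : |z.re| ≤ 1) (h2 : |z.im| ≤ H - 1)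
    (h3 : |w.re| ≤ 1) (h4 : |w.im| ≤ H - 1) :
    ‖deriv ψ z * (z - w) - (ψ z - ψ w)‖ ≤ 8 * ε * ‖z - w‖ ^ 2 := by
  have hε : 0 ≤ ε := (norm_nonneg _).trans (h.bound z (by linarith) (by linarith))
  have hc := convex_crect 1 (H - 1)
  have hsub : segment ℝ w z ⊆ {z : ℂ | |z.re| ≤ 1 ∧ |z.im| ≤ H - 1} :=
    hc.segment_subset ⟨h3, h4⟩ ⟨h1, h2⟩
  have hdd : ∀ x ∈ segment ℝ w z, ‖deriv ψ z - deriv ψ x‖ ≤ 8 * ε * ‖z - w‖ := by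
    intro x hx
    have := hc.norm_image_sub_le_of_norm_deriv_le (𝕜 := ℂ) (f := deriv ψ) (C := 8 * ε)
      (fun y hy => (h.diff.deriv (isOpen_rect 2 H)).differentiableAt
        ((isOpen_rect 2 H).mem_nhds ⟨by linarith [hy.1], by linarith [hy.2]⟩))
      (fun y hy => h.small_deriv hy.1 hy.2) (hsub hx) ⟨h1, h2⟩
    refine this.trans (mul_le_mul_of_nonneg_left ?_ (by positivity))
    rw [segment_symm] at hx
    have := norm_sub_le_of_mem_segment hx
    rw [norm_sub_rev] at this
    rwa [norm_sub_rev z w]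
  have := (convex_segment w z).norm_image_sub_le_of_norm_hasDerivWithin_le (𝕜 := ℂ)
    (f := fun x => deriv ψ z * x - ψ x) (f' := fun x => deriv ψ z - deriv ψ x)
    (C := 8 * ε * ‖z - w‖) (x := w) (y := z) (fun x hx => by
      have hx' := hsub hx
      have hd := (h.differentiableAt (z := x) (by linarith [hx'.1]) (by linarith [hx'.2])).hasDerivAt
      have := ((hasDerivAt_id x).const_mul (deriv ψ z)).sub hd
      simp only [mul_one] at this
      exact this.hasDerivWithinAt) hdd (left_mem_segment _ _ _) (right_mem_segment _ _ _)
  calc _ = ‖deriv ψ z * z - ψ z - (deriv ψ z * w - ψ w)‖ := by congr 1; ring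
    _ ≤ _ := this
    _ = _ := by ring

end Small

/-- The kernel of the Cousin problem for `z ↦ z + 1 + ψ z`. -/
noncomputable def Kk (ψ : ℂ → ℂ) (ζ z : ℂ) : ℂ :=
  kap (ζ - z) + (1 + deriv ψ ζ) * kap (ζ + 1 + ψ ζ - z)

/-- The difference kernel. -/
noncomputable def Mk (ψ : ℂ → ℂ) (ζ z : ℂ) : ℂ := Kk ψ ζ (z + 1 + ψ z) - Kk ψ ζ z

lemma Mk_eq (ψ : ℂ → ℂ) (ζ z : ℂ) : Mk ψ ζ z =
    ((1 + deriv ψ ζ) * kap (ζ - z + (ψ ζ - ψ z)) - kap (ζ - z)) -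
    ((1 + deriv ψ ζ) * kap (ζ - z + 1 + ψ ζ) - kap (ζ - z + 1 - ψ z)) := by
  unfold Mk Kk
  rw [← kap_add_two (ζ - (z + 1 + ψ z))]
  rw [show ζ - (z + 1 + ψ z) + 2 = ζ - z + 1 - ψ z by ring,
    show ζ + 1 + ψ ζ - (z + 1 + ψ z) = ζ - z + (ψ ζ - ψ z) by ring,
    show ζ + 1 + ψ ζ - z = ζ - z + 1 + ψ ζ by ring]
  ring

set_option maxHeartbeats 1000000 in
lemma Mk_le : ∃ C : ℝ, 0 < C ∧ ∀ (ψ : ℂ → ℂ) (ε H : ℝ), Small ψ ε H → ε ≤ 1 / 100 →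
    ∀ ζ z : ℂ, ζ.re = 0 → |ζ.im| ≤ H - 1 → -(1 / 2) ≤ z.re → z.re ≤ 0 → |z.im| ≤ H - 1 →
    ζ ≠ z → ‖Mk ψ ζ z‖ ≤ C * ε / (1 + (ζ.im - z.im) ^ 2) := by
  obtain ⟨C1, hC1, hk⟩ := kap_sub_le
  obtain ⟨lam, C2, hC2, hl, hlb, hll, -⟩ := kap_expansion
  refine ⟨16 * C1 + 400 + 32 + 8 * C2, by positivity, ?_⟩
  intro ψ ε H hψ hε ζ z hζr hζi hz1 hz2 hzi hne
  have hζ1 : |ζ.re| ≤ 1 := by rw [hζr]; simp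
  have hz3 : |z.re| ≤ 1 := abs_le.2 ⟨by linarith, by linarith⟩
  have hs := hψ.bound ζ (by linarith) (by linarith)
  have hr := hψ.bound z (by linarith) (by linarith)
  have hε0 : 0 ≤ ε := (norm_nonneg _).trans hs
  have hd := hψ.deriv_le (z := ζ) (by linarith) (by linarith)
  have hsr := hψ.sub_le hζ1 hζi hz3 hzi
  have ht := hψ.taylor_le hζ1 hζi hz3 hzi
  rw [Mk_eq]
  have hur : (ζ - z).re = - z.re := by simp [hζr]
  have hu0 : ζ - z ≠ 0 := sub_ne_zero.2 hne
  set y := ζ.im - z.im with hy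
  have hui : (ζ - z).im = y := by simp [hy]
  set u := ζ - z with hu
  set s := ψ ζ
  set r := ψ z
  set d := deriv ψ ζ
  have hsre := (Complex.abs_re_le_norm s).trans hs
  have hsim := (Complex.abs_im_le_norm s).trans hs
  have hrre := (Complex.abs_re_le_norm r).trans hr
  have hrim := (Complex.abs_im_le_norm r).trans hr
  rw [abs_le] at hsre hsim hrre hrim
  have R1 : Reg (u + 1 + s) := by
    left
    simp only [Complex.add_re, Complex.one_re, hur]
    rw [abs_of_nonneg (by linarith)]
    constructor <;> linarith
  have R2 : Reg (u + 1 - r) := by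
    left
    simp only [Complex.add_re, Complex.sub_re, Complex.one_re, hur]
    rw [abs_of_nonneg (by linarith)]
    constructor <;> linarith
  have i1 : |(u + 1 + s).im - y| ≤ 1 := by
    simp only [Complex.add_im, Complex.one_im, hui]
    rw [abs_le]; constructor <;> linarith
  have i2 : |(u + 1 - r).im - y| ≤ 1 := by
    simp only [Complex.add_im, Complex.sub_im, Complex.one_im, hui]
    rw [abs_le]; constructor <;> linarith
  have T2 : ‖kap (u + 1 + s) - kap (u + 1 - r)‖ ≤ C1 * (2 * ε) / (1 + y ^ 2) := by
    have e : u + 1 + s - (u + 1 - r) = s + r := by ring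
    have hn : ‖u + 1 + s - (u + 1 - r)‖ ≤ 2 * ε := by
      rw [e]; exact (norm_add_le _ _).trans (by linarith)
    refine (hk _ _ y R1 R2 i1 i2 (hn.trans (by linarith))).trans ?_
    gcongr
  have hsr2 : ‖s - r‖ ≤ 2 * ε := (norm_sub_le _ _).trans (by linarith)
  have hy0 : 0 < 1 + y ^ 2 := by positivity
  rcases le_total (1 / 2) |y| with hy1 | hy1
  · have R3 : Reg u := by right; rw [hui]; linarith
    have hsri := (Complex.abs_im_le_norm (s - r)).trans hsr2
    rw [abs_le] at hsri
    have R4 : Reg (u + (s - r)) := by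
      right
      rw [Complex.add_im, hui]
      rcases abs_cases y with h | h <;>
        rcases abs_cases (y + (s - r).im) with h' | h' <;> linarith
    have i4 : |(u + (s - r)).im - y| ≤ 1 := by
      rw [Complex.add_im, hui, abs_le]; constructor <;> linarith
    have T1 : ‖kap (u + (s - r)) - kap u‖ ≤ C1 * (2 * ε) / (1 + y ^ 2) := by
      have hn : ‖u + (s - r) - u‖ ≤ 2 * ε := by
        rw [add_sub_cancel_left]; exact hsr2
      refine (hk _ _ y R4 R3 i4 (by rw [hui]; simp) (hn.trans (by linarith))).trans ?_
      gcongr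
    have T3 : ‖kap (u + (s - r)) - kap (u + 1 + s)‖ ≤ C1 * 2 / (1 + y ^ 2) := by
      have e : u + (s - r) - (u + 1 + s) = - (1 + r) := by ring
      have hn : ‖u + (s - r) - (u + 1 + s)‖ ≤ 2 := by
        rw [e, norm_neg]; refine (norm_add_le _ _).trans ?_
        rw [norm_one]; linarith
      refine (hk _ _ y R4 R1 i4 i1 (hn.trans (by linarith))).trans ?_
      gcongr
    have e : (1 + d) * kap (u + (s - r)) - kap u - ((1 + d) * kap (u + 1 + s) - kap (u + 1 - r)) =
        (kap (u + (s - r)) - kap u) - (kap (u + 1 + s) - kap (u + 1 - r)) +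
        d * (kap (u + (s - r)) - kap (u + 1 + s)) := by ring
    rw [e]
    calc _ ≤ ‖kap (u + (s - r)) - kap u‖ + ‖kap (u + 1 + s) - kap (u + 1 - r)‖ +
        ‖d‖ * ‖kap (u + (s - r)) - kap (u + 1 + s)‖ := by
          refine (norm_add_le _ _).trans ?_
          rw [norm_mul]
          gcongr
          exact norm_sub_le _ _
      _ ≤ C1 * (2 * ε) / (1 + y ^ 2) + C1 * (2 * ε) / (1 + y ^ 2) +
          2 * ε * (C1 * 2 / (1 + y ^ 2)) := by gcongr
      _ = 8 * C1 * ε / (1 + y ^ 2) := by ring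
      _ ≤ _ := by
        gcongr
        nlinarith
  · have hun : ‖u‖ ≤ 3 / 4 := by
      have h1 : ‖u‖ ^ 2 = u.re ^ 2 + u.im ^ 2 := by
        rw [← Complex.normSq_eq_norm_sq, Complex.normSq_apply]; ring
      rw [hui, hur] at h1
      have h2 : y ^ 2 ≤ 1 / 4 := by rw [← sq_abs]; nlinarith [abs_nonneg y]
      have h3 : (-z.re) ^ 2 ≤ 1 / 4 := by nlinarith
      nlinarith [norm_nonneg u]
    have hup : 0 < ‖u‖ := norm_pos_iff.2 hu0
    set w := u + (s - r) with hw
    have hw1 : ‖w‖ ≤ 1 := (norm_add_le _ _).trans (by nlinarith)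
    have hw2 : ‖u‖ / 2 ≤ ‖w‖ := by
      have : ‖u‖ ≤ ‖w‖ + ‖s - r‖ := by
        have := norm_sub_le w (s - r)
        rwa [hw, add_sub_cancel_right] at this
      nlinarith
    have hw0 : w ≠ 0 := norm_pos_iff.1 (by linarith)
    have T4 : ‖(1 + d) * kap w - kap u‖ ≤ (16 + 4 * C2) * ε := by
      have e : (1 + d) * kap w - kap u = (d * u - (s - r)) / (w * u) + d * lam w +
          (lam w - lam u) := by
        rw [hl w hw0, hl u hu0]
        have : d * u - (s - r) = (1 + d) * u - w := by rw [hw]; ring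
        rw [this]
        field_simp
        ring
      rw [e]
      have t1 : ‖(d * u - (s - r)) / (w * u)‖ ≤ 16 * ε := by
        rw [norm_div, norm_mul w u, div_le_iff₀ (by positivity)]
        calc _ ≤ 8 * ε * ‖u‖ ^ 2 := ht
          _ = 16 * ε * (‖u‖ / 2 * ‖u‖) := by ring
          _ ≤ _ := by gcongr
      have t2 : ‖d * lam w‖ ≤ 2 * ε * C2 := by
        rw [norm_mul]
        exact mul_le_mul hd (hlb w hw1) (norm_nonneg _) (by positivity)
      have t3 : ‖lam w - lam u‖ ≤ C2 * (2 * ε) := by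
        refine (hll w u hw1 (by linarith)).trans ?_
        gcongr
        rw [hw, add_sub_cancel_left]; exact hsr2
      calc _ ≤ _ := norm_add₃_le
        _ ≤ 16 * ε + 2 * ε * C2 + C2 * (2 * ε) := by gcongr
        _ = _ := by ring
    have T5 : ‖d * kap (u + 1 + s)‖ ≤ 160 * ε := by
      rw [norm_mul]
      nlinarith [kap_le _ R1, norm_nonneg (kap (u + 1 + s)), norm_nonneg d]
    have T2' : ‖kap (u + 1 + s) - kap (u + 1 - r)‖ ≤ C1 * (2 * ε) := by
      refine T2.trans (div_le_self (by positivity) ?_)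
      nlinarith [sq_nonneg y]
    have e : (1 + d) * kap w - kap u - ((1 + d) * kap (u + 1 + s) - kap (u + 1 - r)) =
        ((1 + d) * kap w - kap u) + -(kap (u + 1 + s) - kap (u + 1 - r)) +
        -(d * kap (u + 1 + s)) := by ring
    rw [e, le_div_iff₀ hy0]
    have hy2 : 1 + y ^ 2 ≤ 2 := by
      have : y ^ 2 ≤ 1 / 4 := by rw [← sq_abs]; nlinarith [abs_nonneg y]
      linarith
    calc _ ≤ ((16 + 4 * C2) * ε + C1 * (2 * ε) + 160 * ε) * 2 := by
          gcongr
          refine norm_add₃_le.trans ?_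
          rw [norm_neg, norm_neg]
          gcongr
      _ ≤ _ := by nlinarith [mul_nonneg hC1.le hε0, mul_nonneg hC2.le hε0]

lemma differentiableOn_integral {U : Set ℂ} (hU : IsOpen U) {F : ℂ → ℝ → ℂ} {a b : ℝ}
    (hd : ∀ t ∈ Set.uIoc a b, DifferentiableOn ℂ (fun z => F z t) U)
    (hm : ∀ z ∈ U, AEStronglyMeasurable (F z) (volume.restrict (Set.uIoc a b)))
    (hB : ∀ z ∈ U, ∃ V ∈ 𝓝 z, ∃ B : ℝ, ∀ w ∈ V, ∀ t ∈ Set.uIoc a b, ‖F w t‖ ≤ B) :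
    DifferentiableOn ℂ (fun z => ∫ t in a..b, F z t) U := by
  intro z hz
  obtain ⟨V, hV, B, hB⟩ := hB z hz
  obtain ⟨r, hr, hrV⟩ := Metric.mem_nhds_iff.1 (inter_mem hV (hU.mem_nhds hz))
  have hB0 : ∀ w ∈ Metric.ball z (r / 2), ∀ t ∈ Set.uIoc a b,
      ‖deriv (fun z => F z t) w‖ ≤ B / (r / 4) := by
    intro w hw t ht
    have hsub : Metric.closedBall w (r / 4) ⊆ Metric.ball z r := by
      apply Metric.closedBall_subset_ball'
      rw [Metric.mem_ball] at hw
      linarith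
    apply Complex.norm_deriv_le_of_forall_mem_sphere_norm_le (by positivity)
    · apply DifferentiableOn.diffContOnCl
      rw [closure_ball _ (by positivity)]
      exact (hd t ht).mono fun x hx => (hrV (hsub hx)).2
    · intro x hx
      exact hB x (hrV (hsub (Metric.sphere_subset_closedBall hx))).1 t ht
  have hzr : Metric.ball z r ∈ 𝓝 z := Metric.ball_mem_nhds z hr
  have hder : ∀ t ∈ Set.uIoc a b, ∀ w ∈ Metric.ball z r,
      HasDerivAt (fun z => F z t) (deriv (fun z => F z t) w) w := by
    intro t ht w hw
    exact ((hd t ht).differentiableAt (hU.mem_nhds (hrV hw).2)).hasDerivAt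
  have h_int : ∀ w ∈ Metric.ball z r, IntervalIntegrable (F w) volume a b := by
    intro w hw
    rw [intervalIntegrable_iff]
    have : IsFiniteMeasure (volume.restrict (Set.uIoc a b)) := ⟨by simp⟩
    refine Integrable.of_bound (hm w (hrV hw).2) B ?_
    rw [ae_restrict_iff' measurableSet_uIoc]
    exact ae_of_all _ fun t ht => hB w (hrV hw).1 t ht
  have := intervalIntegral.hasDerivAt_integral_of_dominated_loc_of_deriv_le (μ := volume)
    (F := F) (F' := fun w t => deriv (fun z => F z t) w) (x₀ := z) (a := a) (b := b)
    (s := Metric.ball z (r / 2)) (bound := fun _ => B / (r / 4))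
    (Metric.ball_mem_nhds z (by positivity))
    (by filter_upwards [hzr] with w hw using hm w (hrV hw).2)
    (h_int z (Metric.mem_ball_self hr)) ?_
    (ae_of_all _ fun t ht w hw => hB0 w hw t ht) intervalIntegrable_const
    (ae_of_all _ fun t ht w hw => hder t ht w (Metric.ball_subset_ball (by linarith) hw))
  · exact this.2.differentiableAt.differentiableWithinAt
  · have hseq : Tendsto (fun n : ℕ => (r / 2 : ℂ) * ((1 : ℂ) / ((n : ℂ) + 1))) atTop (𝓝[≠] 0) := by
      rw [tendsto_nhdsWithin_iff]
      constructor
      · have h0 := tendsto_one_div_add_atTop_nhds_zero_nat (𝕜 := ℂ)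
        simpa using h0.const_mul (r / 2 : ℂ)
      · filter_upwards with n
        have h1 : (r : ℂ) ≠ 0 := by exact_mod_cast hr.ne'
        have h2 : ((n : ℂ) + 1) ≠ 0 := by exact_mod_cast n.succ_ne_zero
        simp [h1, h2]
    set u : ℕ → ℂ := fun n => (r / 2 : ℂ) * ((1 : ℂ) / ((n : ℂ) + 1))
    have hun : ∀ n, z + u n ∈ Metric.ball z r := by
      intro n
      simp only [u, mem_ball_iff_norm, add_sub_cancel_left, norm_mul, norm_div, norm_one,
        Complex.norm_real, Real.norm_eq_abs, abs_of_pos hr, Complex.norm_ofNat]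
      have : ‖(n : ℂ) + 1‖ = n + 1 := by exact_mod_cast Complex.norm_natCast (n + 1)
      rw [this]
      have : 1 / ((n : ℝ) + 1) ≤ 1 := by
        rw [div_le_one (by positivity)]; linarith [Nat.cast_nonneg (α := ℝ) n]
      nlinarith
    apply aestronglyMeasurable_of_tendsto_ae atTop
      (f := fun n t => (u n)⁻¹ • (F (z + u n) t - F z t))
    · intro n
      exact ((hm _ (hrV (hun n)).2).sub (hm z hz)).const_smul (u n)⁻¹
    · rw [ae_restrict_iff' measurableSet_uIoc]
      refine ae_of_all _ fun t ht => ?_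
      have := (hasDerivAt_iff_tendsto_slope_zero.1
        (hder t ht z (Metric.mem_ball_self hr))).comp hseq
      exact this

/-- the closed left half neighbourhood of the cut -/
def nb (h : ℝ) : Set ℂ := {z : ℂ | -(1 / 2) ≤ z.re ∧ z.re ≤ 0 ∧ |z.im| ≤ h}

/-- the integral operator with kernel `Mk` -/
noncomputable def MM (ψ : ℂ → ℂ) (h : ℝ) (g : ℝ → ℂ) (z : ℂ) : ℂ :=
  (2 * Real.pi : ℂ)⁻¹ * ∫ t in -h..h, g t * Mk ψ (t * Complex.I) z

lemma measurable_kap : Measurable kap := by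
  unfold kap
  fun_prop

lemma integral_cauchy_le (h y : ℝ) : ∫ t in -h..h, 1 / (1 + (t - y) ^ 2) ≤ Real.pi := by
  rw [intervalIntegral.integral_comp_sub_right (fun t => 1 / (1 + t ^ 2)) y,
    integral_one_div_one_add_sq]
  have h1 := Real.arctan_lt_pi_div_two (h - y)
  have h2 := Real.neg_pi_div_two_lt_arctan (-h - y)
  linarith

lemma continuous_cauchy (y : ℝ) : Continuous fun t : ℝ => 1 / (1 + (t - y) ^ 2) := by
  apply Continuous.div (by fun_prop) (by fun_prop)
  intro t
  positivity

section

variable {ψ : ℂ → ℂ} {ε H : ℝ}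

lemma Small.contOn_line (hψ : Small ψ ε H) {s : ℝ} (hs : |s| < 2) :
    ContinuousOn (fun t : ℝ => ψ (s + t * Complex.I)) (Set.Icc (-(H - 1)) (H - 1)) := by
  apply hψ.diff.continuousOn.comp (by fun_prop)
  intro t ht
  have := abs_le.2 ⟨ht.1, ht.2⟩
  simp only [Set.mem_ofPred_eq, Complex.add_re, Complex.add_im, Complex.mul_re, Complex.mul_im,
    Complex.ofReal_re, Complex.ofReal_im, Complex.I_re, Complex.I_im]
  constructor
  · simpa using hs
  · simp; linarith

lemma Small.contOn_line_deriv (hψ : Small ψ ε H) {s : ℝ} (hs : |s| < 2) :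
    ContinuousOn (fun t : ℝ => deriv ψ (s + t * Complex.I)) (Set.Icc (-(H - 1)) (H - 1)) := by
  apply (hψ.diff.deriv (isOpen_rect 2 H)).continuousOn.comp (by fun_prop)
  intro t ht
  have := abs_le.2 ⟨ht.1, ht.2⟩
  simp only [Set.mem_ofPred_eq, Complex.add_re, Complex.add_im, Complex.mul_re, Complex.mul_im,
    Complex.ofReal_re, Complex.ofReal_im, Complex.I_re, Complex.I_im]
  constructor
  · simpa using hs
  · simp; linarith

lemma Small.aesm_Kk (hψ : Small ψ ε H) (hH : 3 ≤ H) (z : ℂ) :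
    AEStronglyMeasurable (fun t : ℝ => Kk ψ (t * Complex.I) z)
      (volume.restrict (Set.uIoc (-(H - 1)) (H - 1))) := by
  have hsub : Set.uIoc (-(H - 1)) (H - 1) ⊆ Set.Icc (-(H - 1)) (H - 1) := by
    rw [Set.uIoc_of_le (by linarith)]; exact Set.Ioc_subset_Icc_self
  have h1 : AEMeasurable (fun t : ℝ => ψ (t * Complex.I))
      (volume.restrict (Set.uIoc (-(H - 1)) (H - 1))) := by
    have := (hψ.contOn_line (s := 0) (by simp)).mono hsub
    simp only [Complex.ofReal_zero, zero_add] at this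
    exact this.aemeasurable measurableSet_uIoc
  have h2 : AEMeasurable (fun t : ℝ => deriv ψ (t * Complex.I))
      (volume.restrict (Set.uIoc (-(H - 1)) (H - 1))) := by
    have := (hψ.contOn_line_deriv (s := 0) (by simp)).mono hsub
    simp only [Complex.ofReal_zero, zero_add] at this
    exact this.aemeasurable measurableSet_uIoc
  have h3 : AEMeasurable (fun t : ℝ => (t * Complex.I : ℂ))
      (volume.restrict (Set.uIoc (-(H - 1)) (H - 1))) :=
    (by fun_prop : Continuous fun t : ℝ => (t * Complex.I : ℂ)).measurable.aemeasurable
  apply AEMeasurable.aestronglyMeasurable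
  unfold Kk
  apply AEMeasurable.add
  · exact measurable_kap.comp_aemeasurable (h3.sub_const z)
  · apply AEMeasurable.mul
    · exact h2.const_add 1
    · exact measurable_kap.comp_aemeasurable (((h3.add_const 1).add h1).sub_const z)

lemma Small.aesm_Mk (hψ : Small ψ ε H) (hH : 3 ≤ H) (z : ℂ) :
    AEStronglyMeasurable (fun t : ℝ => Mk ψ (t * Complex.I) z)
      (volume.restrict (Set.uIoc (-(H - 1)) (H - 1))) :=
  (hψ.aesm_Kk hH _).sub (hψ.aesm_Kk hH _)

/-- the pointwise estimate used throughout for the kernel `Mk` -/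
def MkB (ψ : ℂ → ℂ) (c H : ℝ) : Prop := ∀ ζ z : ℂ, ζ.re = 0 → |ζ.im| ≤ H - 1 → z ∈ nb (H - 1) →
    ζ ≠ z → ‖Mk ψ ζ z‖ ≤ c * (1 / (1 + (ζ.im - z.im) ^ 2))

lemma MkB.ae {c : ℝ} (hM : MkB ψ c H) (hH : 3 ≤ H) {z : ℂ} (hz : z ∈ nb (H - 1)) :
    ∀ᵐ t : ℝ, t ∈ Set.uIoc (-(H - 1)) (H - 1) →
      ‖Mk ψ (t * Complex.I) z‖ ≤ c * (1 / (1 + (t - z.im) ^ 2)) := by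
  filter_upwards [compl_mem_ae_iff.2 (measure_singleton z.im)] with t ht htm
  rw [Set.uIoc_of_le (by linarith)] at htm
  have := hM (t * Complex.I) z (by simp) (by simp [abs_le]; exact ⟨by linarith [htm.1], htm.2⟩) hz
    (fun h => ht (by have := congrArg Complex.im h; simpa using this))
  simpa using this

lemma MkB.intervalIntegrable {c : ℝ} (hM : MkB ψ c H) (hψ : Small ψ ε H) (hH : 3 ≤ H) {g : ℝ → ℂ}
    (hg : Continuous g) {z : ℂ} (hz : z ∈ nb (H - 1)) :
    IntervalIntegrable (fun t => g t * Mk ψ (t * Complex.I) z) volume (-(H - 1)) (H - 1) := by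
  have hi : IntervalIntegrable (fun t => ‖g t‖ * (c * (1 / (1 + (t - z.im) ^ 2)))) volume
      (-(H - 1)) (H - 1) :=
    (hg.norm.mul (continuous_const.mul (continuous_cauchy z.im))).intervalIntegrable _ _
  refine hi.mono_fun (hg.aestronglyMeasurable.mul (hψ.aesm_Mk hH z)) ?_
  filter_upwards [(ae_restrict_iff' measurableSet_uIoc).2 (hM.ae hH hz)] with t ht
  rw [norm_mul]
  refine le_trans ?_ (le_abs_self _)
  gcongr

lemma MkB.norm_MM_le {c : ℝ} (hM : MkB ψ c H) (hH : 3 ≤ H) {g : ℝ → ℂ}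
    (hg : Continuous g) {z : ℂ} (hz : z ∈ nb (H - 1)) :
    ‖MM ψ (H - 1) g z‖ ≤ (2 * Real.pi)⁻¹ *
      ∫ t in -(H - 1)..(H - 1), ‖g t‖ * (c * (1 / (1 + (t - z.im) ^ 2))) := by
  unfold MM
  have e : ‖(2 * Real.pi : ℂ)⁻¹‖ = (2 * Real.pi)⁻¹ := by
    rw [norm_inv, norm_mul, Complex.norm_real, Real.norm_eq_abs, abs_of_pos Real.pi_pos]; simp
  rw [norm_mul, e]
  gcongr
  apply intervalIntegral.norm_integral_le_of_norm_le (by linarith)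
  · filter_upwards [hM.ae hH hz] with t ht htm
    rw [norm_mul]
    gcongr
    apply ht
    rw [Set.uIoc_of_le (by linarith)]; exact htm
  · exact (hg.norm.mul (continuous_const.mul (continuous_cauchy z.im))).intervalIntegrable _ _

lemma MkB.norm_MM_le_const {c : ℝ} (hM : MkB ψ c H) (hc : 0 ≤ c) (hc1 : c ≤ 1) (hH : 3 ≤ H)
    {g : ℝ → ℂ} (hg : Continuous g) {G : ℝ} (hG : ∀ t, ‖g t‖ ≤ G) {z : ℂ}
    (hz : z ∈ nb (H - 1)) : ‖MM ψ (H - 1) g z‖ ≤ G / 2 := by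
  refine (hM.norm_MM_le hH hg hz).trans ?_
  have hG0 : 0 ≤ G := (norm_nonneg _).trans (hG 0)
  have : ∫ t in -(H - 1)..(H - 1), ‖g t‖ * (c * (1 / (1 + (t - z.im) ^ 2))) ≤
      ∫ t in -(H - 1)..(H - 1), G * (1 / (1 + (t - z.im) ^ 2)) := by
    apply intervalIntegral.integral_mono (by linarith)
    · exact (hg.norm.mul (continuous_const.mul (continuous_cauchy z.im))).intervalIntegrable _ _
    · exact (continuous_const.mul (continuous_cauchy z.im)).intervalIntegrable _ _
    · intro t
      have h1 : c * (1 / (1 + (t - z.im) ^ 2)) ≤ 1 * (1 / (1 + (t - z.im) ^ 2)) := by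
        gcongr
      have h2 := hG t
      have h3 : 0 ≤ 1 / (1 + (t - z.im) ^ 2) := by positivity
      have h4 : 0 ≤ c * (1 / (1 + (t - z.im) ^ 2)) := by positivity
      show ‖g t‖ * _ ≤ _
      calc _ ≤ G * (1 * (1 / (1 + (t - z.im) ^ 2))) := mul_le_mul h2 h1 h4 hG0
        _ = _ := by ring
  rw [intervalIntegral.integral_const_mul] at this
  have h5 := integral_cauchy_le (H - 1) z.im
  have hpi := Real.pi_pos
  calc _ ≤ (2 * Real.pi)⁻¹ * (G * Real.pi) := by
        gcongr
        exact this.trans (by gcongr)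
    _ = _ := by field_simp

lemma nb_mem {z : ℂ} (hz : z ∈ nb (H - 1)) (hH : 3 ≤ H) : |z.re| ≤ 1 ∧ |z.im| ≤ H - 1 :=
  ⟨abs_le.2 ⟨by linarith [hz.1], by linarith [hz.2.1]⟩, hz.2.2⟩

lemma continuousAt_kap {w : ℂ} (h : sn w ≠ 0) : ContinuousAt kap w := by
  have h1 : Complex.sin (Real.pi / 2 * w) ≠ 0 := h
  unfold kap
  apply ContinuousAt.mul continuousAt_const
  exact ContinuousAt.div (by fun_prop) (by fun_prop) h1

/-- Regularity of the four arguments of the difference kernel. -/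
lemma Small.sn_ne (hψ : Small ψ ε H) (hε : ε ≤ 1 / 100) (hH : 3 ≤ H) {t : ℝ}
    (ht : |t| ≤ H - 1) {z : ℂ} (hz : z ∈ nb (H - 1)) (hne : (t * Complex.I : ℂ) ≠ z) :
    sn (t * Complex.I - z) ≠ 0 ∧
    sn (t * Complex.I - z + (ψ (t * Complex.I) - ψ z)) ≠ 0 ∧
    sn (t * Complex.I - z + 1 + ψ (t * Complex.I)) ≠ 0 ∧
    sn (t * Complex.I - z + 1 - ψ z) ≠ 0 := by
  obtain ⟨hz1, hz2⟩ := nb_mem hz hH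
  have hr := hψ.bound z (by linarith) (by linarith)
  have hs := hψ.bound (t * Complex.I) (by simp) (by simp; linarith)
  have hsr := hψ.sub_le (z := t * Complex.I) (w := z) (by simp) (by simpa using ht) hz1 hz2
  set s := ψ (t * Complex.I)
  set r := ψ z
  set u := t * Complex.I - z with hu
  have hu0 : u ≠ 0 := sub_ne_zero.2 hne
  have hur : u.re = - z.re := by simp [hu]
  have hsre := (Complex.abs_re_le_norm s).trans hs
  have hrre := (Complex.abs_re_le_norm r).trans hr
  have hsim := (Complex.abs_im_le_norm s).trans hs
  have hrim := (Complex.abs_im_le_norm r).trans hr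
  rw [abs_le] at hsre hrre hsim hrim
  have hup : 0 < ‖u‖ := norm_pos_iff.2 hu0
  have hw0 : u + (s - r) ≠ 0 := by
    intro h
    have : u = -(s - r) := eq_neg_of_add_eq_zero_left h
    have h2 : ‖u‖ = ‖s - r‖ := by rw [this, norm_neg]
    nlinarith
  have hz3 := hz.1
  have hz4 := hz.2.1
  refine ⟨?_, ?_, ?_, ?_⟩
  · rcases le_total (1 / 4) |u.im| with h | h
    · exact Reg.sn_ne (Or.inr h)
    · refine sn_ne_zero ?_ hu0
      refine (Complex.norm_le_abs_re_add_abs_im u).trans_lt ?_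
      rw [hur, abs_of_nonneg (by linarith)]
      linarith
  · rcases le_total (1 / 4) |(u + (s - r)).im| with h | h
    · exact Reg.sn_ne (Or.inr h)
    · refine sn_ne_zero ?_ hw0
      refine (Complex.norm_le_abs_re_add_abs_im _).trans_lt ?_
      have : |(u + (s - r)).re| ≤ 1 := by
        simp only [Complex.add_re, Complex.sub_re, hur]
        rw [abs_le]; constructor <;> linarith
      linarith
  · apply Reg.sn_ne
    left
    simp only [Complex.add_re, Complex.one_re, hur]
    rw [abs_of_nonneg (by linarith)]
    constructor <;> linarith
  · apply Reg.sn_ne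
    left
    simp only [Complex.add_re, Complex.sub_re, Complex.one_re, hur]
    rw [abs_of_nonneg (by linarith)]
    constructor <;> linarith

lemma Small.continuousWithinAt_Mk (hψ : Small ψ ε H) (hε : ε ≤ 1 / 100) (hH : 3 ≤ H) {t : ℝ}
    (ht : |t| ≤ H - 1) {z : ℂ} (hz : z ∈ nb (H - 1)) (hne : (t * Complex.I : ℂ) ≠ z) :
    ContinuousAt (fun z => Mk ψ (t * Complex.I) z) z := by
  obtain ⟨h1, h2, h3, h4⟩ := hψ.sn_ne hε hH ht hz hne
  obtain ⟨hz1, hz2⟩ := nb_mem hz hH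
  have hc : ContinuousAt ψ z :=
    (hψ.differentiableAt (by linarith) (by linarith)).continuousAt
  simp only [Mk_eq]
  have k1 : ContinuousAt (fun z => kap (t * Complex.I - z)) z :=
    ContinuousAt.comp (g := kap) (continuousAt_kap h1) (by fun_prop)
  have k2 : ContinuousAt (fun z => kap (t * Complex.I - z + (ψ (t * Complex.I) - ψ z))) z :=
    ContinuousAt.comp (g := kap) (continuousAt_kap h2) (by fun_prop)
  have k3 : ContinuousAt (fun z => kap (t * Complex.I - z + 1 + ψ (t * Complex.I))) z :=
    ContinuousAt.comp (g := kap) (continuousAt_kap h3) (by fun_prop)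
  have k4 : ContinuousAt (fun z => kap (t * Complex.I - z + 1 - ψ z)) z :=
    ContinuousAt.comp (g := kap) (continuousAt_kap h4) (by fun_prop)
  exact ((continuousAt_const.mul k2).sub k1).sub ((continuousAt_const.mul k3).sub k4)

lemma MkB.continuousOn_MM {c : ℝ} (hM : MkB ψ c H) (hc : 0 ≤ c) (hψ : Small ψ ε H)
    (hε : ε ≤ 1 / 100) (hH : 3 ≤ H) {g : ℝ → ℂ} (hg : Continuous g) :
    ContinuousOn (MM ψ (H - 1) g) (nb (H - 1)) := by
  intro z hz
  unfold MM
  apply ContinuousWithinAt.mul continuousWithinAt_const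
  apply intervalIntegral.continuousWithinAt_of_dominated_interval (bound := fun t => ‖g t‖ * c)
  · filter_upwards with w
    exact hg.aestronglyMeasurable.mul (hψ.aesm_Mk hH w)
  · filter_upwards [self_mem_nhdsWithin] with w hw
    filter_upwards [hM.ae hH hw] with t ht htm
    rw [norm_mul]
    gcongr
    refine (ht htm).trans ?_
    have : 1 / (1 + (t - w.im) ^ 2) ≤ 1 := by
      rw [div_le_one (by positivity)]; nlinarith [sq_nonneg (t - w.im)]
    nlinarith
  · exact (hg.norm.mul continuous_const).intervalIntegrable _ _
  · filter_upwards [compl_mem_ae_iff.2 (measure_singleton z.im)] with t ht htm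
    rw [Set.uIoc_of_le (by linarith)] at htm
    apply ContinuousWithinAt.mul continuousWithinAt_const
    apply ContinuousAt.continuousWithinAt
    apply hψ.continuousWithinAt_Mk hε hH (abs_le.2 ⟨by linarith [htm.1], htm.2⟩) hz
    intro h
    exact ht (by have := congrArg Complex.im h; simpa using this)

end

variable {ψ : ℂ → ℂ} {ε H : ℝ}

/-- interior of `nb` -/
def nbo (h : ℝ) : Set ℂ := {z : ℂ | -(1 / 2) < z.re ∧ z.re < 0 ∧ |z.im| < h}

lemma isOpen_nbo (h : ℝ) : IsOpen (nbo h) := by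
  unfold nbo
  apply IsOpen.inter (isOpen_lt continuous_const Complex.continuous_re)
  apply IsOpen.inter (isOpen_lt Complex.continuous_re continuous_const)
  exact isOpen_lt Complex.continuous_im.abs continuous_const

lemma nbo_subset (h : ℝ) : nbo h ⊆ nb h := fun _ hz => ⟨hz.1.le, hz.2.1.le, hz.2.2.le⟩

lemma differentiableAt_kap {w : ℂ} (h : sn w ≠ 0) : DifferentiableAt ℂ kap w := by
  have h' : Complex.sin (Real.pi / 2 * w) ≠ 0 := h
  unfold kap
  apply DifferentiableAt.const_mul
  exact DifferentiableAt.div (by fun_prop) (by fun_prop) h'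

lemma Small.differentiableAt_Mk (hψ : Small ψ ε H) (hε : ε ≤ 1 / 100) (hH : 3 ≤ H) {t : ℝ}
    (ht : |t| ≤ H - 1) {z : ℂ} (hz : z ∈ nb (H - 1)) (hne : (t * Complex.I : ℂ) ≠ z) :
    DifferentiableAt ℂ (fun z => Mk ψ (t * Complex.I) z) z := by
  obtain ⟨h1, h2, h3, h4⟩ := hψ.sn_ne hε hH ht hz hne
  obtain ⟨hz1, hz2⟩ := nb_mem hz hH
  have hc : DifferentiableAt ℂ ψ z := hψ.differentiableAt (by linarith) (by linarith)
  simp only [Mk_eq]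
  have k1 : DifferentiableAt ℂ (fun z => kap (t * Complex.I - z)) z :=
    DifferentiableAt.comp (g := kap) z (differentiableAt_kap h1) (by fun_prop)
  have k2 : DifferentiableAt ℂ (fun z => kap (t * Complex.I - z + (ψ (t * Complex.I) - ψ z))) z :=
    DifferentiableAt.comp (g := kap) z (differentiableAt_kap h2) (by fun_prop)
  have k3 : DifferentiableAt ℂ (fun z => kap (t * Complex.I - z + 1 + ψ (t * Complex.I))) z :=
    DifferentiableAt.comp (g := kap) z (differentiableAt_kap h3) (by fun_prop)
  have k4 : DifferentiableAt ℂ (fun z => kap (t * Complex.I - z + 1 - ψ z)) z :=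
    DifferentiableAt.comp (g := kap) z (differentiableAt_kap h4) (by fun_prop)
  exact ((k2.const_mul _).sub k1).sub ((k3.const_mul _).sub k4)

lemma MkB.differentiableOn_MM {c : ℝ} (hM : MkB ψ c H) (hc : 0 ≤ c) (hψ : Small ψ ε H)
    (hε : ε ≤ 1 / 100) (hH : 3 ≤ H) {g : ℝ → ℂ} (hg : Continuous g) {G : ℝ}
    (hG : ∀ t, ‖g t‖ ≤ G) : DifferentiableOn ℂ (MM ψ (H - 1) g) (nbo (H - 1)) := by
  unfold MM
  apply DifferentiableOn.const_mul
  have hne : ∀ (t : ℝ), ∀ z ∈ nbo (H - 1), (t * Complex.I : ℂ) ≠ z := by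
    intro t z hz h
    have := congrArg Complex.re h
    simp at this
    have h2 := hz.2.1
    linarith
  have huI : ∀ t ∈ Set.uIoc (-(H - 1)) (H - 1), |t| ≤ H - 1 := by
    intro t ht
    rw [Set.uIoc_of_le (by linarith)] at ht
    exact abs_le.2 ⟨by linarith [ht.1], ht.2⟩
  apply differentiableOn_integral (isOpen_nbo _)
  · intro t ht z hz
    apply DifferentiableAt.differentiableWithinAt
    apply DifferentiableAt.const_mul
    exact hψ.differentiableAt_Mk hε hH (huI t ht) (nbo_subset _ hz) (hne t z hz)
  · intro z _
    exact hg.aestronglyMeasurable.mul (hψ.aesm_Mk hH z)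
  · intro z hz
    refine ⟨nbo (H - 1), (isOpen_nbo _).mem_nhds hz, G * c, fun w hw t ht => ?_⟩
    rw [norm_mul]
    apply mul_le_mul (hG t) _ (norm_nonneg _) ((norm_nonneg _).trans (hG 0))
    refine (hM _ _ (by simp) (by simpa using huI t ht) (nbo_subset _ hw) (hne t w hw)).trans ?_
    have : 1 / (1 + ((t * Complex.I : ℂ).im - w.im) ^ 2) ≤ 1 := by
      rw [div_le_one (by positivity)]; nlinarith [sq_nonneg ((t * Complex.I : ℂ).im - w.im)]
    nlinarith

lemma MkB.exists_fixed {c : ℝ} (hM : MkB ψ c H) (hc : 0 ≤ c) (hc1 : c ≤ 1) (hψ : Small ψ ε H)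
    (hε : ε ≤ 1 / 100) (hH : 3 ≤ H) : ∃ g : ℝ → ℂ, Continuous g ∧ (∀ t, ‖g t‖ ≤ 2 * ε) ∧
    ∀ t, |t| ≤ H - 1 → g t = -ψ (t * Complex.I) - MM ψ (H - 1) g (t * Complex.I) := by
  have hle : -(H - 1) ≤ H - 1 := by linarith
  have hmem : ∀ t ∈ Set.Icc (-(H - 1)) (H - 1), (t * Complex.I : ℂ) ∈ nb (H - 1) := by
    intro t ht
    refine ⟨?_, ?_, ?_⟩
    · simp
    · simp
    · simpa [abs_le] using ht
  have hε0 : 0 ≤ ε := (norm_nonneg _).trans (hψ.bound 0 (by simp) (by simp; linarith))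
  let J := Set.Icc (-(H - 1)) (H - 1)
  let ext : C(J, ℂ) → ℝ → ℂ := fun g => Set.IccExtend hle g
  have hext : ∀ g, Continuous (ext g) := fun g => g.continuous.Icc_extend'
  have hψc : Continuous fun t : J => ψ (t * Complex.I) := by
    have := (hψ.contOn_line (s := 0) (by simp))
    simp only [Complex.ofReal_zero, zero_add] at this
    exact continuousOn_iff_continuous_domRestrict.1 this
  have hMc : ∀ g, Continuous fun t : J => MM ψ (H - 1) (ext g) (t * Complex.I) := by
    intro g
    exact (hM.continuousOn_MM hc hψ hε hH (hext g)).comp_continuous (by fun_prop)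
      (fun t => hmem t t.2)
  let Φ : C(J, ℂ) → C(J, ℂ) := fun g =>
    ⟨fun t => -ψ (t * Complex.I) - MM ψ (H - 1) (ext g) (t * Complex.I), hψc.neg.sub (hMc g)⟩
  have hlip : LipschitzWith (1 / 2) Φ := by
    apply LipschitzWith.of_dist_le_mul
    intro g g'
    rw [ContinuousMap.dist_le (by positivity)]
    intro t
    have hsub : MM ψ (H - 1) (ext g) (t * Complex.I) - MM ψ (H - 1) (ext g') (t * Complex.I) =
        MM ψ (H - 1) (fun t => ext g t - ext g' t) (t * Complex.I) := by
      unfold MM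
      rw [← mul_sub, ← intervalIntegral.integral_sub
        (hM.intervalIntegrable hψ hH (hext g) (hmem t t.2))
        (hM.intervalIntegrable hψ hH (hext g') (hmem t t.2))]
      simp only [sub_mul]
    rw [dist_eq_norm]
    show ‖(-ψ (t * Complex.I) - MM ψ (H - 1) (ext g) (t * Complex.I)) -
      (-ψ (t * Complex.I) - MM ψ (H - 1) (ext g') (t * Complex.I))‖ ≤ _
    rw [sub_sub_sub_cancel_left, norm_sub_rev, hsub]
    refine (hM.norm_MM_le_const hc hc1 hH ((hext g).sub (hext g')) (G := dist g g')
      (fun s => ?_) (hmem t t.2)).trans ?_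
    · show ‖ext g s - ext g' s‖ ≤ _
      rw [← dist_eq_norm]
      exact ContinuousMap.dist_apply_le_dist _
    · simp; linarith
  have hcon : ContractingWith (1 / 2) Φ := ⟨by
    rw [← NNReal.coe_lt_coe]; norm_num, hlip⟩
  obtain ⟨g, hg⟩ : ∃ g, Φ g = g := ⟨_, hcon.fixedPoint_isFixedPt⟩
  have hgt : ∀ t : J, g t = -ψ (t * Complex.I) - MM ψ (H - 1) (ext g) (t * Complex.I) := by
    intro t
    conv_lhs => rw [← hg]
    rfl
  have hbd : ‖g‖ ≤ 2 * ε := by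
    have h1 : ‖g‖ ≤ ε + ‖g‖ / 2 := by
      rw [ContinuousMap.norm_le _ (by positivity)]
      intro t
      rw [hgt t]
      refine (norm_sub_le _ _).trans ?_
      rw [norm_neg]
      have ht := abs_le.2 ⟨t.2.1, t.2.2⟩
      gcongr
      · exact hψ.bound _ (by simp) (by simp; linarith)
      · exact hM.norm_MM_le_const hc hc1 hH (hext g) (fun s => ContinuousMap.norm_coe_le_norm g _)
          (hmem t t.2)
    linarith
  refine ⟨ext g, hext g, fun t => (ContinuousMap.norm_coe_le_norm g _).trans hbd, fun t ht => ?_⟩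
  have := hgt ⟨t, abs_le.1 ht⟩
  rw [← this]
  exact Set.IccExtend_of_mem hle g (abs_le.1 ht)

lemma MkB.line_le {c : ℝ} (hM : MkB ψ c H) (hc : 0 ≤ c) (hc1 : c ≤ 1) (hψ : Small ψ ε H)
    (hε : ε ≤ 1 / 100) (hH : 3 ≤ H) {g : ℝ → ℂ} (hg : Continuous g) {s : ℝ}
    (hs : -(1 / 2) ≤ s) (hs' : s ≤ 0) :
    ∫ y in -(H - 1)..(H - 1), ‖-ψ (s + y * Complex.I) - MM ψ (H - 1) g (s + y * Complex.I)‖ ≤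
    (∫ y in -(H - 1)..(H - 1), ‖ψ (s + y * Complex.I)‖) +
      (∫ t in -(H - 1)..(H - 1), ‖g t‖) / 2 := by
  have hle : -(H - 1) ≤ H - 1 := by linarith
  have hmem : ∀ y ∈ Set.Icc (-(H - 1)) (H - 1), (s + y * Complex.I : ℂ) ∈ nb (H - 1) := by
    intro t ht
    refine ⟨?_, ?_, ?_⟩
    · simpa using hs
    · simpa using hs'
    · simpa [abs_le] using ht
  have hψc : ContinuousOn (fun y : ℝ => ψ (s + y * Complex.I)) (Set.Icc (-(H - 1)) (H - 1)) :=
    hψ.contOn_line (by rw [abs_lt]; constructor <;> linarith)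
  have hMc : ContinuousOn (fun y : ℝ => MM ψ (H - 1) g (s + y * Complex.I))
      (Set.Icc (-(H - 1)) (H - 1)) :=
    (hM.continuousOn_MM hc hψ hε hH hg).comp (by fun_prop) hmem
  have hkc : Continuous (Function.uncurry fun y t : ℝ =>
      ‖g t‖ * (1 * (1 / (1 + (t - y) ^ 2)))) := by
    unfold Function.uncurry
    apply Continuous.mul (by fun_prop)
    apply Continuous.mul continuous_const
    apply Continuous.div continuous_const (by fun_prop)
    intro t
    positivity
  have hsw := MeasureTheory.intervalIntegral_intervalIntegral_swap (a := -(H - 1)) (b := H - 1)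
    (c := -(H - 1)) (d := H - 1) (F := fun y t : ℝ => ‖g t‖ * (1 * (1 / (1 + (t - y) ^ 2))))
    (by
      exact (hkc.locallyIntegrable.integrableOn_isCompact
        ((isCompact_uIcc (a := -(H - 1)) (b := H - 1)).prod
          (isCompact_uIcc (a := -(H - 1)) (b := H - 1)))).mono_set
        (Set.prod_mono Set.uIoc_subset_uIcc Set.uIoc_subset_uIcc))
  have hpi := Real.pi_pos
  have hinner : ∀ y ∈ Set.Icc (-(H - 1)) (H - 1), ‖MM ψ (H - 1) g (s + y * Complex.I)‖ ≤
      (2 * Real.pi)⁻¹ * ∫ t in -(H - 1)..(H - 1), ‖g t‖ * (1 * (1 / (1 + (t - y) ^ 2))) := by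
    intro y hy
    have h1 := hM.norm_MM_le hH hg (hmem y hy)
    have e : (s + y * Complex.I : ℂ).im = y := by simp
    rw [e] at h1
    refine h1.trans ?_
    gcongr
    apply intervalIntegral.integral_mono hle
    · exact (hg.norm.mul (continuous_const.mul (continuous_cauchy y))).intervalIntegrable _ _
    · exact (hg.norm.mul (continuous_const.mul (continuous_cauchy y))).intervalIntegrable _ _
    · intro t
      show ‖g t‖ * _ ≤ ‖g t‖ * _
      gcongr
  have hc1 : Continuous fun y => ∫ t in -(H - 1)..(H - 1), ‖g t‖ * (1 * (1 / (1 + (t - y) ^ 2))) :=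
    intervalIntegral.continuous_parametric_intervalIntegral_of_continuous' hkc _ _
  have hI : ∀ {f : ℝ → ℝ}, ContinuousOn f (Set.Icc (-(H - 1)) (H - 1)) →
      IntervalIntegrable f volume (-(H - 1)) (H - 1) := by
    intro f hf
    apply ContinuousOn.intervalIntegrable
    rwa [Set.uIcc_of_le hle]
  have hI2 : IntervalIntegrable (fun y => (2 * Real.pi)⁻¹ *
      ∫ t in -(H - 1)..(H - 1), ‖g t‖ * (1 * (1 / (1 + (t - y) ^ 2)))) volume
      (-(H - 1)) (H - 1) := (continuous_const.mul hc1).intervalIntegrable _ _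
  calc _ ≤ ∫ y in -(H - 1)..(H - 1), (‖ψ (s + y * Complex.I)‖ + (2 * Real.pi)⁻¹ *
        ∫ t in -(H - 1)..(H - 1), ‖g t‖ * (1 * (1 / (1 + (t - y) ^ 2)))) := by
        apply intervalIntegral.integral_mono_on hle
        · exact hI (hψc.neg.sub hMc).norm
        · exact (hI hψc.norm).add hI2
        · intro y hy
          refine (norm_sub_le _ _).trans ?_
          rw [norm_neg]
          have := hinner y hy
          linarith
    _ = (∫ y in -(H - 1)..(H - 1), ‖ψ (s + y * Complex.I)‖) + (2 * Real.pi)⁻¹ *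
        ∫ t in -(H - 1)..(H - 1), ∫ y in -(H - 1)..(H - 1),
          ‖g t‖ * (1 * (1 / (1 + (t - y) ^ 2))) := by
        rw [intervalIntegral.integral_add (hI hψc.norm) hI2,
          intervalIntegral.integral_const_mul, hsw]
    _ ≤ (∫ y in -(H - 1)..(H - 1), ‖ψ (s + y * Complex.I)‖) + (2 * Real.pi)⁻¹ *
        ∫ t in -(H - 1)..(H - 1), ‖g t‖ * Real.pi := by
        gcongr
        have hkc' : Continuous (Function.uncurry fun t y : ℝ =>
            ‖g t‖ * (1 * (1 / (1 + (t - y) ^ 2)))) := hkc.comp continuous_swap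
        apply intervalIntegral.integral_mono hle
        · exact (intervalIntegral.continuous_parametric_intervalIntegral_of_continuous' hkc'
            _ _).intervalIntegrable _ _
        · exact (hg.norm.mul continuous_const).intervalIntegrable _ _
        · intro t
          show (∫ y in -(H - 1)..(H - 1), ‖g t‖ * (1 * (1 / (1 + (t - y) ^ 2)))) ≤ _
          rw [intervalIntegral.integral_const_mul]
          refine mul_le_mul_of_nonneg_left ?_ (norm_nonneg _)
          refine le_trans (le_of_eq ?_) (integral_cauchy_le (H - 1) t)
          congr 1
          ext y
          rw [one_mul, show (t - y) ^ 2 = (y - t) ^ 2 by ring]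
    _ = _ := by
        rw [intervalIntegral.integral_mul_const]
        congr 1
        field_simp

lemma MkB.exists_density {c : ℝ} (hM : MkB ψ c H) (hc : 0 ≤ c) (hc1 : c ≤ 1) (hψ : Small ψ ε H)
    (hε : ε ≤ 1 / 100) (hH : 3 ≤ H) : ∃ g : ℂ → ℂ, ContinuousOn g (nb (H - 1)) ∧
    DifferentiableOn ℂ g (nbo (H - 1)) ∧ (∀ z ∈ nb (H - 1), ‖g z‖ ≤ 2 * ε) ∧
    (∀ z ∈ nb (H - 1), g z = -ψ z - MM ψ (H - 1) (fun t => g (t * Complex.I)) z) ∧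
    (∫ y in -(H - 1)..(H - 1), ‖g (y * Complex.I)‖ ≤
      2 * ∫ y in -(H - 1)..(H - 1), ‖ψ (y * Complex.I)‖) ∧
    (∫ y in -(H - 1)..(H - 1), ‖g (-(1 / 2) + y * Complex.I)‖ ≤
      (∫ y in -(H - 1)..(H - 1), ‖ψ (-(1 / 2) + y * Complex.I)‖) +
        ∫ y in -(H - 1)..(H - 1), ‖ψ (y * Complex.I)‖) := by
  obtain ⟨g0, hg0, hb, hfix⟩ := hM.exists_fixed hc hc1 hψ hε hH
  have hle : -(H - 1) ≤ H - 1 := by linarith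
  set g : ℂ → ℂ := fun z => -ψ z - MM ψ (H - 1) g0 z with hgdef
  have hline : ∀ t, |t| ≤ H - 1 → g (t * Complex.I) = g0 t := fun t ht => (hfix t ht).symm
  have hMM : ∀ z, MM ψ (H - 1) (fun t => g (t * Complex.I)) z = MM ψ (H - 1) g0 z := by
    intro z
    unfold MM
    congr 1
    apply intervalIntegral.integral_congr
    intro t ht
    rw [Set.uIcc_of_le hle] at ht
    simp only [hline t (abs_le.2 ht)]
  have hψd : ∀ z ∈ nb (H - 1), DifferentiableAt ℂ ψ z := fun z hz =>
    hψ.differentiableAt (by linarith [(nb_mem hz hH).1]) (by linarith [(nb_mem hz hH).2])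
  have h_int : ∫ y in -(H - 1)..(H - 1), ‖g (y * Complex.I)‖ =
      ∫ y in -(H - 1)..(H - 1), ‖g0 y‖ := by
    apply intervalIntegral.integral_congr
    intro t ht
    rw [Set.uIcc_of_le hle] at ht
    simp only [hline t (abs_le.2 ht)]
  have h0 := hM.line_le hc hc1 hψ hε hH hg0 (s := 0) (by norm_num) le_rfl
  have h1 := hM.line_le hc hc1 hψ hε hH hg0 (s := -(1 / 2)) le_rfl (by norm_num)
  simp only [Complex.ofReal_zero, zero_add] at h0
  push_cast at h1
  rw [show (fun y : ℝ => ‖-ψ (y * Complex.I) - MM ψ (H - 1) g0 (y * Complex.I)‖) =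
    fun y : ℝ => ‖g (y * Complex.I)‖ from rfl, h_int] at h0
  refine ⟨g, ?_, ?_, ?_, fun z _ => by rw [hMM], ?_, ?_⟩
  · exact (ContinuousOn.neg fun z hz => (hψd z hz).continuousAt.continuousWithinAt).sub
      (hM.continuousOn_MM hc hψ hε hH hg0)
  · exact (DifferentiableOn.neg fun z hz =>
      (hψd z (nbo_subset _ hz)).differentiableWithinAt).sub
      (hM.differentiableOn_MM hc hψ hε hH hg0 hb)
  · intro z hz
    refine (norm_sub_le _ _).trans ?_
    rw [norm_neg]
    have h1 := hψ.bound z (by linarith [(nb_mem hz hH).1]) (by linarith [(nb_mem hz hH).2])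
    have h2 := hM.norm_MM_le_const hc hc1 hH hg0 hb hz
    linarith
  · rw [h_int]; linarith
  · refine h1.trans ?_
    linarith

section kint
variable {a b : ℝ} {G c : ℝ → ℂ} {U : Set ℂ}

lemma kint_contOn (hG : ContinuousOn G (Set.Icc a b))
    (hc : ContinuousOn c (Set.Icc a b)) {z : ℂ} (hreg : ∀ t ∈ Set.Icc a b, Reg (c t - z)) :
    ContinuousOn (fun t => G t * kap (c t - z)) (Set.Icc a b) := by
  refine hG.mul fun t ht => ?_
  exact ContinuousAt.comp_continuousWithinAt (g := kap) (continuousAt_kap (hreg t ht).sn_ne)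
    ((hc t ht).sub continuousWithinAt_const)

lemma intervalIntegrable_of_Icc {E : Type*} [NormedAddCommGroup E] {f : ℝ → E} (hab : a ≤ b)
    (hf : ContinuousOn f (Set.Icc a b)) : IntervalIntegrable f volume a b := by
  apply ContinuousOn.intervalIntegrable
  rwa [Set.uIcc_of_le hab]

lemma kint_differentiableOn (hab : a ≤ b) (hG : ContinuousOn G (Set.Icc a b))
    (hc : ContinuousOn c (Set.Icc a b)) (hU : IsOpen U)
    (hreg : ∀ t ∈ Set.Icc a b, ∀ z ∈ U, Reg (c t - z)) :
    DifferentiableOn ℂ (fun z => ∫ t in a..b, G t * kap (c t - z)) U := by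
  have hI : Set.uIoc a b ⊆ Set.Icc a b := by
    rw [Set.uIoc_of_le hab]; exact Set.Ioc_subset_Icc_self
  obtain ⟨M, hM⟩ := isCompact_Icc.exists_bound_of_continuousOn hG
  apply differentiableOn_integral hU
  · intro t ht z hz
    apply DifferentiableAt.differentiableWithinAt
    apply DifferentiableAt.const_mul
    exact DifferentiableAt.comp (g := kap) z (differentiableAt_kap (hreg t (hI ht) z hz).sn_ne)
      (by fun_prop)
  · intro z hz
    have := kint_contOn hG hc (fun t ht => hreg t ht z hz)
    exact (this.mono hI).aestronglyMeasurable measurableSet_uIoc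
  · intro z hz
    refine ⟨U, hU.mem_nhds hz, M * 80, fun w hw t ht => ?_⟩
    rw [norm_mul]
    have h1 := hM t (hI ht)
    have h2 := kap_le _ (hreg t (hI ht) w hw)
    exact mul_le_mul h1 h2 (norm_nonneg _) ((norm_nonneg _).trans h1)

lemma kint_norm_le (hab : a ≤ b) (hG : ContinuousOn G (Set.Icc a b)) {z : ℂ}
    (hreg : ∀ t ∈ Set.Icc a b, Reg (c t - z)) :
    ‖∫ t in a..b, G t * kap (c t - z)‖ ≤ 80 * ∫ t in a..b, ‖G t‖ := by
  rw [← intervalIntegral.integral_const_mul]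
  apply intervalIntegral.norm_integral_le_of_norm_le hab
  · refine .of_forall fun t ht => ?_
    rw [norm_mul, mul_comm]
    exact mul_le_mul_of_nonneg_right (kap_le _ (hreg t ⟨ht.1.le, ht.2⟩)) (norm_nonneg _)
  · exact (intervalIntegrable_of_Icc hab hG.norm).const_mul _

lemma kint_sub_le {C : ℝ} (hC : ∀ w v y, Reg w → Reg v → |w.im - y| ≤ 1 → |v.im - y| ≤ 1 →
      ‖w - v‖ ≤ 3 → ‖kap w - kap v‖ ≤ C * ‖w - v‖ / (1 + y ^ 2)) (hab : a ≤ b)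
    (hG : ContinuousOn G (Set.Icc a b)) (hc : ContinuousOn c (Set.Icc a b)) {M : ℝ}
    (hM : ∀ t ∈ Set.Icc a b, ‖G t‖ ≤ M) {z z' : ℂ}
    (hreg : ∀ t ∈ Set.Icc a b, Reg (c t - z)) (hreg' : ∀ t ∈ Set.Icc a b, Reg (c t - z'))
    (hzz : ‖z - z'‖ ≤ 1 / 2) {y : ℝ → ℝ} (hy : Continuous y)
    (hyc : ∀ t ∈ Set.Icc a b, |(c t).im - y t| ≤ 1 / 2) :
    ‖(∫ t in a..b, G t * kap (c t - z)) - ∫ t in a..b, G t * kap (c t - z')‖ ≤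
      (M * C * ∫ t in a..b, 1 / (1 + (y t - z.im) ^ 2)) * ‖z - z'‖ := by
  rw [← intervalIntegral.integral_sub
    (intervalIntegrable_of_Icc hab (kint_contOn hG hc hreg))
    (intervalIntegrable_of_Icc hab (kint_contOn hG hc hreg')), mul_right_comm,
    ← intervalIntegral.integral_const_mul]
  apply intervalIntegral.norm_integral_le_of_norm_le hab
  · refine .of_forall fun t ht => ?_
    have ht' : t ∈ Set.Icc a b := ⟨ht.1.le, ht.2⟩
    rw [← mul_sub, norm_mul]
    have h1 := hM t ht'
    have e : c t - z - (c t - z') = -(z - z') := by ring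
    have him : |z.im - z'.im| ≤ 1 / 2 := by
      rw [← Complex.sub_im]; exact (Complex.abs_im_le_norm _).trans hzz
    have hy1 := hyc t ht'
    rw [abs_le] at him hy1
    have h2 := hC (c t - z) (c t - z') (y t - z.im) (hreg t ht') (hreg' t ht')
      (by rw [Complex.sub_im, abs_le]; constructor <;> linarith)
      (by rw [Complex.sub_im, abs_le]; constructor <;> linarith)
      (by rw [e, norm_neg]; linarith)
    rw [e, norm_neg] at h2
    refine (mul_le_mul h1 h2 (norm_nonneg _) ((norm_nonneg _).trans h1)).trans (le_of_eq ?_)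
    ring
  · apply Continuous.intervalIntegrable
    apply Continuous.mul continuous_const
    apply Continuous.div continuous_const (by fun_prop)
    intro t
    positivity

end kint

lemma log_sub_log_neg_of_im_pos {w : ℂ} (h : 0 < w.im) :
    Complex.log w - Complex.log (-w) = Real.pi * Complex.I := by
  unfold Complex.log
  rw [norm_neg, Complex.arg_neg_eq_arg_sub_pi_of_im_pos h]
  push_cast
  ring

lemma log_sub_log_neg_of_im_neg {w : ℂ} (h : w.im < 0) :
    Complex.log w - Complex.log (-w) = -(Real.pi * Complex.I) := by
  unfold Complex.log
  rw [norm_neg, Complex.arg_neg_eq_arg_add_pi_of_im_neg h]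
  push_cast
  ring

/-- integral of `F` along the polygonal path `-ih → -1/2-ih → -1/2+ih → ih`. -/
noncomputable def gm (h : ℝ) (F : ℂ → ℂ) : ℂ :=
  -(∫ x in (-(1 / 2) : ℝ)..0, F (x + ((-h : ℝ) : ℂ) * Complex.I)) +
    Complex.I * (∫ t in -h..h, F (((-(1 / 2) : ℝ) : ℂ) + t * Complex.I)) +
    ∫ x in (-(1 / 2) : ℝ)..0, F (x + (h : ℂ) * Complex.I)

lemma gm_eq_of_off {h : ℝ} (hh : 0 ≤ h) {F : ℂ → ℂ} (z : ℂ) (hc : ContinuousOn F (nb h))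
    (hd : ∀ w ∈ nbo h, w ≠ z → DifferentiableAt ℂ F w) :
    Complex.I * ∫ t in -h..h, F (t * Complex.I) = gm h F := by
  have e1 : (Set.uIcc (-(1 / 2) : ℝ) 0 ×ℂ Set.uIcc (-h) h) = nb h := by
    ext w
    rw [Complex.mem_reProdIm, Set.uIcc_of_le (by norm_num), Set.uIcc_of_le (by linarith)]
    simp only [nb, Set.mem_Icc, Set.mem_ofPred_eq, abs_le, and_assoc]
  have e2 : (Set.Ioo (min (-(1 / 2) : ℝ) 0) (max (-(1 / 2)) 0) ×ℂ
      Set.Ioo (min (-h) h) (max (-h) h)) ⊆ nbo h := by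
    intro w hw
    rw [Complex.mem_reProdIm, min_eq_left (by norm_num), max_eq_right (by norm_num),
      min_eq_left (by linarith), max_eq_right (by linarith)] at hw
    exact ⟨hw.1.1, hw.1.2, abs_lt.2 hw.2⟩
  have := Complex.integral_boundary_rect_eq_zero_of_differentiable_on_off_countable F
    (⟨-(1 / 2), -h⟩ : ℂ) (⟨0, h⟩ : ℂ) {z} (Set.countable_singleton z) (by
      simpa only [e1] using hc)
    (fun w hw => hd w (e2 hw.1) (by simpa using hw.2))
  simp only [smul_eq_mul, Complex.ofReal_zero, zero_add] at this
  unfold gm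
  linear_combination this

lemma integral_horiz {s t d : ℝ} {z : ℂ} (hd : d - z.im ≠ 0) :
    ∫ x in s..t, (1 : ℂ) / (x + d * Complex.I - z) =
      Complex.log (t + d * Complex.I - z) - Complex.log (s + d * Complex.I - z) := by
  have him : ∀ x : ℝ, (x + d * Complex.I - z : ℂ).im = d - z.im := by intro x; simp
  have hs : ∀ x : ℝ, (x + d * Complex.I - z : ℂ) ∈ Complex.slitPlane := by
    intro x; right; rw [him]; exact hd
  have hne : ∀ x : ℝ, (x + d * Complex.I - z : ℂ) ≠ 0 := fun x =>
    Complex.slitPlane_ne_zero (hs x)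
  apply intervalIntegral.integral_eq_sub_of_hasDerivAt
    (f := fun x : ℝ => Complex.log (x + d * Complex.I - z))
  · intro x _
    have h1 : HasDerivAt (fun x : ℝ => (x + d * Complex.I - z : ℂ)) 1 x :=
      ((Complex.ofRealCLM.hasDerivAt (x := x)).add_const _).sub_const _
    exact h1.clog_real (hs x)
  · apply Continuous.intervalIntegrable
    exact continuous_const.div (by fun_prop) hne

lemma integral_vert {s h σ : ℝ} {z : ℂ} (hσ : σ = 1 ∨ σ = -1) (hd : 0 < σ * (s - z.re)) :
    ∫ y in -h..h, (1 : ℂ) / (s + y * Complex.I - z) =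
      -Complex.I * (Complex.log (σ * (s + h * Complex.I - z)) -
        Complex.log (σ * (s + ((-h : ℝ) : ℂ) * Complex.I - z))) := by
  have hre : ∀ x : ℝ, (σ * (s + x * Complex.I - z) : ℂ).re = σ * (s - z.re) := by intro x; simp
  have hs : ∀ x : ℝ, (σ * (s + x * Complex.I - z) : ℂ) ∈ Complex.slitPlane := by
    intro x; left; rw [hre]; exact hd
  have hne : ∀ x : ℝ, (s + x * Complex.I - z : ℂ) ≠ 0 := fun x hx => by
    have := Complex.slitPlane_ne_zero (hs x)
    rw [hx, mul_zero] at this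
    exact this rfl
  rw [mul_sub]
  have hσ0 : (σ : ℂ) ≠ 0 := by rcases hσ with h | h <;> simp [h]
  apply intervalIntegral.integral_eq_sub_of_hasDerivAt
    (f := fun x : ℝ => -Complex.I * Complex.log (σ * (s + x * Complex.I - z)))
  · intro x _
    have h1 : HasDerivAt (fun x : ℝ => (σ * (s + x * Complex.I - z) : ℂ)) (σ * (1 * Complex.I)) x :=
      ((((Complex.ofRealCLM.hasDerivAt (x := x)).mul_const Complex.I).const_add _).sub_const
        _).const_mul _
    have h2 := (h1.clog_real (hs x)).const_mul (-Complex.I)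
    rwa [one_mul, mul_div_mul_left _ _ hσ0, ← mul_div_assoc, neg_mul, Complex.I_mul_I, neg_neg] at h2
  · apply Continuous.intervalIntegrable
    exact continuous_const.div (by fun_prop) hne

lemma gm_inv {h : ℝ} {z : ℂ} (hz : z ∈ nbo h) :
    Complex.I * ∫ t in -h..h, 1 / ((t * Complex.I : ℂ) - z) =
      gm h (fun w => 1 / (w - z)) + 2 * Real.pi * Complex.I := by
  obtain ⟨h1, h2, h3⟩ := hz
  rw [abs_lt] at h3
  have v1 := integral_vert (s := 0) (h := h) (σ := 1) (z := z) (Or.inl rfl) (by linarith)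
  have v2 := integral_vert (s := -(1 / 2)) (h := h) (σ := -1) (z := z) (Or.inr rfl) (by linarith)
  have t1 := integral_horiz (s := -(1 / 2)) (t := 0) (d := h) (z := z) (by linarith)
  have t2 := integral_horiz (s := -(1 / 2)) (t := 0) (d := -h) (z := z) (by linarith)
  have l1 := log_sub_log_neg_of_im_pos
    (w := ((-(1 / 2) : ℝ) : ℂ) + h * Complex.I - z) (by simp; linarith)
  have l2 := log_sub_log_neg_of_im_neg
    (w := ((-(1 / 2) : ℝ) : ℂ) + ((-h : ℝ) : ℂ) * Complex.I - z) (by simp; linarith)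
  unfold gm
  simp only [Complex.ofReal_zero, Complex.ofReal_one, one_mul, zero_add, Complex.ofReal_neg,
    neg_mul] at v1 v2 t1 t2 l1 l2 ⊢
  rw [v1, v2, t1, t2]
  linear_combination l1 - l2 + (-Complex.log (h * Complex.I - z) +
    Complex.log (-(h * Complex.I) - z) -
    Complex.log (-(-((1 / 2 : ℝ) : ℂ) + -(h * Complex.I) - z)) +
    Complex.log (-(-((1 / 2 : ℝ) : ℂ) + h * Complex.I - z))) * Complex.I_sq

lemma sn_ne_zero_of_re {w : ℂ} (hw : |w.re| < 2) (h0 : w ≠ 0) : sn w ≠ 0 := by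
  intro h
  have h1 := norm_sn_sq w
  rw [h, norm_zero] at h1
  have h2 : Real.sinh (Real.pi / 2 * w.im) = 0 := by
    nlinarith [sq_nonneg (Real.sin (Real.pi / 2 * w.re)),
      sq_nonneg (Real.sinh (Real.pi / 2 * w.im))]
  rw [Real.sinh_eq_zero] at h2
  have h3 : w.im = 0 := by
    have := Real.pi_pos
    rcases mul_eq_zero.1 h2 with h | h
    · linarith
    · exact h
  refine sn_ne_zero ?_ h0 h
  have : w = (w.re : ℂ) := Complex.ext rfl (by simpa using h3)
  rw [this, Complex.norm_real]
  exact hw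

lemma gm_add {h : ℝ} (hh : 0 ≤ h) {F K : ℂ → ℂ} {S : Set ℂ} (hF : ContinuousOn F S)
    (hK : ContinuousOn K S) (hS : ∀ w, (-(1 / 2) ≤ w.re ∧ w.re ≤ 0 ∧ |w.im| = h) ∨
      (w.re = -(1 / 2) ∧ |w.im| ≤ h) → w ∈ S) :
    gm h (fun w => F w + K w) = gm h F + gm h K := by
  have c1 : ∀ {F : ℂ → ℂ} {d : ℝ}, |d| = h → ContinuousOn F S →
      IntervalIntegrable (fun x : ℝ => F (x + (d : ℂ) * Complex.I)) volume (-(1 / 2)) 0 := by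
    intro F d hd hF
    apply intervalIntegrable_of_Icc (by norm_num)
    refine hF.comp (by fun_prop) fun x hx => hS _ (Or.inl ?_)
    simpa using ⟨by linarith [hx.1], hx.2, hd⟩
  have c2 : ∀ {F : ℂ → ℂ}, ContinuousOn F S →
      IntervalIntegrable (fun t : ℝ => F (((-(1 / 2) : ℝ) : ℂ) + t * Complex.I)) volume (-h) h := by
    intro F hF
    apply intervalIntegrable_of_Icc (by linarith)
    refine hF.comp (by fun_prop) fun x hx => hS _ (Or.inr ?_)
    simpa [abs_le] using hx
  unfold gm
  rw [intervalIntegral.integral_add (c1 (by rw [abs_neg, abs_of_nonneg hh]) hF)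
      (c1 (by rw [abs_neg, abs_of_nonneg hh]) hK),
    intervalIntegral.integral_add (c1 (abs_of_nonneg hh) hF) (c1 (abs_of_nonneg hh) hK),
    intervalIntegral.integral_add (c2 hF) (c2 hK)]
  ring

lemma gm_const_mul {h : ℝ} {F : ℂ → ℂ} (c : ℂ) : gm h (fun w => c * F w) = c * gm h F := by
  unfold gm
  simp only [intervalIntegral.integral_const_mul]
  ring

/-- Residue formula for the kernel `kap` on the rectangle `nb h`. -/
lemma gm_kap {h : ℝ} (hh : 0 ≤ h) {g : ℂ → ℂ} (hc : ContinuousOn g (nb h))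
    (hd : DifferentiableOn ℂ g (nbo h)) {z : ℂ} (hz : z ∈ nbo h) :
    Complex.I * ∫ t in -h..h, g (t * Complex.I) * kap (t * Complex.I - z) =
      gm h (fun w => g w * kap (w - z)) + 2 * Real.pi * Complex.I * g z := by
  obtain ⟨lam, C, _, hk, _, _, hlam⟩ := kap_expansion
  have hlam' : ∀ w : ℂ, |w.re| < 2 → DifferentiableAt ℂ lam w := by
    intro w hw
    by_cases h0 : w = 0
    · subst h0
      exact hlam.differentiableAt (Metric.isOpen_ball.mem_nhds (by simp))
    · have hd := (differentiableAt_kap (sn_ne_zero_of_re hw h0)).sub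
        ((differentiableAt_const (1 : ℂ)).div differentiableAt_id h0)
      refine hd.congr_of_eventuallyEq ?_
      filter_upwards [isOpen_ne.mem_nhds h0] with v hv
      simp [hk v hv]
  have hre : ∀ w ∈ nb h, |(w - z).re| < 2 := by
    intro w hw
    rw [Complex.sub_re, abs_lt]
    constructor <;> linarith [hw.1, hw.2.1, hz.1, hz.2.1]
  have hgz : DifferentiableAt ℂ g z := hd.differentiableAt ((isOpen_nbo h).mem_nhds hz)
  have hnb : nb h ∈ 𝓝 z := mem_of_superset ((isOpen_nbo h).mem_nhds hz) (nbo_subset h)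
  set F : ℂ → ℂ := fun w => dslope g z w + g w * lam (w - z) with hF
  have hFc : ContinuousOn F (nb h) := by
    refine ContinuousOn.add ((continuousOn_dslope hnb).2 ⟨hc, hgz⟩) (hc.mul fun w hw => ?_)
    exact (DifferentiableAt.comp (g := lam) w (hlam' _ (hre w hw))
      (by fun_prop)).continuousAt.continuousWithinAt
  have hFd : DifferentiableOn ℂ F (nbo h) := by
    refine DifferentiableOn.add ((Complex.differentiableOn_dslope
      ((isOpen_nbo h).mem_nhds hz)).2 hd) (hd.mul fun w hw => ?_)
    exact (DifferentiableAt.comp (g := lam) w (hlam' _ (hre w (nbo_subset _ hw)))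
      (by fun_prop)).differentiableWithinAt
  have hFe : ∀ w, w ≠ z → F w + g z * (1 / (w - z)) = g w * kap (w - z) := by
    intro w hw
    have hwz : w - z ≠ 0 := sub_ne_zero.2 hw
    rw [hF]
    simp only
    rw [hk _ hwz, dslope_of_ne _ hw, slope_def_field]
    field_simp
    ring
  have hS : ∀ w, (-(1 / 2) ≤ w.re ∧ w.re ≤ 0 ∧ |w.im| = h) ∨
      (w.re = -(1 / 2) ∧ |w.im| ≤ h) → w ∈ nb h \ {z} := by
    intro w hw
    rcases hw with hw | hw
    · refine ⟨⟨hw.1, hw.2.1, hw.2.2.le⟩, ?_⟩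
      rintro rfl
      linarith [hz.2.2]
    · refine ⟨⟨hw.1.ge, by linarith, hw.2⟩, ?_⟩
      rintro rfl
      linarith [hz.1]
  have hinv : ContinuousOn (fun w => 1 / (w - z)) (nb h \ {z}) := by
    apply ContinuousOn.div continuousOn_const (by fun_prop)
    intro w hw
    exact sub_ne_zero.2 hw.2
  have e1 : gm h (fun w => g w * kap (w - z)) =
      gm h F + g z * gm h (fun w => 1 / (w - z)) := by
    rw [← gm_const_mul, ← gm_add (K := fun w => g z * (1 / (w - z))) hh (hFc.mono Set.sdiff_subset)
      (continuousOn_const.mul hinv) hS]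
    unfold gm
    have hne : ∀ w, (-(1 / 2) ≤ w.re ∧ w.re ≤ 0 ∧ |w.im| = h) ∨
      (w.re = -(1 / 2) ∧ |w.im| ≤ h) → g w * kap (w - z) = F w + g z * (1 / (w - z)) :=
      fun w hw => (hFe w (hS w hw).2).symm
    congr 1
    · congr 1
      · congr 1
        apply intervalIntegral.integral_congr
        intro x hx
        rw [Set.uIcc_of_le (by norm_num)] at hx
        apply hne
        left
        simpa [abs_of_nonneg hh] using ⟨by linarith [hx.1], hx.2⟩
      · congr 1
        apply intervalIntegral.integral_congr
        intro x hx
        rw [Set.uIcc_of_le (by linarith)] at hx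
        apply hne
        right
        simpa [abs_le] using hx
    · apply intervalIntegral.integral_congr
      intro x hx
      rw [Set.uIcc_of_le (by norm_num)] at hx
      apply hne
      left
      simpa [abs_of_nonneg hh] using ⟨by linarith [hx.1], hx.2⟩
  have hline : ∀ t ∈ Set.uIcc (-h) h, (t * Complex.I : ℂ) ∈ nb h := by
    intro t ht
    rw [Set.uIcc_of_le (by linarith)] at ht
    refine ⟨by simp, by simp, by simpa [abs_le] using ht⟩
  have hlne : ∀ t : ℝ, (t * Complex.I : ℂ) ≠ z := by
    rintro t rfl
    have := hz.2.1
    simp at this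
  have e2 : ∫ t in -h..h, g (t * Complex.I) * kap (t * Complex.I - z) =
      (∫ t in -h..h, F (t * Complex.I)) + g z * ∫ t in -h..h, 1 / ((t * Complex.I : ℂ) - z) := by
    rw [← intervalIntegral.integral_const_mul, ← intervalIntegral.integral_add]
    · apply intervalIntegral.integral_congr
      intro t _
      exact (hFe _ (hlne t)).symm
    · exact (hFc.comp (by fun_prop) hline).intervalIntegrable
    · apply Continuous.intervalIntegrable
      apply Continuous.mul continuous_const
      exact continuous_const.div (by fun_prop) fun t => sub_ne_zero.2 (hlne t)
  have e3 := gm_eq_of_off hh z hFc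
    fun w hw _ => hFd.differentiableAt ((isOpen_nbo h).mem_nhds hw)
  have e4 := gm_inv hz
  rw [e1, e2]
  linear_combination e3 + g z * e4

lemma gm_kap_off {h : ℝ} (hh : 0 ≤ h) {g : ℂ → ℂ} (hc : ContinuousOn g (nb h))
    (hd : DifferentiableOn ℂ g (nbo h)) {z : ℂ} (hz : ∀ w ∈ nb h, sn (w - z) ≠ 0) :
    Complex.I * ∫ t in -h..h, g (t * Complex.I) * kap (t * Complex.I - z) =
      gm h (fun w => g w * kap (w - z)) := by
  apply gm_eq_of_off (F := fun w => g w * kap (w - z)) hh z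
  · refine hc.mul fun w hw => ?_
    exact (ContinuousAt.comp (f := fun w => w - z) (g := kap) (continuousAt_kap (hz w hw))
      (by fun_prop)).continuousWithinAt
  · intro w hw _
    apply (hd.differentiableAt ((isOpen_nbo h).mem_nhds hw)).mul
    exact DifferentiableAt.comp (g := kap) w (differentiableAt_kap (hz w (nbo_subset _ hw)))
      (by fun_prop)

/-- the rectangle on which the local linearizing coordinate is constructed -/
def Q2 (H : ℝ) : Set ℂ := {z : ℂ | -(1 / 8) < z.re ∧ z.re < 9 / 10 ∧ |z.im| < H - 2}

lemma isOpen_Q2 (h : ℝ) : IsOpen (Q2 h) := by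
  unfold Q2
  apply IsOpen.inter (isOpen_lt continuous_const Complex.continuous_re)
  apply IsOpen.inter (isOpen_lt Complex.continuous_re continuous_const)
  exact isOpen_lt Complex.continuous_im.abs continuous_const

lemma integral_inv_le_length {a b : ℝ} (hab : a ≤ b) (y : ℝ → ℝ) (hy : Continuous y) :
    ∫ t in a..b, 1 / (1 + (y t) ^ 2) ≤ b - a := by
  have : ∫ t in a..b, 1 / (1 + (y t) ^ 2) ≤ ∫ _ in a..b, (1 : ℝ) := by
    apply intervalIntegral.integral_mono hab
    · apply Continuous.intervalIntegrable
      exact continuous_const.div (by fun_prop) fun t => by positivity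
    · exact continuous_const.intervalIntegrable _ _
    · intro t
      show 1 / (1 + (y t) ^ 2) ≤ 1
      rw [div_le_one (by positivity)]
      nlinarith [sq_nonneg (y t)]
  simpa using this

theorem exists_local_coordinate : ∃ ε0 > (0 : ℝ), ∃ C > (0 : ℝ), ∀ (ψ : ℂ → ℂ) (ε H v : ℝ),
    Small ψ ε H → ε ≤ ε0 → 3 ≤ H →
    (∫ y in -(H - 1)..(H - 1), ‖ψ (y * Complex.I)‖ ≤ v) →
    (∫ y in -(H - 1)..(H - 1), ‖ψ (-(1 / 2) + y * Complex.I)‖ ≤ v) →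
    ∃ L : ℂ → ℂ, DifferentiableOn ℂ L (Q2 H) ∧ (∀ z ∈ Q2 H, ‖L z - z‖ ≤ C * (ε + v)) ∧
      (∀ z ∈ Q2 H, ‖deriv L z - 1‖ ≤ C * ε) ∧
      ∀ z ∈ Q2 H, z + 1 + ψ z ∈ Q2 H → L (z + 1 + ψ z) = L z + 1 := by
  obtain ⟨C1, hC1, hk⟩ := kap_sub_le
  obtain ⟨C2, hC2, hM⟩ := Mk_le
  refine ⟨min (1 / 100) (1 / C2), by positivity, 480 + 60 * C1, by positivity, ?_⟩
  intro ψ ε H v hψ hε hH hv1 hv2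
  have hε1 : ε ≤ 1 / 100 := hε.trans (min_le_left _ _)
  have hε2 : C2 * ε ≤ 1 := by
    have := hε.trans (min_le_right _ _)
    rwa [le_div_iff₀ hC2, mul_comm] at this
  have hε0 : 0 ≤ ε := (norm_nonneg _).trans (hψ.bound 0 (by simp) (by simp; linarith))
  have hMB : MkB ψ (C2 * ε) H := by
    intro ζ z h1 h2 hz hne
    have := hM ψ ε H hψ hε1 ζ z h1 h2 hz.1 hz.2.1 hz.2.2 hne
    rwa [mul_one_div]
  obtain ⟨g, gc, gd, gb, gfix, gv1, gv2⟩ :=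
    hMB.exists_density (by positivity) hε2 hψ hε1 hH
  set h := H - 1 with hh
  have hle : -h ≤ h := by linarith
  set c1 : ℝ → ℂ := fun x => x + ((-h : ℝ) : ℂ) * Complex.I with hc1
  set c2 : ℝ → ℂ := fun t => ((-(1 / 2) : ℝ) : ℂ) + t * Complex.I with hc2
  set c3 : ℝ → ℂ := fun x => x + (h : ℂ) * Complex.I with hc3
  set c4 : ℝ → ℂ := fun t => t * Complex.I + 1 + ψ (t * Complex.I) with hc4
  set G1 : ℝ → ℂ := fun t => g (c1 t) with hG1
  set G2 : ℝ → ℂ := fun t => g (c2 t) with hG2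
  set G3 : ℝ → ℂ := fun t => g (c3 t) with hG3
  set G4 : ℝ → ℂ := fun t => g (t * Complex.I) * (1 + deriv ψ (t * Complex.I)) with hG4
  have m1 : ∀ x ∈ Set.Icc (-(1 / 2) : ℝ) 0, c1 x ∈ nb h := fun x hx => by
    simp [nb, hc1, hx.2, abs_of_nonneg (show 0 ≤ h by linarith)]; linarith [hx.1]
  have m3 : ∀ x ∈ Set.Icc (-(1 / 2) : ℝ) 0, c3 x ∈ nb h := fun x hx => by
    simp [nb, hc3, hx.2, abs_of_nonneg (show 0 ≤ h by linarith)]; linarith [hx.1]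
  have m2 : ∀ x ∈ Set.Icc (-h) h, c2 x ∈ nb h := fun x hx => by
    simpa [nb, hc2, abs_le] using hx
  have m4 : ∀ x ∈ Set.Icc (-h) h, (x * Complex.I : ℂ) ∈ nb h := fun x hx => by
    simpa [nb, abs_le] using hx
  have cc1 : ContinuousOn c1 (Set.Icc (-(1 / 2)) 0) := by fun_prop
  have cc3 : ContinuousOn c3 (Set.Icc (-(1 / 2)) 0) := by fun_prop
  have cc2 : ContinuousOn c2 (Set.Icc (-h) h) := by fun_prop
  have hψc : ContinuousOn (fun t : ℝ => ψ (t * Complex.I)) (Set.Icc (-h) h) := by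
    have := hψ.contOn_line (s := 0) (by simp)
    rwa [Complex.ofReal_zero, funext fun t : ℝ => congrArg ψ (zero_add (t * Complex.I))] at this
  have hψc' : ContinuousOn (fun t : ℝ => deriv ψ (t * Complex.I)) (Set.Icc (-h) h) := by
    have := hψ.contOn_line_deriv (s := 0) (by simp)
    rwa [Complex.ofReal_zero,
      funext fun t : ℝ => congrArg (deriv ψ) (zero_add (t * Complex.I))] at this
  have cc4 : ContinuousOn c4 (Set.Icc (-h) h) := ContinuousOn.add (by fun_prop) hψc
  have cg1 : ContinuousOn G1 (Set.Icc (-(1 / 2)) 0) := gc.comp cc1 m1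
  have cg2 : ContinuousOn G2 (Set.Icc (-h) h) := gc.comp cc2 m2
  have cg3 : ContinuousOn G3 (Set.Icc (-(1 / 2)) 0) := gc.comp cc3 m3
  have cg0 : ContinuousOn (fun t : ℝ => g (t * Complex.I)) (Set.Icc (-h) h) :=
    gc.comp (by fun_prop) m4
  have cg4 : ContinuousOn G4 (Set.Icc (-h) h) := cg0.mul (continuousOn_const.add hψc')
  have pb : ∀ t ∈ Set.Icc (-h) h, ‖ψ (t * Complex.I)‖ ≤ 1 / 100 := fun t ht => by
    have := abs_le.2 ht
    exact (hψ.bound _ (by simp) (by simp; linarith)).trans hε1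
  have db : ∀ t ∈ Set.Icc (-h) h, ‖1 + deriv ψ (t * Complex.I)‖ ≤ 2 := fun t ht => by
    have := abs_le.2 ht
    have h1 := hψ.deriv_le (z := t * Complex.I) (by simp) (by simp; linarith)
    refine (norm_add_le _ _).trans ?_
    rw [norm_one]
    linarith
  have r1 : ∀ t ∈ Set.Icc (-(1 / 2) : ℝ) 0, ∀ z ∈ Q2 H, Reg (c1 t - z) := by
    intro t ht z hz
    right
    have := abs_lt.1 hz.2.2
    simp only [hc1, Complex.sub_im, Complex.add_im, Complex.ofReal_im, Complex.mul_im,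
      Complex.ofReal_re, Complex.I_im, Complex.I_re]
    rw [abs_of_nonpos (by linarith)]
    linarith
  have r3 : ∀ t ∈ Set.Icc (-(1 / 2) : ℝ) 0, ∀ z ∈ Q2 H, Reg (c3 t - z) := by
    intro t ht z hz
    right
    have := abs_lt.1 hz.2.2
    simp only [hc3, Complex.sub_im, Complex.add_im, Complex.ofReal_im, Complex.mul_im,
      Complex.ofReal_re, Complex.I_im, Complex.I_re]
    rw [abs_of_nonneg (by linarith)]
    linarith
  have r2 : ∀ t ∈ Set.Icc (-h) h, ∀ z ∈ Q2 H, Reg (c2 t - z) := by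
    intro t ht z hz
    left
    have : (c2 t - z).re = -(1 / 2) - z.re := by simp [hc2]
    rw [this, abs_of_nonpos (by linarith [hz.1])]
    constructor <;> linarith [hz.1, hz.2.1]
  have r4 : ∀ t ∈ Set.Icc (-h) h, ∀ z ∈ Q2 H, Reg (c4 t - z) := by
    intro t ht z hz
    left
    have : (c4 t - z).re = 1 + (ψ (t * Complex.I)).re - z.re := by simp [hc4]
    have h2 := abs_le.1 ((Complex.abs_re_le_norm _).trans (pb t ht))
    rw [this, abs_of_nonneg (by linarith [hz.1, hz.2.1])]
    constructor <;> linarith [hz.1, hz.2.1]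
  set P1 : ℂ → ℂ := fun z => ∫ t in (-(1 / 2) : ℝ)..0, G1 t * kap (c1 t - z) with hP1
  set P2 : ℂ → ℂ := fun z => ∫ t in (-h)..h, G2 t * kap (c2 t - z) with hP2
  set P3 : ℂ → ℂ := fun z => ∫ t in (-(1 / 2) : ℝ)..0, G3 t * kap (c3 t - z) with hP3
  set P4 : ℂ → ℂ := fun z => ∫ t in (-h)..h, G4 t * kap (c4 t - z) with hP4
  have h20 : (-(1 / 2) : ℝ) ≤ 0 := by norm_num
  have hpi := Real.pi_gt_three
  have hpi4 := Real.pi_lt_four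
  have hpin : ‖(2 * Real.pi : ℂ)⁻¹‖ ≤ 1 := by
    rw [norm_inv, norm_mul, Complex.norm_real, Real.norm_eq_abs, abs_of_pos Real.pi_pos]
    apply inv_le_one_of_one_le₀
    simp; linarith
  set p : ℂ → ℂ := fun z => (2 * Real.pi : ℂ)⁻¹ *
    (-Complex.I * (-P1 z + Complex.I * P2 z + P3 z) + P4 z) with hp
  have hpd : DifferentiableOn ℂ p (Q2 H) := by
    have d1 := kint_differentiableOn h20 cg1 cc1 (isOpen_Q2 H) r1
    have d2 := kint_differentiableOn hle cg2 cc2 (isOpen_Q2 H) r2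
    have d3 := kint_differentiableOn h20 cg3 cc3 (isOpen_Q2 H) r3
    have d4 := kint_differentiableOn hle cg4 cc4 (isOpen_Q2 H) r4
    exact (((d1.neg.add (d2.const_mul _)).add d3).const_mul _ |>.add d4).const_mul _
  have hcomb : ∀ a1 a2 a3 a4 : ℂ, ‖(2 * Real.pi : ℂ)⁻¹ *
      (-Complex.I * (-a1 + Complex.I * a2 + a3) + a4)‖ ≤ ‖a1‖ + ‖a2‖ + ‖a3‖ + ‖a4‖ := by
    intro a1 a2 a3 a4
    rw [norm_mul]
    have e1 : ‖-Complex.I * (-a1 + Complex.I * a2 + a3) + a4‖ ≤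
        ‖a1‖ + ‖a2‖ + ‖a3‖ + ‖a4‖ := by
      refine (norm_add_le _ _).trans ?_
      rw [norm_mul, norm_neg, Complex.norm_I, one_mul]
      have := norm_add_le (-a1 + Complex.I * a2) a3
      have h2 := norm_add_le (-a1) (Complex.I * a2)
      rw [norm_mul, norm_neg, Complex.norm_I, one_mul] at h2
      linarith
    calc _ ≤ 1 * (‖a1‖ + ‖a2‖ + ‖a3‖ + ‖a4‖) :=
        mul_le_mul hpin e1 (norm_nonneg _) zero_le_one
      _ = _ := one_mul _
  have gb1 : ∀ t ∈ Set.Icc (-(1 / 2) : ℝ) 0, ‖G1 t‖ ≤ 2 * ε := fun t ht => gb _ (m1 t ht)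
  have gb2 : ∀ t ∈ Set.Icc (-h) h, ‖G2 t‖ ≤ 2 * ε := fun t ht => gb _ (m2 t ht)
  have gb3 : ∀ t ∈ Set.Icc (-(1 / 2) : ℝ) 0, ‖G3 t‖ ≤ 2 * ε := fun t ht => gb _ (m3 t ht)
  have gb4 : ∀ t ∈ Set.Icc (-h) h, ‖G4 t‖ ≤ 4 * ε := fun t ht => by
    rw [hG4]
    simp only
    rw [norm_mul]
    have := mul_le_mul (gb _ (m4 t ht)) (db t ht) (norm_nonneg _) (by linarith)
    linarith
  have hpb : ∀ z ∈ Q2 H, ‖p z‖ ≤ 480 * (ε + v) := by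
    intro z hz
    have n1 := kint_norm_le h20 cg1 (fun t ht => r1 t ht z hz)
    have n2 := kint_norm_le hle cg2 (fun t ht => r2 t ht z hz)
    have n3 := kint_norm_le h20 cg3 (fun t ht => r3 t ht z hz)
    have n4 := kint_norm_le hle cg4 (fun t ht => r4 t ht z hz)
    have i1 : ∫ t in (-(1 / 2) : ℝ)..0, ‖G1 t‖ ≤ ε := by
      have := intervalIntegral.integral_mono_on h20 (intervalIntegrable_of_Icc h20 cg1.norm)
        (intervalIntegrable_const (c := 2 * ε)) gb1
      simp at this
      linarith
    have i3 : ∫ t in (-(1 / 2) : ℝ)..0, ‖G3 t‖ ≤ ε := by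
      have := intervalIntegral.integral_mono_on h20 (intervalIntegrable_of_Icc h20 cg3.norm)
        (intervalIntegrable_const (c := 2 * ε)) gb3
      simp at this
      linarith
    have i2 : ∫ t in (-h)..h, ‖G2 t‖ ≤ 2 * v := by
      have e : ∀ t, G2 t = g (-(1 / 2) + t * Complex.I) := by
        intro t; simp [hG2, hc2]
      simp only [e]
      linarith
    have i4 : ∫ t in (-h)..h, ‖G4 t‖ ≤ 4 * v := by
      have := intervalIntegral.integral_mono_on hle (intervalIntegrable_of_Icc hle cg4.norm)
        ((intervalIntegrable_of_Icc hle cg0.norm).const_mul 2) (fun t ht => by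
          show ‖G4 t‖ ≤ 2 * ‖g (t * Complex.I)‖
          rw [hG4]
          simp only
          rw [norm_mul, mul_comm]
          exact mul_le_mul_of_nonneg_right (db t ht) (norm_nonneg _))
      rw [intervalIntegral.integral_const_mul] at this
      linarith
    refine (hcomb _ _ _ _).trans ?_
    linarith
  have hpl : ∀ z ∈ Q2 H, ∀ z' ∈ Q2 H, ‖z - z'‖ ≤ 1 / 2 →
      ‖p z - p z'‖ ≤ 60 * C1 * ε * ‖z - z'‖ := by
    intro z hz z' hz' hzz
    have n1 := kint_sub_le hk h20 cg1 cc1 gb1 (fun t ht => r1 t ht z hz)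
      (fun t ht => r1 t ht z' hz') hzz (y := fun _ => -h) continuous_const
      (fun t ht => by simp [hc1])
    have n2 := kint_sub_le hk hle cg2 cc2 gb2 (fun t ht => r2 t ht z hz)
      (fun t ht => r2 t ht z' hz') hzz (y := fun t => t) continuous_id
      (fun t ht => by simp [hc2])
    have n3 := kint_sub_le hk h20 cg3 cc3 gb3 (fun t ht => r3 t ht z hz)
      (fun t ht => r3 t ht z' hz') hzz (y := fun _ => h) continuous_const
      (fun t ht => by simp [hc3])
    have n4 := kint_sub_le hk hle cg4 cc4 gb4 (fun t ht => r4 t ht z hz)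
      (fun t ht => r4 t ht z' hz') hzz (y := fun t => t) continuous_id
      (fun t ht => by
        have : (c4 t).im - t = (ψ (t * Complex.I)).im := by simp [hc4]
        rw [this]
        exact ((Complex.abs_im_le_norm _).trans (pb t ht)).trans (by norm_num))
    have j1 := integral_inv_le_length h20 (fun _ => -h - z.im) continuous_const
    have j3 := integral_inv_le_length h20 (fun _ => h - z.im) continuous_const
    have j2 := integral_cauchy_le h z.im
    have hn := norm_nonneg (z - z')
    have hC : 0 ≤ C1 * ε := by positivity
    have q1 := mul_le_mul_of_nonneg_right (mul_le_mul_of_nonneg_left j1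
      (show 0 ≤ 2 * ε * C1 by positivity)) hn
    have q3 := mul_le_mul_of_nonneg_right (mul_le_mul_of_nonneg_left j3
      (show 0 ≤ 2 * ε * C1 by positivity)) hn
    have q2 := mul_le_mul_of_nonneg_right (mul_le_mul_of_nonneg_left (j2.trans hpi4.le)
      (show 0 ≤ 2 * ε * C1 by positivity)) hn
    have q4 := mul_le_mul_of_nonneg_right (mul_le_mul_of_nonneg_left (j2.trans hpi4.le)
      (show 0 ≤ 4 * ε * C1 by positivity)) hn
    have e : p z - p z' = (2 * Real.pi : ℂ)⁻¹ *
      (-Complex.I * (-(P1 z - P1 z') + Complex.I * (P2 z - P2 z') + (P3 z - P3 z')) +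
        (P4 z - P4 z')) := by
      simp only [hp]; ring
    rw [e]
    refine (hcomb _ _ _ _).trans ?_
    have hfin : 0 ≤ C1 * ε * ‖z - z'‖ := by positivity
    have a1 := n1.trans q1
    have a2 := n2.trans q2
    have a3 := n3.trans q3
    have a4 := n4.trans q4
    refine (add_le_add (add_le_add (add_le_add a1 a2) a3) a4).trans ?_
    ring_nf
    nlinarith [hfin]
  refine ⟨fun z => z + p z, differentiableOn_id.add hpd, ?_, ?_, ?_⟩
  · intro z hz
    have hv0 : 0 ≤ ε + v := by
      have := (norm_nonneg (p z)).trans (hpb z hz)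
      linarith
    simp only [add_sub_cancel_left]
    refine (hpb z hz).trans ?_
    nlinarith
  · intro z hz
    have hpz : DifferentiableAt ℂ p z := hpd.differentiableAt ((isOpen_Q2 H).mem_nhds hz)
    have e : deriv (fun z => z + p z) z - 1 = deriv p z := by
      have := (hasDerivAt_id z).add hpz.hasDerivAt
      rw [show (fun z => z + p z) = id + p from rfl, this.deriv]
      ring
    rw [e]
    have : ‖deriv p z‖ ≤ 60 * C1 * ε := by
      apply norm_deriv_le_of_lip' (by positivity)
      filter_upwards [(isOpen_Q2 H).mem_nhds hz,
        Metric.closedBall_mem_nhds z (show (0 : ℝ) < 1 / 2 by norm_num)] with w hw hwz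
      exact hpl w hw z hz (by rwa [mem_closedBall_iff_norm] at hwz)
    nlinarith
  · intro z hz hAz
    set A : ℂ := z + 1 + ψ z with hA
    have hzn : |z.re| < 2 ∧ |z.im| < H :=
      ⟨by rw [abs_lt]; constructor <;> linarith [hz.1, hz.2.1], by linarith [hz.2.2]⟩
    have hψz := (hψ.bound z hzn.1 hzn.2).trans hε1
    have hre := abs_le.1 ((Complex.abs_re_le_norm _).trans hψz)
    have hAre : A.re = z.re + 1 + (ψ z).re := by simp [hA]
    have hz0 : z.re < 0 := by linarith [hAz.2.1]
    have hA0 : 0 < A.re := by linarith [hz.1]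
    have hzo : z ∈ nbo h := ⟨by linarith [hz.1], hz0, by linarith [hz.2.2]⟩
    have snA : ∀ w ∈ nb h, sn (w - A) ≠ 0 := by
      intro w hw
      apply sn_ne_zero_of_re
      · rw [Complex.sub_re, abs_lt]; constructor <;> linarith [hw.1, hw.2.1, hAz.2.1]
      · intro h0
        rw [sub_eq_zero.1 h0] at hw
        linarith [hw.2.1]
    have sz : ∀ t ∈ Set.Icc (-h) h, sn (t * Complex.I - z) ≠ 0 := by
      intro t ht
      have e : (t * Complex.I - z : ℂ).re = -z.re := by simp
      apply sn_ne_zero_of_re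
      · rw [e, abs_lt]; constructor <;> linarith [hz.1]
      · intro h0
        rw [h0, Complex.zero_re] at e
        linarith
    have e1 := gm_kap (show 0 ≤ h by linarith) gc gd hzo
    have e2 := gm_kap_off (show 0 ≤ h by linarith) gc gd snA
    have hgz : gm h (fun w => g w * kap (w - z)) = -P1 z + Complex.I * P2 z + P3 z := rfl
    have hgA : gm h (fun w => g w * kap (w - A)) = -P1 A + Complex.I * P2 A + P3 A := rfl
    rw [hgz] at e1
    rw [hgA] at e2
    have hfix := gfix z (nbo_subset _ hzo)
    have hMM : MM ψ h (fun t => g (t * Complex.I)) z = (2 * Real.pi : ℂ)⁻¹ *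
        ((∫ t in -h..h, g (t * Complex.I) * kap (t * Complex.I - A)) + P4 A -
        ((∫ t in -h..h, g (t * Complex.I) * kap (t * Complex.I - z)) + P4 z)) := by
      have k1 : ∀ {y : ℂ}, (∀ t ∈ Set.Icc (-h) h, sn (t * Complex.I - y) ≠ 0) →
          IntervalIntegrable (fun t : ℝ => g (t * Complex.I) * kap (t * Complex.I - y))
            volume (-h) h := by
        intro y hy
        apply intervalIntegrable_of_Icc hle
        refine cg0.mul fun t ht => ?_
        exact (ContinuousAt.comp (f := fun t : ℝ => (t * Complex.I - y : ℂ)) (g := kap)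
          (continuousAt_kap (hy t ht)) (by fun_prop)).continuousWithinAt
      have k2 : ∀ {y : ℂ}, y ∈ Q2 H →
          IntervalIntegrable (fun t : ℝ => G4 t * kap (c4 t - y)) volume (-h) h := fun hy =>
        intervalIntegrable_of_Icc hle (kint_contOn cg4 cc4 fun t ht => r4 t ht _ hy)
      have kA := k1 (fun t ht => snA _ (m4 t ht))
      have kz := k1 sz
      rw [← intervalIntegral.integral_add kA (k2 hAz), ← intervalIntegral.integral_add kz (k2 hz),
        ← intervalIntegral.integral_sub (kA.add (k2 hAz)) (kz.add (k2 hz))]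
      unfold MM
      congr 1
      apply intervalIntegral.integral_congr
      intro t _
      simp only [Mk, Kk, hG4, hc4, hA]
      ring
    rw [hMM] at hfix
    show A + p A = z + p z + 1
    have hpA : p A = (2 * Real.pi : ℂ)⁻¹ *
        ((∫ t in -h..h, g (t * Complex.I) * kap (t * Complex.I - A)) + P4 A) := by
      simp only [hp]
      rw [← e2, ← mul_assoc, neg_mul, Complex.I_mul_I, neg_neg, one_mul]
    have hpz : p z = (2 * Real.pi : ℂ)⁻¹ *
        ((∫ t in -h..h, g (t * Complex.I) * kap (t * Complex.I - z)) + P4 z) - g z := by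
      simp only [hp]
      have e1 := sub_eq_of_eq_add e1
      rw [← e1]
      have hpi0 : (Real.pi : ℂ) ≠ 0 := by exact_mod_cast Real.pi_ne_zero
      generalize (∫ t in -h..h, g (t * Complex.I) * kap (t * Complex.I - z)) = J
      field_simp
      linear_combination (2 * Real.pi * g z - J) * Complex.I_sq
    rw [hpA, hpz, hA]
    linear_combination hfix

/-- the open rectangle `-a < Re z < b`, `|Im z| < h` -/
def rct (a b h : ℝ) : Set ℂ := {z : ℂ | -a < z.re ∧ z.re < b ∧ |z.im| < h}

lemma isOpen_rct (a b h : ℝ) : IsOpen (rct a b h) := by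
  unfold rct
  apply IsOpen.inter (isOpen_lt continuous_const Complex.continuous_re)
  apply IsOpen.inter (isOpen_lt Complex.continuous_re continuous_const)
  exact isOpen_lt Complex.continuous_im.abs continuous_const

lemma convex_rct (a b h : ℝ) : Convex ℝ (rct a b h) := by
  intro x hx y hy s t hs ht hst
  simp only [rct, Set.mem_ofPred_eq, abs_lt, Complex.add_re, Complex.add_im, Complex.real_smul,
    Complex.mul_re, Complex.mul_im, Complex.ofReal_re, Complex.ofReal_im, zero_mul, sub_zero,
    add_zero] at *
  have : t = 1 - s := by linarith
  subst this
  rcases eq_or_lt_of_le hs with h | h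
  · subst h; simpa using hy
  rcases eq_or_lt_of_le ht with h' | h'
  · have : s = 1 := by linarith
    subst this; simpa using hx
  refine ⟨?_, ?_, ?_, ?_⟩ <;> nlinarith

lemma conj_mem_rct {a b h : ℝ} {z : ℂ} (hz : z ∈ rct a b h) : conj z ∈ rct a b h := by
  simpa [rct] using hz

lemma rct_mono {a b h a' b' h' : ℝ} (ha : a ≤ a') (hb : b ≤ b') (hh : h ≤ h') :
    rct a b h ⊆ rct a' b' h' := fun z hz =>
  ⟨by linarith [hz.1], by linarith [hz.2.1], by linarith [hz.2.2]⟩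

/-- `L` is an approximate coordinate on `rct a (9/10) h` conjugating `z ↦ z + 1 + ψ z` to the
unit translation. -/
structure Coord (ψ L : ℂ → ℂ) (a h b d : ℝ) : Prop where
  diff : DifferentiableOn ℂ L (rct a (9 / 10) h)
  near : ∀ z ∈ rct a (9 / 10) h, ‖L z - z‖ ≤ b
  deriv_near : ∀ z ∈ rct a (9 / 10) h, ‖deriv L z - 1‖ ≤ d
  feq : ∀ z ∈ rct a (9 / 10) h, z + 1 + ψ z ∈ rct a (9 / 10) h → L (z + 1 + ψ z) = L z + 1
  symm : ∀ z ∈ rct a (9 / 10) h, L (conj z) = conj (L z)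

lemma Coord.symmetrize {ψ L : ℂ → ℂ} {a h b d : ℝ}
    (hd : DifferentiableOn ℂ L (rct a (9 / 10) h))
    (hn : ∀ z ∈ rct a (9 / 10) h, ‖L z - z‖ ≤ b)
    (hdn : ∀ z ∈ rct a (9 / 10) h, ‖deriv L z - 1‖ ≤ d)
    (hf : ∀ z ∈ rct a (9 / 10) h, z + 1 + ψ z ∈ rct a (9 / 10) h → L (z + 1 + ψ z) = L z + 1)
    (hs : ∀ z ∈ rct a (9 / 10) h, ψ (conj z) = conj (ψ z)) :
    Coord ψ (fun z => (L z + conj (L (conj z))) / 2) a h b d := by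
  have hd1 : ∀ z ∈ rct a (9 / 10) h, DifferentiableAt ℂ L z := fun z hz =>
    hd.differentiableAt ((isOpen_rct _ _ _).mem_nhds hz)
  have hd2 : ∀ z ∈ rct a (9 / 10) h,
      HasDerivAt (fun z => conj (L (conj z))) (conj (deriv L (conj z))) z := fun z hz => by
    have := (hd1 _ (conj_mem_rct hz)).hasDerivAt.conj_conj
    rwa [Complex.conj_conj] at this
  have hd3 : ∀ z ∈ rct a (9 / 10) h, HasDerivAt (fun z => (L z + conj (L (conj z))) / 2)
      ((deriv L z + conj (deriv L (conj z))) / 2) z := fun z hz =>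
    ((hd1 z hz).hasDerivAt.add (hd2 z hz)).div_const 2
  have avg : ∀ {x y : ℂ} {r : ℝ}, ‖x‖ ≤ r → ‖y‖ ≤ r → ‖(x + conj y) / 2‖ ≤ r := by
    intro x y r hx hy
    rw [norm_div]
    have := norm_add_le x (conj y)
    rw [RCLike.norm_conj] at this
    simp only [Complex.norm_ofNat]
    linarith
  constructor
  · exact fun z hz => (hd3 z hz).differentiableAt.differentiableWithinAt
  · intro z hz
    have e : (L z + conj (L (conj z))) / 2 - z =
        ((L z - z) + conj (L (conj z) - conj z)) / 2 := by
      simp only [map_sub, Complex.conj_conj]; ring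
    rw [e]
    exact avg (hn z hz) (hn _ (conj_mem_rct hz))
  · intro z hz
    rw [(hd3 z hz).deriv]
    have e : (deriv L z + conj (deriv L (conj z))) / 2 - 1 =
        ((deriv L z - 1) + conj (deriv L (conj z) - 1)) / 2 := by
      simp only [map_sub, map_one]; ring
    rw [e]
    exact avg (hdn z hz) (hdn _ (conj_mem_rct hz))
  · intro z hz hAz
    have e : conj (z + 1 + ψ z) = conj z + 1 + ψ (conj z) := by
      rw [hs z hz]; simp
    have h1 := hf _ (conj_mem_rct hz) (by rw [← e]; exact conj_mem_rct hAz)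
    show (L (z + 1 + ψ z) + conj (L (conj (z + 1 + ψ z)))) / 2 = _
    rw [hf z hz hAz, e, h1, map_add, map_one]
    ring
  · intro z hz
    simp only [Complex.conj_conj, map_div₀, map_add]
    rw [add_comm]
    congr 1
    exact (map_ofNat _ 2).symm

lemma Coord.extend {ψ L : ℂ → ℂ} {a h b d ε ε1 : ℝ} (hL : Coord ψ L a h b d) (ha : 1 / 8 ≤ a)
    (hψd : DifferentiableOn ℂ ψ (rct (a + 9 / 10) 2 h))
    (hψ : ∀ z ∈ rct (a + 9 / 10) 2 h, ‖ψ z‖ ≤ ε)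
    (hψ' : ∀ z ∈ rct (a + 9 / 10) 2 h, ‖deriv ψ z‖ ≤ ε1)
    (hs : ∀ z ∈ rct (a + 9 / 10) 2 h, ψ (conj z) = conj (ψ z)) (hε : ε ≤ 1 / 100) (hd0 : 0 ≤ d)
    (hε0 : 0 ≤ ε) :
    ∃ L', Coord ψ L' (a + 9 / 10) (h - ε) (b + ε) ((1 + d) * (1 + ε1) - 1) := by
  obtain ⟨c, hc⟩ : ∃ c : ℝ, c = -(23 / 200) := ⟨_, rfl⟩
  have hsub : rct (a + 9 / 10) (9 / 10) (h - ε) ⊆ rct (a + 9 / 10) 2 h :=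
    rct_mono le_rfl (by norm_num) (by linarith)
  have hAm : ∀ z ∈ rct (a + 9 / 10) (9 / 10) (h - ε), z.re < -(11 / 100) →
      z + 1 + ψ z ∈ rct a (9 / 10) h := by
    intro z hz hzr
    have h1 := (hψ z (hsub hz)).trans hε
    have h2 := abs_le.1 ((Complex.abs_re_le_norm _).trans h1)
    have h3 := (Complex.abs_im_le_norm _).trans (hψ z (hsub hz))
    refine ⟨?_, ?_, ?_⟩
    · simp only [Complex.add_re, Complex.one_re]; linarith [hz.1]
    · simp only [Complex.add_re, Complex.one_re]; linarith [hz.1]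
    · simp only [Complex.add_im, Complex.one_im, add_zero]
      have := abs_add_le z.im (ψ z).im
      linarith [hz.2.2]
  have hRm : ∀ z ∈ rct (a + 9 / 10) (9 / 10) (h - ε), -(1 / 8) < z.re →
      z ∈ rct a (9 / 10) h := fun z hz hzr =>
    ⟨by linarith, hz.2.1, by linarith [hz.2.2]⟩
  have hε10 : ∀ z ∈ rct (a + 9 / 10) 2 h, 0 ≤ ε1 := fun z hz =>
    (norm_nonneg _).trans (hψ' z hz)
  set L' : ℂ → ℂ := fun z => if z.re < c then L (z + 1 + ψ z) - 1 else L z with hL'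
  have v1 : ∀ z ∈ rct (a + 9 / 10) (9 / 10) (h - ε), z.re < -(11 / 100) →
      L' z = L (z + 1 + ψ z) - 1 := by
    intro z hz hzr
    simp only [hL']
    split_ifs with hlt
    · rfl
    · have h' := not_lt.1 hlt
      rw [hL.feq z (hRm z hz (by linarith)) (hAm z hz hzr)]; ring
  have v2 : ∀ z ∈ rct (a + 9 / 10) (9 / 10) (h - ε), -(1 / 8) < z.re → L' z = L z := by
    intro z hz hzr
    simp only [hL']
    split_ifs with hlt
    · rw [hL.feq z (hRm z hz (by linarith)) (hAm z hz (by linarith))]; ring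
    · rfl
  have o1 : IsOpen (rct (a + 9 / 10) (9 / 10) (h - ε) ∩ {z | z.re < -(11 / 100)}) :=
    (isOpen_rct _ _ _).inter (isOpen_lt Complex.continuous_re continuous_const)
  have o2 : IsOpen (rct (a + 9 / 10) (9 / 10) (h - ε) ∩ {z | -(1 / 8) < z.re}) :=
    (isOpen_rct _ _ _).inter (isOpen_lt continuous_const Complex.continuous_re)
  have d1 : ∀ z ∈ rct (a + 9 / 10) (9 / 10) (h - ε), z.re < -(11 / 100) →
      HasDerivAt L' (deriv L (z + 1 + ψ z) * (1 + deriv ψ z)) z := by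
    intro z hz hzr
    have hψz : DifferentiableAt ℂ ψ z :=
      hψd.differentiableAt ((isOpen_rct _ _ _).mem_nhds (hsub hz))
    have hLz : DifferentiableAt ℂ L (z + 1 + ψ z) :=
      hL.diff.differentiableAt ((isOpen_rct _ _ _).mem_nhds (hAm z hz hzr))
    have hA : HasDerivAt (fun z => z + 1 + ψ z) (1 + deriv ψ z) z :=
      ((hasDerivAt_id z).add_const 1).add hψz.hasDerivAt
    have h1 := (HasDerivAt.comp (h₂ := L) z hLz.hasDerivAt hA).sub_const 1
    refine h1.congr_of_eventuallyEq ?_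
    filter_upwards [o1.mem_nhds ⟨hz, hzr⟩] with w hw
    exact v1 w hw.1 hw.2
  have d2 : ∀ z ∈ rct (a + 9 / 10) (9 / 10) (h - ε), -(1 / 8) < z.re →
      HasDerivAt L' (deriv L z) z := by
    intro z hz hzr
    have hLz : DifferentiableAt ℂ L z :=
      hL.diff.differentiableAt ((isOpen_rct _ _ _).mem_nhds (hRm z hz hzr))
    refine hLz.hasDerivAt.congr_of_eventuallyEq ?_
    filter_upwards [o2.mem_nhds ⟨hz, hzr⟩] with w hw
    exact v2 w hw.1 hw.2
  refine ⟨L', ⟨?_, ?_, ?_, ?_, ?_⟩⟩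
  · intro z hz
    rcases lt_or_ge z.re (-(11 / 100)) with hzr | hzr
    · exact (d1 z hz hzr).differentiableAt.differentiableWithinAt
    · exact (d2 z hz (by linarith)).differentiableAt.differentiableWithinAt
  · intro z hz
    rcases lt_or_ge z.re (-(11 / 100)) with hzr | hzr
    · rw [v1 z hz hzr]
      have e : L (z + 1 + ψ z) - 1 - z = (L (z + 1 + ψ z) - (z + 1 + ψ z)) + ψ z := by ring
      rw [e]
      exact (norm_add_le _ _).trans (add_le_add (hL.near _ (hAm z hz hzr)) (hψ z (hsub hz)))
    · rw [v2 z hz (by linarith)]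
      have := hL.near z (hRm z hz (by linarith))
      linarith
  · intro z hz
    have h0 := hε10 z (hsub hz)
    rcases lt_or_ge z.re (-(11 / 100)) with hzr | hzr
    · rw [(d1 z hz hzr).deriv]
      have h1 := hL.deriv_near _ (hAm z hz hzr)
      have h2 := hψ' z (hsub hz)
      set x := deriv L (z + 1 + ψ z) with hx
      have e : x * (1 + deriv ψ z) - 1 = (x - 1) * (1 + deriv ψ z) + deriv ψ z := by ring
      rw [e]
      have h3 : ‖1 + deriv ψ z‖ ≤ 1 + ε1 := (norm_add_le _ _).trans (by rw [norm_one]; linarith)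
      calc _ ≤ ‖x - 1‖ * ‖1 + deriv ψ z‖ + ‖deriv ψ z‖ := by
            rw [← norm_mul]; exact norm_add_le _ _
        _ ≤ d * (1 + ε1) + ε1 := by gcongr
        _ = _ := by ring
    · rw [(d2 z hz (by linarith)).deriv]
      have := hL.deriv_near z (hRm z hz (by linarith))
      nlinarith
  · intro z hz hAz
    rcases lt_or_ge z.re (-(11 / 100)) with hzr | hzr
    · rw [v1 z hz hzr]
      rcases lt_or_ge (z + 1 + ψ z).re (-(11 / 100)) with hzr' | hzr'
      · rw [v1 _ hAz hzr', hL.feq _ (hAm z hz hzr) (hAm _ hAz hzr')]; ring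
      · rw [v2 _ hAz (by linarith)]; ring
    · have h1 := (hψ z (hsub hz)).trans hε
      have h2 := abs_le.1 ((Complex.abs_re_le_norm _).trans h1)
      have h3 : -(1 / 8) < (z + 1 + ψ z).re := by
        simp only [Complex.add_re, Complex.one_re]; linarith
      rw [v2 _ hAz h3, v2 z hz (by linarith)]
      exact hL.feq z (hRm z hz (by linarith)) (hRm _ hAz h3)
  · intro z hz
    have hcz := conj_mem_rct hz
    rcases lt_or_ge z.re (-(11 / 100)) with hzr | hzr
    · rw [v1 z hz hzr, v1 _ hcz (by simpa using hzr), hs z (hsub hz)]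
      have := hL.symm _ (hAm z hz hzr)
      rw [map_sub, map_one, ← this]
      simp
    · rw [v2 z hz (by linarith), v2 _ hcz (by simp; linarith)]
      exact hL.symm z (hRm z hz (by linarith))

lemma Coord.mono {ψ L : ℂ → ℂ} {a h b d a' h' b' d' : ℝ} (hL : Coord ψ L a h b d)
    (ha : a' ≤ a) (hh : h' ≤ h) (hb : b ≤ b') (hd : d ≤ d') : Coord ψ L a' h' b' d' := by
  have hs : rct a' (9 / 10) h' ⊆ rct a (9 / 10) h := rct_mono ha le_rfl hh
  exact ⟨hL.diff.mono hs, fun z hz => (hL.near z (hs hz)).trans hb,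
    fun z hz => (hL.deriv_near z (hs hz)).trans hd,
    fun z hz hz' => hL.feq z (hs hz) (hs hz'), fun z hz => hL.symm z (hs hz)⟩

/-- A map `z ↦ z + 1 + ψ z` close to the unit translation has a holomorphic coordinate
conjugating it to the unit translation on a long rectangle. -/
theorem exists_long_coordinate : ∃ ε0 > 0, ∃ C > 0, ∀ (ψ : ℂ → ℂ) (ε ε1 H W v : ℝ),
    DifferentiableOn ℂ ψ (rct (W + 2) 2 H) → (∀ z ∈ rct (W + 2) 2 H, ‖ψ z‖ ≤ ε) → ε ≤ ε0 →
    (∀ z ∈ rct (W + 2) 2 (H - 2), ‖deriv ψ z‖ ≤ ε1) → 0 ≤ ε1 → ε1 * W ≤ 1 / 100 →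
    (∀ z ∈ rct (W + 2) 2 H, ψ (conj z) = conj (ψ z)) → 2 ≤ W → 3 ≤ H →
    (∫ y in (-(H - 1))..(H - 1), ‖ψ (y * Complex.I)‖) ≤ v →
    (∫ y in (-(H - 1))..(H - 1), ‖ψ (-(1 / 2) + y * Complex.I)‖) ≤ v →
    ∃ L, Coord ψ L W (H - 2 - 2 * W * ε) (C * (ε + v) + 2 * W * ε) (1 / 2) := by
  obtain ⟨e0, he0, C, hC, key⟩ := exists_local_coordinate
  refine ⟨min e0 (min (1 / 100) (1 / (4 * C))), by positivity, C, hC, ?_⟩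
  intro ψ ε ε1 H W v hd hb hε hd1 h1 h1W hs hW hH hv1 hv2
  have hε1 : ε ≤ e0 := hε.trans (min_le_left _ _)
  have hε2 : ε ≤ 1 / 100 := hε.trans ((min_le_right _ _).trans (min_le_left _ _))
  have hε3 : C * ε ≤ 1 / 4 := by
    have : ε ≤ 1 / (4 * C) := hε.trans ((min_le_right _ _).trans (min_le_right _ _))
    rw [le_div_iff₀ (by positivity)] at this
    linarith
  have hε0 : 0 ≤ ε := (norm_nonneg _).trans (hb 0 ⟨by simp; linarith, by simp, by simp; linarith⟩)
  have hsub : ∀ z : ℂ, |z.re| < 2 → |z.im| < H → z ∈ rct (W + 2) 2 H := fun z h2 h3 =>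
    ⟨by linarith [(abs_lt.1 h2).1], (abs_lt.1 h2).2, h3⟩
  have hS : Small ψ ε H := ⟨hd.mono fun z hz => hsub z hz.1 hz.2, fun z h2 h3 => hb z (hsub z h2 h3)⟩
  obtain ⟨L0, a1, a2, a3, a4⟩ := key ψ ε H v hS hε1 hH hv1 hv2
  have hmid : rct (W + 2) 2 (H - 2) ⊆ rct (W + 2) 2 H := rct_mono le_rfl le_rfl (by linarith)
  have base := Coord.symmetrize (ψ := ψ) (L := L0) (a := 1 / 8) (h := H - 2) a1 a2 a3 a4
    (fun z hz => hs z (rct_mono (by linarith) (by norm_num) (by linarith) hz))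
  have step : ∀ n : ℕ, 1 / 8 + 9 / 10 * (n : ℝ) ≤ W + 2 → ∃ L, Coord ψ L (1 / 8 + 9 / 10 * (n : ℝ))
      (H - 2 - n * ε) (C * (ε + v) + n * ε) ((1 + C * ε) * (1 + ε1) ^ n - 1) := by
    intro n
    induction n with
    | zero => intro _; exact ⟨_, base.mono (by simp) (by simp) (by simp) (by simp)⟩
    | succ n ih =>
      intro hn
      push_cast at hn
      obtain ⟨L, hL⟩ := ih (by linarith)
      have hm : rct (1 / 8 + 9 / 10 * (n : ℝ) + 9 / 10) 2 (H - 2 - n * ε) ⊆ rct (W + 2) 2 (H - 2) :=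
        rct_mono (by linarith) le_rfl (by nlinarith [n.cast_nonneg (α := ℝ)])
      have hp : 1 ≤ (1 + ε1) ^ n := one_le_pow₀ (by linarith)
      obtain ⟨L', hL'⟩ := hL.extend (ε := ε) (ε1 := ε1)
        (by linarith [n.cast_nonneg (α := ℝ)]) (hd.mono (hm.trans hmid))
        (fun z hz => hb z (hmid (hm hz))) (fun z hz => hd1 z (hm hz))
        (fun z hz => hs z (hmid (hm hz))) hε2
        (by nlinarith [mul_nonneg hC.le hε0]) hε0
      refine ⟨L', hL'.mono ?_ ?_ ?_ ?_⟩
      · push_cast; linarith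
      · push_cast; linarith
      · push_cast; linarith
      · rw [pow_succ]; linarith
  have hn1 := Nat.le_ceil (W / (9 / 10))
  have hn2 := Nat.ceil_lt_add_one (a := W / (9 / 10)) (by positivity)
  set n := ⌈W / (9 / 10)⌉₊
  rw [div_le_iff₀ (by norm_num)] at hn1
  have hn3 : (n : ℝ) * (9 / 10) < W + 9 / 10 := by
    have := mul_lt_mul_of_pos_right hn2 (show (0 : ℝ) < 9 / 10 by norm_num)
    rwa [add_mul, div_mul_cancel₀ _ (by norm_num), one_mul] at this
  obtain ⟨L, hL⟩ := step n (by linarith)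
  have hn4 : (n : ℝ) ≤ 2 * W := by linarith
  refine ⟨L, hL.mono (by linarith) (by nlinarith) (by nlinarith) ?_⟩
  have e1 : (1 + ε1) ^ n ≤ Real.exp (1 / 50) := by
    calc (1 + ε1) ^ n ≤ (Real.exp ε1) ^ n := by
          gcongr; linarith [Real.add_one_le_exp ε1]
      _ = Real.exp (n * ε1) := (Real.exp_nat_mul _ _).symm
      _ ≤ _ := by apply Real.exp_le_exp.2; nlinarith
  have e2 : Real.exp (1 / 50) ≤ 1.05 := by
    have := Real.exp_bound_div_one_sub_of_interval (x := 1 / 50) (by norm_num) (by norm_num)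
    norm_num at this ⊢
    linarith
  have e3 := mul_le_mul (show 1 + C * ε ≤ 1.25 by linarith) (e1.trans e2) (by positivity)
    (by norm_num)
  norm_num at e3 ⊢
  linarith

section Inverse

variable {U : Set ℂ} {u : ℂ → ℂ} {b : ℝ}

lemma norm_sub_sub_le_of_deriv (hU : IsOpen U) (hc : Convex ℝ U) (hd : DifferentiableOn ℂ u U)
    {k : ℝ} (hd1 : ∀ z ∈ U, ‖deriv u z - 1‖ ≤ k) {x y : ℂ} (hx : x ∈ U) (hy : y ∈ U) :
    ‖(u y - y) - (u x - x)‖ ≤ k * ‖y - x‖ := by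
  have hd' : ∀ z ∈ U, HasDerivAt (fun z => u z - z) (deriv u z - 1) z := fun z hz =>
    (hd.differentiableAt (hU.mem_nhds hz)).hasDerivAt.sub (hasDerivAt_id z)
  exact hc.norm_image_sub_le_of_norm_hasDerivWithin_le (f := fun z => u z - z)
    (fun z hz => (hd' z hz).hasDerivWithinAt) hd1 hx hy

lemma norm_sub_le_two_mul (hU : IsOpen U) (hc : Convex ℝ U) (hd : DifferentiableOn ℂ u U)
    (hd1 : ∀ z ∈ U, ‖deriv u z - 1‖ ≤ 1 / 2) {x y : ℂ} (hx : x ∈ U) (hy : y ∈ U) :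
    ‖y - x‖ ≤ 2 * ‖u y - u x‖ := by
  have h1 := norm_sub_sub_le_of_deriv hU hc hd hd1 hx hy
  have h2 : ‖y - x‖ ≤ ‖u y - u x‖ + ‖(u y - y) - (u x - x)‖ := by
    have e : y - x = (u y - u x) - ((u y - y) - (u x - x)) := by ring
    calc ‖y - x‖ = ‖(u y - u x) - ((u y - y) - (u x - x))‖ := by rw [← e]
      _ ≤ _ := norm_sub_le _ _
  linarith

/-- A holomorphic map close to the identity has a holomorphic right inverse. -/
lemma exists_inverse (hU : IsOpen U) (hc : Convex ℝ U) (hd : DifferentiableOn ℂ u U)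
    (hn : ∀ z ∈ U, ‖u z - z‖ ≤ b) (hd1 : ∀ z ∈ U, ‖deriv u z - 1‖ ≤ 1 / 2)
    (hb : 0 ≤ b) {V : Set ℂ} (hV : IsOpen V) (hVU : ∀ w ∈ V, Metric.closedBall w b ⊆ U) :
    ∃ M : ℂ → ℂ, DifferentiableOn ℂ M V ∧ ∀ w ∈ V, M w ∈ U ∧ ‖M w - w‖ ≤ b ∧ u (M w) = w ∧
      deriv M w = (deriv u (M w))⁻¹ := by
  have ex : ∀ w, w ∈ V → ∃ z, z ∈ Metric.closedBall w b ∧ u z = w := by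
    intro w hw
    have hmaps : Set.MapsTo (fun z => z - (u z - w)) (Metric.closedBall w b)
        (Metric.closedBall w b) := by
      intro z hz
      rw [Metric.mem_closedBall, dist_eq_norm]
      have := hn z (hVU w hw hz)
      rwa [show z - (u z - w) - w = -(u z - z) by ring, norm_neg]
    have hcon : ContractingWith (1 / 2) (hmaps.restrict _ _ _) := by
      refine ⟨by rw [← NNReal.coe_lt_coe]; norm_num, LipschitzWith.of_dist_le_mul ?_⟩
      rintro ⟨x, hx⟩ ⟨y, hy⟩
      rw [Subtype.dist_eq, Subtype.dist_eq]
      simp only [Set.MapsTo.val_restrict_apply, dist_eq_norm]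
      have := norm_sub_sub_le_of_deriv hU hc hd hd1 (hVU w hw hy) (hVU w hw hx)
      rw [show x - (u x - w) - (y - (u y - w)) = -((u x - x) - (u y - y)) by ring, norm_neg]
      simpa using this
    obtain ⟨z, hz, hfz, -⟩ := ContractingWith.exists_fixedPoint'
      (Metric.isClosed_closedBall.isComplete) hmaps hcon (Metric.mem_closedBall_self hb)
      (edist_ne_top _ _)
    refine ⟨z, hz, ?_⟩
    have h2 : z - (u z - w) = z := hfz
    linear_combination -h2
  choose! M hM1 hM2 using ex
  have hMU : ∀ w ∈ V, M w ∈ U := fun w hw => hVU w hw (hM1 w hw)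
  have hder : ∀ w ∈ V, HasDerivAt M (deriv u (M w))⁻¹ w := by
    intro w hw
    have hcont : ContinuousAt M w := by
      rw [Metric.continuousAt_iff]
      intro e he
      obtain ⟨d, hd0, hdV⟩ := Metric.isOpen_iff.1 hV w hw
      refine ⟨min d (e / 2), by positivity, fun {x} hx => ?_⟩
      have hxV : x ∈ V := hdV (hx.trans_le (min_le_left _ _))
      have := norm_sub_le_two_mul hU hc hd hd1 (hMU w hw) (hMU x hxV)
      rw [hM2 x hxV, hM2 w hw] at this
      rw [dist_eq_norm] at hx ⊢
      have := hx.trans_le (min_le_right _ _)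
      linarith
    refine HasDerivAt.of_local_left_inverse hcont
      (hd.differentiableAt (hU.mem_nhds (hMU w hw))).hasDerivAt ?_ ?_
    · intro h0
      have := hd1 _ (hMU w hw)
      rw [h0] at this
      norm_num at this
    · filter_upwards [hV.mem_nhds hw] with x hx using hM2 x hx
  refine ⟨M, fun w hw => (hder w hw).differentiableAt.differentiableWithinAt, fun w hw =>
    ⟨hMU w hw, ?_, hM2 w hw, (hder w hw).deriv⟩⟩
  have := hM1 w hw
  rwa [Metric.mem_closedBall, dist_eq_norm] at this

end Inverse

lemma closedBall_subset_rct {a c h b : ℝ} {w : ℂ} (hw : w ∈ rct (a - b) (c - b) (h - b)) :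
    Metric.closedBall w b ⊆ rct a c h := by
  intro z hz
  rw [Metric.mem_closedBall, dist_eq_norm] at hz
  have h1 := abs_le.1 ((Complex.abs_re_le_norm _).trans hz)
  have h2 := (Complex.abs_im_le_norm _).trans hz
  rw [Complex.sub_re] at h1
  rw [Complex.sub_im] at h2
  refine ⟨by linarith [hw.1], by linarith [hw.2.1], ?_⟩
  have := abs_add_le (z.im - w.im) w.im
  rw [sub_add_cancel] at this
  linarith [hw.2.2]

/-- the open strip `|Im z| < h` -/
def strip (h : ℝ) : Set ℂ := {z : ℂ | |z.im| < h}

lemma isOpen_strip (h : ℝ) : IsOpen (strip h) := isOpen_lt Complex.continuous_im.abs continuous_const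

lemma convex_strip (h : ℝ) : Convex ℝ (strip h) := by
  intro x hx y hy s t hs ht hst
  have h1 : |s * x.im + t * y.im| ≤ s * |x.im| + t * |y.im| := by
    refine (abs_add_le _ _).trans ?_
    rw [abs_mul, abs_mul, abs_of_nonneg hs, abs_of_nonneg ht]
  simp only [strip, Set.mem_ofPred_eq, Complex.add_im, Complex.real_smul, Complex.mul_im,
    Complex.ofReal_re, Complex.ofReal_im, zero_mul, add_zero] at *
  refine h1.trans_lt ?_
  rcases eq_or_lt_of_le hs with h' | h'
  · have : t = 1 := by linarith
    subst this; subst h'; simpa using hy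
  · have e1 := mul_lt_mul_of_pos_left hx h'
    have e2 := mul_le_mul_of_nonneg_left hy.le ht
    have e3 : s * h + t * h = h := by rw [← add_mul, hst, one_mul]
    linarith

lemma closedBall_subset_strip {h b : ℝ} {w : ℂ} (hw : w ∈ strip (h - b)) :
    Metric.closedBall w b ⊆ strip h := by
  intro z hz
  rw [Metric.mem_closedBall, dist_eq_norm] at hz
  have h2 := (Complex.abs_im_le_norm _).trans hz
  rw [Complex.sub_im] at h2
  have := abs_add_le (z.im - w.im) w.im
  rw [sub_add_cancel] at this
  have h3 : |w.im| < h - b := hw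
  show |z.im| < h
  linarith

/-- two holomorphic functions on a convex open set agreeing at the real points agree, as soon as
there is a real point -/
lemma eqOn_of_real {U : Set ℂ} (hU : IsOpen U) (hc : Convex ℝ U) {f g : ℂ → ℂ}
    (hf : DifferentiableOn ℂ f U) (hg : DifferentiableOn ℂ g U) {x0 : ℝ} (hx0 : (x0 : ℂ) ∈ U)
    (h : ∀ x : ℝ, (x : ℂ) ∈ U → f x = g x) : Set.EqOn f g U := by
  refine (hf.analyticOnNhd hU).eqOn_of_preconnected_of_frequently_eq (hg.analyticOnNhd hU)
    hc.isPreconnected hx0 ?_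
  have h1 : Tendsto (fun t : ℝ => (t : ℂ)) (𝓝[≠] x0) (𝓝[≠] (x0 : ℂ)) := by
    refine tendsto_nhdsWithin_iff.2 ⟨?_, ?_⟩
    · exact (Complex.continuous_ofReal.tendsto x0).mono_left nhdsWithin_le_nhds
    · filter_upwards [self_mem_nhdsWithin] with t ht
      simpa using ht
  have h2 : ∀ᶠ t : ℝ in 𝓝[≠] x0, f t = g t := by
    have : ∀ᶠ t : ℝ in 𝓝 x0, (t : ℂ) ∈ U :=
      (Complex.continuous_ofReal.tendsto x0) (hU.mem_nhds hx0)
    filter_upwards [nhdsWithin_le_nhds this] with t ht using h t ht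
  exact h1.frequently h2.frequently

lemma conj_symm_of_real {U : Set ℂ} (hU : IsOpen U) (hc : Convex ℝ U)
    (hs : ∀ z ∈ U, conj z ∈ U) {f : ℂ → ℂ} (hf : DifferentiableOn ℂ f U) {x0 : ℝ}
    (hx0 : (x0 : ℂ) ∈ U) (h : ∀ x : ℝ, (x : ℂ) ∈ U → (f x).im = 0) :
    ∀ z ∈ U, f (conj z) = conj (f z) := by
  have hd : DifferentiableOn ℂ (fun z => conj (f (conj z))) U := fun z hz =>
    (hf.differentiableAt (hU.mem_nhds (hs z hz))).hasDerivAt.conj_conj.differentiableAt.differentiableWithinAt |> fun h => by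
      rw [Complex.conj_conj] at h; exact h
  have := eqOn_of_real hU hc hf hd hx0 (fun x hx => by
    simp only [Complex.conj_ofReal]
    exact (Complex.conj_eq_iff_im.2 (h x hx)).symm)
  intro z hz
  have h1 := this (hs z hz)
  simpa only [Complex.conj_conj] using h1

/-- the translation of the real line by `t` -/
noncomputable def tr (t : ℝ) : ℝ ≃o ℝ := OrderIso.addRight t

@[simp] lemma tr_apply (t x : ℝ) : tr t x = x + t := rfl

lemma mul_apply' (f g : ℝ ≃o ℝ) (x : ℝ) : (f * g) x = f (g x) := rfl

lemma inv_apply_self' (f : ℝ ≃o ℝ) (x : ℝ) : f⁻¹ (f x) = x := f.symm_apply_apply x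

lemma apply_inv_self' (f : ℝ ≃o ℝ) (x : ℝ) : f (f⁻¹ x) = x := f.apply_symm_apply x

lemma one_apply' (x : ℝ) : (1 : ℝ ≃o ℝ) x = x := rfl

lemma tr_add (s t : ℝ) : tr (s + t) = tr s * tr t := by
  ext x; simp [mul_apply']; ring

lemma tr_zero : tr 0 = 1 := by ext x; simp [one_apply']

lemma tr_neg (t : ℝ) : tr (-t) = (tr t)⁻¹ := by
  rw [eq_inv_iff_mul_eq_one, ← tr_add]; simp [tr_zero]

lemma tr_zpow (t : ℝ) (n : ℤ) : (tr t) ^ n = tr (n * t) := by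
  induction n using Int.induction_on with
  | zero => simp [tr_zero]
  | succ n ih => rw [zpow_add_one, ih, ← tr_add]; congr 1; push_cast; ring
  | pred n ih => rw [zpow_sub_one, ih, ← tr_neg, ← tr_add]; congr 1; push_cast; ring

/-- a commuting pair of homeomorphisms of the line acting like the translations by `1` and `ρ` -/
def RotPair (A B : ℝ ≃o ℝ) (ρ : ℝ) : Prop :=
  Commute A B ∧ ∀ m n : ℤ, 0 < m + n * ρ → ∀ x, x < (A ^ m * B ^ n) x

lemma RotPair.lt_id {A B : ℝ ≃o ℝ} {ρ : ℝ} (h : RotPair A B ρ) (m n : ℤ) (hmn : m + n * ρ < 0)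
    (x : ℝ) : (A ^ m * B ^ n) x < x := by
  have h1 := h.2 (-m) (-n) (by push_cast; linarith) ((A ^ m * B ^ n) x)
  rw [← mul_apply'] at h1
  have e : A ^ (-m) * B ^ (-n) * (A ^ m * B ^ n) = 1 := by
    have hc : Commute (B ^ (-n)) (A ^ m) := (h.1.symm).zpow_zpow _ _
    rw [mul_assoc, ← mul_assoc (B ^ (-n)), hc.eq]
    group
  rwa [e, one_apply'] at h1

lemma RotPair.conj {A B : ℝ ≃o ℝ} {ρ : ℝ} (h : RotPair A B ρ) (L : ℝ ≃o ℝ) :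
    RotPair (L * A * L⁻¹) (L * B * L⁻¹) ρ := by
  refine ⟨?_, fun m n hmn x => ?_⟩
  · show _ = _
    have := h.1.eq
    calc L * A * L⁻¹ * (L * B * L⁻¹) = L * (A * B) * L⁻¹ := by group
      _ = L * (B * A) * L⁻¹ := by rw [this]
      _ = _ := by group
  · rw [conj_zpow, conj_zpow]
    have e : L * A ^ m * L⁻¹ * (L * B ^ n * L⁻¹) = L * (A ^ m * B ^ n) * L⁻¹ := by group
    rw [e, mul_apply', mul_apply']
    have h1 := L.strictMono (h.2 m n hmn (L⁻¹ x))
    rwa [apply_inv_self'] at h1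

lemma RotPair.swap {A B : ℝ ≃o ℝ} {ρ : ℝ} (h : RotPair A B ρ) (hρ : 0 < ρ) :
    RotPair B A (1 / ρ) := by
  refine ⟨h.1.symm, fun m n hmn x => ?_⟩
  rw [((h.1.symm).zpow_zpow m n).eq]
  apply h.2
  have := mul_pos hmn hρ
  rw [add_mul, mul_assoc, one_div, inv_mul_cancel₀ hρ.ne', mul_one] at this
  linarith

lemma RotPair.inv {A B : ℝ ≃o ℝ} {ρ : ℝ} (h : RotPair A B ρ) : RotPair A B⁻¹ (-ρ) := by
  refine ⟨h.1.inv_right, fun m n hmn x => ?_⟩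
  rw [inv_zpow']
  apply h.2
  push_cast; linarith

lemma RotPair.shift {A B : ℝ ≃o ℝ} {ρ : ℝ} (h : RotPair A B ρ) (k : ℤ) :
    RotPair A (A ^ k * B) (ρ + k) := by
  have hc : Commute (A ^ k) B := h.1.zpow_left k
  refine ⟨(Commute.refl A).zpow_right k |>.mul_right h.1, fun m n hmn x => ?_⟩
  rw [hc.mul_zpow, ← mul_assoc, ← zpow_mul, ← zpow_add]
  apply h.2
  push_cast; linarith

/-- `h` has a holomorphic extension at `x` with positive derivative -/
def HolAt (h : ℝ → ℝ) (x : ℝ) : Prop :=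
  ∃ g : ℂ → ℂ, ∃ c : ℝ, 0 < c ∧ AnalyticAt ℂ g x ∧ HasDerivAt g c x ∧
    ∀ᶠ y : ℝ in 𝓝 x, g y = h y

/-- `h` has a holomorphic extension with positive derivative at all real points -/
def HolDiff (h : ℝ → ℝ) : Prop := ∀ x : ℝ, HolAt h x

lemma HolAt.hasDerivAt {h : ℝ → ℝ} {x : ℝ} (hh : HolAt h x) :
    ∃ c : ℝ, 0 < c ∧ HasDerivAt h c x := by
  obtain ⟨g, c, hc, -, hg, he⟩ := hh
  refine ⟨c, hc, ?_⟩
  have h1 := hg.real_of_complex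
  simp only [Complex.ofReal_re] at h1
  refine h1.congr_of_eventuallyEq ?_
  filter_upwards [he] with y hy
  rw [hy]; simp

lemma HolDiff.continuous {h : ℝ → ℝ} (hh : HolDiff h) : Continuous h :=
  continuous_iff_continuousAt.2 fun x => let ⟨_, _, hd⟩ := (hh x).hasDerivAt; hd.continuousAt

lemma HolAt.comp {h k : ℝ → ℝ} {x : ℝ} (hh : HolAt h (k x)) (hk : HolAt k x) :
    HolAt (fun x => h (k x)) x := by
  obtain ⟨c0, -, hc0⟩ := hk.hasDerivAt
  obtain ⟨g1, c1, h1, a1, d1, e1⟩ := hk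
  obtain ⟨g2, c2, h2, a2, d2, e2⟩ := hh
  have e0 : g1 x = (k x : ℂ) := e1.self_of_nhds
  refine ⟨g2 ∘ g1, c2 * c1, mul_pos h2 h1, ?_, ?_, ?_⟩
  · exact AnalyticAt.comp (by rwa [e0]) a1
  · push_cast
    exact HasDerivAt.comp (h₂ := g2) _ (by rwa [e0]) d1
  · have := hc0.continuousAt.tendsto.eventually e2
    filter_upwards [e1, this] with y hy hy2
    show g2 (g1 y) = _
    rw [hy, hy2]

lemma HolAt.congr {h k : ℝ → ℝ} {x : ℝ} (hh : HolAt h x) (hk : ∀ᶠ y in 𝓝 x, k y = h y) :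
    HolAt k x := by
  obtain ⟨g1, c1, h1, a1, d1, e1⟩ := hh
  refine ⟨g1, c1, h1, a1, d1, ?_⟩
  filter_upwards [e1, hk] with y hy hy2
  rw [hy, hy2]

lemma HolAt.add_const {h : ℝ → ℝ} {x : ℝ} (hh : HolAt h x) (t : ℝ) :
    HolAt (fun x => h x + t) x := by
  obtain ⟨g1, c1, h1, a1, d1, e1⟩ := hh
  refine ⟨fun z => g1 z + t, c1, h1, a1.add analyticAt_const, d1.add_const _, ?_⟩
  filter_upwards [e1] with y hy
  rw [hy]; push_cast; rfl

lemma HolDiff.comp {h k : ℝ → ℝ} (hh : HolDiff h) (hk : HolDiff k) :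
    HolDiff (fun x => h (k x)) := fun x => (hh _).comp (hk x)

lemma HolDiff.inv {L : ℝ ≃o ℝ} (hL : HolDiff L) : HolDiff ⇑(L⁻¹) := by
  intro y
  obtain ⟨g, c, hc, hg, hd, he⟩ := hL (L⁻¹ y)
  have hd' : deriv g ((L⁻¹ y : ℝ) : ℂ) = c := hd.deriv
  have hne : deriv g ((L⁻¹ y : ℝ) : ℂ) ≠ 0 := by
    rw [hd']; exact_mod_cast hc.ne'
  have e0 : g ((L⁻¹ y : ℝ) : ℂ) = y := by rw [he.self_of_nhds, apply_inv_self']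
  have r1 := hg.analyticAt_localInverse hne
  have r2 := hg.hasStrictDerivAt.to_localInverse hne
  have r3 := hg.hasStrictDerivAt.eventually_left_inverse hne
  set r := hg.hasStrictDerivAt.localInverse _ _ _ hne
  rw [e0] at r1 r2
  refine ⟨r, c⁻¹, inv_pos.2 hc, r1, ?_, ?_⟩
  · have := r2.hasDerivAt
    rw [hd'] at this
    exact_mod_cast this
  · have c1 : Tendsto (fun t : ℝ => L⁻¹ t) (𝓝 y) (𝓝 (L⁻¹ y)) := (L⁻¹).continuous.tendsto y
    have c2 := (Complex.continuous_ofReal.tendsto (L⁻¹ y)).comp c1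
    filter_upwards [c1.eventually he, c2.eventually r3] with t ht1 ht2
    simp only [Function.comp] at ht2
    rw [ht1, apply_inv_self'] at ht2
    exact ht2

lemma HolDiff.mul {L M : ℝ ≃o ℝ} (hL : HolDiff L) (hM : HolDiff M) : HolDiff ⇑(L * M) :=
  HolDiff.comp (h := L) (k := M) hL hM

lemma holDiff_one : HolDiff ⇑(1 : ℝ ≃o ℝ) := fun x =>
  ⟨fun z => z, 1, one_pos, analyticAt_id, hasDerivAt_id _, Eventually.of_forall fun _ => rfl⟩

lemma HolDiff.zpow {L : ℝ ≃o ℝ} (hL : HolDiff L) (n : ℤ) : HolDiff ⇑(L ^ n) := by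
  induction n using Int.induction_on with
  | zero => exact holDiff_one
  | succ n ih => rw [zpow_add_one]; exact ih.mul hL
  | pred n ih => rw [zpow_sub_one]; exact ih.mul hL.inv

lemma holDiff_tr (t : ℝ) : HolDiff (tr t) := fun x =>
  ⟨fun z => z + t, 1, one_pos, analyticAt_id.add analyticAt_const,
    by simpa using (hasDerivAt_id (x : ℂ)).add_const (t : ℂ), Eventually.of_forall fun y => by simp⟩

/-- the elements of the group translated by `h` -/
def trSub (h : ℝ → ℝ) : Subgroup (ℝ ≃o ℝ) where
  carrier := {γ | ∃ t, ∀ x, h (γ x) = h x + t}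
  mul_mem' := by
    rintro a b ⟨s, hs⟩ ⟨t, ht⟩
    exact ⟨t + s, fun x => by rw [mul_apply', hs, ht]; ring⟩
  one_mem' := ⟨0, fun x => by simp [one_apply']⟩
  inv_mem' := by
    rintro a ⟨s, hs⟩
    refine ⟨-s, fun x => ?_⟩
    have := hs (a⁻¹ x)
    rw [apply_inv_self'] at this
    linarith

/-- the two homeomorphisms are simultaneously analytically conjugate to translations -/
def Lin (A B : ℝ ≃o ℝ) : Prop := ∃ h : ℝ → ℝ, HolDiff h ∧ A ∈ trSub h ∧ B ∈ trSub h

lemma Lin.conj {A B L : ℝ ≃o ℝ} (hL : HolDiff L) (h : Lin (L * A * L⁻¹) (L * B * L⁻¹)) :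
    Lin A B := by
  obtain ⟨h, hh, ⟨s, hs⟩, t, ht⟩ := h
  refine ⟨fun x => h (L x), hh.comp hL, ⟨s, fun x => ?_⟩, t, fun x => ?_⟩
  · have := hs (L x)
    rwa [mul_apply', mul_apply', inv_apply_self'] at this
  · have := ht (L x)
    rwa [mul_apply', mul_apply', inv_apply_self'] at this

/-- a holomorphic function with derivative near one, real on the reals, restricts to `HolDiff` -/
lemma exists_pos_hasDerivAt {g : ℂ → ℂ} {h : ℝ → ℝ} {x : ℝ} (hg : DifferentiableAt ℂ g x)
    (h1 : ‖deriv g x - 1‖ ≤ 1 / 2) (he : ∀ᶠ y : ℝ in 𝓝 x, g y = h y) :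
    ∃ c : ℝ, 0 < c ∧ HasDerivAt g c x := by
  have hd := hg.hasDerivAt
  have h2 : HasDerivAt (fun y : ℝ => g y) (deriv g x) x := hd.comp_ofReal
  have h3 : HasDerivAt (fun y : ℝ => (g y).im) (deriv g x).im x := by
    exact Complex.imCLM.hasFDerivAt.comp_hasDerivAt x h2
  have h4 : HasDerivAt (fun y : ℝ => (g y).im) 0 x := by
    refine (hasDerivAt_const x (0 : ℝ)).congr_of_eventuallyEq ?_
    filter_upwards [he] with y hy
    rw [hy]; simp
  have h5 := h3.unique h4
  refine ⟨(deriv g x).re, ?_, ?_⟩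
  · have := abs_le.1 ((Complex.abs_re_le_norm _).trans h1)
    rw [Complex.sub_re, Complex.one_re] at this
    linarith
  · have e : (((deriv g x).re : ℝ) : ℂ) = deriv g x := by
      apply Complex.ext <;> simp [h5]
    rwa [e]

lemma exists_lt_pow {A : ℝ ≃o ℝ} (hA : ∀ x, x < A x) (a x : ℝ) : ∃ n : ℕ, x < (A ^ n) a := by
  by_contra! hcon
  have hm : Monotone fun n : ℕ => (A ^ n) a := monotone_nat_of_le_succ fun n => by
    rw [pow_succ', mul_apply']; exact (hA _).le
  have hb : BddAbove (Set.range fun n : ℕ => (A ^ n) a) := ⟨x, by rintro _ ⟨n, rfl⟩; exact hcon n⟩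
  have ht := tendsto_atTop_ciSup hm hb
  have h1 := (A.continuous.tendsto _).comp ht
  have h2 := ht.comp (tendsto_add_atTop_nat 1)
  have e : (⇑A ∘ fun n : ℕ => (A ^ n) a) = ((fun n : ℕ => (A ^ n) a) ∘ fun n => n + 1) := by
    ext n; simp [pow_succ', mul_apply']
  rw [e] at h1
  have := tendsto_nhds_unique h1 h2
  exact (hA _).ne' this

lemma exists_pow_lt {A : ℝ ≃o ℝ} (hA : ∀ x, x < A x) (a x : ℝ) :
    ∃ n : ℕ, (A ^ (-(n : ℤ))) a ≤ x := by
  obtain ⟨n, hn⟩ := exists_lt_pow hA x a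
  refine ⟨n, ?_⟩
  have := (A ^ (-(n : ℤ))).monotone hn.le
  rw [← mul_apply'] at this
  simpa [one_apply'] using this

lemma strictMono_zpow_apply {A : ℝ ≃o ℝ} (hA : ∀ x, x < A x) (a : ℝ) :
    StrictMono fun n : ℤ => (A ^ n) a := strictMono_int_of_lt_succ fun n => by
  rw [add_comm, zpow_add, zpow_one, mul_apply']; exact hA _

lemma exists_zpow_mem {A : ℝ ≃o ℝ} (hA : ∀ x, x < A x) (a x : ℝ) :
    ∃ n : ℤ, (A ^ n) a ≤ x ∧ x < (A ^ (n + 1)) a := by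
  obtain ⟨k, hk⟩ := exists_lt_pow hA a x
  obtain ⟨l, hl⟩ := exists_pow_lt hA a x
  obtain ⟨n, hn1, hn2⟩ := Int.exists_greatest_of_bdd (P := fun n : ℤ => (A ^ n) a ≤ x)
    ⟨k, fun n hn => by
      by_contra! h
      have h1 := (strictMono_zpow_apply hA a) h
      simp only [zpow_natCast] at h1
      linarith⟩ ⟨_, hl⟩
  refine ⟨n, hn1, ?_⟩
  by_contra! h
  have := hn2 _ h
  omega

/-- a local analytic coordinate for `A` on a fundamental domain extends to the line -/
theorem exists_real_coordinate {A : ℝ ≃o ℝ} (hA : ∀ x, x < A x) (hAh : HolDiff A) {c d a : ℝ}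
    {l : ℝ → ℝ} (ha : a ∈ Set.Ioo c d) (hAa : A a ∈ Set.Ioo c d)
    (hmono : StrictMonoOn l (Set.Ioo c d)) (hl : ∀ x ∈ Set.Ioo c d, HolAt l x)
    (hf : ∀ x ∈ Set.Ioo c d, A x ∈ Set.Ioo c d → l (A x) = l x + 1) :
    ∃ L : ℝ ≃o ℝ, HolDiff L ∧ (∀ x ∈ Set.Ioo c d, L x = l x) ∧ L * A * L⁻¹ = tr 1 := by
  have hnat : ∀ (k : ℕ) (u : ℝ), u ∈ Set.Ioo c d → (A ^ k) u ∈ Set.Ioo c d →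
      l ((A ^ k) u) = l u + k := by
    intro k
    induction k with
    | zero => intro u _ _; simp [one_apply']
    | succ k ih =>
      intro u hu hk
      rw [pow_succ', mul_apply'] at hk ⊢
      have h1 : u ≤ (A ^ k) u := by
        have := (strictMono_zpow_apply hA u).monotone (Int.natCast_nonneg k)
        simpa [one_apply'] using this
      have h2 : (A ^ k) u ∈ Set.Ioo c d := ⟨hu.1.trans_le h1, (hA _).trans hk.2⟩
      rw [hf _ h2 hk, ih u hu h2]; push_cast; ring
  have h_int : ∀ (k : ℤ) (u : ℝ), u ∈ Set.Ioo c d → (A ^ k) u ∈ Set.Ioo c d →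
      l ((A ^ k) u) = l u + k := by
    intro k u hu hk
    obtain ⟨n, rfl | rfl⟩ := k.eq_nat_or_neg
    · exact_mod_cast hnat n u hu (by exact_mod_cast hk)
    · have h1 : (A ^ n) ((A ^ (-(n : ℤ))) u) = u := by
        rw [← mul_apply']; simp [one_apply']
      have h2 := hnat n _ hk (by rwa [h1])
      rw [h1] at h2
      push_cast
      linarith
  choose n hn1 hn2 using exists_zpow_mem hA a
  have hmem : ∀ x, (A ^ (-n x)) x ∈ Set.Ico a (A a) := by
    intro x
    constructor
    · have := (A ^ (-n x)).monotone (hn1 x)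
      rw [← mul_apply'] at this
      simpa [one_apply'] using this
    · have := (A ^ (-n x)).strictMono (hn2 x)
      rw [← mul_apply', ← zpow_add] at this
      simpa using this
  have hI : Set.Ico a (A a) ⊆ Set.Ioo c d := fun x hx => ⟨ha.1.trans_le hx.1, hx.2.trans hAa.2⟩
  set L0 : ℝ → ℝ := fun x => l ((A ^ (-n x)) x) + n x with hL0
  have hval : ∀ (m : ℤ) (x : ℝ), (A ^ (-m)) x ∈ Set.Ioo c d → L0 x = l ((A ^ (-m)) x) + m := by
    intro m x hx
    have e : (A ^ (-n x)) x = (A ^ (m - n x)) ((A ^ (-m)) x) := by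
      rw [← mul_apply', ← zpow_add]; congr 2; ring
    have h1 := h_int (m - n x) _ hx (by rw [← e]; exact hI (hmem x))
    simp only [hL0]
    rw [e, h1]; push_cast; ring
  have hcomm : ∀ x, L0 (A x) = L0 x + 1 := by
    intro x
    have h1 : (A ^ (-(n x + 1))) (A x) = (A ^ (-n x)) x := by
      have : (A ^ (-(n x + 1))) (A x) = (A ^ (-(n x + 1)) * A) x := rfl
      rw [this, ← zpow_add_one]; congr 2; ring
    rw [hval (n x + 1) (A x) (by rw [h1]; exact hI (hmem x)), h1]
    simp only [hL0]; push_cast; ring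
  have hhol : HolDiff L0 := by
    intro x
    have hc : Tendsto (fun y => (A ^ (-n x)) y) (𝓝 x) (𝓝 ((A ^ (-n x)) x)) :=
      (A ^ (-n x)).continuous.tendsto x
    have h1 : HolAt (fun y => l ((A ^ (-n x)) y) + (n x : ℝ)) x :=
      ((hl _ (hI (hmem x))).comp (hAh.zpow (-n x) x)).add_const _
    refine h1.congr ?_
    filter_upwards [hc.eventually (Ioo_mem_nhds (hI (hmem x)).1 (hI (hmem x)).2)] with y hy
    exact hval _ _ hy
  have hLa : l (A a) = l a + 1 := hf a ha hAa
  have hstrict : StrictMono L0 := by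
    intro x y hxy
    have hle : n x ≤ n y := by
      by_contra! h
      have h1 := (strictMono_zpow_apply hA a).monotone (show n y + 1 ≤ n x by omega)
      have := hn2 y
      have := hn1 x
      linarith
    rcases eq_or_lt_of_le hle with h | h
    · simp only [hL0, ← h]
      have h1 : (A ^ (-n x)) y ∈ Set.Ioo c d := by rw [h]; exact hI (hmem y)
      have := hmono (hI (hmem x)) h1 ((A ^ (-n x)).strictMono hxy)
      linarith
    · simp only [hL0]
      have h1 := hmono (hI (hmem x)) hAa (hmem x).2
      have h2 := hmono.monotoneOn ha (hI (hmem y)) (hmem y).1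
      have h3 : (n x : ℝ) + 1 ≤ n y := by exact_mod_cast h
      linarith
  have hpow : ∀ k : ℤ, L0 ((A ^ k) a) = l a + k := by
    intro k
    have h1 : (A ^ (-k)) ((A ^ k) a) = a := by rw [← mul_apply']; simp [one_apply']
    rw [hval k _ (by rw [h1]; exact ha), h1]
  have hsurj : Function.Surjective L0 := by
    refine hhol.continuous.surjective ?_ ?_
    · refine hstrict.monotone.tendsto_atTop_atTop fun b => ?_
      refine ⟨(A ^ ⌈b - l a⌉) a, ?_⟩
      rw [hpow]; linarith [Int.le_ceil (b - l a)]
    · refine hstrict.monotone.tendsto_atBot_atBot fun b => ?_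
      refine ⟨(A ^ ⌊b - l a⌋) a, ?_⟩
      rw [hpow]; linarith [Int.floor_le (b - l a)]
  refine ⟨StrictMono.orderIsoOfSurjective L0 hstrict hsurj, hhol, fun x hx => ?_, ?_⟩
  · have := hval 0 x (by simpa [one_apply'] using hx)
    simpa [one_apply'] using this
  · set L := StrictMono.orderIsoOfSurjective L0 hstrict hsurj with hL
    rw [mul_inv_eq_iff_eq_mul]
    ext x
    exact hcomm x

lemma exists_periodic_extension {g : ℂ → ℂ} {h x0 : ℝ}
    (hg : DifferentiableOn ℂ g (rct (1 - x0) (x0 + 2) h))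
    (hp : ∀ z ∈ rct (1 - x0) (x0 + 2) h, z + 1 ∈ rct (1 - x0) (x0 + 2) h → g (z + 1) = g z) :
    ∃ G : ℂ → ℂ, DifferentiableOn ℂ G (strip h) ∧ (∀ z, G (z + 1) = G z) ∧
      (∀ z ∈ rct (1 - x0) (x0 + 2) h, G z = g z) ∧
      ∀ z ∈ strip h, ∃ w ∈ rct (1 - x0) (x0 + 2) h, w.im = z.im ∧ G z = g w := by
  set G : ℂ → ℂ := fun z => g (z - (⌊z.re - x0⌋ : ℤ)) with hG
  have hper : ∀ (z : ℂ) (n : ℤ), G (z - n) = G z := by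
    intro z n
    have e : (z - n).re - x0 = z.re - x0 - n := by simp; ring
    simp only [hG, e, Int.floor_sub_intCast]
    push_cast
    congr 1; ring
  have hre : ∀ z : ℂ, x0 ≤ (z - (⌊z.re - x0⌋ : ℤ)).re ∧ (z - (⌊z.re - x0⌋ : ℤ)).re < x0 + 1 := by
    intro z
    have h1 := Int.floor_le (z.re - x0)
    have h2 := Int.lt_floor_add_one (z.re - x0)
    simp only [Complex.sub_re, Complex.intCast_re]
    constructor <;> linarith
  have hmem : ∀ z ∈ strip h, z - (⌊z.re - x0⌋ : ℤ) ∈ rct (1 - x0) (x0 + 2) h := by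
    intro z hz
    refine ⟨by linarith [(hre z).1], by linarith [(hre z).2], ?_⟩
    simpa [strip] using hz
  have hval : ∀ z ∈ rct (1 - x0) (x0 + 2) h, G z = g z := by
    intro z hz
    have h0 := hmem z hz.2.2
    have h1 := hre z
    simp only [hG]
    set n := ⌊z.re - x0⌋ with hn
    have n1 : -1 ≤ n := by
      rw [hn, Int.le_floor]; push_cast; linarith [hz.1]
    have n2 : n ≤ 1 := by
      have : n < 2 := by rw [hn, Int.floor_lt]; push_cast; linarith [hz.2.1]
      omega
    obtain h | h | h : n = -1 ∨ n = 0 ∨ n = 1 := by omega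
    · rw [h] at h0 ⊢
      push_cast at h0 ⊢
      rw [sub_neg_eq_add] at h0 ⊢
      exact hp z hz h0
    · simp [h]
    · rw [h] at h0 ⊢
      push_cast at h0 ⊢
      have := hp _ h0 (by rwa [sub_add_cancel])
      rw [sub_add_cancel] at this
      exact this.symm
  refine ⟨G, ?_, fun z => ?_, hval, fun z hz => ⟨_, hmem z hz, by simp, rfl⟩⟩
  · intro z hz
    have h1 : DifferentiableAt ℂ g (z - (⌊z.re - x0⌋ : ℤ)) :=
      hg.differentiableAt ((isOpen_rct _ _ _).mem_nhds (hmem z hz))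
    have h2 : DifferentiableAt ℂ (fun w : ℂ => g (w - (⌊z.re - x0⌋ : ℤ))) z :=
      DifferentiableAt.comp (g := g) z h1 (differentiableAt_id.sub_const _)
    refine (h2.congr_of_eventuallyEq ?_).differentiableWithinAt
    have hc : ContinuousAt (fun w : ℂ => w - (⌊z.re - x0⌋ : ℤ)) z := by fun_prop
    filter_upwards [hc ((isOpen_rct _ _ _).mem_nhds (hmem z hz))] with w hw
    rw [← hper w ⌊z.re - x0⌋]
    exact hval _ hw
  · have := hper (z + 1) 1
    push_cast at this
    rw [add_sub_cancel_right] at this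
    exact this.symm

/-- horizontal integrals of periodic holomorphic functions over a period do not depend on the
height -/
lemma horizontal_integral_eq {G : ℂ → ℂ} {h : ℝ} (hG : DifferentiableOn ℂ G (strip h))
    (hp : ∀ z, G (z + 1) = G z) {y1 y2 : ℝ} (h1 : |y1| < h) (h2 : |y2| < h) :
    (∫ x in (0 : ℝ)..1, G (x + y1 * Complex.I)) = ∫ x in (0 : ℝ)..1, G (x + y2 * Complex.I) := by
  have key := Complex.integral_boundary_rect_eq_zero_of_differentiableOn G
    (⟨0, y1⟩ : ℂ) (⟨1, y2⟩ : ℂ) (hG.mono (by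
      intro z hz
      have hz2 := hz.2
      simp only [Set.mem_preimage, Set.uIcc, Set.mem_Icc] at hz2
      rw [abs_lt] at h1 h2
      exact abs_lt.2 ⟨(lt_min h1.1 h2.1).trans_le hz2.1, hz2.2.trans_lt (max_lt h1.2 h2.2)⟩))
  simp only [Complex.ofReal_one, Complex.ofReal_zero, zero_add] at key
  have e : (∫ y : ℝ in y1..y2, G (1 + y * Complex.I)) = ∫ y : ℝ in y1..y2, G (y * Complex.I) := by
    congr 1
    ext y
    rw [add_comm, hp]
  rw [e, add_sub_cancel_right, sub_eq_zero] at key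
  exact key

/-- a bounded periodic holomorphic function on a strip is close to a constant deep inside -/
theorem periodic_decay {g : ℂ → ℂ} {h E : ℝ} (hg : DifferentiableOn ℂ g (strip h))
    (hp : ∀ z, g (z + 1) = g z) (hE : ∀ z ∈ strip h, ‖g z‖ ≤ E) :
    ∃ c : ℂ, ∀ z ∈ strip (h - 1), ‖g z - c‖ ≤ 100 * E * Real.exp (-(2 * Real.pi * (h - |z.im|))) := by
  set I : ℤ → ℝ → ℂ := fun n y => ∫ x in (0 : ℝ)..1,
    g (x + y * Complex.I) * Complex.exp (-(2 * Real.pi * Complex.I * n * (x + y * Complex.I)))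
    with hI
  have hIeq : ∀ n : ℤ, ∀ y1 y2 : ℝ, |y1| < h → |y2| < h → I n y1 = I n y2 := by
    intro n y1 y2 h1 h2
    refine horizontal_integral_eq (G := fun z => g z *
      Complex.exp (-(2 * Real.pi * Complex.I * n * z))) (h := h) ?_ ?_ h1 h2
    · exact hg.mul (by fun_prop)
    · intro z
      show g (z + 1) * _ = _
      rw [hp]
      congr 1
      rw [Complex.exp_eq_exp_iff_exists_int]
      exact ⟨-n, by push_cast; ring⟩
  have hIb : ∀ n : ℤ, ∀ y : ℝ, |y| < h → ‖I n y‖ ≤ E * Real.exp (2 * Real.pi * n * y) := by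
    intro n y hy
    have := intervalIntegral.norm_integral_le_of_norm_le_const (a := 0) (b := 1)
      (f := fun x : ℝ => g (x + y * Complex.I) *
        Complex.exp (-(2 * Real.pi * Complex.I * n * (x + y * Complex.I))))
      (C := E * Real.exp (2 * Real.pi * n * y)) ?_
    · simpa using this
    · intro x _
      rw [norm_mul, Complex.norm_exp]
      have e : (-(2 * (Real.pi : ℂ) * Complex.I * n * (x + y * Complex.I))).re
          = 2 * Real.pi * n * y := by
        simp
      rw [e]
      gcongr
      apply hE
      simpa [strip] using hy
  refine ⟨I 0 0, fun z hz => ?_⟩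
  have hz' : |z.im| < h - 1 := hz
  have hh : |(0 : ℝ)| < h := by rw [abs_zero]; linarith [abs_nonneg z.im]
  have hE0 : 0 ≤ E := (norm_nonneg _).trans (hE 0 (by simpa [strip] using hh))
  set y := z.im with hy
  have hyh : |y| < h := by linarith
  have hFp : Function.Periodic (fun x : ℝ => g (x + y * Complex.I)) 1 := by
    intro x
    have := hp (x + y * Complex.I)
    simp only
    rw [← this]; congr 1; push_cast; ring
  have hFc : Continuous (fun x : ℝ => g (x + y * Complex.I)) := by
    refine hg.continuousOn.comp_continuous (by fun_prop) fun x => ?_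
    simpa [strip] using hyh
  set f : C(AddCircle (1 : ℝ), ℂ) := ⟨hFp.lift, continuous_coinduced_dom.mpr hFc⟩ with hf
  have hfx : ∀ x : ℝ, f (x : AddCircle (1 : ℝ)) = g (x + y * Complex.I) := fun x =>
    hFp.lift_coe x
  have : Fact ((0 : ℝ) < 1) := ⟨one_pos⟩
  have hcoef : ∀ n : ℤ, fourierCoeff f n = I n y * Complex.exp (-(2 * Real.pi * n * y)) := by
    intro n
    rw [fourierCoeff_eq_intervalIntegral f n 0]
    simp only [hI, div_one, one_smul, zero_add]
    rw [← intervalIntegral.integral_mul_const]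
    congr 1
    ext x
    rw [fourier_coe_apply, hfx, smul_eq_mul, mul_comm, mul_assoc (g _), ← Complex.exp_add]
    congr 2
    push_cast
    ring_nf
    rw [Complex.I_sq]; ring
  set q : ℝ := Real.exp (-(2 * Real.pi * (h - 1 / 2 - |y|))) with hq
  have hcb : ∀ n : ℤ, ‖fourierCoeff f n‖ ≤ E * q ^ n.natAbs := by
    intro n
    rw [hcoef, norm_mul, Complex.norm_exp]
    have e : (-(2 * (Real.pi : ℂ) * n * y)).re = -(2 * Real.pi * n * y) := by
      simp
    rw [e]
    have hn : (n.natAbs : ℝ) = |(n : ℝ)| := by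
      rw [← Int.cast_abs, Int.abs_eq_natAbs]; simp
    set y' : ℝ := if 0 ≤ n then -(h - 1 / 2) else h - 1 / 2 with hy'
    have hyy : |y'| < h := by
      have h0 := abs_nonneg y
      simp only [hy']
      split_ifs
      · rw [abs_neg, abs_of_pos (by linarith)]; linarith
      · rw [abs_of_pos (by linarith)]; linarith
    have hny : n * y' = -(|(n : ℝ)| * (h - 1 / 2)) := by
      simp only [hy']
      split_ifs with h0
      · rw [abs_of_nonneg (by exact_mod_cast h0)]; ring
      · rw [abs_of_neg (by exact_mod_cast (not_le.1 h0))]; ring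
    rw [hIeq n y y' hyh hyy]
    calc _ ≤ E * Real.exp (2 * Real.pi * n * y') * Real.exp (-(2 * Real.pi * n * y)) := by
          gcongr; exact hIb n y' hyy
      _ ≤ E * q ^ n.natAbs := by
        rw [mul_assoc, ← Real.exp_add, hq, ← Real.exp_nat_mul, hn]
        gcongr
        have h1 : -(n * y) ≤ |(n : ℝ)| * |y| := by
          rw [← abs_mul]; exact neg_le_abs _
        have := mul_le_mul_of_nonneg_left h1 (show 0 ≤ 2 * Real.pi by positivity)
        have e1 : 2 * Real.pi * n * y' = 2 * Real.pi * (n * y') := by ring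
        rw [e1, hny]
        nlinarith
  have hq0 : 0 < q := Real.exp_pos _
  have hq1 : q ≤ 1 / 20 := by
    have h1 : q ≤ Real.exp (-3) := by
      rw [hq]; apply Real.exp_le_exp.2
      nlinarith [Real.pi_gt_three]
    have h2 : Real.exp (-3) ≤ 1 / 20 := by
      rw [Real.exp_neg, ← one_div]
      apply one_div_le_one_div_of_le (by norm_num)
      have := Real.exp_one_gt_d9
      have e : Real.exp 3 = Real.exp 1 ^ 3 := by rw [← Real.exp_nat_mul]; norm_num
      rw [e]
      have : (2.7182818283 : ℝ) ^ 3 ≤ Real.exp 1 ^ 3 := by gcongr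
      norm_num at this ⊢
      linarith
    linarith
  have hgeo : HasSum (fun n : ℕ => q ^ n) (1 - q)⁻¹ :=
    hasSum_geometric_of_lt_one hq0.le (by linarith)
  have hZ : HasSum (fun n : ℤ => E * q ^ n.natAbs) (E * ((1 - q)⁻¹ + q * (1 - q)⁻¹)) := by
    refine HasSum.mul_left E (HasSum.of_nat_of_neg_add_one (f := fun n : ℤ => q ^ n.natAbs) ?_ ?_)
    · simpa using hgeo
    · have := hgeo.mul_left q
      refine this.congr_fun ?_ |> fun h => h
      intro n
      have : (-((n : ℤ) + 1)).natAbs = n + 1 := by omega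
      rw [this, pow_succ']
  have hsum : Summable (fourierCoeff f) := Summable.of_norm_bounded hZ.summable hcb
  have hS := has_pointwise_sum_fourier_series_of_summable hsum (z.re : AddCircle (1 : ℝ))
  have hS' := hasSum_ite_sub_hasSum hS 0
  have hZ' := hasSum_ite_sub_hasSum hZ 0
  have hfin := hS'.norm_le_of_bounded hZ' (fun n => by
    split_ifs with hn
    · simp
    · rw [norm_smul, fourier_apply, Circle.norm_coe, mul_one]; exact hcb n)
  have hc0 : fourierCoeff f 0 = I 0 0 := by
    rw [hcoef, hIeq 0 y 0 hyh hh]; simp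
  rw [hfx, hc0, fourier_zero, smul_eq_mul, mul_one, hy, Complex.re_add_im] at hfin
  refine hfin.trans ?_
  simp only [Int.natAbs_zero, pow_zero, mul_one]
  have hq2 : (1 - q)⁻¹ ≤ 20 / 19 := by
    rw [inv_le_comm₀ (by linarith) (by norm_num)]; norm_num; linarith
  have e1 : E * ((1 - q)⁻¹ + q * (1 - q)⁻¹) - E = E * (2 * q * (1 - q)⁻¹) := by
    have : 1 - q ≠ 0 := by linarith
    field_simp
    ring
  rw [e1]
  have e2 : q = Real.exp Real.pi * Real.exp (-(2 * Real.pi * (h - |y|))) := by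
    rw [hq, ← Real.exp_add]; congr 1; ring
  have e3 : Real.exp Real.pi ≤ 40 := by
    have h1 : Real.exp Real.pi ≤ Real.exp 3.2 := Real.exp_le_exp.2 (by
      linarith [Real.pi_lt_d2])
    have h2 : Real.exp 3.2 = Real.exp 1 ^ 3 * Real.exp (1 / 5) := by
      rw [← Real.exp_nat_mul, ← Real.exp_add]; norm_num
    have h3 := Real.exp_bound_div_one_sub_of_interval (x := 1 / 5) (by norm_num) (by norm_num)
    have h4 : Real.exp 1 ^ 3 ≤ (2.7182818286 : ℝ) ^ 3 := by
      gcongr; exact Real.exp_one_lt_d9.le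
    have h5 : (2.7182818286 : ℝ) ^ 3 ≤ 20.1 := by norm_num
    have h6 : Real.exp (1 / 5) ≤ 1.25 := h3.trans (by norm_num)
    rw [h2] at h1
    calc _ ≤ _ := h1
      _ ≤ 20.1 * 1.25 := mul_le_mul (h4.trans h5) h6 (Real.exp_pos _).le (by norm_num)
      _ ≤ 40 := by norm_num
  have h5 := Real.exp_pos (-(2 * Real.pi * (h - |y|)))
  set X := Real.exp (-(2 * Real.pi * (h - |y|)))
  have : 2 * q * (1 - q)⁻¹ ≤ 100 * X := by
    calc 2 * q * (1 - q)⁻¹ ≤ 2 * q * (20 / 19) := by gcongr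
      _ ≤ 100 * X := by rw [e2]; nlinarith
  calc _ ≤ E * (100 * X) := by gcongr
    _ = _ := by ring

/-- a commuting homeomorphism with rotation number `ρ`, exponentially close to the translation by
`ρ` in the strip of half-width `Δ` -/
def Good (ρ Δ : ℝ) (G : ℝ ≃o ℝ) : Prop :=
  RotPair (tr 1) G ρ ∧ ∃ g : ℂ → ℂ, DifferentiableOn ℂ g (strip Δ) ∧ (∀ x : ℝ, g x = G x) ∧
    (∀ z, g (z + 1) = g z + 1) ∧
    ∀ z ∈ strip Δ, ‖g z - z - ρ‖ ≤ Real.exp (-(2 * Real.pi * (Δ - |z.im|)))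

lemma Good.mono {ρ Δ Δ' : ℝ} {G : ℝ ≃o ℝ} (h : Good ρ Δ G) (hΔ : Δ' ≤ Δ) : Good ρ Δ' G := by
  obtain ⟨h1, g, h2, h3, h4, h5⟩ := h
  have hs : strip Δ' ⊆ strip Δ := fun z hz => lt_of_lt_of_le hz hΔ
  refine ⟨h1, g, h2.mono hs, h3, h4, fun z hz => (h5 z (hs hz)).trans ?_⟩
  apply Real.exp_le_exp.2
  nlinarith [Real.pi_pos]

lemma tr_one_zpow_apply (m : ℤ) (x : ℝ) : ((tr 1) ^ m) x = x + m := by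
  rw [tr_zpow]; simp

lemma RotPair.abs_sub_le {G : ℝ ≃o ℝ} {ρ c η : ℝ} (h : RotPair (tr 1) G ρ)
    (hc : ∀ x, |G x - x - c| ≤ η) : |c - ρ| ≤ η := by
  have up : ∀ n : ℕ, (G ^ n) 0 ≤ n * (c + η) := by
    intro n
    induction n with
    | zero => simp [one_apply']
    | succ n ih =>
      rw [pow_succ', mul_apply']; push_cast
      linarith [(abs_le.1 (hc ((G ^ n) 0))).2]
  have lo : ∀ n : ℕ, n * (c - η) ≤ (G ^ n) 0 := by
    intro n
    induction n with
    | zero => simp [one_apply']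
    | succ n ih =>
      rw [pow_succ', mul_apply']; push_cast
      linarith [(abs_le.1 (hc ((G ^ n) 0))).1]
  rw [abs_le]
  constructor
  · by_contra! hcon
    obtain ⟨n, hn⟩ := exists_nat_gt (1 / (ρ - c - η))
    rw [div_lt_iff₀ (by linarith)] at hn
    have h1 := Int.ceil_lt_add_one (n * ρ)
    have h2 := h.2 (-⌈(n : ℝ) * ρ⌉ + 1) n (by push_cast; linarith) 0
    rw [mul_apply', tr_one_zpow_apply, zpow_natCast] at h2
    have := up n
    have := Int.le_ceil (n * ρ)
    push_cast at h2
    nlinarith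
  · by_contra! hcon
    obtain ⟨n, hn⟩ := exists_nat_gt (1 / (c - ρ - η))
    rw [div_lt_iff₀ (by linarith)] at hn
    have h1 := Int.lt_floor_add_one (n * ρ)
    have h2 := h.lt_id (-⌊(n : ℝ) * ρ⌋ - 1) n (by push_cast; linarith) 0
    rw [mul_apply', tr_one_zpow_apply, zpow_natCast] at h2
    have := lo n
    have := Int.floor_le (n * ρ)
    push_cast at h2
    nlinarith

/-- a commuting homeomorphism becomes exponentially close to a translation in the coordinate
where the first element of the pair is the unit translation -/
theorem exists_renormalization {A B : ℝ ≃o ℝ} {ρ W h b E : ℝ} {ψ L Bh : ℂ → ℂ}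
    (hAB : RotPair A B ρ) (hA : HolDiff A) (hL : Coord ψ L W h b (1 / 2))
    (hAψ : ∀ x : ℝ, -W < x → x < 9 / 10 → (A x : ℂ) = x + 1 + ψ x)
    (hψ : ∀ x : ℝ, -W < x → x < 9 / 10 → ‖ψ x‖ ≤ 1 / 100)
    (hBd : DifferentiableOn ℂ Bh (rct W (9 / 10) h))
    (hBE : ∀ z ∈ rct W (9 / 10) h, ‖Bh z - z‖ ≤ E)
    (hB : ∀ x : ℝ, -W < x → x < 9 / 10 → Bh x = B x)
    (hb : 0 ≤ b) (hE : 0 ≤ E) (hW : 2 * E + 2 * b + 10 ≤ W) (hpos : 0 < h - 1 - 60 * E - 120 * b) :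
    ∃ Λ : ℝ ≃o ℝ, HolDiff Λ ∧ Λ * A * Λ⁻¹ = tr 1 ∧
      (∀ x : ℝ, -W < x → x < 9 / 10 → (Λ x : ℂ) = L x) ∧
      Good ρ (h - 1 - 60 * E - 120 * b) (Λ * B * Λ⁻¹) := by
  set U := rct W (9 / 10) h with hU
  have oU : IsOpen U := isOpen_rct _ _ _
  have cU : Convex ℝ U := convex_rct _ _ _
  have hA1 : ∀ x, x < A x := by
    have := hAB.2 1 0 (by simp)
    simpa using this
  have hh : 0 < h := by linarith
  have hreal : ∀ x : ℝ, -W < x → x < 9 / 10 → (x : ℂ) ∈ U := fun x h1 h2 =>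
    ⟨by simpa using h1, by simpa using h2, by simpa using hh⟩
  have hLreal : ∀ x : ℝ, -W < x → x < 9 / 10 → (((L x).re : ℝ) : ℂ) = L x := by
    intro x h1 h2
    have := hL.symm x (hreal x h1 h2)
    rw [Complex.conj_ofReal] at this
    exact Complex.conj_eq_iff_re.1 this.symm
  have hmono : StrictMonoOn (fun x : ℝ => (L x).re) (Set.Ioo (-W) (9 / 10)) := by
    intro x hx y hy hxy
    have h1 := norm_sub_sub_le_of_deriv oU cU hL.diff hL.deriv_near (hreal x hx.1 hx.2)
      (hreal y hy.1 hy.2)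
    have h2 := abs_le.1 ((Complex.abs_re_le_norm _).trans h1)
    rw [← Complex.ofReal_sub y x, Complex.norm_real, Real.norm_eq_abs,
      abs_of_pos (by linarith : 0 < y - x)] at h2
    simp only [Complex.sub_re, Complex.ofReal_re] at h2
    show (L x).re < (L y).re
    linarith [h2.1]
  have hHol : ∀ x ∈ Set.Ioo (-W) (9 / 10), HolAt (fun x : ℝ => (L x).re) x := by
    intro x hx
    have hxU := hreal x hx.1 hx.2
    have he : ∀ᶠ y : ℝ in 𝓝 x, L y = ((L y).re : ℝ) := by
      filter_upwards [Ioo_mem_nhds hx.1 hx.2] with y hy using (hLreal y hy.1 hy.2).symm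
    obtain ⟨c, hc, hd⟩ := exists_pos_hasDerivAt (hL.diff.differentiableAt (oU.mem_nhds hxU))
      (hL.deriv_near _ hxU) he
    exact ⟨L, c, hc, hL.diff.analyticAt (oU.mem_nhds hxU), hd, he⟩
  have hfeq : ∀ x ∈ Set.Ioo (-W) (9 / 10), A x ∈ Set.Ioo (-W) (9 / 10) →
      (L (A x)).re = (L x).re + 1 := by
    intro x hx hAx
    have h1 := hL.feq x (hreal x hx.1 hx.2) (by
      rw [← hAψ x hx.1 hx.2]; exact hreal _ hAx.1 hAx.2)
    rw [← hAψ x hx.1 hx.2] at h1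
    rw [h1]; simp
  have hW10 : 10 ≤ W := by linarith
  have hAhalf : A (-(1 / 2)) ∈ Set.Ioo (-W) (9 / 10) := by
    have h1 := hAψ (-(1 / 2)) (by linarith) (by norm_num)
    have h2 := hψ (-(1 / 2)) (by linarith) (by norm_num)
    have h3 := congrArg Complex.re h1
    simp only [Complex.ofReal_re, Complex.add_re, Complex.one_re] at h3
    have h4 := abs_le.1 ((Complex.abs_re_le_norm _).trans h2)
    constructor <;> linarith
  obtain ⟨Λ, hΛ1, hΛ2, hΛ3⟩ := exists_real_coordinate hA1 hA
    (a := -(1 / 2)) ⟨by linarith, by norm_num⟩ hAhalf hmono hHol hfeq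
  have hΛL : ∀ x : ℝ, -W < x → x < 9 / 10 → (Λ x : ℂ) = L x := fun x h1 h2 => by
    rw [hΛ2 x ⟨h1, h2⟩, hLreal x h1 h2]
  refine ⟨Λ, hΛ1, hΛ3, hΛL, ?_⟩
  have hrot : RotPair (tr 1) (Λ * B * Λ⁻¹) ρ := by
    have := hAB.conj Λ
    rwa [hΛ3] at this
  refine ⟨hrot, ?_⟩
  set G := Λ * B * Λ⁻¹ with hG
  -- the inverse of the coordinate
  have oV : IsOpen (rct (W - b) (9 / 10 - b) (h - b)) := isOpen_rct _ _ _
  obtain ⟨M, hMd, hM⟩ := exists_inverse oU cU hL.diff hL.near hL.deriv_near hb oV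
    (fun w hw => closedBall_subset_rct hw)
  have hMuniq : ∀ x ∈ U, ∀ y ∈ U, L x = L y → x = y := by
    intro x hx y hy hxy
    have := norm_sub_le_two_mul oU cU hL.diff hL.deriv_near hx hy
    rw [hxy, sub_self, norm_zero, mul_zero] at this
    exact (sub_eq_zero.1 (norm_le_zero_iff.1 this)).symm
  set x0 : ℝ := -(W / 2) with hx0
  set h' : ℝ := h - b - E with hh'
  set D := rct (1 - x0) (x0 + 2) h' with hD
  have hDV : D ⊆ rct (W - b) (9 / 10 - b) (h - b) :=
    rct_mono (by linarith) (by linarith) (by linarith)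
  have hnear : ∀ (w : ℂ), w ∈ D → ∀ u : ℂ, ‖u - w‖ ≤ b + E → u ∈ U := by
    intro w hw u hu
    have : w ∈ rct (W - (b + E)) (9 / 10 - (b + E)) (h - (b + E)) :=
      rct_mono (by linarith) (by linarith) (by linarith) hw
    apply closedBall_subset_rct this
    rwa [Metric.mem_closedBall, dist_eq_norm]
  have hBM : ∀ w ∈ D, Bh (M w) ∈ U := by
    intro w hw
    obtain ⟨m1, m2, m3, -⟩ := hM w (hDV hw)
    apply hnear w hw
    have e : Bh (M w) - w = (M w - w) + (Bh (M w) - M w) := by ring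
    rw [e]
    exact (norm_add_le _ _).trans (add_le_add m2 (hBE _ m1))
  set g : ℂ → ℂ := fun w => L (Bh (M w)) - w with hg
  have hgd : DifferentiableOn ℂ g D := by
    refine DifferentiableOn.sub ?_ differentiableOn_id
    refine DifferentiableOn.comp (g := L) (t := U) hL.diff ?_ hBM
    exact DifferentiableOn.comp (g := Bh) (t := U) hBd (hMd.mono hDV) (fun w hw => (hM w (hDV hw)).1)
  have hgE : ∀ w ∈ D, ‖g w‖ ≤ E + 2 * b := by
    intro w hw
    obtain ⟨m1, m2, m3, -⟩ := hM w (hDV hw)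
    have e : g w = (L (Bh (M w)) - Bh (M w)) + (Bh (M w) - M w) + (M w - w) := by
      simp only [hg]; ring
    rw [e]
    have := norm_add₃_le (a := L (Bh (M w)) - Bh (M w)) (b := Bh (M w) - M w) (c := M w - w)
    linarith [hL.near _ (hBM w hw), hBE _ m1]
  have hgreal : ∀ x : ℝ, (x : ℂ) ∈ D → g x = G x - x := by
    intro x hx
    obtain ⟨m1, m2, m3, -⟩ := hM x (hDV hx)
    have h1 : conj (M x) = M x := by
      apply hMuniq _ (conj_mem_rct m1) _ m1
      rw [hL.symm _ m1, m3, Complex.conj_ofReal]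
    obtain ⟨t, ht⟩ : ∃ t : ℝ, M x = t := ⟨_, (Complex.conj_eq_iff_re.1 h1).symm⟩
    have hBx := hBM x hx
    rw [ht] at m1 m3 hBx
    have t1 : -W < t := by simpa using m1.1
    have t2 : t < 9 / 10 := by simpa using m1.2.1
    rw [← hΛL t t1 t2] at m3
    have m4 : Λ t = x := by exact_mod_cast m3
    have m5 : Λ⁻¹ x = t := by rw [← m4, inv_apply_self']
    rw [hB t t1 t2] at hBx
    have b1 : -W < B t := by simpa using hBx.1
    have b2 : B t < 9 / 10 := by simpa using hBx.2.1
    simp only [hg]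
    rw [ht, hB t t1 t2, ← hΛL _ b1 b2, hG, mul_apply', mul_apply', m5]
  have hGT : ∀ x : ℝ, G (x + 1) = G x + 1 := by
    intro x
    have h1 : (tr 1 * G) x = (G * tr 1) x := by rw [hrot.1.eq]
    exact h1.symm
  have hper : ∀ z ∈ D, z + 1 ∈ D → g (z + 1) = g z := by
    have hV : ∀ z ∈ rct (1 - x0) (x0 + 1) h', z ∈ D ∧ z + 1 ∈ D := by
      intro z hz
      refine ⟨⟨hz.1, by linarith [hz.2.1], hz.2.2⟩, ?_, ?_, ?_⟩
      · simp only [Complex.add_re, Complex.one_re]; linarith [hz.1]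
      · simp only [Complex.add_re, Complex.one_re]; linarith [hz.2.1]
      · simpa using hz.2.2
    have hh'0 : 0 < h' := by linarith
    have key := eqOn_of_real (isOpen_rct (1 - x0) (x0 + 1) h') (convex_rct _ _ _)
      (f := fun z => g (z + 1)) (g := g)
      (hgd.comp (differentiableOn_id.add_const 1) fun z hz => (hV z hz).2)
      (hgd.mono fun z hz => (hV z hz).1) (x0 := x0)
      ⟨by simp, by simp, by simpa using hh'0⟩ (fun x hx => by
        have e : ((x : ℂ) + 1) = ((x + 1 : ℝ) : ℂ) := by push_cast; ring
        have h1 := (hV x hx).2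
        rw [e] at h1
        simp only [e]
        rw [hgreal _ h1, hgreal _ (hV x hx).1, hGT]
        push_cast; ring)
    intro z hz hz1
    refine key ⟨hz.1, ?_, hz.2.2⟩
    have := hz1.2.1
    simp only [Complex.add_re, Complex.one_re] at this
    linarith
  obtain ⟨g1, d1, p1, v1, w1⟩ := exists_periodic_extension hgd hper
  obtain ⟨c, hc⟩ := periodic_decay d1 p1 (fun z hz => by
    obtain ⟨w, hw, -, e⟩ := w1 z hz
    rw [e]; exact hgE w hw)
  have hh'1 : 0 < h' - 1 := by linarith
  have hg1real : ∀ x : ℝ, g1 x = G x - x := by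
    intro x
    have hpn : ∀ (z : ℂ) (n : ℕ), g1 (z + n) = g1 z := by
      intro z n
      induction n with
      | zero => simp
      | succ n ih => push_cast; rw [← add_assoc, p1, ih]
    have hpG : ∀ (y : ℝ) (n : ℕ), G (y + n) = G y + n := by
      intro y n
      induction n with
      | zero => simp
      | succ n ih => push_cast; rw [← add_assoc, hGT, ih]; ring
    have hfr : ∀ y : ℝ, x0 ≤ y → y < x0 + 1 → g1 y = G y - y := by
      intro y y1 y2
      have hy : (y : ℂ) ∈ D := ⟨by simp; linarith, by simp; linarith, by simp; linarith⟩
      rw [v1 _ hy, hgreal _ hy]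
    have f1 := Int.floor_le (x - x0)
    have f2 := Int.lt_floor_add_one (x - x0)
    obtain ⟨n, hn | hn⟩ := Int.eq_nat_or_neg ⌊x - x0⌋
    · rw [hn] at f1 f2
      push_cast at f1 f2
      have h1 := hfr (x - n) (by linarith) (by linarith)
      have h2 := hpn ((x - n : ℝ) : ℂ) n
      have h3 := hpG (x - n) n
      rw [sub_add_cancel] at h3
      push_cast at h2 h1
      rw [sub_add_cancel, h1] at h2
      rw [h2, h3]; push_cast; ring
    · rw [hn] at f1 f2
      push_cast at f1 f2
      have h1 := hfr (x + n) (by linarith) (by linarith)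
      rw [hpG] at h1
      push_cast at h1
      rw [hpn] at h1
      rw [h1]; ring
  set K := 100 * (E + 2 * b) with hK
  have hK0 : 0 ≤ K := by positivity
  set η := K * Real.exp (-(2 * Real.pi * h')) with hη
  have hc1 : ∀ x : ℝ, ‖((G x - x : ℝ) : ℂ) - c‖ ≤ η := by
    intro x
    have := hc x (by simpa [strip] using hh'1)
    rw [hg1real] at this
    simpa using this
  have hcre : |c.re - ρ| ≤ η := hrot.abs_sub_le fun x => by
    have := (Complex.abs_re_le_norm _).trans (hc1 x)
    simpa using this
  have hcim : |c.im| ≤ η := by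
    have := (Complex.abs_im_le_norm _).trans (hc1 0)
    simpa using this
  have hcρ : ‖c - ρ‖ ≤ 2 * η := by
    have := Complex.norm_le_abs_re_add_abs_im (c - ρ)
    simp only [Complex.sub_re, Complex.ofReal_re, Complex.sub_im, Complex.ofReal_im,
      sub_zero] at this
    linarith
  have hstrip : strip (h - 1 - 60 * E - 120 * b) ⊆ strip (h' - 1) := fun z hz =>
    lt_of_lt_of_le (show |z.im| < _ from hz) (by linarith)
  have hstrip' : strip (h' - 1) ⊆ strip h' := fun z hz =>
    lt_of_lt_of_le (show |z.im| < _ from hz) (by linarith)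
  refine ⟨fun z => z + g1 z, ?_, ?_, ?_, ?_⟩
  · exact differentiableOn_id.add (d1.mono (hstrip.trans hstrip'))
  · intro x
    show (x:ℂ) + g1 x = _
    rw [hg1real]; ring
  · intro z
    show z + 1 + g1 (z+1) = z + g1 z + 1
    rw [p1]; ring
  · intro z hz
    have h1 := hc z (hstrip hz)
    have e : z + g1 z - z - ρ = (g1 z - c) + (c - ρ) := by ring
    rw [e]
    refine (norm_add_le _ _).trans ?_
    have h2 : η ≤ K * Real.exp (-(2 * Real.pi * (h' - |z.im|))) := by
      rw [hη]
      gcongr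
      linarith [abs_nonneg z.im]
    set X := Real.exp (-(2 * Real.pi * (h' - |z.im|))) with hX
    have hX0 : 0 < X := Real.exp_pos _
    have e2 : Real.exp (-(2 * Real.pi * (h - 1 - 60 * E - 120 * b - |z.im|))) =
        X * Real.exp (2 * Real.pi * (h' - (h - 1 - 60 * E - 120 * b))) := by
      rw [hX, ← Real.exp_add]; congr 1; ring
    rw [e2]
    have h3 : 3 * K ≤ Real.exp (2 * Real.pi * (h' - (h - 1 - 60 * E - 120 * b))) := by
      have h4 := Real.add_one_le_exp (2 * Real.pi * (h' - (h - 1 - 60 * E - 120 * b)))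
      have h5 : 3 * K ≤ 2 * Real.pi * (h' - (h - 1 - 60 * E - 120 * b)) := by
        have : 2 * 3 * (50 * E + 100 * b + 1) ≤ 2 * Real.pi * (h' - (h - 1 - 60 * E - 120 * b)) := by
          gcongr
          · exact Real.pi_gt_three.le
          · linarith
        linarith
      linarith
    calc _ ≤ K * X + 2 * (K * X) := by linarith
      _ = X * (3 * K) := by ring
      _ ≤ _ := by gcongr

lemma norm_deriv_le_of_closedBall {f : ℂ → ℂ} {U : Set ℂ} {z : ℂ} {r C : ℝ} (hr : 0 < r)
    (hf : DifferentiableOn ℂ f U) (hz : Metric.closedBall z r ⊆ U)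
    (hC : ∀ w ∈ Metric.closedBall z r, ‖f w‖ ≤ C) : ‖deriv f z‖ ≤ C / r := by
  apply Complex.norm_deriv_le_of_forall_mem_sphere_norm_le hr
  · apply DifferentiableOn.diffContOnCl
    rw [closure_ball _ hr.ne']
    exact hf.mono hz
  · intro w hw
    exact hC w (Metric.sphere_subset_closedBall hw)

/-- the dilation of the real line by a positive factor -/
noncomputable def dil {a : ℝ} (ha : 0 < a) : ℝ ≃o ℝ := OrderIso.mulLeft₀ a ha

@[simp] lemma dil_apply {a : ℝ} (ha : 0 < a) (x : ℝ) : dil ha x = a * x := rfl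

lemma dil_inv_apply {a : ℝ} (ha : 0 < a) (x : ℝ) : (dil ha)⁻¹ x = x / a := by
  apply (dil ha).injective
  rw [apply_inv_self', dil_apply]
  field_simp

lemma holDiff_dil {a : ℝ} (ha : 0 < a) : HolDiff (dil ha) := fun x =>
  ⟨fun z => a * z, a, ha, analyticAt_const.mul analyticAt_id, by
    simpa using (hasDerivAt_id (x : ℂ)).const_mul (a : ℂ), by simp⟩

lemma strip_real {Δ : ℝ} (hΔ : 0 < Δ) (x : ℝ) : (x : ℂ) ∈ strip Δ := by simpa [strip] using hΔ

lemma abs_im_le_of_mem_closedBall {z w : ℂ} {r : ℝ} (hw : w ∈ Metric.closedBall z r) :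
    |w.im| ≤ |z.im| + r := by
  rw [Metric.mem_closedBall, dist_eq_norm] at hw
  have h2 := (Complex.abs_im_le_norm _).trans hw
  rw [Complex.sub_im] at h2
  have := abs_add_le (w.im - z.im) z.im
  rw [sub_add_cancel] at this
  linarith

lemma norm_deriv_displacement_le {Δ ρ r : ℝ} {g : ℂ → ℂ} (hr : 0 < r)
    (hg : DifferentiableOn ℂ g (strip Δ))
    (hE : ∀ z ∈ strip Δ, ‖g z - z - ρ‖ ≤ Real.exp (-(2 * Real.pi * (Δ - |z.im|))))
    {z : ℂ} (hz : z ∈ strip (Δ - r)) :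
    ‖deriv (fun z => g z - z - ρ) z‖ ≤ Real.exp (-(2 * Real.pi * (Δ - r - |z.im|))) / r := by
  have hsub := closedBall_subset_strip hz
  refine norm_deriv_le_of_closedBall hr ((hg.sub differentiableOn_id).sub_const (ρ : ℂ)) hsub ?_
  intro w hw
  refine (hE w (hsub hw)).trans (Real.exp_le_exp.2 ?_)
  nlinarith [Real.pi_pos, abs_im_le_of_mem_closedBall hw]

lemma norm_deriv_sub_one_le {Δ ρ r : ℝ} {g : ℂ → ℂ} (hr : 0 < r)
    (hg : DifferentiableOn ℂ g (strip Δ))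
    (hE : ∀ z ∈ strip Δ, ‖g z - z - ρ‖ ≤ Real.exp (-(2 * Real.pi * (Δ - |z.im|))))
    {z : ℂ} (hz : z ∈ strip (Δ - r)) :
    ‖deriv g z - 1‖ ≤ Real.exp (-(2 * Real.pi * (Δ - r - |z.im|))) / r := by
  have h := norm_deriv_displacement_le hr hg hE hz
  have hz' : z ∈ strip Δ := lt_of_lt_of_le (show |z.im| < _ from hz) (by linarith)
  have h1 := (((hg.differentiableAt ((isOpen_strip Δ).mem_nhds hz')).hasDerivAt.sub
    (hasDerivAt_id z)).sub_const (ρ : ℂ)).deriv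
  have h2 : deriv (fun z => g z - z - ρ) z = deriv g z - 1 := h1
  rwa [h2] at h

lemma Good.holDiff {ρ Δ : ℝ} {G : ℝ ≃o ℝ} (h : Good ρ Δ G) (hΔ : 2 ≤ Δ) : HolDiff G := by
  obtain ⟨-, g, hg, hgr, -, hE⟩ := h
  intro x
  have hd := norm_deriv_sub_one_le one_pos hg hE (strip_real (by linarith : 0 < Δ - 1) x)
  have hx : DifferentiableAt ℂ g x :=
    hg.differentiableAt ((isOpen_strip Δ).mem_nhds (strip_real (by linarith) x))
  have hd2 : ‖deriv g x - 1‖ ≤ 1 / 2 := by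
    refine hd.trans ?_
    rw [div_one, Real.exp_neg]
    have h1 := Real.add_one_le_exp (2 * Real.pi * (Δ - 1 - |(x : ℂ).im|))
    have h2 : 6 ≤ 2 * Real.pi * (Δ - 1 - |(x : ℂ).im|) := by
      rw [Complex.ofReal_im, abs_zero]
      nlinarith [Real.pi_gt_three]
    rw [one_div]
    exact inv_anti₀ (by norm_num) (by linarith)
  obtain ⟨c, hc, hd3⟩ := exists_pos_hasDerivAt hx hd2 (Eventually.of_forall hgr)
  exact ⟨g, c, hc, hg.analyticAt ((isOpen_strip Δ).mem_nhds (strip_real (by linarith) x)),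
    hd3, Eventually.of_forall hgr⟩

lemma Good.shift {ρ Δ : ℝ} {G : ℝ ≃o ℝ} (h : Good ρ Δ G) (k : ℤ) :
    Good (ρ + k) Δ (tr 1 ^ k * G) := by
  obtain ⟨hR, g, hg, hgr, hgp, hE⟩ := h
  refine ⟨hR.shift k, fun z => g z + k, hg.add_const _, fun x => ?_, fun z => ?_, fun z hz => ?_⟩
  · show g x + k = _
    rw [mul_apply', tr_one_zpow_apply, hgr]; push_cast; ring
  · show g (z + 1) + k = g z + k + 1
    rw [hgp]; ring
  · have e : g z + k - z - ((ρ + k : ℝ) : ℂ) = g z - z - ρ := by push_cast; ring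
    rw [e]; exact hE z hz

lemma tr_conj_tr (s t : ℝ) : tr t * tr s * (tr t)⁻¹ = tr s := by
  rw [← tr_neg, ← tr_add, ← tr_add]; congr 1; ring

lemma Good.conj_tr {ρ Δ : ℝ} {G : ℝ ≃o ℝ} (h : Good ρ Δ G) (t : ℝ) :
    Good ρ Δ (tr t * G * (tr t)⁻¹) := by
  obtain ⟨hR, g, hg, hgr, hgp, hE⟩ := h
  have him : ∀ z : ℂ, (z - t).im = z.im := fun z => by simp
  refine ⟨?_, fun z => g (z - t) + t, ?_, fun x => ?_, fun z => ?_, fun z hz => ?_⟩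
  · have := hR.conj (tr t)
    rwa [tr_conj_tr] at this
  · refine (hg.comp (differentiableOn_id.sub_const _) fun z hz => ?_).add_const _
    show |(z - t).im| < _
    rw [him]; exact hz
  · rw [← tr_neg, mul_apply', mul_apply', tr_apply, tr_apply]
    push_cast
    rw [← hgr]; push_cast; ring_nf
  · show g (z + 1 - t) + t = g (z - t) + t + 1
    rw [show z + 1 - t = z - t + 1 by ring, hgp]; ring
  · have e : g (z - t) + t - z - ρ = g (z - t) - (z - t) - ρ := by ring
    have := hE (z - t) (by show |(z - t).im| < _; rw [him]; exact hz)
    rw [him] at this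
    rw [e]; exact this

lemma integral_le_of_le_exp {q : ℝ → ℝ} {a k h : ℝ} (hh : 0 ≤ h) (hk : 0 < k) (ha : 0 ≤ a)
    (hq : ContinuousOn q (Set.Icc (-h) h))
    (hle : ∀ y ∈ Set.Icc (-h) h, q y ≤ a * Real.exp (k * |y|)) :
    ∫ y in (-h)..h, q y ≤ 2 * a * Real.exp (k * h) / k := by
  have hd : ∀ y : ℝ, HasDerivAt (fun y => a * ((Real.exp (k * y) - Real.exp (-(k * y))) / k))
      (a * (Real.exp (k * y) + Real.exp (-(k * y)))) y := by
    intro y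
    have h1 : HasDerivAt (fun y : ℝ => k * y) k y := by
      simpa using (hasDerivAt_id y).const_mul k
    refine (((h1.exp.sub h1.neg.exp).div_const k).const_mul a).congr_deriv ?_
    show a * ((Real.exp (k * y) * k - Real.exp (-(k * y)) * -k) / k) = _
    rw [show Real.exp (k * y) * k - Real.exp (-(k * y)) * -k =
      (Real.exp (k * y) + Real.exp (-(k * y))) * k by ring, mul_div_cancel_right₀ _ hk.ne']
  have hc : Continuous fun y : ℝ => a * (Real.exp (k * y) + Real.exp (-(k * y))) := by fun_prop
  have h1 : ∫ y in (-h)..h, q y ≤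
      ∫ y in (-h)..h, a * (Real.exp (k * y) + Real.exp (-(k * y))) := by
    refine intervalIntegral.integral_mono_on (by linarith) ?_ (hc.intervalIntegrable _ _) ?_
    · apply ContinuousOn.intervalIntegrable
      rwa [Set.uIcc_of_le (by linarith)]
    · intro y hy
      refine (hle y hy).trans ?_
      gcongr
      rcases abs_cases y with ⟨e, _⟩ | ⟨e, _⟩ <;> rw [e]
      · linarith [Real.exp_pos (-(k * y))]
      · rw [mul_neg]; linarith [Real.exp_pos (k * y)]
  rw [intervalIntegral.integral_eq_sub_of_hasDerivAt (fun y _ => hd y)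
    (hc.intervalIntegrable _ _)] at h1
  refine h1.trans ?_
  have e : a * ((Real.exp (k * h) - Real.exp (-(k * h))) / k) -
      a * ((Real.exp (k * -h) - Real.exp (-(k * -h))) / k) =
      2 * a * (Real.exp (k * h) - Real.exp (-(k * h))) / k := by
    rw [mul_neg, neg_neg]; ring
  rw [e]
  gcongr
  linarith [Real.exp_pos (-(k * h))]

/-- passing to the coordinate in which `F` is the unit translation, with a loss of height
proportional to `log α⁻¹` -/
theorem exists_linear_step : ∃ C c : ℝ, 0 < C ∧ 0 < c ∧ ∀ (α Δ W0 X : ℝ) (F : ℝ ≃o ℝ),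
    0 < α → α < 1 → Good α Δ F → C ≤ W0 → Real.exp (-X) * W0 ≤ c →
    (Real.log α⁻¹ + X) / (2 * Real.pi) + C < Δ →
    ∃ L : ℝ ≃o ℝ, HolDiff L ∧ L * F * L⁻¹ = tr 1 ∧
      Good (Int.fract α⁻¹) ((Δ - (Real.log α⁻¹ + X) / (2 * Real.pi) - C) / α)
        (tr 1 ^ (-⌊α⁻¹⌋) * (L * tr 1 * L⁻¹)) ∧
      ∃ l : ℂ → ℂ, DifferentiableOn ℂ l
          (rct (W0 / 2) (W0 / 2) (Δ - (Real.log α⁻¹ + X) / (2 * Real.pi) - C)) ∧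
        (∀ x : ℝ, |x| < W0 / 2 → l x = L x) ∧
        ∀ z ∈ rct (W0 / 2) (W0 / 2) (Δ - (Real.log α⁻¹ + X) / (2 * Real.pi) - C),
          ‖l z - z / α‖ ≤ C * (Real.exp (-X) * W0) / α := by
  obtain ⟨ε0, hε0, C1, hC1, key⟩ := exists_long_coordinate
  have hc0 : 0 < min (min ε0 (1 / 100)) (1 / (2 * C1 + 2)) := by positivity
  refine ⟨2 * C1 + 200, min (min ε0 (1 / 100)) (1 / (2 * C1 + 2)), by positivity, hc0, ?_⟩
  intro α Δ W0 X F hα hα1 hF hW0 hXW hΔ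
  obtain ⟨s, hs⟩ : ∃ s, s = (Real.log α⁻¹ + X) / (2 * Real.pi) := ⟨_, rfl⟩
  rw [← hs] at hΔ ⊢
  have hpi := Real.pi_pos
  have hlog : Real.exp (-(2 * Real.pi * s)) = α * Real.exp (-X) := by
    rw [hs, mul_div_cancel₀ _ (by positivity), neg_add, Real.exp_add, ← Real.log_inv, inv_inv,
      Real.exp_log hα]
  obtain ⟨e, he⟩ : ∃ e, e = Real.exp (-X) := ⟨_, rfl⟩
  rw [← he] at hXW hlog ⊢
  have he0 : 0 < e := he ▸ Real.exp_pos _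
  have hW200 : 200 ≤ W0 := by linarith
  have hc1 : e * W0 ≤ ε0 := hXW.trans ((min_le_left _ _).trans (min_le_left _ _))
  have hc2 : e * W0 ≤ 1 / 100 := hXW.trans ((min_le_left _ _).trans (min_le_right _ _))
  have hc3 : (2 * C1 + 2) * (e * W0) ≤ 1 := by
    have := hXW.trans (min_le_right _ _)
    rwa [le_div_iff₀ (by positivity), mul_comm] at this
  have heW : e ≤ e * W0 := by nlinarith
  have hF1 := hF.conj_tr (-(W0 / 2))
  have hF1h := hF1.holDiff (by
    have : 0 < s ∨ s ≤ 0 := lt_or_ge _ _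
    have h1 : 0 ≤ Real.log α⁻¹ := Real.log_nonneg ((one_le_inv₀ hα).2 hα1.le)
    have h2 : 0 < X := by
      by_contra! hcon
      have : 1 ≤ Real.exp (-X) := by rw [Real.one_le_exp_iff]; linarith
      nlinarith
    have : 0 < s := by rw [hs]; positivity
    linarith)
  have hs0 : 0 < s := by
    have h1 : 0 ≤ Real.log α⁻¹ := Real.log_nonneg ((one_le_inv₀ hα).2 hα1.le)
    have h2 : 0 < X := by
      by_contra! hcon
      have : 1 ≤ Real.exp (-X) := by rw [Real.one_le_exp_iff]; linarith
      nlinarith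
    rw [hs]; positivity
  obtain ⟨F1, hF1d⟩ : ∃ F1, F1 = tr (-(W0 / 2)) * F * (tr (-(W0 / 2)))⁻¹ := ⟨_, rfl⟩
  rw [← hF1d] at hF1 hF1h
  obtain ⟨hR, g, hg, hgr, hgp, hE⟩ := hF1
  -- the rescaled displacement
  obtain ⟨ψ, hψ⟩ : ∃ ψ : ℂ → ℂ, ψ = fun u => (g (α * u) - α * u - α) / α := ⟨_, rfl⟩
  obtain ⟨H, hH⟩ : ∃ H, H = (Δ - s - 1) / α := ⟨_, rfl⟩
  obtain ⟨W, hW⟩ : ∃ W, W = W0 / α := ⟨_, rfl⟩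
  have hα1' : 1 ≤ α⁻¹ := (one_le_inv₀ hα).2 hα1.le
  have him : ∀ u : ℂ, |((α : ℂ) * u).im| = α * |u.im| := fun u => by
    rw [Complex.im_ofReal_mul, abs_mul, abs_of_pos hα]
  have hmem : ∀ {h' h'' : ℝ} {u : ℂ}, |u.im| < h' → α * h' ≤ h'' → (α : ℂ) * u ∈ strip h'' := by
    intro h' h'' u hu hh
    show |((α : ℂ) * u).im| < h''
    rw [him]
    nlinarith
  have hαH : α * H = Δ - s - 1 := by rw [hH]; field_simp
  have hαW : α * W = W0 := by rw [hW]; field_simp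
  have hWpos : 200 ≤ W := by rw [hW, le_div_iff₀ hα]; nlinarith
  have hHpos : 190 / α ≤ H := by rw [hH]; gcongr; linarith
  have hαinv : 1 ≤ 1 / α := by rwa [one_div]
  have hαc : (α : ℂ) ≠ 0 := by exact_mod_cast hα.ne'
  have hψd : DifferentiableOn ℂ ψ (rct (W + 2) 2 H) := by
    rw [hψ]
    refine DifferentiableOn.div_const (DifferentiableOn.sub_const (DifferentiableOn.sub
      (hg.comp (differentiableOn_id.const_mul _) fun u hu => ?_)
      (differentiableOn_id.const_mul _)) _) _
    exact hmem hu.2.2 (by linarith)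
  have hψle : ∀ u : ℂ, |u.im| < H + 1 / α → ‖ψ u‖ ≤ e * Real.exp (-(2 * Real.pi * (α * (H + 1 / α - |u.im|)))) := by
    intro u hu
    have h1 := hE (α * u) (hmem hu (by
      rw [mul_add, hαH, mul_one_div_cancel hα.ne']; linarith))
    rw [hψ]
    simp only
    rw [norm_div, Complex.norm_real, Real.norm_eq_abs, abs_of_pos hα, div_le_iff₀ hα]
    refine h1.trans (le_of_eq ?_)
    rw [him, mul_comm e, mul_assoc (Real.exp _) e, mul_comm e α, ← hlog, ← Real.exp_add]
    congr 1
    have : α * (H + 1 / α - |u.im|) = Δ - s - α * |u.im| := by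
      rw [mul_sub, mul_add, hαH, mul_one_div_cancel hα.ne']; ring
    rw [this]; ring
  have hψe : ∀ u : ℂ, |u.im| < H + 1 / α → ‖ψ u‖ ≤ e := by
    intro u hu
    refine (hψle u hu).trans ?_
    have : Real.exp (-(2 * Real.pi * (α * (H + 1 / α - |u.im|)))) ≤ 1 := by
      rw [Real.exp_le_one_iff, neg_nonpos]
      have : 0 ≤ H + 1 / α - |u.im| := by linarith
      positivity
    nlinarith
  have hψd' : DifferentiableOn ℂ ψ (strip (H + 1 / α)) := by
    rw [hψ]
    refine DifferentiableOn.div_const (DifferentiableOn.sub_const (DifferentiableOn.sub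
      (hg.comp (differentiableOn_id.const_mul _) fun u hu => ?_)
      (differentiableOn_id.const_mul _)) _) _
    exact hmem hu (by rw [mul_add, hαH, mul_one_div_cancel hα.ne']; linarith)
  have hconj : ∀ z ∈ strip Δ, g (conj z) = conj (g z) :=
    conj_symm_of_real (isOpen_strip Δ) (convex_strip Δ) (fun z hz => by simpa [strip] using hz)
      hg (strip_real (by linarith) 0) (fun x _ => by rw [hgr, Complex.ofReal_im])
  have h_int : ∀ t : ℝ, ∫ y in (-(H - 1))..(H - 1), ‖ψ (t + y * Complex.I)‖ ≤ e / α := by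
    intro t
    have himt : ∀ y : ℝ, ((t : ℂ) + y * Complex.I).im = y := fun y => by simp
    have hH1 : 0 ≤ H - 1 := by linarith [show (190:ℝ) ≤ 190 / α by rw [le_div_iff₀ hα]; linarith]
    have h1 := integral_le_of_le_exp (q := fun y : ℝ => ‖ψ (t + y * Complex.I)‖)
      (a := e * Real.exp (-(2 * Real.pi * (α * (H + 1 / α))))) (k := 2 * Real.pi * α) hH1
      (by positivity) (by positivity) (by
        refine (hψd'.continuousOn.comp (by fun_prop) fun y hy => ?_).norm
        show |((t : ℂ) + y * Complex.I).im| < _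
        rw [himt]
        have := abs_le.2 ⟨hy.1, hy.2⟩
        linarith) (by
        intro y hy
        have hy1 := abs_le.2 ⟨hy.1, hy.2⟩
        have h2 := hψle (t + y * Complex.I) (by rw [himt]; linarith)
        rw [himt] at h2
        refine h2.trans (le_of_eq ?_)
        rw [mul_assoc e, ← Real.exp_add]
        congr 2; ring)
    refine h1.trans ?_
    have h3 : Real.exp (-(2 * Real.pi * (α * (H + 1 / α)))) * Real.exp (2 * Real.pi * α * (H - 1)) ≤ 1 := by
      rw [← Real.exp_add, Real.exp_le_one_iff]
      have : -(2 * Real.pi * (α * (H + 1 / α))) + 2 * Real.pi * α * (H - 1) =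
        - (2 * Real.pi * α * (1 / α + 1)) := by ring
      rw [this, neg_nonpos]
      positivity
    rw [div_le_div_iff₀ (by positivity) hα]
    have h4 : 2 ≤ 2 * Real.pi := by linarith [Real.pi_gt_three]
    calc _ = 2 * (e * α) * (Real.exp (-(2 * Real.pi * (α * (H + 1 / α)))) *
          Real.exp (2 * Real.pi * α * (H - 1))) := by ring
      _ ≤ 2 * (e * α) * 1 := by gcongr
      _ ≤ 2 * Real.pi * (e * α) := by rw [mul_one]; gcongr
      _ = _ := by ring
  have heε : e ≤ ε0 := by linarith
  have he100 : e ≤ 1 / 100 := by linarith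
  obtain ⟨Lc, hLc⟩ := key ψ e (e * α) H W (e / α) hψd
    (fun z hz => hψe z (by linarith [hz.2.2])) heε
    (by
      intro z hz
      have hz2 := hz.2.2
      have h1 := norm_deriv_le_of_closedBall (r := 1 / α) (C := e) (z := z) (by positivity) hψd'
        (closedBall_subset_strip (by show |z.im| < _; linarith)) (fun w hw => hψe w (by
          have := closedBall_subset_strip (h := H + 1 / α) (b := 1 / α) (w := z)
            (by show |z.im| < _; linarith) hw
          exact this))
      rwa [div_div_eq_mul_div, div_one] at h1)
    (by positivity) (by rw [mul_assoc, hαW]; exact hc2)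
    (by
      intro z hz
      have h1 := hconj (α * z) (hmem hz.2.2 (by linarith))
      rw [hψ]
      simp only
      rw [map_mul, Complex.conj_ofReal] at h1
      rw [h1]; simp)
    (by linarith)
    (by linarith [show (3:ℝ) ≤ 190 / α by rw [le_div_iff₀ hα]; linarith])
    (by simpa using h_int 0)
    (by have := h_int (-(1/2)); push_cast at this; exact this)
  obtain ⟨b, hb⟩ : ∃ b, b = C1 * (e + e / α) + 2 * W * e := ⟨_, rfl⟩
  obtain ⟨h, hh⟩ : ∃ h, h = H - 2 - 2 * W * e := ⟨_, rfl⟩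
  rw [← hb, ← hh] at hLc
  have hWe : 2 * W * e = 2 * (e * W0) / α := by rw [hW]; ring
  have hb0 : 0 ≤ b := by rw [hb]; positivity
  have hb1 : b ≤ (2 * C1 + 2) * (e * W0) / α := by
    rw [hb, hWe]
    have h1 : e + e / α ≤ 2 * (e * W0) / α := by
      have : e ≤ e / α := by rw [le_div_iff₀ hα]; nlinarith
      have h2 : e / α ≤ (e * W0) / α := by gcongr
      have h3 : 2 * (e * W0) / α = (e * W0) / α + (e * W0) / α := by ring
      linarith
    calc _ ≤ C1 * (2 * (e * W0) / α) + 2 * (e * W0) / α := by gcongr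
      _ = _ := by ring
  have hb2 : b ≤ 1 / α := hb1.trans (by gcongr)
  have hfin : (Δ - s - (2 * C1 + 200)) / α ≤ h - 1 - 60 * (1 / α) - 120 * b := by
    have h1 : 2 * (e * W0) / α ≤ 1 / α := by gcongr; linarith
    have h2 : H = (Δ - s - 200) / α + 199 * (1 / α) := by rw [hH]; ring
    have h3 : (Δ - s - (2 * C1 + 200)) / α ≤ (Δ - s - 200) / α := by gcongr; linarith
    rw [hh, hWe]
    linarith
  have hfinpos : 0 < (Δ - s - (2 * C1 + 200)) / α := div_pos (by linarith) hα
  have hhfin : (Δ - s - (2 * C1 + 200)) / α ≤ h := by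
    have : 0 < 1 / α := by positivity
    linarith
  have hαi : 0 < α⁻¹ := by positivity
  have hdi : ∀ x, (dil hαi)⁻¹ x = α * x := fun x => by rw [dil_inv_apply]; field_simp
  have hAval : ∀ x : ℝ, ((dil hαi * F1 * (dil hαi)⁻¹) x : ℂ) = x + 1 + ψ x := by
    intro x
    rw [mul_apply', mul_apply', hdi, dil_apply, hψ]
    push_cast
    rw [← hgr]
    push_cast
    field_simp
    ring
  have hBval : ∀ x : ℝ, (x : ℂ) + 1 / α = ((dil hαi * tr 1 * (dil hαi)⁻¹) x : ℝ) := by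
    intro x
    rw [mul_apply', mul_apply', hdi, dil_apply, tr_apply]
    push_cast
    field_simp
  obtain ⟨Λ, hΛ1, hΛ2, hΛ3, hΛ4⟩ := exists_renormalization (A := dil hαi * F1 * (dil hαi)⁻¹)
    (B := dil hαi * tr 1 * (dil hαi)⁻¹) (ρ := 1 / α) (E := 1 / α)
    (Bh := fun z => z + 1 / α) ((hR.swap hα).conj _)
    (((holDiff_dil hαi).mul hF1h).mul (holDiff_dil hαi).inv) hLc
    (fun x _ _ => hAval x) (fun x _ _ => (hψe x (by
      rw [Complex.ofReal_im, abs_zero]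
      have : 0 < 190 / α := by positivity
      have : 0 < 1 / α := by positivity
      linarith)).trans he100)
    (differentiableOn_id.add_const _) (fun z _ => by
      rw [add_sub_cancel_left, norm_div, norm_one, Complex.norm_real, Real.norm_eq_abs,
        abs_of_pos hα]) (fun x _ _ => hBval x) hb0 (by positivity)
    (by
      have h1 : W = W0 * (1 / α) := by rw [hW]; ring
      have h2 : 200 * (1 / α) ≤ W0 * (1 / α) := by gcongr
      linarith) (by linarith)
  have hΛ5 := (hΛ4.mono hfin).shift (-⌊α⁻¹⌋)
  have hfr : 1 / α + ((-⌊α⁻¹⌋ : ℤ) : ℝ) = Int.fract α⁻¹ := by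
    rw [Int.fract]; push_cast; rw [one_div]; ring
  rw [hfr] at hΛ5
  obtain ⟨t, ht⟩ : ∃ t, t = W0 / 2 := ⟨_, rfl⟩
  rw [← ht] at hF1d ⊢
  have hmemz : Set.MapsTo (fun z : ℂ => (z - t) / α) (rct t t (Δ - s - (2 * C1 + 200)))
      (rct W (9 / 10) h) := by
    intro z hz
    have e1 : ((z - t) / α).re = (z.re - t) / α := by
      rw [Complex.div_ofReal_re, Complex.sub_re, Complex.ofReal_re]
    have e2 : ((z - t) / α).im = z.im / α := by
      rw [Complex.div_ofReal_im, Complex.sub_im, Complex.ofReal_im, sub_zero]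
    refine ⟨?_, ?_, ?_⟩
    · show _ < ((z - t) / α).re
      rw [e1, hW, ← neg_div]; gcongr; linarith [hz.1]
    · show ((z - t) / α).re < _
      rw [e1]
      exact lt_of_lt_of_le (div_neg_of_neg_of_pos (by linarith [hz.2.1]) hα) (by norm_num)
    · show |((z - t) / α).im| < _
      rw [e2, abs_div, abs_of_pos hα]
      refine lt_of_lt_of_le ?_ hhfin
      gcongr
      exact hz.2.2
  refine ⟨tr (t / α) * Λ * dil hαi * tr (-t), ?_, ?_, ?_, fun z => t / α + Lc ((z - t) / α),
    ?_, ?_, ?_⟩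
  · exact (((holDiff_tr _).mul hΛ1).mul (holDiff_dil hαi)).mul (holDiff_tr _)
  · have e1 : tr (t / α) * Λ * dil hαi * tr (-t) * F * (tr (t / α) * Λ * dil hαi * tr (-t))⁻¹ =
        tr (t / α) * (Λ * (dil hαi * (tr (-t) * F * (tr (-t))⁻¹) * (dil hαi)⁻¹) * Λ⁻¹) *
          (tr (t / α))⁻¹ := by group
    rw [e1, ← hF1d, hΛ2, tr_conj_tr]
  · have := hΛ5.conj_tr (t / α)
    have e1 : tr (t / α) * (tr 1 ^ (-⌊α⁻¹⌋) * (Λ * (dil hαi * tr 1 * (dil hαi)⁻¹) * Λ⁻¹)) *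
        (tr (t / α))⁻¹ = tr 1 ^ (-⌊α⁻¹⌋) * (tr (t / α) * Λ * dil hαi * tr (-t) * tr 1 *
          (tr (t / α) * Λ * dil hαi * tr (-t))⁻¹) := by
      have h1 : tr (t / α) * tr 1 ^ (-⌊α⁻¹⌋) = tr 1 ^ (-⌊α⁻¹⌋) * tr (t / α) := by
        rw [tr_zpow, ← tr_add, ← tr_add, add_comm]
      have h2 : tr (-t) * tr 1 * (tr (-t))⁻¹ = tr 1 := tr_conj_tr _ _
      calc _ = (tr (t / α) * tr 1 ^ (-⌊α⁻¹⌋)) * (Λ * (dil hαi * tr 1 * (dil hαi)⁻¹) * Λ⁻¹) *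
            (tr (t / α))⁻¹ := by group
        _ = (tr 1 ^ (-⌊α⁻¹⌋) * tr (t / α)) * (Λ * (dil hαi * (tr (-t) * tr 1 * (tr (-t))⁻¹) *
            (dil hαi)⁻¹) * Λ⁻¹) * (tr (t / α))⁻¹ := by rw [h1, h2]
        _ = _ := by group
    rwa [e1] at this
  · refine (hLc.diff.comp ((differentiableOn_id.sub_const _).div_const _) hmemz).const_add _
  · intro x hx
    have hx' := abs_lt.1 hx
    have h1 := hΛ3 ((x - t) / α) (by rw [hW, ← neg_div]; gcongr; linarith)
      (lt_of_lt_of_le (div_neg_of_neg_of_pos (by linarith) hα) (by norm_num))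
    simp only [mul_apply', tr_apply, dil_apply]
    rw [show α⁻¹ * (x + -t) = (x - t) / α by ring]
    push_cast at h1 ⊢
    rw [h1]; ring
  · intro z hz
    have h1 := hLc.near _ (hmemz hz)
    have e1 : (t : ℂ) / α + Lc ((z - t) / α) - z / α = Lc ((z - t) / α) - (z - t) / α := by ring
    rw [e1]
    refine h1.trans (hb1.trans ?_)
    gcongr
    norm_num

/-- an infinite orbit of the Gauss map -/
structure GaussSeq (a : ℕ → ℝ) : Prop where
  pos : ∀ n, 0 < a n
  lt_one : ∀ n, a n < 1
  succ : ∀ n, a (n + 1) = Int.fract (a n)⁻¹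

/-- the products of the first terms of the sequence `a` -/
noncomputable def prodSeq (a : ℕ → ℝ) (n : ℕ) : ℝ := ∏ i ∈ Finset.range n, a i

lemma prodSeq_succ (a : ℕ → ℝ) (n : ℕ) : prodSeq a (n + 1) = prodSeq a n * a n :=
  Finset.prod_range_succ _ _

lemma prodSeq_zero (a : ℕ → ℝ) : prodSeq a 0 = 1 := Finset.prod_range_zero _

namespace GaussSeq

variable {a : ℕ → ℝ}

lemma drop (ha : GaussSeq a) (m : ℕ) : GaussSeq fun n => a (m + n) :=
  ⟨fun n => ha.pos _, fun n => ha.lt_one _, fun n => ha.succ _⟩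

lemma prodSeq_pos (ha : GaussSeq a) (n : ℕ) : 0 < prodSeq a n := Finset.prod_pos fun i _ => ha.pos i

lemma prodSeq_le_one (ha : GaussSeq a) (n : ℕ) : prodSeq a n ≤ 1 :=
  Finset.prod_le_one (fun i _ => (ha.pos i).le) fun i _ => (ha.lt_one i).le

lemma mul_succ_le (ha : GaussSeq a) (n : ℕ) : a n * a (n + 1) ≤ 1 / 2 := by
  have h0 := ha.pos n
  have h1 : a (n + 1) ≤ (a n)⁻¹ - 1 := by
    rw [ha.succ, Int.fract]
    have : (1 : ℤ) ≤ ⌊(a n)⁻¹⌋ := by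
      rw [Int.le_floor]; push_cast
      exact ((one_lt_inv₀ h0).2 (ha.lt_one n)).le
    have : (1 : ℝ) ≤ ⌊(a n)⁻¹⌋ := by exact_mod_cast this
    linarith
  have h2 : a n * a (n + 1) ≤ 1 - a n := by
    have := mul_le_mul_of_nonneg_left h1 h0.le
    rwa [mul_sub, mul_inv_cancel₀ h0.ne', mul_one] at this
  nlinarith [ha.lt_one (n + 1)]

lemma prodSeq_add_two (ha : GaussSeq a) (n : ℕ) : prodSeq a (n + 2) ≤ prodSeq a n / 2 := by
  rw [prodSeq_succ, prodSeq_succ, mul_assoc]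
  nlinarith [ha.mul_succ_le n, ha.prodSeq_pos n]

lemma sum_sqrt_le (ha : GaussSeq a) (n : ℕ) : ∑ i ∈ Finset.range n, √(prodSeq a i) ≤ 8 := by
  have h2 : ∀ n, √(prodSeq a (n + 2)) ≤ 3 / 4 * √(prodSeq a n) := by
    intro n
    rw [Real.sqrt_le_left (by positivity), mul_pow, Real.sq_sqrt (ha.prodSeq_pos n).le]
    linarith [ha.prodSeq_add_two n, ha.prodSeq_pos n]
  have h : ∀ n, ∑ i ∈ Finset.range n, √(prodSeq a i) + 4 * (√(prodSeq a n) +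
      √(prodSeq a (n + 1))) ≤ 8 := by
    intro n
    induction n with
    | zero =>
      have h0 : √(prodSeq a 0) = 1 := by rw [prodSeq_zero, Real.sqrt_one]
      have h1 : √(prodSeq a 1) ≤ 1 := by
        refine Real.sqrt_le_one.2 ?_
        exact ha.prodSeq_le_one 1
      simp only [Finset.range_zero, Finset.sum_empty, zero_add]
      linarith
    | succ n ih =>
      rw [Finset.sum_range_succ]
      linarith [h2 n]
  linarith [h n, Real.sqrt_nonneg (prodSeq a n), Real.sqrt_nonneg (prodSeq a (n + 1))]

lemma prodSeq_le_sqrt (ha : GaussSeq a) (n : ℕ) : prodSeq a n ≤ √(prodSeq a n) := by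
  apply Real.le_sqrt_of_sq_le
  nlinarith [ha.prodSeq_le_one n, ha.prodSeq_pos n]

lemma sum_prodSeq_le (ha : GaussSeq a) (n : ℕ) : ∑ i ∈ Finset.range n, prodSeq a i ≤ 8 :=
  (Finset.sum_le_sum fun i _ => ha.prodSeq_le_sqrt i).trans (ha.sum_sqrt_le n)

lemma summable_prodSeq (ha : GaussSeq a) : Summable (prodSeq a) :=
  summable_of_sum_range_le (fun n => (ha.prodSeq_pos n).le) ha.sum_prodSeq_le

lemma sum_mul_log_le (ha : GaussSeq a) (n : ℕ) :
    ∑ i ∈ Finset.range n, prodSeq a i * Real.log (prodSeq a i)⁻¹ ≤ 16 := by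
  have h : ∀ i, prodSeq a i * Real.log (prodSeq a i)⁻¹ ≤ 2 * √(prodSeq a i) := by
    intro i
    have h0 := ha.prodSeq_pos i
    have hs := Real.sqrt_pos.2 h0
    have h1 := Real.log_le_sub_one_of_pos (inv_pos.2 hs)
    have h2 : Real.log (prodSeq a i)⁻¹ = 2 * Real.log (√(prodSeq a i))⁻¹ := by
      rw [Real.log_inv, Real.log_inv, Real.log_sqrt h0.le]; ring
    rw [h2]
    have h3 : Real.log (√(prodSeq a i))⁻¹ ≤ (√(prodSeq a i))⁻¹ := by linarith
    calc prodSeq a i * (2 * Real.log (√(prodSeq a i))⁻¹)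
        ≤ prodSeq a i * (2 * (√(prodSeq a i))⁻¹) := by gcongr
      _ = 2 * (prodSeq a i / √(prodSeq a i)) := by ring
      _ = _ := by rw [Real.div_sqrt]
  calc _ ≤ ∑ i ∈ Finset.range n, 2 * √(prodSeq a i) := Finset.sum_le_sum fun i _ => h i
    _ = 2 * ∑ i ∈ Finset.range n, √(prodSeq a i) := by rw [Finset.mul_sum]
    _ ≤ 16 := by linarith [ha.sum_sqrt_le n]

end GaussSeq

/-- all partial sums of the Brjuno series of the sequence `a` are at most `B` -/
def BrjunoLE (a : ℕ → ℝ) (B : ℝ) : Prop :=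
  ∀ n, ∑ i ∈ Finset.range n, prodSeq a i * Real.log (a i)⁻¹ ≤ B

/-- the sequence of renormalizations of `F`, with holomorphic extensions of the coordinates to
large domains, when the height is large compared with the Brjuno series -/
lemma exists_tower : ∃ C5 : ℝ, 0 < C5 ∧ ∀ (a : ℕ → ℝ) (B Δ : ℝ) (F : ℝ ≃o ℝ), GaussSeq a →
    BrjunoLE a B → 0 ≤ B → C5 * (B + 1) ≤ 2 * Real.pi * Δ → Good (a 0) Δ F →
    ∃ (G L : ℕ → ℝ ≃o ℝ) (l : ℕ → ℂ → ℂ), G 0 = F ∧ ∀ n, RotPair (tr 1) (G n) (a n) ∧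
      HolDiff (L n) ∧ L n * G n * (L n)⁻¹ = tr 1 ∧
      G (n + 1) = tr 1 ^ (-⌊(a n)⁻¹⌋) * (L n * tr 1 * (L n)⁻¹) ∧
      DifferentiableOn ℂ (l n)
        (rct (10 / prodSeq a n) (10 / prodSeq a n) (10 / prodSeq a n)) ∧
      (∀ x : ℝ, |x| < 10 / prodSeq a n → l n x = L n x) ∧
      ∀ z ∈ rct (10 / prodSeq a n) (10 / prodSeq a n) (10 / prodSeq a n),
        ‖l n z - z / a n‖ ≤ 1 / 800 / a n := by
  obtain ⟨C, c, hC, hc, step⟩ := exists_linear_step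
  obtain ⟨w, hw⟩ : ∃ w, w = C + 20 := ⟨_, rfl⟩
  have hw0 : 0 < w := by linarith
  obtain ⟨e0, he0, he1, he2, he3⟩ : ∃ e0 : ℝ, 0 < e0 ∧ e0 ≤ 1 ∧ e0 * w ≤ c ∧
      C * (e0 * w) ≤ 1 / 800 := by
    refine ⟨min 1 (min (c / w) (1 / 800 / (C * w))), by positivity, min_le_left _ _, ?_, ?_⟩
    · rw [← le_div_iff₀ hw0]
      exact (min_le_right _ _).trans (min_le_left _ _)
    · have : min 1 (min (c / w) (1 / 800 / (C * w))) ≤ 1 / 800 / (C * w) :=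
        (min_le_right _ _).trans (min_le_right _ _)
      rw [le_div_iff₀ (by positivity)] at this
      linarith
  obtain ⟨X0, hX0⟩ : ∃ X0, X0 = -Real.log e0 := ⟨_, rfl⟩
  have hX0n : 0 ≤ X0 := by rw [hX0]; linarith [Real.log_nonpos he0.le he1]
  have hpi := Real.pi_gt_three
  refine ⟨2 + 16 + 8 * X0 + 2 * Real.pi * (8 * C + 10), by positivity, ?_⟩
  intro a B Δ F ha hB hB0 hΔ hF
  obtain ⟨b, hb⟩ : ∃ b, b = prodSeq a := ⟨_, rfl⟩
  have hbpos : ∀ n, 0 < b n := fun n => hb ▸ ha.prodSeq_pos n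
  have hbs : ∀ n, b (n + 1) = b n * a n := fun n => hb ▸ prodSeq_succ a n
  have hb0 : b 0 = 1 := hb ▸ prodSeq_zero a
  have hb1 : ∀ n, b n ≤ 1 := fun n => hb ▸ ha.prodSeq_le_one n
  obtain ⟨X, hX⟩ : ∃ X : ℕ → ℝ, X = fun n => X0 + Real.log (b n)⁻¹ := ⟨_, rfl⟩
  have hXe : ∀ n, Real.exp (-X n) * (w / b n) = e0 * w := by
    intro n
    rw [hX]
    simp only
    rw [neg_add, Real.exp_add, hX0, neg_neg, Real.exp_log he0, Real.log_inv, neg_neg,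
      Real.exp_log (hbpos n)]
    field_simp [(hbpos n).ne']
  obtain ⟨s, hs⟩ : ∃ s : ℕ → ℝ, s = fun n => (Real.log (a n)⁻¹ + X n) / (2 * Real.pi) :=
    ⟨_, rfl⟩
  obtain ⟨D, hD⟩ : ∃ D : ℕ → ℝ,
    D = fun n => (Δ - ∑ i ∈ Finset.range n, b i * (s i + C)) / b n := ⟨_, rfl⟩
  have hD0 : D 0 = Δ := by rw [hD]; simp [hb0]
  have hDs : ∀ n, D (n + 1) = (D n - s n - C) / a n := by
    intro n
    rw [hD]
    simp only
    rw [Finset.sum_range_succ, hbs]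
    have := (hbpos n).ne'
    have := (ha.pos n).ne'
    field_simp
    ring
  have hDpos : ∀ n, 10 ≤ b n * D n := by
    intro n
    have h1 : ∑ i ∈ Finset.range n, b i * (s i + C) =
        (∑ i ∈ Finset.range n, b i * Real.log (a i)⁻¹ + X0 * ∑ i ∈ Finset.range n, b i +
          ∑ i ∈ Finset.range n, b i * Real.log (b i)⁻¹) / (2 * Real.pi) +
          C * ∑ i ∈ Finset.range n, b i := by
      rw [Finset.mul_sum, Finset.mul_sum, ← Finset.sum_add_distrib, ← Finset.sum_add_distrib,
        Finset.sum_div, ← Finset.sum_add_distrib]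
      refine Finset.sum_congr rfl fun i _ => ?_
      rw [hs, hX]
      simp only
      ring
    have h2 := hB n
    have h3 := ha.sum_prodSeq_le n
    have h4 := ha.sum_mul_log_le n
    rw [← hb] at h2 h3 h4
    have h5 : b n * D n = Δ - ∑ i ∈ Finset.range n, b i * (s i + C) := by
      rw [hD]; exact mul_div_cancel₀ _ (hbpos n).ne'
    rw [h5, h1]
    have h6 : (∑ i ∈ Finset.range n, b i * Real.log (a i)⁻¹ + X0 * ∑ i ∈ Finset.range n, b i +
          ∑ i ∈ Finset.range n, b i * Real.log (b i)⁻¹) / (2 * Real.pi) ≤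
          (B + X0 * 8 + 16) / (2 * Real.pi) := by gcongr
    have h7 : C * ∑ i ∈ Finset.range n, b i ≤ C * 8 := by gcongr
    have h8 : (B + X0 * 8 + 16) / (2 * Real.pi) ≤ Δ - 8 * C - 10 := by
      rw [div_le_iff₀ (by positivity)]
      have : 0 ≤ (16 + 8 * X0 + 2 * Real.pi * (8 * C + 10)) * B := by positivity
      nlinarith
    linarith
  have hlast : ∀ n, 10 / b n ≤ D n - s n - C := by
    intro n
    have h1 := hDpos (n + 1)
    rw [hDs, hbs, mul_assoc, mul_div_cancel₀ _ (ha.pos n).ne'] at h1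
    rw [div_le_iff₀ (hbpos n)]
    linarith
  have hnext : ∀ n (G : ℝ ≃o ℝ), Good (a n) (D n) G → ∃ (L G' : ℝ ≃o ℝ) (l : ℂ → ℂ),
      Good (a (n + 1)) (D (n + 1)) G' ∧
      HolDiff L ∧ L * G * L⁻¹ = tr 1 ∧ G' = tr 1 ^ (-⌊(a n)⁻¹⌋) * (L * tr 1 * L⁻¹) ∧
      DifferentiableOn ℂ l (rct (10 / b n) (10 / b n) (10 / b n)) ∧
      (∀ x : ℝ, |x| < 10 / b n → l x = L x) ∧
      ∀ z ∈ rct (10 / b n) (10 / b n) (10 / b n), ‖l z - z / a n‖ ≤ 1 / 800 / a n := by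
    intro n G hG
    have hbi : 0 < 10 / b n := div_pos (by norm_num) (hbpos n)
    have hwb : w ≤ w / b n := by
      rw [le_div_iff₀ (hbpos n)]; nlinarith [hb1 n]
    have hw2 : 10 / b n ≤ w / b n / 2 := by
      have : 20 / b n ≤ w / b n := by
        have := hbpos n
        gcongr; linarith
      have e : 20 / b n = 2 * (10 / b n) := by ring
      linarith
    have hsn : (Real.log (a n)⁻¹ + X n) / (2 * Real.pi) = s n := by rw [hs]
    obtain ⟨L, h1, h2, h3, l, h4, h5, h6⟩ := step (a n) (D n) (w / b n) (X n) G (ha.pos n)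
      (ha.lt_one n) hG (by linarith) (by rw [hXe]; exact he2)
      (by rw [hsn]; linarith [hlast n])
    rw [hsn] at h3 h4 h6
    have hsub : rct (10 / b n) (10 / b n) (10 / b n) ⊆
        rct (w / b n / 2) (w / b n / 2) (D n - s n - C) := rct_mono hw2 hw2 (hlast n)
    refine ⟨L, _, l, ?_, h1, h2, rfl, h4.mono hsub, fun x hx => h5 x (hx.trans_le hw2),
      fun z hz => (h6 z (hsub hz)).trans ?_⟩
    · rw [ha.succ, hDs]; exact h3
    · rw [hXe]
      have := ha.pos n
      gcongr
  choose! Lf Gf lf hP using hnext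
  obtain ⟨G, hG⟩ : ∃ G : ℕ → ℝ ≃o ℝ, G = fun n => Nat.rec F (fun n H => Gf n H) n := ⟨_, rfl⟩
  have hG0 : G 0 = F := by subst hG; rfl
  have hGs : ∀ n, G (n + 1) = Gf n (G n) := fun n => by rw [hG]
  have hgood : ∀ n, Good (a n) (D n) (G n) := by
    intro n
    induction n with
    | zero => rw [hG0, hD0]; exact hF
    | succ n ih => rw [hGs]; exact (hP n _ ih).1
  refine ⟨G, fun n => Lf n (G n), fun n => lf n (G n), hG0, fun n => ?_⟩
  have h := hP n _ (hgood n)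
  rw [← hb]
  refine ⟨(hgood n).1, h.2.1, h.2.2.1, ?_, h.2.2.2.2⟩
  rw [hGs]; exact h.2.2.2.1

/-- an analytic commuting pair whose height is large compared with the Brjuno series is
linearizable -/
theorem exists_lin_of_brjuno : ∃ C5 : ℝ, 0 < C5 ∧ ∀ (a : ℕ → ℝ) (B Δ : ℝ) (F : ℝ ≃o ℝ),
    GaussSeq a → BrjunoLE a B → 0 ≤ B → C5 * (B + 1) ≤ 2 * Real.pi * Δ → Good (a 0) Δ F →
    Lin (tr 1) F := by
  obtain ⟨C5, hC5, tower⟩ := exists_tower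
  refine ⟨C5, hC5, fun a B Δ F ha hB hB0 hΔ hF => ?_⟩
  obtain ⟨G, L, l, hG0, hT⟩ := tower a B Δ F ha hB hB0 hΔ hF
  obtain ⟨b, hb⟩ : ∃ b, b = prodSeq a := ⟨_, rfl⟩
  have hbpos : ∀ n, 0 < b n := fun n => hb ▸ ha.prodSeq_pos n
  have hbs : ∀ n, b (n + 1) = b n * a n := fun n => hb ▸ prodSeq_succ a n
  have hb0 : b 0 = 1 := hb ▸ prodSeq_zero a
  have hbsum : Summable b := hb ▸ ha.summable_prodSeq
  have hbsumle : ∀ n, ∑ i ∈ Finset.range n, b i ≤ 8 := hb ▸ ha.sum_prodSeq_le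
  rw [← hb] at hT
  obtain ⟨M, hM0, hMs⟩ : ∃ M : ℕ → ℝ ≃o ℝ, M 0 = 1 ∧ ∀ n, M (n + 1) = L n * M n :=
    ⟨fun n => Nat.rec 1 (fun n H => L n * H) n, rfl, fun n => rfl⟩
  obtain ⟨m, hm0, hms⟩ : ∃ m : ℕ → ℂ → ℂ, m 0 = id ∧ ∀ n, m (n + 1) = l n ∘ m n :=
    ⟨fun n => Nat.rec id (fun n H => l n ∘ H) n, rfl, fun n => rfl⟩
  obtain ⟨Q, hQ⟩ : ∃ Q, Q = rct 3 3 1 := ⟨_, rfl⟩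
  have oQ : IsOpen Q := hQ ▸ isOpen_rct _ _ _
  -- control of the compositions
  have hmem : ∀ n, ∀ z ∈ Q, ‖b n * m n z - z‖ ≤ 1 / 80 →
      m n z ∈ rct (10 / b n) (10 / b n) (10 / b n) := by
    intro n z hz h1
    rw [hQ] at hz
    have h2 := abs_le.1 ((Complex.abs_re_le_norm _).trans h1)
    have h3 := abs_le.1 ((Complex.abs_im_le_norm _).trans h1)
    simp only [Complex.sub_re, Complex.sub_im, Complex.re_ofReal_mul, Complex.im_ofReal_mul]
      at h2 h3
    have h4 := abs_lt.1 hz.2.2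
    refine ⟨?_, ?_, abs_lt.2 ⟨?_, ?_⟩⟩
    · rw [← neg_div, div_lt_iff₀ (hbpos n)]; linarith [hz.1]
    · rw [lt_div_iff₀ (hbpos n)]; linarith [hz.2.1]
    · rw [← neg_div, div_lt_iff₀ (hbpos n)]; linarith
    · rw [lt_div_iff₀ (hbpos n)]; linarith
  have hstep : ∀ n, ∀ z ∈ Q, ‖b n * m n z - z‖ ≤ 1 / 80 →
      ‖b (n + 1) * m (n + 1) z - b n * m n z‖ ≤ b n / 800 := by
    intro n z hz h1
    have h2 := (hT n).2.2.2.2.2.2 _ (hmem n z hz h1)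
    have hα := ha.pos n
    have hαc : (a n : ℂ) ≠ 0 := by exact_mod_cast hα.ne'
    have e : (b (n + 1) : ℂ) * m (n + 1) z - b n * m n z =
        ((b n * a n : ℝ) : ℂ) * (l n (m n z) - m n z / a n) := by
      rw [hms, hbs, Function.comp]
      push_cast
      field_simp
    rw [e, norm_mul, Complex.norm_real, Real.norm_eq_abs, abs_of_pos (mul_pos (hbpos n) hα)]
    calc _ ≤ b n * a n * (1 / 800 / a n) := by
          gcongr
          exact (mul_pos (hbpos n) hα).le
      _ = _ := by field_simp
  have hind : ∀ n, ∀ z ∈ Q, ‖b n * m n z - z‖ ≤ (∑ i ∈ Finset.range n, b i) / 800 := by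
    intro n z hz
    induction n with
    | zero => simp [hb0, hm0]
    | succ n ih =>
      have h1 := hstep n z hz (ih.trans (by linarith [hbsumle n]))
      rw [Finset.sum_range_succ]
      calc _ = ‖(b (n + 1) * m (n + 1) z - b n * m n z) + (b n * m n z - z)‖ := by ring_nf
        _ ≤ _ := norm_add_le _ _
        _ ≤ _ := by linarith
  have hsmall : ∀ n, ∀ z ∈ Q, ‖b n * m n z - z‖ ≤ 1 / 80 := fun n z hz =>
    (hind n z hz).trans (by linarith [hbsumle n])
  have hmdiff : ∀ n, DifferentiableOn ℂ (m n) Q := by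
    intro n
    induction n with
    | zero => rw [hm0]; exact differentiableOn_id
    | succ n ih =>
      rw [hms]
      exact ((hT n).2.2.2.2.1).comp ih fun z hz => hmem n z hz (hsmall n z hz)
  have hreal : ∀ n, ∀ x : ℝ, |x| < 3 → m n x = M n x := by
    intro n x hx
    have hxQ : (x : ℂ) ∈ Q := by
      rw [hQ]; exact ⟨by simpa using (abs_lt.1 hx).1, by simpa using (abs_lt.1 hx).2, by simp⟩
    induction n with
    | zero => rw [hm0, hM0]; rfl
    | succ n ih =>
      have h1 := hmem n x hxQ (hsmall n x hxQ)
      rw [ih] at h1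
      rw [hms, hMs, Function.comp, ih, mul_apply']
      refine (hT n).2.2.2.2.2.1 _ (abs_lt.2 ⟨?_, ?_⟩)
      · simpa using h1.1
      · simpa using h1.2.1
  -- the limit
  obtain ⟨f, hf⟩ : ∃ f : ℕ → ℂ → ℂ, f = fun n z => b (n + 1) * m (n + 1) z - b n * m n z :=
    ⟨_, rfl⟩
  have hfd : ∀ n, DifferentiableOn ℂ (f n) Q := fun n => by
    rw [hf]
    exact ((hmdiff (n + 1)).const_mul _).sub ((hmdiff n).const_mul _)
  have hfle : ∀ n z, z ∈ Q → ‖f n z‖ ≤ b n / 800 := fun n z hz => by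
    rw [hf]; exact hstep n z hz (hsmall n z hz)
  have hsum8 : Summable fun n => b n / 800 := hbsum.div_const _
  obtain ⟨h, hh⟩ : ∃ h : ℂ → ℂ, h = fun z => z + ∑' n, f n z := ⟨_, rfl⟩
  have hhd : DifferentiableOn ℂ h Q := by
    rw [hh]
    exact differentiableOn_id.add (Complex.differentiableOn_tsum_of_summable_norm hsum8 hfd oQ hfle)
  have htend : ∀ z ∈ Q, Tendsto (fun n => b n * m n z) atTop (𝓝 (h z)) := by
    intro z hz
    have h1 : Summable fun n => f n z := Summable.of_norm_bounded hsum8 fun n => hfle n z hz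
    have h2 := (h1.hasSum.tendsto_sum_nat).const_add z
    rw [hh]
    refine h2.congr fun n => ?_
    rw [hf]
    simp only
    rw [Finset.sum_range_sub (fun n => (b n : ℂ) * m n z), hb0, hm0]
    simp
  have hnear : ∀ z ∈ Q, ‖h z - z‖ ≤ 1 / 80 := fun z hz =>
    le_of_tendsto ((htend z hz).sub_const z).norm (Eventually.of_forall fun n => hsmall n z hz)
  have hderiv : ∀ z ∈ rct (5 / 2) (5 / 2) (1 / 2), ‖deriv h z - 1‖ ≤ 1 / 2 := by
    intro z hz
    have hsub : Metric.closedBall z (1 / 2) ⊆ Q := by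
      rw [hQ]
      apply closedBall_subset_rct
      exact rct_mono (by norm_num) (by norm_num) (by norm_num) hz
    have h1 := norm_deriv_le_of_closedBall (f := fun z => h z - z) (r := 1 / 2) (C := 1 / 80)
      (by norm_num) (hhd.sub differentiableOn_id) hsub fun w hw => hnear w (hsub hw)
    have hz' : z ∈ Q := hsub (Metric.mem_closedBall_self (by norm_num))
    have h2 : deriv (fun z => h z - z) z = deriv h z - 1 :=
      ((hhd.differentiableAt (oQ.mem_nhds hz')).hasDerivAt.sub (hasDerivAt_id z)).deriv
    rw [h2] at h1
    exact h1.trans (by norm_num)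
  have hrealQ : ∀ x : ℝ, |x| < 3 → (x : ℂ) ∈ Q := fun x hx => by
    rw [hQ]; exact ⟨by simpa using (abs_lt.1 hx).1, by simpa using (abs_lt.1 hx).2, by simp⟩
  have htendr : ∀ x : ℝ, |x| < 3 → Tendsto (fun n => b n * M n x) atTop (𝓝 (h x).re) := by
    intro x hx
    refine ((Complex.continuous_re.tendsto _).comp (htend x (hrealQ x hx))).congr fun n => ?_
    rw [Function.comp, hreal n x hx, ← Complex.ofReal_mul, Complex.ofReal_re]
  have hre : ∀ x : ℝ, |x| < 3 → h x = ((h x).re : ℝ) := by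
    intro x hx
    refine tendsto_nhds_unique (htend x (hrealQ x hx))
      (((Complex.continuous_ofReal.tendsto _).comp (htendr x hx)).congr fun n => ?_)
    rw [Function.comp, hreal n x hx, Complex.ofReal_mul]
  -- the action of the group in the coordinates
  have hgrp : ∀ (γ : ℝ ≃o ℝ) (r : ℝ), (∃ p q : ℤ, γ = tr 1 ^ p * F ^ q ∧ p + q * a 0 = r) →
      ∀ n, ∃ p q : ℤ, M n * γ * (M n)⁻¹ = tr 1 ^ p * G n ^ q ∧ p + q * a n = r / b n := by
    rintro γ r ⟨p, q, h1, h2⟩ n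
    induction n with
    | zero => exact ⟨p, q, by rw [hM0, hG0, h1]; group, by rw [h2, hb0, div_one]⟩
    | succ n ih =>
      obtain ⟨p, q, h1, h2⟩ := ih
      obtain ⟨-, -, h3, h4, -⟩ := hT n
      refine ⟨⌊(a n)⁻¹⌋ * p + q, p, ?_, ?_⟩
      · have h5 : L n * tr 1 * (L n)⁻¹ = tr 1 ^ ⌊(a n)⁻¹⌋ * G (n + 1) := by
          rw [h4, ← mul_assoc, ← zpow_add, add_neg_cancel, zpow_zero, one_mul]
        have hc : Commute (tr 1) (G (n + 1)) := (hT (n + 1)).1.1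
        calc M (n + 1) * γ * (M (n + 1))⁻¹ = L n * (M n * γ * (M n)⁻¹) * (L n)⁻¹ := by
              rw [hMs]; group
          _ = (L n * tr 1 * (L n)⁻¹) ^ p * (L n * G n * (L n)⁻¹) ^ q := by
              rw [h1, conj_zpow, conj_zpow]; group
          _ = tr 1 ^ (⌊(a n)⁻¹⌋ * p) * (G (n + 1) ^ p * tr 1 ^ q) := by
              rw [h3, h5, (hc.zpow_left _).mul_zpow, ← zpow_mul, mul_assoc]
          _ = _ := by
              rw [← (hc.zpow_zpow q p).eq, ← mul_assoc, ← zpow_add]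
      · have h6 := (ha.pos n).ne'
        have h7 : a (n + 1) = (a n)⁻¹ - ⌊(a n)⁻¹⌋ := ha.succ n
        rw [hbs, ← div_div, ← h2, h7]
        push_cast
        field_simp
        ring
  have hfun : ∀ (γ : ℝ ≃o ℝ) (r : ℝ), (∃ p q : ℤ, γ = tr 1 ^ p * F ^ q ∧ p + q * a 0 = r) →
      ∀ x : ℝ, |x| < 3 → |γ x| < 3 → (h (γ x : ℝ)).re = (h x).re + r := by
    intro γ r hγ x hx hγx
    have hn : ∀ n, |b n * M n (γ x) - b n * M n x - r| ≤ 2 * b n := by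
      intro n
      obtain ⟨p, q, h1, h2⟩ := hgrp γ r hγ n
      have hR := (hT n).1
      obtain ⟨y, hy⟩ : ∃ y, y = M n x := ⟨_, rfl⟩
      have h3 : M n (γ x) = (G n ^ q) y + p := by
        have : M n (γ x) = (M n * γ * (M n)⁻¹) y := by
          rw [mul_apply', mul_apply', hy, inv_apply_self']
        rw [this, h1, mul_apply', tr_one_zpow_apply]
      have h4 := Int.floor_le (r / b n)
      have h5 := Int.lt_floor_add_one (r / b n)
      have h6 := hR.2 (p - ⌊r / b n⌋ + 1) q (by push_cast; linarith) y
      have h7 := hR.lt_id (p - ⌊r / b n⌋ - 1) q (by push_cast; linarith) y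
      rw [mul_apply', tr_one_zpow_apply] at h6 h7
      push_cast at h6 h7
      rw [← hy, h3]
      have hbn := hbpos n
      have e : b n * ((G n ^ q) y + p) - b n * y - r =
          b n * ((G n ^ q) y + p - y - r / b n) := by field_simp
      rw [e, abs_mul, abs_of_pos hbn, mul_comm]
      gcongr
      rw [abs_le]
      constructor <;> linarith
    have h1 := (((htendr _ hγx).sub (htendr x hx)).sub_const r).abs
    have h2 : Tendsto (fun n => 2 * b n) atTop (𝓝 0) := by
      simpa using hbsum.tendsto_atTop_zero.const_mul 2
    have h3 := le_of_tendsto_of_tendsto' h1 h2 hn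
    have h4 := abs_eq_zero.1 (le_antisymm h3 (abs_nonneg _))
    linarith
  have hR0 : RotPair (tr 1) F (a 0) := hF.1
  have hI : ∀ x ∈ Set.Ioo (-(5 / 2) : ℝ) (5 / 2), (x : ℂ) ∈ rct (5 / 2) (5 / 2) (1 / 2) :=
    fun x hx => ⟨by simpa using hx.1, by simpa using hx.2, by simp⟩
  have hI3 : ∀ x ∈ Set.Ioo (-(5 / 2) : ℝ) (5 / 2), |x| < 3 := fun x hx =>
    abs_lt.2 ⟨by linarith [hx.1], by linarith [hx.2]⟩
  have hmono : StrictMonoOn (fun x : ℝ => (h x).re) (Set.Ioo (-(5 / 2)) (5 / 2)) := by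
    intro x hx y hy hxy
    have hQ' : rct (5 / 2) (5 / 2) (1 / 2) ⊆ Q := by
      rw [hQ]; exact rct_mono (by norm_num) (by norm_num) (by norm_num)
    have h1 := norm_sub_sub_le_of_deriv (isOpen_rct _ _ _) (convex_rct _ _ _) (hhd.mono hQ')
      hderiv (hI x hx) (hI y hy)
    have h2 := abs_le.1 ((Complex.abs_re_le_norm _).trans h1)
    rw [← Complex.ofReal_sub y x, Complex.norm_real, Real.norm_eq_abs,
      abs_of_pos (by linarith : 0 < y - x)] at h2
    simp only [Complex.sub_re, Complex.ofReal_re] at h2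
    show (h x).re < (h y).re
    linarith [h2.1]
  have hhol : ∀ x ∈ Set.Ioo (-(5 / 2) : ℝ) (5 / 2), HolAt (fun x : ℝ => (h x).re) x := by
    intro x hx
    have hxQ := hrealQ x (hI3 x hx)
    have he : ∀ᶠ y : ℝ in 𝓝 x, h y = ((h y).re : ℝ) := by
      filter_upwards [Ioo_mem_nhds hx.1 hx.2] with y hy using hre y (hI3 y hy)
    obtain ⟨c, hc, hd⟩ := exists_pos_hasDerivAt (hhd.differentiableAt (oQ.mem_nhds hxQ))
      (hderiv _ (hI x hx)) he
    exact ⟨h, c, hc, hhd.analyticAt (oQ.mem_nhds hxQ), hd, he⟩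
  have h01 : (0 : ℝ) ∈ Set.Ioo (-(5 / 2) : ℝ) (5 / 2) := by constructor <;> norm_num
  have h11 : tr 1 (0 : ℝ) ∈ Set.Ioo (-(5 / 2) : ℝ) (5 / 2) := by
    rw [tr_apply]; constructor <;> norm_num
  obtain ⟨Λ, hΛ, hΛ1, hΛ2⟩ := exists_real_coordinate (A := tr 1) (by simp) (holDiff_tr 1) h01 h11
    hmono hhol (fun x hx hx1 => hfun (tr 1) 1 ⟨1, 0, by simp, by simp⟩ x (hI3 x hx) (hI3 _ hx1))
  have hΛper : ∀ (n : ℤ) x, Λ (x + n) = Λ x + n := by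
    intro n x
    have h1 : Λ * tr 1 ^ n = tr 1 ^ n * Λ := by
      have h2 : Λ * tr 1 ^ n * Λ⁻¹ = tr 1 ^ n := by rw [← conj_zpow, hΛ2]
      calc Λ * tr 1 ^ n = (Λ * tr 1 ^ n * Λ⁻¹) * Λ := by group
        _ = _ := by rw [h2]
    have h2 : (Λ * tr 1 ^ n) x = (tr 1 ^ n * Λ) x := by rw [h1]
    rwa [mul_apply', mul_apply', tr_one_zpow_apply, tr_one_zpow_apply] at h2
  refine ⟨Λ, hΛ, ⟨1, fun x => by simpa using hΛper 1 x⟩, a 0, fun x => ?_⟩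
  have hF1 := hR0.2 0 1 (by simpa using ha.pos 0) (Int.fract x)
  have hF2 := hR0.lt_id (-1) 1 (by push_cast; linarith [ha.lt_one 0]) (Int.fract x)
  rw [mul_apply', tr_one_zpow_apply, zpow_one] at hF1 hF2
  push_cast at hF1 hF2
  have hx0 := Int.fract_nonneg x
  have hx1 := Int.fract_lt_one x
  have hxI : Int.fract x ∈ Set.Ioo (-(5 / 2) : ℝ) (5 / 2) := ⟨by linarith, by linarith⟩
  have hFI : F (Int.fract x) ∈ Set.Ioo (-(5 / 2) : ℝ) (5 / 2) := ⟨by linarith, by linarith⟩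
  have h3 := hfun F (a 0) ⟨0, 1, by simp, by simp⟩ _ (hI3 _ hxI) (hI3 _ hFI)
  rw [← hΛ1 _ hxI, ← hΛ1 _ hFI] at h3
  have h4 : F x = F (Int.fract x) + ⌊x⌋ := by
    have h5 : (F * tr 1 ^ ⌊x⌋) (Int.fract x) = (tr 1 ^ ⌊x⌋ * F) (Int.fract x) := by
      rw [(hR0.1.zpow_left ⌊x⌋).eq]
    rwa [mul_apply', mul_apply', tr_one_zpow_apply, tr_one_zpow_apply, Int.fract_add_floor] at h5
  rw [h4, hΛper, h3]
  have h6 := hΛper ⌊x⌋ (Int.fract x)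
  rw [Int.fract_add_floor] at h6
  linarith

lemma exp_neg_six_le : Real.exp (-6) ≤ 1 / 100 := by
  have h := Real.exp_one_gt_d9
  have h2 : Real.exp 6 = Real.exp 1 ^ 6 := by rw [← Real.exp_nat_mul]; norm_num
  have h3 : (2.7 : ℝ) ^ 6 ≤ Real.exp 1 ^ 6 := by gcongr; linarith
  rw [Real.exp_neg, h2, one_div]
  exact inv_anti₀ (by norm_num) (le_trans (by norm_num) h3)

lemma Good.inv {ρ Δ : ℝ} {G : ℝ ≃o ℝ} (h : Good ρ Δ G) (hΔ : 3 ≤ Δ) :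
    Good (-ρ) (Δ - 2) G⁻¹ := by
  obtain ⟨hR, g, hg, hgr, hgp, hE⟩ := h
  have hpi := Real.pi_gt_three
  have hs : strip (Δ - 1) ⊆ strip Δ := fun z hz =>
    lt_of_lt_of_le (show |z.im| < _ from hz) (by linarith)
  have hs2 : strip (Δ - 2) ⊆ strip (Δ - 1) := fun z hz =>
    lt_of_lt_of_le (show |z.im| < _ from hz) (by linarith)
  obtain ⟨u, hu⟩ : ∃ u : ℂ → ℂ, u = fun z => g z - ρ := ⟨_, rfl⟩
  have hud : DifferentiableOn ℂ u (strip (Δ - 1)) := by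
    rw [hu]; exact (hg.mono hs).sub_const _
  have huE : ∀ z ∈ strip Δ, ‖u z - z‖ ≤ Real.exp (-(2 * Real.pi * (Δ - |z.im|))) :=
    fun z hz => by
      have := hE z hz
      rw [hu]
      rwa [sub_right_comm] at this
  have hun : ∀ z ∈ strip (Δ - 1), ‖u z - z‖ ≤ 1 / 100 := fun z hz => by
    refine (huE z (hs hz)).trans (le_trans (Real.exp_le_exp.2 ?_) exp_neg_six_le)
    have : |z.im| < Δ - 1 := hz
    nlinarith
  have huder : ∀ z ∈ strip (Δ - 1), ‖deriv u z - 1‖ ≤ 1 / 2 := fun z hz => by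
    have hz1 : |z.im| < Δ - 1 := hz
    have h1 := norm_deriv_sub_one_le (r := 1 / 2) (by norm_num) hg hE
      (z := z) (show |z.im| < _ by linarith)
    have h2 : deriv u z = deriv g z := by rw [hu]; exact deriv_sub_const _
    rw [h2]
    refine h1.trans ?_
    have h3 : Real.exp (-(2 * Real.pi * (Δ - 1 / 2 - |z.im|))) ≤ 1 / 4 := by
      rw [Real.exp_neg, show (1 : ℝ) / 4 = 4⁻¹ by norm_num]
      refine inv_anti₀ (by norm_num) ?_
      have h4 := Real.add_one_le_exp (2 * Real.pi * (Δ - 1 / 2 - |z.im|))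
      nlinarith
    linarith
  have oU := isOpen_strip (Δ - 1)
  have cU := convex_strip (Δ - 1)
  obtain ⟨M, hMd, hM⟩ := exists_inverse oU cU hud hun huder (by norm_num) (isOpen_strip (Δ - 2))
    (fun w hw => closedBall_subset_strip (by
      have : |w.im| < Δ - 2 := hw
      show |w.im| < _
      linarith))
  have huniq : ∀ x ∈ strip (Δ - 1), ∀ y ∈ strip (Δ - 1), u x = u y → x = y := by
    intro x hx y hy hxy
    have := norm_sub_le_two_mul oU cU hud huder hx hy
    rw [hxy, sub_self, norm_zero, mul_zero] at this
    exact (sub_eq_zero.1 (norm_le_zero_iff.1 this)).symm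
  have hshift : ∀ (w : ℂ) (t : ℝ), w - t ∈ strip (Δ - 2) ↔ w ∈ strip (Δ - 2) := fun w t => by
    simp [strip]
  have hone : ∀ w : ℂ, ∀ r, w + 1 ∈ strip r ↔ w ∈ strip r := fun w r => by
    simp [strip]
  obtain ⟨m, hval, hval'⟩ : ∃ m : ℂ → ℂ, (∀ w ∈ strip (Δ - 2), m w = M (w - ρ)) ∧
      ∀ w, w ∉ strip (Δ - 2) → m w = w := by
    classical
    exact ⟨fun w => if w ∈ strip (Δ - 2) then M (w - ρ) else w, fun w hw => if_pos hw,
      fun w hw => if_neg hw⟩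
  refine ⟨hR.inv, m, ?_, ?_, ?_, ?_⟩
  · refine (hMd.comp (differentiableOn_id.sub_const (ρ : ℂ)) fun w hw => (hshift w ρ).2 hw).congr
      fun w hw => hval w hw
  · intro x
    have hx : (x : ℂ) ∈ strip (Δ - 2) := strip_real (by linarith) x
    have hx1 := hM _ ((hshift x ρ).2 hx)
    rw [hval _ hx]
    refine huniq _ hx1.1 _ (strip_real (by linarith) _) ?_
    rw [hx1.2.2.1, hu]
    simp only
    rw [hgr, apply_inv_self']
  · intro w
    by_cases hw : w ∈ strip (Δ - 2)
    · rw [hval _ hw, hval _ ((hone w _).2 hw)]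
      have h1 := hM _ ((hshift w ρ).2 hw)
      have h2 := hM _ ((hshift (w + 1) ρ).2 ((hone w _).2 hw))
      refine huniq _ h2.1 _ ((hone _ _).2 h1.1) ?_
      have h3 : u (M (w - ρ) + 1) = u (M (w - ρ)) + 1 := by rw [hu]; simp only; rw [hgp]; ring
      rw [h2.2.2.1, h3, h1.2.2.1]; ring
    · rw [hval' _ hw, hval' _ (fun hh => hw ((hone w _).1 hh))]
  · intro w hw
    rw [hval w hw]
    have h1 := hM _ ((hshift w ρ).2 hw)
    have h2 := huE _ (hs h1.1)
    have e : M (w - ρ) - w - ((-ρ : ℝ) : ℂ) = -(u (M (w - ρ)) - M (w - ρ)) := by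
      rw [h1.2.2.1]; push_cast; ring
    rw [e, norm_neg]
    refine h2.trans (Real.exp_le_exp.2 ?_)
    have h3 := abs_im_le_of_mem_closedBall (z := w - ρ) (w := M (w - ρ)) (r := 1 / 100)
      (by rw [Metric.mem_closedBall, dist_eq_norm]; exact h1.2.1)
    have h4 : (w - (ρ : ℂ)).im = w.im := by simp
    rw [h4] at h3
    nlinarith

lemma Lin.of_renormalization {F L : ℝ ≃o ℝ} (hL : HolDiff L) (hF : L * F * L⁻¹ = tr 1) (n : ℤ)
    (h : Lin (tr 1) (tr 1 ^ n * (L * tr 1 * L⁻¹))) : Lin (tr 1) F := by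
  obtain ⟨k, hk, h1, h2⟩ := h
  refine Lin.conj hL ⟨k, hk, ?_, hF ▸ h1⟩
  have := (trSub k).mul_mem ((trSub k).inv_mem ((trSub k).zpow_mem h1 n)) h2
  rwa [inv_mul_cancel_left] at this

/-- the linear renormalization step -/
lemma exists_linear_step' : ∃ C : ℝ, 0 < C ∧ ∀ (α Δ : ℝ) (F : ℝ ≃o ℝ), 0 < α → α < 1 →
    Good α Δ F → Real.log α⁻¹ + C < 2 * Real.pi * Δ →
    ∃ (F' : ℝ ≃o ℝ) (Δ' : ℝ), Good (Int.fract α⁻¹) Δ' F' ∧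
      α * (2 * Real.pi * Δ') = 2 * Real.pi * Δ - Real.log α⁻¹ - C ∧
      (Lin (tr 1) F' → Lin (tr 1) F) := by
  obtain ⟨C, c, hC, hc, key⟩ := exists_linear_step
  have hpi := Real.pi_pos
  obtain ⟨X, hX⟩ : ∃ X, X = |Real.log (C / c)| := ⟨_, rfl⟩
  have hXc : Real.exp (-X) * C ≤ c := by
    have h1 : C / c ≤ Real.exp X := by
      rw [← Real.log_le_iff_le_exp (by positivity), hX]; exact le_abs_self _
    rw [div_le_iff₀ hc] at h1
    rw [Real.exp_neg, inv_mul_le_iff₀ (Real.exp_pos _)]; exact h1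
  have hX0 : 0 ≤ X := hX ▸ abs_nonneg _
  refine ⟨X + 2 * Real.pi * C, by positivity, fun α Δ F h0 h1 hF hΔ => ?_⟩
  obtain ⟨L, hL, hLF, hG, -⟩ := key α Δ C X F h0 h1 hF le_rfl hXc (by
    have : (Real.log α⁻¹ + X) / (2 * Real.pi) < Δ - C := by
      rw [div_lt_iff₀ (by positivity)]; linarith
    linarith)
  refine ⟨_, _, hG, ?_, fun h => Lin.of_renormalization hL hLF _ h⟩
  field_simp
  ring

/-- linear steps suffice when the height exceeds the Brjuno series by a universal constant -/
theorem exists_lin_of_brjunoLE : ∃ C : ℝ, 0 < C ∧ ∀ (a : ℕ → ℝ) (B Δ : ℝ) (F : ℝ ≃o ℝ),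
    GaussSeq a → BrjunoLE a B → B + C ≤ 2 * Real.pi * Δ → Good (a 0) Δ F → Lin (tr 1) F := by
  obtain ⟨C, hC, step⟩ := exists_linear_step'
  obtain ⟨C5, hC5, fin⟩ := exists_lin_of_brjuno
  refine ⟨9 * C + 1, by positivity, fun a B Δ F ha hB hΔ hF => ?_⟩
  obtain ⟨b, hb⟩ : ∃ b, b = prodSeq a := ⟨_, rfl⟩
  have hbpos : ∀ n, 0 < b n := fun n => hb ▸ ha.prodSeq_pos n
  have hbs : ∀ n, b (n + 1) = b n * a n := fun n => hb ▸ prodSeq_succ a n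
  have hb0 : b 0 = 1 := hb ▸ prodSeq_zero a
  have hbsum : Summable b := hb ▸ ha.summable_prodSeq
  have hb8 : ∀ n, ∑ i ∈ Finset.range n, b i ≤ 8 := hb ▸ ha.sum_prodSeq_le
  have hb1 : ∀ n, b n ≤ 1 := hb ▸ ha.prodSeq_le_one
  obtain ⟨t, ht⟩ : ∃ t : ℕ → ℝ, t = fun i => b i * Real.log (a i)⁻¹ := ⟨_, rfl⟩
  have ht0 : ∀ n, 0 ≤ t n := fun n => by
    rw [ht]
    exact mul_nonneg (hbpos n).le
      (Real.log_nonneg ((one_le_inv₀ (ha.pos n)).2 (ha.lt_one n).le))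
  have htB : ∀ n, ∑ i ∈ Finset.range n, t i ≤ B := fun n => by rw [ht, hb]; exact hB n
  have hts : Summable t := summable_of_sum_range_le ht0 htB
  have htot : ∑' i, t i ≤ B := hts.tsum_le_of_sum_range_le htB
  have hind : ∀ n, ∃ (G : ℝ ≃o ℝ) (D : ℝ), Good (a n) D G ∧ (Lin (tr 1) G → Lin (tr 1) F) ∧
      ∑' i, t i - ∑ i ∈ Finset.range n, t i + (9 * C + 1) - C * ∑ i ∈ Finset.range n, b i ≤
        b n * (2 * Real.pi * D) := by
    intro n
    induction n with
    | zero =>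
      refine ⟨F, Δ, hF, id, ?_⟩
      rw [hb0]; simp; linarith
    | succ n ih =>
      obtain ⟨G, D, hG, hGF, hD⟩ := ih
      have h1 : ∑ i ∈ Finset.range (n + 1), t i ≤ ∑' i, t i :=
        hts.sum_le_tsum _ fun i _ => ht0 i
      have h2 : t n = b n * Real.log (a n)⁻¹ := by rw [ht]
      rw [Finset.sum_range_succ] at h1
      obtain ⟨G', D', hG', hD', hL⟩ := step (a n) D G (ha.pos n) (ha.lt_one n) hG (by
        by_contra! hcon
        have := mul_le_mul_of_nonneg_left hcon (hbpos n).le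
        nlinarith [hb8 n, hb1 n])
      refine ⟨G', D', ha.succ n ▸ hG', fun h => hGF (hL h), ?_⟩
      rw [hbs, mul_assoc, hD', Finset.sum_range_succ, Finset.sum_range_succ]
      nlinarith
  have hlim : Tendsto (fun n => C5 * ((∑' i, t i - ∑ i ∈ Finset.range n, t i) + b n)) atTop
      (𝓝 (C5 * ((∑' i, t i - ∑' i, t i) + 0))) :=
    ((tendsto_const_nhds.sub hts.hasSum.tendsto_sum_nat).add
      hbsum.tendsto_atTop_zero).const_mul _
  rw [sub_self, add_zero, mul_zero] at hlim
  obtain ⟨n, hn⟩ := (hlim.eventually (gt_mem_nhds one_pos)).exists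
  obtain ⟨G, D, hG, hGF, hD⟩ := hind n
  obtain ⟨r, hr⟩ : ∃ r, r = ∑' i, t i - ∑ i ∈ Finset.range n, t i := ⟨_, rfl⟩
  rw [← hr] at hn hD
  have hr0 : 0 ≤ r := by rw [hr]; exact sub_nonneg.2 (hts.sum_le_tsum _ fun i _ => ht0 i)
  refine hGF (fin (fun j => a (n + j)) (r / b n) D G (ha.drop n) (fun m => ?_)
    (div_nonneg hr0 (hbpos n).le) ?_ hG)
  · rw [le_div_iff₀ (hbpos n), Finset.sum_mul]
    have h1 : ∀ i, prodSeq (fun j => a (n + j)) i * Real.log (a (n + i))⁻¹ * b n = t (n + i) := by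
      intro i
      rw [ht, hb]
      simp only [prodSeq]
      rw [Finset.prod_range_add]; ring
    rw [Finset.sum_congr rfl fun i _ => h1 i, hr, le_sub_iff_add_le', ← Finset.sum_range_add]
    exact hts.sum_le_tsum _ fun i _ => ht0 i
  · have h1 : C5 * (r / b n + 1) = C5 * (r + b n) / b n := by
      field_simp [(hbpos n).ne']
    rw [h1, div_le_iff₀ (hbpos n)]
    nlinarith [hb8 n]

lemma norm_sub_sub_mul_le_of_deriv {U : Set ℂ} {u : ℂ → ℂ} {k : ℝ} {D x y : ℂ} (hU : IsOpen U)
    (hc : Convex ℝ U) (hd : DifferentiableOn ℂ u U) (hd1 : ∀ z ∈ U, ‖deriv u z - D‖ ≤ k)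
    (hx : x ∈ U) (hy : y ∈ U) : ‖u y - u x - D * (y - x)‖ ≤ k * ‖y - x‖ := by
  have h1 : ∀ z ∈ U, HasDerivWithinAt (fun z => u z - D * z) (deriv u z - D) U z := fun z hz =>
    (((hd.differentiableAt (hU.mem_nhds hz)).hasDerivAt.sub
      ((hasDerivAt_id z).const_mul D)).congr_deriv (by simp)).hasDerivWithinAt
  have h2 := hc.norm_image_sub_le_of_norm_hasDerivWithin_le h1 hd1 hx hy
  refine le_trans (le_of_eq ?_) h2
  congr 1; ring

/-- a commuting pair whose first member is close to the unit translation and whose second member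
is nearly affine in a large disc can be renormalized to a large height -/
lemma exists_good_of_disc : ∃ K0 c : ℝ, 0 < K0 ∧ 0 < c ∧ ∀ (K : ℝ) (A B : ℝ ≃o ℝ) (ρ D : ℝ)
    (g Bh : ℂ → ℂ), K0 ≤ K → 0 < ρ → ρ < 1 → RotPair A B (-ρ) → HolDiff A →
    DifferentiableOn ℂ g (Metric.ball 0 K) → DifferentiableOn ℂ Bh (Metric.ball 0 K) →
    (∀ x : ℝ, |x| < K → g x = A x) → (∀ x : ℝ, |x| < K → Bh x = B x) → A 0 = 1 →
    (∀ z ∈ Metric.ball (0 : ℂ) K, ‖deriv g z - 1‖ ≤ c / K) → 0 < D →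
    (∀ z ∈ Metric.ball (0 : ℂ) K, ‖deriv Bh z - D‖ ≤ c * D) →
    ∃ Λ : ℝ ≃o ℝ, HolDiff Λ ∧ Λ * A * Λ⁻¹ = tr 1 ∧ Good ρ (K / 20) (Λ * B⁻¹ * Λ⁻¹) := by
  obtain ⟨ε0, hε0, C, hC, coord⟩ := exists_long_coordinate
  refine ⟨10 ^ 6, min ε0 (1 / (10 ^ 5 * (2 * C + 1))), by norm_num, by positivity, ?_⟩
  intro K A B ρ D g Bh hK hρ hρ1 hAB hA hg hBh hgA hBB hA0 hgd hD hBd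
  obtain ⟨c, hc⟩ : ∃ c, c = min ε0 (1 / (10 ^ 5 * (2 * C + 1))) := ⟨_, rfl⟩
  rw [← hc] at hgd hBd
  have hc0 : 0 < c := by rw [hc]; positivity
  have hcε : c ≤ ε0 := hc ▸ min_le_left _ _
  have hcC : c * (2 * C + 1) ≤ 1 / 10 ^ 5 := by
    have : c ≤ 1 / (10 ^ 5 * (2 * C + 1)) := hc ▸ min_le_right _ _
    rw [le_div_iff₀ (by positivity)] at this
    linarith
  have hc5 : c ≤ 1 / 10 ^ 5 := by nlinarith
  clear hc
  have hK0 : 0 < K := by linarith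
  have oU : IsOpen (Metric.ball (0 : ℂ) K) := Metric.isOpen_ball
  have cU : Convex ℝ (Metric.ball (0 : ℂ) K) := convex_ball _ _
  have hmem : ∀ {x y h : ℝ} {z : ℂ}, z ∈ rct x y h → x ≤ K / 4 → y ≤ K / 4 → h ≤ K / 2 →
      z ∈ Metric.ball (0 : ℂ) K := by
    intro x y h z hz hx hy hh
    rw [mem_ball_zero_iff]
    have h1 : |z.re| < K / 4 := abs_lt.2 ⟨by linarith [hz.1], by linarith [hz.2.1]⟩
    have h2 : |z.im| < K / 2 := by linarith [hz.2.2]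
    linarith [Complex.norm_le_abs_re_add_abs_im z]
  have hmemr : ∀ {x : ℝ}, |x| < K → (x : ℂ) ∈ Metric.ball (0 : ℂ) K := fun {x} hx => by
    rwa [mem_ball_zero_iff, Complex.norm_real]
  have h0mem : (0 : ℂ) ∈ Metric.ball (0 : ℂ) K := Metric.mem_ball_self hK0
  have hg0 : g 0 = 1 := by
    have := hgA 0 (by simpa using hK0)
    rw [hA0] at this; simpa using this
  obtain ⟨ψ, hψ⟩ : ∃ ψ : ℂ → ℂ, ψ = fun z => g z - z - 1 := ⟨_, rfl⟩
  have hψd : DifferentiableOn ℂ ψ (Metric.ball 0 K) := by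
    rw [hψ]; exact (hg.sub differentiableOn_id).sub_const _
  have hψb : ∀ z ∈ Metric.ball (0 : ℂ) K, ‖ψ z‖ ≤ c := fun z hz => by
    have h1 := norm_sub_sub_mul_le_of_deriv oU cU hg hgd h0mem hz
    rw [hg0, sub_zero, one_mul] at h1
    rw [hψ]
    simp only
    rw [sub_right_comm]
    refine h1.trans ?_
    rw [div_mul_eq_mul_div, div_le_iff₀ hK0]
    have := (mem_ball_zero_iff.1 hz).le
    gcongr
  have hψ1 : ∀ z ∈ Metric.ball (0 : ℂ) K, ‖deriv ψ z‖ ≤ c / K := fun z hz => by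
    have h1 := (hg.differentiableAt (oU.mem_nhds hz)).hasDerivAt
    have h2 : HasDerivAt ψ (deriv g z - 1) z := by
      rw [hψ]; exact (h1.sub (hasDerivAt_id z)).sub_const _
    rw [h2.deriv]; exact hgd z hz
  have hgs : ∀ z ∈ Metric.ball (0 : ℂ) K, g (conj z) = conj (g z) := fun z hz =>
    conj_symm_of_real oU cU (fun w hw => by
      rw [mem_ball_zero_iff] at hw ⊢; rwa [Complex.norm_conj]) hg (x0 := 0)
      (by simpa using hK0) (fun x hx => by
        rw [hgA x (by rwa [mem_ball_zero_iff, Complex.norm_real] at hx)]; simp) z hz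
  obtain ⟨W, hW⟩ : ∃ W, W = K / 8 - 2 := ⟨_, rfl⟩
  obtain ⟨H, hH⟩ : ∃ H, H = K / 2 := ⟨_, rfl⟩
  obtain ⟨b, hb⟩ : ∃ b, b = C * (c + K * c) + 2 * W * c := ⟨_, rfl⟩
  have h_int : ∀ t : ℝ, |t| ≤ 1 → (∫ y in (-(H - 1))..(H - 1), ‖ψ (t + y * Complex.I)‖) ≤ K * c := by
    intro t ht
    have h1 : ∀ y ∈ Set.uIoc (-(H - 1)) (H - 1), ‖‖ψ (t + y * Complex.I)‖‖ ≤ c := fun y hy => by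
      rw [Set.uIoc_of_le (by linarith)] at hy
      rw [norm_norm]
      refine hψb _ (hmem (x := 2) (y := 2) (h := K / 2) ⟨?_, ?_, ?_⟩ (by linarith) (by linarith)
        le_rfl)
      · simp; linarith [(abs_le.1 ht).1]
      · simp; linarith [(abs_le.1 ht).2]
      · simpa using abs_lt.2 ⟨by linarith [hy.1], by linarith [hy.2]⟩
    have h2 := intervalIntegral.norm_integral_le_of_norm_le_const h1
    refine (Real.le_norm_self _).trans (h2.trans ?_)
    rw [abs_of_pos (by linarith)]
    nlinarith
  obtain ⟨L, hL⟩ := coord ψ c (c / K) H W (K * c)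
    (hψd.mono fun z hz => hmem hz (by linarith) (by linarith) hH.le)
    (fun z hz => hψb z (hmem hz (by linarith) (by linarith) hH.le)) hcε
    (fun z hz => hψ1 z (hmem hz (by linarith) (by linarith) (by linarith))) (by positivity)
    (by rw [div_mul_eq_mul_div, div_le_iff₀ hK0]; nlinarith)
    (fun z hz => by
      rw [hψ]; simp only
      rw [hgs z (hmem hz (by linarith) (by linarith) hH.le)]; simp)
    (by linarith) (by linarith) (by simpa using h_int 0 (by norm_num))
    (by simpa using h_int (-(1 / 2)) (by norm_num [abs_le]))
  rw [← hb] at hL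
  have hb0 : 0 ≤ b := by
    rw [hb]
    have : 0 ≤ W := by linarith
    positivity
  have hbK : b ≤ K / 10 ^ 5 := by rw [hb, hW]; nlinarith [mul_pos hC hc0]
  -- the displacement of `B`
  have hBlt : ∀ x, B x < x := fun x => by
    have := hAB.lt_id 0 1 (by push_cast; linarith) x
    simpa using this
  have hABlt : ∀ x, x < A (B x) := fun x => by
    have := hAB.2 1 1 (by push_cast; linarith) x
    simpa [mul_apply'] using this
  have hBx : ∀ x : ℝ, |x| ≤ K / 2 → x - 2 < B x := by
    intro x hx
    have h1 : |x - 2| < K := by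
      have := abs_sub x 2
      rw [abs_two] at this; linarith
    have h2 := hψb _ (hmemr h1)
    have h3 : (ψ ((x - 2 : ℝ) : ℂ)) = ((A (x - 2) - (x - 2) - 1 : ℝ) : ℂ) := by
      rw [hψ]; simp only; rw [hgA _ h1]; push_cast; ring
    rw [h3, Complex.norm_real, Real.norm_eq_abs] at h2
    have h4 := (abs_le.1 h2).2
    rw [← A.lt_iff_lt]
    linarith [hABlt x]
  have hK2 : |K / 2| ≤ K / 2 := (abs_of_pos (by linarith)).le
  have hK2' : |-(K / 2)| ≤ K / 2 := by rw [abs_neg]; exact hK2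
  have hDK : |K - D * K| ≤ 2 + c * D * K := by
    have h1 := norm_sub_sub_mul_le_of_deriv oU cU hBh hBd (hmemr (x := -(K / 2)) (by linarith))
      (hmemr (x := K / 2) (by linarith))
    rw [hBB _ (by linarith), hBB _ (by linarith)] at h1
    have h2 : ((B (K / 2) : ℂ)) - B (-(K / 2)) - D * (((K / 2 : ℝ) : ℂ) - ((-(K / 2) : ℝ) : ℂ)) =
      ((B (K / 2) - B (-(K / 2)) - D * K : ℝ) : ℂ) := by push_cast; ring
    have h3 : (((K / 2 : ℝ) : ℂ) - ((-(K / 2) : ℝ) : ℂ)) = (K : ℂ) := by push_cast; ring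
    rw [h2, h3, Complex.norm_real, Complex.norm_real, Real.norm_eq_abs, Real.norm_eq_abs,
      abs_of_pos hK0] at h1
    have h4 := abs_le.1 h1
    rw [abs_le]
    constructor <;> linarith [hBx _ hK2, hBx _ hK2', hBlt (K / 2), hBlt (-(K / 2))]
  have hD2 : D ≤ 2 := by
    by_contra! hcon
    have := (abs_le.1 hDK).1
    nlinarith [mul_pos hc0 hK0, mul_pos hD hK0]
  obtain ⟨E, hE⟩ : ∃ E, E = 4 + 4 * c * K := ⟨_, rfl⟩
  have hE0 : 0 ≤ E := by rw [hE]; positivity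
  have hEK : E ≤ K / 10 ^ 4 := by rw [hE]; nlinarith
  have hBE : ∀ z ∈ Metric.ball (0 : ℂ) K, ‖Bh z - z‖ ≤ E := by
    intro z hz
    have h1 := norm_sub_sub_mul_le_of_deriv oU cU hBh hBd h0mem hz
    have hzK : ‖z‖ ≤ K := (mem_ball_zero_iff.1 hz).le
    have h2 := hBB 0 (by simpa using hK0)
    have h3 : |B 0| ≤ 2 := abs_le.2 ⟨by linarith [hBx 0 (by simpa using by linarith)],
      by linarith [hBlt 0]⟩
    have e : Bh z - z = (Bh z - Bh 0 - D * (z - 0)) + ((B 0 : ℝ) : ℂ) + ((D - 1 : ℝ) : ℂ) * z := by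
      rw [← h2]; push_cast; ring
    rw [sub_zero] at h1
    have h4 : ‖((D - 1 : ℝ) : ℂ) * z‖ ≤ |D - 1| * K := by
      rw [norm_mul, Complex.norm_real, Real.norm_eq_abs]; gcongr
    have h5 : |D - 1| * K = |K - D * K| := by
      rw [show K - D * K = -((D - 1) * K) by ring, abs_neg, abs_mul, abs_of_pos hK0]
    have h6 : c * D * ‖z‖ ≤ c * 2 * K := by gcongr
    have h7 : c * D * K ≤ c * 2 * K := by gcongr
    rw [e, hE]
    refine (norm_add₃_le).trans ?_
    rw [Complex.norm_real, Real.norm_eq_abs, sub_zero]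
    linarith
  obtain ⟨Λ, hΛ, hΛA, -, hG⟩ := exists_renormalization (E := E) hAB hA hL
    (fun x h1 h2 => by
      rw [hψ]; simp only
      rw [hgA x (abs_lt.2 ⟨by linarith, by linarith⟩)]; ring)
    (fun x h1 h2 => (hψb _ (hmemr (abs_lt.2 ⟨by linarith, by linarith⟩))).trans (by linarith))
    (hBh.mono fun z hz => hmem hz (by linarith) (by linarith) (by nlinarith))
    (fun z hz => hBE z (hmem hz (by linarith) (by linarith) (by nlinarith)))
    (fun x h1 h2 => hBB x (abs_lt.2 ⟨by linarith, by linarith⟩)) hb0 hE0 (by linarith)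
    (by nlinarith)
  refine ⟨Λ, hΛ, hΛA, ?_⟩
  have h1 : K / 10 ≤ H - 2 - 2 * W * c - 1 - 60 * E - 120 * b := by nlinarith
  have h2 := (hG.mono h1).inv (by linarith)
  rw [neg_neg] at h2
  have e : (Λ * B * Λ⁻¹)⁻¹ = Λ * B⁻¹ * Λ⁻¹ := by group
  rw [e] at h2
  exact h2.mono (by linarith)

section Iterates

variable {𝕜 : Type*} [NontriviallyNormedField 𝕜]

/-- the derivative of the `i`-th iterate of `g`, where `g1` is the derivative of `g` -/
def dIter (g g1 : 𝕜 → 𝕜) (i : ℕ) (z : 𝕜) : 𝕜 := ∏ j ∈ Finset.range i, g1 (g^[j] z)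

/-- the logarithmic derivative of `dIter g g1 i`, where `n` is that of `g1` -/
def nIter (g g1 n : 𝕜 → 𝕜) (i : ℕ) (z : 𝕜) : 𝕜 :=
  ∑ j ∈ Finset.range i, n (g^[j] z) * dIter g g1 j z

/-- the Schwarzian derivative of the `i`-th iterate of `g`, where `s` is that of `g` -/
def sIter (g g1 s : 𝕜 → 𝕜) (i : ℕ) (z : 𝕜) : 𝕜 :=
  ∑ j ∈ Finset.range i, s (g^[j] z) * dIter g g1 j z ^ 2

/-- `g1` is the derivative, `n` the logarithmic derivative of `g1` and `s` the Schwarzian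
derivative of `g` at `w` -/
structure Jet (g g1 n s : 𝕜 → 𝕜) (w : 𝕜) : Prop where
  d1 : HasDerivAt g (g1 w) w
  d2 : HasDerivAt g1 (g1 w * n w) w
  d3 : HasDerivAt n (n w ^ 2 / 2 + s w) w

lemma dIter_succ (g g1 : 𝕜 → 𝕜) (i : ℕ) (z : 𝕜) :
    dIter g g1 (i + 1) z = dIter g g1 i z * g1 (g^[i] z) := Finset.prod_range_succ _ _

lemma nIter_succ (g g1 n : 𝕜 → 𝕜) (i : ℕ) (z : 𝕜) :
    nIter g g1 n (i + 1) z = nIter g g1 n i z + n (g^[i] z) * dIter g g1 i z :=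
  Finset.sum_range_succ _ _

lemma sIter_succ (g g1 s : 𝕜 → 𝕜) (i : ℕ) (z : 𝕜) :
    sIter g g1 s (i + 1) z = sIter g g1 s i z + s (g^[i] z) * dIter g g1 i z ^ 2 :=
  Finset.sum_range_succ _ _

variable {g g1 n s : 𝕜 → 𝕜}

lemma hasDerivAt_iterate_dIter {i : ℕ} {z : 𝕜} (h : ∀ j < i, Jet g g1 n s (g^[j] z)) :
    HasDerivAt (g^[i]) (dIter g g1 i z) z := by
  induction i with
  | zero => simpa [dIter] using hasDerivAt_id z
  | succ i ih =>
    rw [Function.iterate_succ', dIter_succ, mul_comm]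
    exact (h i (by omega)).d1.comp z (ih fun j hj => h j (by omega))

lemma hasDerivAt_dIter {i : ℕ} {z : 𝕜} (h : ∀ j < i, Jet g g1 n s (g^[j] z)) :
    HasDerivAt (dIter g g1 i) (dIter g g1 i z * nIter g g1 n i z) z := by
  induction i with
  | zero =>
    have : dIter g g1 0 = fun _ => (1 : 𝕜) := by ext; simp [dIter]
    rw [this]; simpa [nIter] using hasDerivAt_const z (1 : 𝕜)
  | succ i ih =>
    have h' : ∀ j < i, Jet g g1 n s (g^[j] z) := fun j hj => h j (by omega)
    have h1 := (ih h').mul ((h i (by omega)).d2.comp z (hasDerivAt_iterate_dIter h'))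
    have e : dIter g g1 (i + 1) = dIter g g1 i * (g1 ∘ g^[i]) := by
      ext w; simp [dIter_succ]
    rw [e]
    refine h1.congr_deriv ?_
    rw [← e, dIter_succ, nIter_succ]
    simp only [Function.comp_apply]
    ring

lemma hasDerivAt_nIter [NeZero (2 : 𝕜)] {i : ℕ} {z : 𝕜} (h : ∀ j < i, Jet g g1 n s (g^[j] z)) :
    HasDerivAt (nIter g g1 n i) (nIter g g1 n i z ^ 2 / 2 + sIter g g1 s i z) z := by
  induction i with
  | zero =>
    have : nIter g g1 n 0 = fun _ => (0 : 𝕜) := by ext; simp [nIter]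
    rw [this]; simpa [sIter] using hasDerivAt_const z (0 : 𝕜)
  | succ i ih =>
    have h' : ∀ j < i, Jet g g1 n s (g^[j] z) := fun j hj => h j (by omega)
    have h1 := (ih h').add (((h i (by omega)).d3.comp z (hasDerivAt_iterate_dIter h')).mul
      (hasDerivAt_dIter h'))
    have e : nIter g g1 n (i + 1) = nIter g g1 n i + (n ∘ g^[i]) * dIter g g1 i := by
      ext w; simp [nIter_succ]
    rw [e]
    refine h1.congr_deriv ?_
    rw [← e, nIter_succ, sIter_succ]
    simp only [Function.comp_apply]
    have h2 : (2 : 𝕜) ≠ 0 := two_ne_zero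
    field_simp
    ring

end Iterates

/-- bounds for the derivatives of the iterates of a circle diffeomorphism along intervals with
bounded total length -/
lemma iterate_bounds {f f1 n s F : ℝ → ℝ} {a a' δ M : ℝ} {Q : ℕ} (hJ : ∀ x, Jet f f1 n s x)
    (hpos : ∀ x, 0 < f1 x) (hn : ∀ x, |n x| ≤ a) (hs : ∀ x, |s x| ≤ a')
    (hf : ∀ x, f (x + 1) = f x + 1) (hf1 : ∀ x, f1 (x + 1) = f1 x) (hnp : ∀ x, n (x + 1) = n x)
    (hcomm : ∀ x, F (f x) = f (F x)) (hδ : 0 < δ) (hF1 : ∀ x, δ ≤ F x - x)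
    (hF2 : ∀ x, F x - x ≤ M) (hsum : ∀ x, ∑ i ∈ Finset.range Q, (F (f^[i] x) - f^[i] x) ≤ 1) :
    (∀ i ≤ Q, ∀ x, 0 < dIter f f1 i x ∧ dIter f f1 i x ≤ Real.exp a * M / δ) ∧
    (∀ i ≤ Q, ∀ x, ∑ j ∈ Finset.range i, dIter f f1 j x ≤ Real.exp a / δ) ∧
    ∀ i ≤ Q, ∀ x, nIter f f1 n i x ^ 2 ≤ 2 * a' * (Real.exp a) ^ 2 * M / δ ^ 2 := by
  have ha : 0 ≤ a := (abs_nonneg _).trans (hn 0)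
  have ha' : 0 ≤ a' := (abs_nonneg _).trans (hs 0)
  have hM : 0 < M := hδ.trans_le ((hF1 0).trans (hF2 0))
  have hmono : StrictMono f := strictMono_of_hasDerivAt_pos (fun x => (hJ x).d1) hpos
  have hmi : ∀ i, StrictMono (f^[i]) := fun i => hmono.iterate i
  have hD0 : ∀ i x, 0 < dIter f f1 i x := fun i x => Finset.prod_pos fun j _ => hpos _
  have hcommi : ∀ i x, F (f^[i] x) = f^[i] (F x) := fun i x =>
    (Function.Commute.iterate_right (show Function.Commute F f from hcomm) i) x
  have hlog : ∀ x y, |Real.log (f1 y) - Real.log (f1 x)| ≤ a * |y - x| := fun x y => by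
    have h1 : ∀ z, HasDerivAt (fun z => Real.log (f1 z)) (n z) z := fun z =>
      ((hJ z).d2.log (hpos z).ne').congr_deriv (by field_simp [(hpos z).ne'])
    have := convex_univ.norm_image_sub_le_of_norm_hasDerivWithin_le (f := fun z => Real.log (f1 z))
      (fun z _ => (h1 z).hasDerivWithinAt) (fun z _ => hn z) (Set.mem_univ x) (Set.mem_univ y)
    simpa [Real.norm_eq_abs] using this
  have hlogD : ∀ i x, Real.log (dIter f f1 i x) =
      ∑ j ∈ Finset.range i, Real.log (f1 (f^[j] x)) := fun i x => by
    rw [dIter, Real.log_prod fun j _ => (hpos _).ne']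
  have hpt : ∀ i ≤ Q, ∀ x, dIter f f1 i x ≤ Real.exp a * (F (f^[i] x) - f^[i] x) / δ := by
    intro i hi x
    have hx : x < F x := by linarith [hF1 x]
    obtain ⟨ξ, hξ, hξe⟩ := exists_hasDerivAt_eq_slope (f^[i]) (dIter f f1 i) hx
      (fun z _ => (hasDerivAt_iterate_dIter fun j _ => hJ _).continuousAt.continuousWithinAt)
      (fun z _ => hasDerivAt_iterate_dIter fun j _ => hJ _)
    have h1 : dIter f f1 i ξ * δ ≤ F (f^[i] x) - f^[i] x := by
      rw [hcommi, ← div_mul_cancel₀ (f^[i] (F x) - f^[i] x) (sub_pos.2 hx).ne', ← hξe]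
      exact mul_le_mul_of_nonneg_left (hF1 x) (hD0 _ _).le
    have h2 : Real.log (dIter f f1 i x) ≤ Real.log (dIter f f1 i ξ) + a := by
      rw [hlogD, hlogD, ← sub_le_iff_le_add', ← Finset.sum_sub_distrib]
      calc ∑ j ∈ Finset.range i, (Real.log (f1 (f^[j] x)) - Real.log (f1 (f^[j] ξ)))
          ≤ ∑ j ∈ Finset.range i, a * (F (f^[j] x) - f^[j] x) := by
            refine Finset.sum_le_sum fun j _ => ?_
            refine (le_abs_self _).trans ((hlog _ _).trans ?_)
            have h3 := (hmi j).lt_iff_lt.2 hξ.1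
            have h4 := (hmi j).lt_iff_lt.2 hξ.2
            rw [hcommi, abs_sub_comm, abs_of_pos (by linarith)]
            gcongr
        _ ≤ ∑ j ∈ Finset.range Q, a * (F (f^[j] x) - f^[j] x) :=
            Finset.sum_le_sum_of_subset_of_nonneg (Finset.range_mono hi) fun j _ _ =>
              mul_nonneg ha (hδ.le.trans (hF1 _))
        _ ≤ a := by
            rw [← Finset.mul_sum]
            exact mul_le_of_le_one_right ha (hsum x)
    have h3 : dIter f f1 i x ≤ dIter f f1 i ξ * Real.exp a := by
      rw [← Real.log_le_log_iff (hD0 _ _) (mul_pos (hD0 _ _) (Real.exp_pos _)),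
        Real.log_mul (hD0 _ _).ne' (Real.exp_pos _).ne', Real.log_exp]
      exact h2
    rw [le_div_iff₀ hδ]
    calc dIter f f1 i x * δ ≤ dIter f f1 i ξ * Real.exp a * δ := by gcongr
      _ = Real.exp a * (dIter f f1 i ξ * δ) := by ring
      _ ≤ _ := by gcongr
  have hpt2 : ∀ i ≤ Q, ∀ x, dIter f f1 i x ≤ Real.exp a * M / δ := fun i hi x =>
    (hpt i hi x).trans (by gcongr; exact hF2 _)
  have hsumD : ∀ i ≤ Q, ∀ x, ∑ j ∈ Finset.range i, dIter f f1 j x ≤ Real.exp a / δ := by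
    intro i hi x
    calc _ ≤ ∑ j ∈ Finset.range Q, dIter f f1 j x :=
          Finset.sum_le_sum_of_subset_of_nonneg (Finset.range_mono hi) fun j _ _ => (hD0 _ _).le
      _ ≤ ∑ j ∈ Finset.range Q, Real.exp a / δ * (F (f^[j] x) - f^[j] x) :=
          Finset.sum_le_sum fun j hj => (hpt j (Finset.mem_range.1 hj).le x).trans
            (by rw [mul_div_right_comm])
      _ ≤ _ := by
          rw [← Finset.mul_sum]
          exact mul_le_of_le_one_right (by positivity) (hsum x)
  refine ⟨fun i hi x => ⟨hD0 i x, hpt2 i hi x⟩, hsumD, fun i hi => ?_⟩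
  have hS : ∀ x, |sIter f f1 s i x| ≤ a' * (Real.exp a) ^ 2 * M / δ ^ 2 := by
    intro x
    calc |sIter f f1 s i x| ≤ ∑ j ∈ Finset.range i, |s (f^[j] x) * dIter f f1 j x ^ 2| :=
          Finset.abs_sum_le_sum_abs _ _
      _ ≤ ∑ j ∈ Finset.range i, a' * (Real.exp a * M / δ) * dIter f f1 j x := by
          refine Finset.sum_le_sum fun j hj => ?_
          have h1 := hpt2 j ((Finset.mem_range.1 hj).le.trans hi) x
          rw [abs_mul, abs_of_nonneg (sq_nonneg (dIter f f1 j x)), sq, ← mul_assoc]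
          have := hD0 j x
          gcongr
          exact hs _
      _ ≤ a' * (Real.exp a * M / δ) * (Real.exp a / δ) := by
          rw [← Finset.mul_sum]
          exact mul_le_mul_of_nonneg_left (hsumD i hi x) (by positivity)
      _ = _ := by field_simp
  have hND : ∀ x, HasDerivAt (nIter f f1 n i) (nIter f f1 n i x ^ 2 / 2 + sIter f f1 s i x) x :=
    fun x => hasDerivAt_nIter fun j _ => hJ _
  have hfi : ∀ j x, f^[j] (x + 1) = f^[j] x + 1 := fun j x =>
    (Function.Commute.iterate_left (show Function.Commute f (· + 1) from hf) j) x
  have hper : Function.Periodic (nIter f f1 n i) 1 := fun x => by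
    simp only [nIter, dIter, hfi, hf1, hnp]
  have hcont : Continuous (nIter f f1 n i) := continuous_iff_continuousAt.2 fun x =>
    (hND x).continuousAt
  obtain ⟨m, -, hm⟩ := isCompact_Icc.exists_isMaxOn (Set.nonempty_Icc.2 zero_le_one)
    (hcont.pow 2).continuousOn (s := Set.Icc (0 : ℝ) 1)
  have hmax : ∀ x, nIter f f1 n i x ^ 2 ≤ nIter f f1 n i m ^ 2 := by
    intro x
    obtain ⟨y, hy, hxy⟩ := hper.exists_mem_Ico₀ one_pos x
    rw [hxy]
    exact hm ⟨hy.1, hy.2.le⟩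
  have hzero := IsLocalMax.hasDerivAt_eq_zero (f := fun x => nIter f f1 n i x ^ 2)
    (Filter.Eventually.of_forall hmax) ((hND m).pow 2)
  intro x
  refine (hmax x).trans ?_
  have h1 := (abs_le.1 (hS m)).1
  have h2 : 0 ≤ a' * (Real.exp a) ^ 2 * M / δ ^ 2 := by positivity
  have h3 : 2 * a' * (Real.exp a) ^ 2 * M / δ ^ 2 = 2 * (a' * (Real.exp a) ^ 2 * M / δ ^ 2) := by
    ring
  rw [h3]
  simp only [Nat.cast_ofNat, Nat.add_one_sub_one, pow_one, mul_eq_zero] at hzero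
  rcases hzero with h | h
  · rcases h with h | h
    · norm_num at h
    · rw [h]; linarith
  · linarith

lemma gronwallBound_le {d k e x : ℝ} (hk : 0 ≤ k) (he : 0 ≤ e) (hx : 0 ≤ x) :
    gronwallBound d k e x ≤ (d + e * x) * Real.exp (k * x) := by
  rcases hk.eq_or_lt with rfl | hk
  · rw [gronwallBound_K0]; simp
  · rw [gronwallBound_of_K_ne_0 hk.ne', add_mul]
    refine add_le_add le_rfl ?_
    have h1 := Real.add_one_le_exp (-(k * x))
    have h2 : Real.exp (k * x) - 1 ≤ k * x * Real.exp (k * x) := by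
      have h3 : Real.exp (-(k * x)) * Real.exp (k * x) = 1 := by rw [← Real.exp_add]; simp
      nlinarith [Real.exp_pos (k * x)]
    calc e / k * (Real.exp (k * x) - 1) ≤ e / k * (k * x * Real.exp (k * x)) := by gcongr
      _ = _ := by field_simp

lemma norm_le_of_deriv_le_in_ball {u u' : ℂ → ℂ} {x0 z : ℂ} {R k e : ℝ}
    (hu : ∀ w ∈ Metric.ball x0 R, HasDerivAt u (u' w) w)
    (hb : ∀ w ∈ Metric.ball x0 R, ‖u' w‖ ≤ k * ‖u w‖ + e) (hk : 0 ≤ k) (he : 0 ≤ e)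
    (hz : z ∈ Metric.ball x0 R) : ‖u z‖ ≤ (‖u x0‖ + e * R) * Real.exp (k * R) := by
  have hzR : ‖z - x0‖ ≤ R := by rw [← dist_eq_norm]; exact (Metric.mem_ball.1 hz).le
  have hR : 0 ≤ R := (norm_nonneg _).trans hzR
  have hmem : ∀ t ∈ Set.Icc (0 : ℝ) 1, x0 + t * (z - x0) ∈ Metric.ball x0 R := fun t ht => by
    rw [Metric.mem_ball, dist_eq_norm, add_sub_cancel_left, norm_mul, Complex.norm_real,
      Real.norm_eq_abs, abs_of_nonneg ht.1]
    rw [Metric.mem_ball, dist_eq_norm] at hz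
    nlinarith [ht.2, norm_nonneg (z - x0)]
  have hd : ∀ t ∈ Set.Icc (0 : ℝ) 1, HasDerivAt (fun t : ℝ => u (x0 + t * (z - x0)))
      (u' (x0 + t * (z - x0)) * (z - x0)) t := fun t ht => by
    have h1 : HasDerivAt (fun t : ℂ => x0 + t * (z - x0)) (z - x0) (t : ℂ) := by
      simpa using ((hasDerivAt_id (t : ℂ)).mul_const (z - x0)).const_add x0
    exact ((hu _ (hmem t ht)).comp (t : ℂ) h1).comp_ofReal
  have h := norm_le_gronwallBound_of_norm_deriv_right_le (a := 0) (b := 1)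
    (δ := ‖u x0‖) (K := k * R) (ε := e * R)
    (fun t ht => (hd t ht).continuousAt.continuousWithinAt)
    (fun t ht => (hd t (Set.Ico_subset_Icc_self ht)).hasDerivWithinAt) (by simp)
    (fun t ht => by
      rw [norm_mul]
      have h1 := hb _ (hmem t (Set.Ico_subset_Icc_self ht))
      calc _ ≤ (k * ‖u (x0 + t * (z - x0))‖ + e) * R := by gcongr
        _ = _ := by ring) 1 (by simp)
  have h2 := gronwallBound_le (d := ‖u x0‖) (mul_nonneg hk hR) (mul_nonneg he hR)
    (x := 1 - 0) (by norm_num)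
  simpa using h.trans h2

/-- control of the iterates in a complex disc -/
lemma disc_bounds {g g1 n s : ℂ → ℂ} {ν a a' R η P S H : ℝ} {x0 : ℂ} {Q : ℕ}
    (hJ : ∀ z ∈ strip ν, Jet g g1 n s z) (hn : ∀ z ∈ strip ν, ‖n z‖ ≤ a)
    (hs : ∀ z ∈ strip ν, ‖s z‖ ≤ a') (hre : ∀ i, (g^[i] x0).im = 0)
    (hP : ∀ i ≤ Q, ‖dIter g g1 i x0‖ ≤ P)
    (hS : ∀ i ≤ Q, ∑ j ∈ Finset.range i, ‖dIter g g1 j x0‖ ≤ S)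
    (hη : ∀ i ≤ Q, ‖nIter g g1 n i x0‖ ≤ η) (hR : 0 < R) (hν : 2 * P * R < ν)
    (hH : H = (η + 4 * a' * P * S * R) * Real.exp (a * S * R)) (hHR : H * R ≤ 1 / 2) :
    ∀ i ≤ Q, ∀ z ∈ Metric.ball x0 R, (∀ j < i, g^[j] z ∈ strip ν) ∧
      ‖dIter g g1 i z - dIter g g1 i x0‖ ≤ 2 * H * R * ‖dIter g g1 i x0‖ ∧
      ‖nIter g g1 n i z‖ ≤ H := by
  have hP0 : 0 ≤ P := (norm_nonneg _).trans (hP 0 (Nat.zero_le _))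
  have hS0 : 0 ≤ S := by simpa using hS 0 (Nat.zero_le _)
  have hη0 : 0 ≤ η := (norm_nonneg _).trans (hη 0 (Nat.zero_le _))
  have hν0 : 0 < ν := lt_of_le_of_lt (by positivity) hν
  have hx0 : x0 ∈ strip ν := by
    have : x0.im = 0 := hre 0
    show |x0.im| < ν
    rw [this]; simpa using hν0
  have ha : 0 ≤ a := (norm_nonneg _).trans (hn _ hx0)
  have ha' : 0 ≤ a' := (norm_nonneg _).trans (hs _ hx0)
  have hH0 : 0 ≤ H := by rw [hH]; positivity
  have hx0R : x0 ∈ Metric.ball x0 R := Metric.mem_ball_self hR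
  intro i
  induction i using Nat.strong_induction_on with
  | _ i ih =>
  intro hi
  have hD2 : ∀ j < i, ∀ z ∈ Metric.ball x0 R, ‖dIter g g1 j z‖ ≤ 2 * ‖dIter g g1 j x0‖ := by
    intro j hj z hz
    have h1 := (ih j hj (by omega) z hz).2.1
    have h2 := norm_sub_norm_le (dIter g g1 j z) (dIter g g1 j x0)
    nlinarith [norm_nonneg (dIter g g1 j x0)]
  have horb : ∀ z ∈ Metric.ball x0 R, ∀ j < i, g^[j] z ∈ strip ν := by
    intro z hz j hj
    have h1 := (convex_ball x0 R).norm_image_sub_le_of_norm_hasDerivWithin_le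
      (f := g^[j]) (f' := dIter g g1 j) (C := 2 * P)
      (fun w hw => (hasDerivAt_iterate_dIter fun k hk =>
        hJ _ ((ih j hj (by omega) w hw).1 k hk)).hasDerivWithinAt)
      (fun w hw => (hD2 j hj w hw).trans (by gcongr; exact hP j (by omega))) hx0R hz
    have h2 := Complex.abs_im_le_norm (g^[j] z - g^[j] x0)
    rw [Complex.sub_im, hre, sub_zero] at h2
    have h3 : ‖z - x0‖ ≤ R := by rw [← dist_eq_norm]; exact (Metric.mem_ball.1 hz).le
    refine lt_of_le_of_lt (h2.trans (h1.trans ?_)) hν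
    gcongr
  have hJi : ∀ z ∈ Metric.ball x0 R, ∀ j < i, Jet g g1 n s (g^[j] z) := fun z hz j hj =>
    hJ _ (horb z hz j hj)
  have hsumD : ∀ z ∈ Metric.ball x0 R, ∑ j ∈ Finset.range i, ‖dIter g g1 j z‖ ≤ 2 * S := by
    intro z hz
    calc _ ≤ ∑ j ∈ Finset.range i, 2 * ‖dIter g g1 j x0‖ :=
          Finset.sum_le_sum fun j hj => hD2 j (Finset.mem_range.1 hj) z hz
      _ ≤ _ := by
          rw [← Finset.mul_sum]
          gcongr
          exact hS i hi
  have hN : ∀ z ∈ Metric.ball x0 R, ‖nIter g g1 n i z‖ ≤ 2 * a * S := by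
    intro z hz
    calc _ ≤ ∑ j ∈ Finset.range i, ‖n (g^[j] z) * dIter g g1 j z‖ := norm_sum_le _ _
      _ ≤ ∑ j ∈ Finset.range i, a * ‖dIter g g1 j z‖ := by
          refine Finset.sum_le_sum fun j hj => ?_
          rw [norm_mul]
          gcongr
          exact hn _ (horb z hz j (Finset.mem_range.1 hj))
      _ ≤ _ := by
          rw [← Finset.mul_sum]
          nlinarith [hsumD z hz]
  have hSch : ∀ z ∈ Metric.ball x0 R, ‖sIter g g1 s i z‖ ≤ 4 * a' * P * S := by
    intro z hz
    calc _ ≤ ∑ j ∈ Finset.range i, ‖s (g^[j] z) * dIter g g1 j z ^ 2‖ := norm_sum_le _ _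
      _ ≤ ∑ j ∈ Finset.range i, a' * (2 * P) * ‖dIter g g1 j z‖ := by
          refine Finset.sum_le_sum fun j hj => ?_
          have hj := Finset.mem_range.1 hj
          rw [norm_mul, norm_pow, sq, ← mul_assoc]
          gcongr
          · exact hs _ (horb z hz j hj)
          · exact (hD2 j hj z hz).trans (by gcongr; exact hP j (by omega))
      _ ≤ _ := by
          rw [← Finset.mul_sum]
          calc _ ≤ a' * (2 * P) * (2 * S) := by gcongr; exact hsumD z hz
            _ = _ := by ring
  have hNH : ∀ z ∈ Metric.ball x0 R, ‖nIter g g1 n i z‖ ≤ H := by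
    intro z hz
    have h1 := norm_le_of_deriv_le_in_ball (k := a * S) (e := 4 * a' * P * S)
      (fun w hw => hasDerivAt_nIter (hJi w hw)) (fun w hw => by
        refine (norm_add_le _ _).trans (add_le_add ?_ (hSch w hw))
        rw [norm_div, norm_pow, Complex.norm_ofNat]
        nlinarith [hN w hw, norm_nonneg (nIter g g1 n i w)]) (by positivity) (by positivity) hz
    refine h1.trans ?_
    rw [hH]
    gcongr
    exact hη i hi
  intro z hz
  refine ⟨horb z hz, ?_, hNH z hz⟩
  obtain ⟨d, hd⟩ : ∃ d, d = ‖dIter g g1 i x0‖ := ⟨_, rfl⟩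
  have h1 := norm_le_of_deriv_le_in_ball (k := H) (e := H * d)
    (u := fun w => dIter g g1 i w - dIter g g1 i x0)
    (fun w hw => (hasDerivAt_dIter (hJi w hw)).sub_const _) (fun w hw => by
      rw [norm_mul]
      have h2 := norm_sub_norm_le (dIter g g1 i w) (dIter g g1 i x0)
      rw [← hd] at h2
      have h3 := hNH w hw
      nlinarith [norm_nonneg (dIter g g1 i w), norm_nonneg (nIter g g1 n i w)])
      hH0 (by rw [hd]; positivity) hz
  rw [sub_self, norm_zero, zero_add] at h1
  rw [← hd]
  have h2 : Real.exp (H * R) ≤ 2 := by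
    have h3 := Real.exp_le_exp.2 hHR
    have h4 : Real.exp (1 / 2) * Real.exp (1 / 2) = Real.exp 1 := by
      rw [← Real.exp_add]; norm_num
    nlinarith [Real.exp_one_lt_d9, Real.exp_pos (1 / 2)]
  refine h1.trans ?_
  have h3 : 0 ≤ H * d * R := by rw [hd]; positivity
  nlinarith

/-- `g` extends the lift `f` of a circle diffeomorphism to a strip where the logarithmic derivative
of its derivative and its Schwarzian derivative are bounded by `a` and `a'` -/
structure StripJet (f : ℝ → ℝ) (g g1 n s : ℂ → ℂ) (f1 m t : ℝ → ℝ) (ν a a' : ℝ) : Prop where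
  jet : ∀ z ∈ strip ν, Jet g g1 n s z
  norm_n : ∀ z ∈ strip ν, ‖n z‖ ≤ a
  norm_s : ∀ z ∈ strip ν, ‖s z‖ ≤ a'
  real0 : ∀ x : ℝ, g x = f x
  real1 : ∀ x : ℝ, g1 x = f1 x
  real2 : ∀ x : ℝ, n x = m x
  real3 : ∀ x : ℝ, s x = t x
  pos : ∀ x, 0 < f1 x
  per0 : ∀ x, f (x + 1) = f x + 1
  per1 : ∀ x, f1 (x + 1) = f1 x
  per2 : ∀ x, m (x + 1) = m x

lemma im_eq_zero_of_hasDerivAt {u : ℂ → ℂ} {u' : ℂ} {x : ℝ} (h : HasDerivAt u u' x)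
    (hu : ∀ y : ℝ, (u y).im = 0) : u'.im = 0 := by
  have h1 : HasDerivAt (fun y : ℝ => (u y).im) u'.im x :=
    (Complex.imCLM.hasFDerivAt.comp_hasDerivAt x h.comp_ofReal)
  simp only [hu] at h1
  exact h1.unique (hasDerivAt_const x 0)

lemma hasDerivAt_of_ofReal {u : ℂ → ℂ} {v : ℝ → ℝ} {u' : ℂ} {v' x : ℝ} (h : HasDerivAt u u' x)
    (hu : ∀ y : ℝ, u y = v y) (hv : u' = v') : HasDerivAt v v' x := by
  have h1 := h.real_of_complex
  simp only [hu, hv, Complex.ofReal_re] at h1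
  exact h1

lemma exists_stripJet {f : ℝ ≃o ℝ} {g : ℂ → ℂ} {ν a a' : ℝ} (hν : 0 < ν)
    (hg : DifferentiableOn ℂ g (strip ν)) (hgf : ∀ x : ℝ, g x = f x)
    (hg1 : ∀ z, g (z + 1) = g z + 1) (hne : ∀ z ∈ strip ν, deriv g z ≠ 0)
    (hn : ∀ z ∈ strip ν, ‖deriv (deriv g) z / deriv g z‖ ≤ a)
    (hs : ∀ z ∈ strip ν, ‖deriv (fun w => deriv (deriv g) w / deriv g w) z -
      (deriv (deriv g) z / deriv g z) ^ 2 / 2‖ ≤ a') :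
    ∃ g1 n s f1 m t, StripJet f g g1 n s f1 m t ν a a' := by
  have oU := isOpen_strip ν
  obtain ⟨g1, hg1d⟩ : ∃ g1, g1 = deriv g := ⟨_, rfl⟩
  obtain ⟨n, hnd⟩ : ∃ n : ℂ → ℂ, n = fun w => deriv (deriv g) w / deriv g w := ⟨_, rfl⟩
  obtain ⟨s, hsd⟩ : ∃ s : ℂ → ℂ, s = fun w => deriv n w - n w ^ 2 / 2 := ⟨_, rfl⟩
  have hdg : DifferentiableOn ℂ (deriv g) (strip ν) := hg.deriv oU
  have hddg : DifferentiableOn ℂ (deriv (deriv g)) (strip ν) := hdg.deriv oU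
  have hnD : DifferentiableOn ℂ n (strip ν) := hnd ▸ hddg.div hdg hne
  have hJ : ∀ z ∈ strip ν, Jet g g1 n s z := fun z hz => by
    have hz' := oU.mem_nhds hz
    refine ⟨?_, ?_, ?_⟩
    · rw [hg1d]; exact (hg.differentiableAt hz').hasDerivAt
    · rw [hg1d, hnd]
      refine (hdg.differentiableAt hz').hasDerivAt.congr_deriv ?_
      field_simp [hne z hz]
    · refine (hnD.differentiableAt hz').hasDerivAt.congr_deriv ?_
      rw [hsd]; ring
  have hr0 : ∀ x : ℝ, (g x).im = 0 := fun x => by rw [hgf]; simp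
  have hxs : ∀ x : ℝ, (x : ℂ) ∈ strip ν := strip_real hν
  have hr1 : ∀ x : ℝ, (g1 x).im = 0 := fun x =>
    im_eq_zero_of_hasDerivAt (hJ x (hxs x)).d1 hr0
  have of_im : ∀ {w : ℂ}, w.im = 0 → w = (w.re : ℝ) := fun {w} h =>
    Complex.ext (by simp) (by simp [h])
  have hne1 : ∀ x : ℝ, g1 x ≠ 0 := fun x => hg1d ▸ hne x (hxs x)
  have hre1 : ∀ x : ℝ, (g1 x).re ≠ 0 := fun x h => hne1 x (Complex.ext h (hr1 x))
  have hr2 : ∀ x : ℝ, (n x).im = 0 := fun x => by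
    have h1 := im_eq_zero_of_hasDerivAt (hJ x (hxs x)).d2 hr1
    rw [Complex.mul_im, hr1, zero_mul, add_zero] at h1
    exact (mul_eq_zero.1 h1).resolve_left (hre1 x)
  have hr3 : ∀ x : ℝ, (s x).im = 0 := fun x => by
    have h1 := im_eq_zero_of_hasDerivAt (hJ x (hxs x)).d3 hr2
    rw [of_im (hr2 x)] at h1
    have h2 : ((((n x).re : ℝ) : ℂ) ^ 2 / 2).im = 0 := by
      rw [show ((((n x).re : ℝ) : ℂ) ^ 2 / 2) = (((n x).re ^ 2 / 2 : ℝ) : ℂ) by push_cast; rfl]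
      exact Complex.ofReal_im _
    rwa [Complex.add_im, h2, zero_add] at h1
  have hp1 : ∀ z, g1 (z + 1) = g1 z := fun z => by
    rw [hg1d, ← deriv_comp_add_const, show (fun x => g (x + 1)) = fun x => g x + 1 from
      funext hg1, deriv_add_const]
  have hp2 : ∀ z, n (z + 1) = n z := fun z => by
    rw [hnd]; simp only [← hg1d]
    rw [hp1, ← deriv_comp_add_const, show (fun x => g1 (x + 1)) = g1 from funext hp1]
  have hpr : ∀ x : ℝ, ((x + 1 : ℝ) : ℂ) = (x : ℂ) + 1 := fun x => by push_cast; rfl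
  refine ⟨g1, n, s, fun x => (g1 x).re, fun x => (n x).re, fun x => (s x).re, hJ, ?_, ?_, hgf,
    fun x => of_im (hr1 x), fun x => of_im (hr2 x), fun x => of_im (hr3 x), fun x => ?_,
    fun x => ?_, fun x => ?_, fun x => ?_⟩
  · rw [hnd]; exact hn
  · rw [hsd, hnd]; exact hs
  · have h1 : HasDerivAt f (g1 x).re x :=
      hasDerivAt_of_ofReal (hJ x (hxs x)).d1 hgf (of_im (hr1 x))
    refine lt_of_le_of_ne ?_ (Ne.symm (hre1 x))
    rw [← h1.deriv]
    exact f.strictMono.monotone.deriv_nonneg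
  · have := hg1 x
    rw [← hpr, hgf, hgf] at this
    exact_mod_cast this
  · rw [hpr, hp1]
  · rw [hpr, hp2]

namespace StripJet

variable {f : ℝ → ℝ} {g g1 n s : ℂ → ℂ} {f1 m t : ℝ → ℝ} {ν a a' : ℝ}

lemma real_jet (h : StripJet f g g1 n s f1 m t ν a a') (hν : 0 < ν) (x : ℝ) :
    Jet f f1 m t x := by
  have h1 := h.jet x (strip_real hν x)
  refine ⟨hasDerivAt_of_ofReal h1.d1 h.real0 (h.real1 x),
    hasDerivAt_of_ofReal h1.d2 h.real1 ?_, hasDerivAt_of_ofReal h1.d3 h.real2 ?_⟩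
  · rw [h.real1, h.real2]; push_cast; rfl
  · rw [h.real2, h.real3]; push_cast; rfl

lemma iterate_ofReal (h : StripJet f g g1 n s f1 m t ν a a') (i : ℕ) (x : ℝ) :
    g^[i] x = (f^[i] x : ℝ) := by
  induction i with
  | zero => simp
  | succ i ih => rw [Function.iterate_succ_apply', Function.iterate_succ_apply', ih, h.real0]

lemma dIter_ofReal (h : StripJet f g g1 n s f1 m t ν a a') (i : ℕ) (x : ℝ) :
    dIter g g1 i x = (dIter f f1 i x : ℝ) := by
  simp only [dIter, h.iterate_ofReal, h.real1]
  push_cast; rfl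

lemma nIter_ofReal (h : StripJet f g g1 n s f1 m t ν a a') (i : ℕ) (x : ℝ) :
    nIter g g1 n i x = (nIter f f1 m i x : ℝ) := by
  simp only [nIter, h.iterate_ofReal, h.real2, h.dIter_ofReal]
  push_cast; rfl

end StripJet

lemma exists_good_of_stripJet : ∃ K0 c : ℝ, 0 < K0 ∧ 0 < c ∧ ∀ (f : ℝ → ℝ) (g g1 n s : ℂ → ℂ)
    (f1 m t : ℝ → ℝ) (ν a a' : ℝ) (A B : ℝ ≃o ℝ) (ρ p p' δ M K x0 h : ℝ) (q q' Q : ℕ),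
    StripJet f g g1 n s f1 m t ν a a' → K0 ≤ K → 0 < ρ → ρ < 1 → RotPair A B (-ρ) → HolDiff A →
    q ≤ Q → q' ≤ Q → (∀ x, A x = f^[q] x + p) → (∀ x, B x = f^[q'] x + p') →
    (∀ x, A (f x) = f (A x)) → 0 < δ → (∀ x, δ ≤ A x - x) → A x0 - x0 = δ →
    (∀ x, A x - x ≤ M) →
    (∀ x, ∑ i ∈ Finset.range Q, (A (f^[i] x) - f^[i] x) ≤ 1) →
    2 * K * Real.exp a * M < ν →
    h = K * Real.exp a * (√(2 * a' * M) + 4 * a' * Real.exp a * M * K) *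
      Real.exp (a * K * Real.exp a) → 2 * h ≤ c →
    (2 * h ≤ c / K ∨ ∀ z ∈ Metric.ball (x0 : ℂ) (K * δ), ‖dIter g g1 q z - 1‖ ≤ c / K) →
    ∃ Λ : ℝ ≃o ℝ, HolDiff Λ ∧ Λ * A * Λ⁻¹ = tr 1 ∧ Good ρ (K / 20) (Λ * B⁻¹ * Λ⁻¹) := by
  obtain ⟨K0, c, hK0, hc, disc⟩ := exists_good_of_disc
  refine ⟨K0, min c 1, hK0, lt_min hc one_pos, ?_⟩
  intro f g g1 n s f1 m t ν a a' A B ρ p p' δ M K x0 h q q' Q hG hK hρ hρ1 hAB hA hq hq' hAf hBf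
    hcomm hδ hmin hx0 hM hsum hν hh hhc hAc
  have hKp : 0 < K := hK0.trans_le hK
  have hMp : 0 < M := hδ.trans_le ((hmin 0).trans (hM 0))
  have hν0 : 0 < ν := lt_trans (by positivity) hν
  have ha' : 0 ≤ a' := (norm_nonneg _).trans (hG.norm_s _ (strip_real hν0 0))
  have hJr := fun x => hG.real_jet hν0 x
  obtain ⟨b1, b2, b3⟩ := iterate_bounds (F := A) (a := a) (a' := a') hJr hG.pos
    (fun x => by
      have := hG.norm_n x (strip_real hν0 x)
      rwa [hG.real2, Complex.norm_real, Real.norm_eq_abs] at this)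
    (fun x => by
      have := hG.norm_s x (strip_real hν0 x)
      rwa [hG.real3, Complex.norm_real, Real.norm_eq_abs] at this)
    hG.per0 hG.per1 hG.per2 hcomm hδ hmin hM hsum
  have hd := disc_bounds (R := K * δ) (η := √(2 * a' * M) * Real.exp a / δ) (Q := Q)
    (P := Real.exp a * M / δ) (S := Real.exp a / δ) (x0 := x0) (H := h / (K * δ))
    hG.jet hG.norm_n hG.norm_s
    (fun i => by rw [hG.iterate_ofReal, Complex.ofReal_im])
    (fun i hi => by
      rw [hG.dIter_ofReal, Complex.norm_real, Real.norm_eq_abs, abs_of_pos (b1 i hi x0).1]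
      exact (b1 i hi x0).2)
    (fun i hi => by
      refine le_trans (le_of_eq ?_) (b2 i hi x0)
      refine Finset.sum_congr rfl fun j hj => ?_
      have hj' := (Finset.mem_range.1 hj).le.trans hi
      rw [hG.dIter_ofReal, Complex.norm_real, Real.norm_eq_abs, abs_of_pos (b1 j hj' x0).1])
    (fun i hi => by
      rw [hG.nIter_ofReal, Complex.norm_real, Real.norm_eq_abs]
      refine abs_le_of_sq_le_sq ((b3 i hi x0).trans (le_of_eq ?_)) (by positivity)
      rw [div_pow, mul_pow, Real.sq_sqrt (by positivity)]; ring)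
    (by positivity) (by
      rw [show 2 * (Real.exp a * M / δ) * (K * δ) = 2 * K * Real.exp a * M by field_simp]
      exact hν)
    (by
      rw [hh, show a * (Real.exp a / δ) * (K * δ) = a * K * Real.exp a by field_simp]
      field_simp)
    (by
      rw [div_mul_cancel₀ _ (by positivity : K * δ ≠ 0)]
      have := hhc.trans (min_le_right c 1)
      linarith)
  have e2 : 2 * (h / (K * δ)) * (K * δ) = 2 * h := by field_simp
  rw [e2] at hd
  have hmem : ∀ z ∈ Metric.ball (0 : ℂ) K, (x0 + δ * z : ℂ) ∈ Metric.ball (x0 : ℂ) (K * δ) := by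
    intro z hz
    rw [mem_ball_zero_iff] at hz
    rw [mem_ball_iff_norm, add_sub_cancel_left, norm_mul, Complex.norm_real, Real.norm_eq_abs,
      abs_of_pos hδ, mul_comm]
    exact mul_lt_mul_of_pos_right hz hδ
  have hder : ∀ i ≤ Q, ∀ r : ℝ, ∀ z ∈ Metric.ball (0 : ℂ) K,
      HasDerivAt (fun u : ℂ => (g^[i] (x0 + δ * u) + r - x0) / δ) (dIter g g1 i (x0 + δ * z)) z := by
    intro i hi r z hz
    have h1 := hasDerivAt_iterate_dIter (i := i) (g := g) (g1 := g1) (n := n) (s := s)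
      (z := x0 + δ * z) fun j hj => hG.jet _ ((hd i hi _ (hmem z hz)).1 j hj)
    have h2 : HasDerivAt (fun u : ℂ => (x0 + δ * u : ℂ)) δ z := by
      simpa using ((hasDerivAt_id z).const_mul (δ : ℂ)).const_add (x0 : ℂ)
    have h3 := (((h1.comp z h2).add_const (r : ℂ)).sub_const (x0 : ℂ)).div_const (δ : ℂ)
    refine h3.congr_deriv ?_
    exact mul_div_cancel_right₀ _ (Complex.ofReal_ne_zero.2 hδ.ne')
  have hdq : dIter f f1 q x0 = 1 := by
    have h1 : HasDerivAt (fun y => f^[q] y + p - y) (dIter f f1 q x0 - 1) x0 :=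
      ((hasDerivAt_iterate_dIter (n := m) (s := t) fun j _ => hJr _).add_const p).sub
        (hasDerivAt_id x0)
    have h2 : IsLocalMin (fun y => f^[q] y + p - y) x0 := Eventually.of_forall fun y => by
      have := hmin y
      rw [← hx0, hAf, hAf] at this
      exact this
    linarith [h2.hasDerivAt_eq_zero h1]
  obtain ⟨L, hL⟩ : ∃ L : ℝ ≃o ℝ, L = (dil hδ)⁻¹ * tr (-x0) := ⟨_, rfl⟩
  have hLx : ∀ x, L x = (x - x0) / δ := fun x => by
    rw [hL, mul_apply', dil_inv_apply, tr_apply]; rfl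
  have hLi : ∀ u, L⁻¹ u = x0 + δ * u := fun u => by
    apply L.injective
    rw [apply_inv_self', hLx]; field_simp; ring
  have hLH : HolDiff L := hL ▸ (holDiff_dil hδ).inv.mul (holDiff_tr _)
  have hval : ∀ (C : ℝ ≃o ℝ) (i : ℕ) (r : ℝ), (∀ x, C x = f^[i] x + r) → ∀ x : ℝ,
      ((g^[i] (x0 + δ * (x : ℂ)) + r - x0) / δ : ℂ) = (L * C * L⁻¹) x := by
    intro C i r hC x
    rw [mul_apply', mul_apply', hLi, hLx, hC]
    rw [show (x0 + δ * (x : ℂ) : ℂ) = ((x0 + δ * x : ℝ) : ℂ) by push_cast; rfl,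
      hG.iterate_ofReal]
    push_cast; rfl
  have hD0 := (b1 q' hq' x0).1
  obtain ⟨Λ, h1, h2, h3⟩ := disc K (L * A * L⁻¹) (L * B * L⁻¹) ρ (dIter f f1 q' x0)
    (fun u : ℂ => (g^[q] (x0 + δ * u) + p - x0) / δ)
    (fun u : ℂ => (g^[q'] (x0 + δ * u) + p' - x0) / δ) hK hρ hρ1 (hAB.conj L)
    ((hLH.mul hA).mul hLH.inv)
    (fun z hz => (hder q hq p z hz).differentiableAt.differentiableWithinAt)
    (fun z hz => (hder q' hq' p' z hz).differentiableAt.differentiableWithinAt)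
    (fun x _ => hval A q p hAf x) (fun x _ => hval B q' p' hBf x)
    (by
      rw [mul_apply', mul_apply', hLi, mul_zero, add_zero, hLx, hx0, div_self hδ.ne'])
    (fun z hz => by
      rw [(hder q hq p z hz).deriv]
      rcases hAc with hAc | hAc
      · have := (hd q hq _ (hmem z hz)).2.1
        rw [hG.dIter_ofReal q x0, hdq, Complex.ofReal_one, norm_one, mul_one] at this
        refine (this.trans hAc).trans ?_
        gcongr; exact min_le_left _ _
      · refine (hAc _ (hmem z hz)).trans ?_
        gcongr; exact min_le_left _ _)
    hD0
    (fun z hz => by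
      rw [(hder q' hq' p' z hz).deriv]
      have := (hd q' hq' _ (hmem z hz)).2.1
      rw [hG.dIter_ofReal q' x0, Complex.norm_real, Real.norm_eq_abs, abs_of_pos hD0] at this
      refine this.trans ?_
      gcongr
      exact hhc.trans (min_le_left _ _))
  refine ⟨Λ * L, h1.mul hLH, ?_, ?_⟩
  · rw [← h2]; group
  · have e : Λ * L * B⁻¹ * (Λ * L)⁻¹ = Λ * (L * B * L⁻¹)⁻¹ * Λ⁻¹ := by group
    rw [e]; exact h3

lemma exists_stripJet_of_deriv_close {f : ℝ ≃o ℝ} {g : ℂ → ℂ} {ε : ℝ}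
    (hg : DifferentiableOn ℂ g (strip 3)) (hgf : ∀ x : ℝ, g x = f x)
    (hg1 : ∀ z, g (z + 1) = g z + 1) (hε : ε ≤ 1 / 3)
    (hd : ∀ z ∈ strip 3, ‖deriv g z - 1‖ ≤ ε) :
    ∃ g1 n s f1 m t, StripJet f g g1 n s f1 m t 1 (3 * ε) (3 * ε) := by
  have hε0 : 0 ≤ ε := (norm_nonneg _).trans (hd _ (strip_real (by norm_num) 0))
  have sub : ∀ {b c : ℝ}, b ≤ c → strip b ⊆ strip c := fun h z hz => lt_of_lt_of_le hz h
  have hdg : DifferentiableOn ℂ (deriv g) (strip 3) := hg.deriv (isOpen_strip _)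
  have hddg : DifferentiableOn ℂ (deriv (deriv g)) (strip 3) := hdg.deriv (isOpen_strip _)
  have low : ∀ z ∈ strip 3, 2 / 3 ≤ ‖deriv g z‖ := fun z hz => by
    have h1 := norm_sub_norm_le (1 : ℂ) (1 - deriv g z)
    rw [sub_sub_cancel, norm_one, norm_sub_rev] at h1
    have := hd z hz
    linarith
  have hne : ∀ z ∈ strip 3, deriv g z ≠ 0 := fun z hz h => by
    have := low z hz
    rw [h, norm_zero] at this
    norm_num at this
  have hdd : ∀ z ∈ strip (3 - 1), ‖deriv (deriv g) z‖ ≤ ε := fun z hz => by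
    have h1 := norm_deriv_le_of_closedBall (r := 1) one_pos (hdg.sub_const (1 : ℂ))
      (closedBall_subset_strip hz) (C := ε) fun w hw => hd w (closedBall_subset_strip hz hw)
    rwa [deriv_sub_const, div_one] at h1
  have hN : ∀ z ∈ strip (3 - 1), ‖deriv (deriv g) z / deriv g z‖ ≤ 3 / 2 * ε := fun z hz => by
    have hl := low z (sub (by norm_num) hz)
    rw [norm_div, div_le_iff₀ (by linarith)]
    have := hdd z hz
    nlinarith
  have hND : DifferentiableOn ℂ (fun w => deriv (deriv g) w / deriv g w) (strip (3 - 1)) :=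
    (hddg.div hdg hne).mono (sub (by norm_num))
  have hN' : ∀ z ∈ strip 1, ‖deriv (fun w => deriv (deriv g) w / deriv g w) z‖ ≤ 3 / 2 * ε :=
    fun z hz => by
    have hsub : Metric.closedBall z 1 ⊆ strip (3 - 1) :=
      closedBall_subset_strip (sub (by norm_num) hz)
    have h1 := norm_deriv_le_of_closedBall (r := 1) one_pos hND hsub fun w hw => hN w (hsub hw)
    rwa [div_one] at h1
  have s13 : strip 1 ⊆ strip 3 := sub (by norm_num)
  have s12 : strip 1 ⊆ strip (3 - 1) := sub (by norm_num)
  refine exists_stripJet one_pos (hg.mono s13) hgf hg1 (fun z hz => hne z (s13 hz))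
    (fun z hz => (hN z (s12 hz)).trans (by linarith)) fun z hz => ?_
  refine (norm_sub_le _ _).trans ?_
  rw [norm_div, norm_pow, Complex.norm_ofNat]
  have h1 := hN z (s12 hz)
  have h2 := hN' z hz
  have h3 := norm_nonneg (deriv (deriv g) z / deriv g z)
  nlinarith

lemma exists_min_displacement {F : ℝ → ℝ} (hF : Continuous F) (h1 : ∀ x, F (x + 1) = F x + 1) :
    ∃ x0, ∀ x, F x0 - x0 ≤ F x - x := by
  have hper : Function.Periodic (fun x => F x - x) 1 := fun x => by
    simp only [h1]; ring
  obtain ⟨x0, -, hx0⟩ := isCompact_Icc.exists_isMinOn (Set.nonempty_Icc.2 zero_le_one)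
    (hF.sub continuous_id).continuousOn (s := Set.Icc (0 : ℝ) 1)
  refine ⟨x0, fun x => ?_⟩
  obtain ⟨y, hy, hxy⟩ := hper.exists_mem_Ico₀ one_pos x
  rw [show F x - x = F y - y from hxy]
  exact hx0 ⟨hy.1, hy.2.le⟩

lemma pow_apply' (f : ℝ ≃o ℝ) (n : ℕ) (x : ℝ) : (f ^ n) x = f^[n] x := by
  induction n with
  | zero => simp [one_apply']
  | succ n ih => rw [pow_succ', mul_apply', ih, Function.iterate_succ_apply']

lemma RotPair.apply_add_one {F : ℝ ≃o ℝ} {α : ℝ} (h : RotPair (tr 1) F α) (x : ℝ) :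
    F (x + 1) = F x + 1 := by
  have := DFunLike.congr_fun h.1.eq x
  simpa [mul_apply'] using this.symm

set_option maxHeartbeats 1000000 in
lemma exists_exponential_step : ∃ D c : ℝ, 0 < c ∧ ∀ (α Δ : ℝ) (F : ℝ ≃o ℝ), 0 < α → α < 1 →
    0 < Int.fract α⁻¹ → Good α Δ F → D ≤ 2 * Real.pi * Δ → 2 * Real.pi * Δ ≤ Real.log α⁻¹ →
    ∃ (F' : ℝ ≃o ℝ) (Δ' : ℝ), Good (Int.fract α⁻¹) Δ' F' ∧
      2 * Real.pi * Δ' = c * Real.exp (2 * Real.pi * Δ) ∧ (Lin (tr 1) F' → Lin (tr 1) F) := by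
  obtain ⟨K0, c, hK0, hc, close⟩ := exists_good_of_stripJet
  obtain ⟨κ, hκ, hκc, hκ1⟩ : ∃ κ, 0 < κ ∧ 72 * κ ≤ c ∧ κ ≤ 1 / 36 :=
    ⟨min (c / 72) (1 / 36), by positivity, by linarith [min_le_left (c / 72) (1 / 36)],
      min_le_right _ _⟩
  obtain ⟨b, hb⟩ : ∃ b, b = Real.exp (8 * Real.pi) := ⟨_, rfl⟩
  have hb0 : 0 < b := hb ▸ Real.exp_pos _
  have hb2 : 2 ≤ b := by
    have := Real.add_one_le_exp (8 * Real.pi)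
    rw [← hb] at this
    linarith [Real.pi_gt_three]
  refine ⟨max (8 * Real.pi) (max (Real.log (3 * b)) (Real.log (K0 * b / κ))),
    2 * Real.pi * (κ / b / 20), by positivity, ?_⟩
  intro α Δ F hα hα1 hfr hF hD hΔα
  obtain ⟨E, hE⟩ : ∃ E, E = Real.exp (-(2 * Real.pi * Δ)) := ⟨_, rfl⟩
  have hE0 : 0 < E := hE ▸ Real.exp_pos _
  have hEi : Real.exp (2 * Real.pi * Δ) = 1 / E := by rw [hE, Real.exp_neg]; simp
  have hαE : α ≤ E := by
    rw [hE, ← Real.exp_log hα]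
    apply Real.exp_le_exp.2
    rw [Real.log_inv] at hΔα
    linarith
  have hΔ4 : 4 ≤ Δ := by
    have := (le_max_left _ _).trans hD
    nlinarith [Real.pi_pos]
  have hE3 : 3 * b * E ≤ 1 := by
    have := ((le_max_left _ _).trans (le_max_right _ _)).trans hD
    rw [Real.log_le_iff_le_exp (by positivity), hEi, le_div_iff₀ hE0] at this
    exact this
  have hEK : K0 * b / κ * E ≤ 1 := by
    have := ((le_max_right _ _).trans (le_max_right _ _)).trans hD
    rw [Real.log_le_iff_le_exp (by positivity), hEi, le_div_iff₀ hE0] at this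
    exact this
  obtain ⟨hrot, g, hg, hgF, hg1, hgE⟩ := id hF
  obtain ⟨e, he⟩ : ∃ e, e = E * b := ⟨_, rfl⟩
  have he0 : 0 < e := by rw [he]; positivity
  have he3 : e ≤ 1 / 3 := by rw [he]; linarith
  have hd3 : ∀ z ∈ strip 3, ‖deriv g z - 1‖ ≤ e := fun z hz => by
    have hz3 : |z.im| < 3 := hz
    have := norm_deriv_sub_one_le one_pos hg hgE (z := z)
      (lt_of_lt_of_le hz3 (by linarith))
    refine this.trans ?_
    rw [div_one, he, hE, hb, ← Real.exp_add]
    apply Real.exp_le_exp.2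
    nlinarith [Real.pi_pos]
  obtain ⟨g1, n, s, f1, m, t, hJ⟩ := exists_stripJet_of_deriv_close
    (hg.mono fun z hz => lt_of_lt_of_le (show |z.im| < 3 from hz) (by linarith)) hgF hg1 he3 hd3
  have hFH : HolDiff F := hF.holDiff (by linarith)
  have hF1 := hrot.apply_add_one
  obtain ⟨x0, hx0⟩ := exists_min_displacement hFH.continuous hF1
  obtain ⟨δ, hδ⟩ : ∃ δ, δ = F x0 - x0 := ⟨_, rfl⟩
  have hδ0 : 0 < δ := by
    have := hrot.2 0 1 (by push_cast; linarith) x0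
    simp only [zpow_zero, zpow_one, one_mul] at this
    linarith
  obtain ⟨a1, ha1⟩ : ∃ a1 : ℕ, (a1 : ℤ) = ⌊α⁻¹⌋ :=
    ⟨⌊α⁻¹⌋.toNat, Int.toNat_of_nonneg (Int.floor_nonneg.2 (inv_pos.2 hα).le)⟩
  have ha1' : 1 ≤ a1 := by
    have : (1 : ℤ) ≤ ⌊α⁻¹⌋ := Int.le_floor.2 (by push_cast; exact (one_le_inv₀ hα).2 hα1.le)
    omega
  obtain ⟨B, hB⟩ : ∃ B : ℝ ≃o ℝ, B = F ^ (a1 : ℤ) * (tr 1)⁻¹ := ⟨_, rfl⟩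
  have hFB : RotPair F B (-(Int.fract α⁻¹)) := by
    have := (hrot.swap hα).inv.shift a1
    rw [← hB] at this
    convert this using 1
    rw [Int.fract, ← ha1, one_div]; ring
  have hBx : ∀ x, B x = F^[a1] x + (-1) := fun x => by
    have hc : F ^ (a1 : ℤ) * (tr 1)⁻¹ = (tr 1)⁻¹ * F ^ (a1 : ℤ) :=
      ((hrot.1.inv_left).zpow_right a1).symm.eq
    rw [hB, hc, mul_apply', ← tr_neg, tr_apply, zpow_natCast, pow_apply']
  have hBlt : ∀ x, F^[a1] x - x ≤ 1 := fun x => by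
    have := hFB.lt_id 0 1 (by push_cast; linarith) x
    simp only [zpow_zero, zpow_one, one_mul] at this
    rw [hBx] at this
    linarith
  have hFM : ∀ x, F x - x ≤ e := fun x => by
    have h1 := hgE x (strip_real (by linarith) x)
    rw [hgF, Complex.ofReal_im, abs_zero, sub_zero, ← hE, ← Complex.ofReal_sub,
      ← Complex.ofReal_sub, Complex.norm_real, Real.norm_eq_abs] at h1
    have := (abs_le.1 h1).2
    rw [he]; nlinarith
  have hδe : δ ≤ e := hδ ▸ hFM x0
  have hexp : Real.exp (3 * e) ≤ 3 := by
    calc Real.exp (3 * e) ≤ Real.exp 1 := Real.exp_le_exp.2 (by linarith)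
      _ ≤ 3 := by linarith [Real.exp_one_lt_d9]
  have hexp0 := Real.exp_pos (3 * e)
  obtain ⟨h, hh⟩ : ∃ h, h = κ / e * Real.exp (3 * e) *
      (√(2 * (3 * e) * e) + 4 * (3 * e) * Real.exp (3 * e) * e * (κ / e)) *
      Real.exp (3 * e * (κ / e) * Real.exp (3 * e)) := ⟨_, rfl⟩
  have hh36 : h ≤ 36 * κ := by
    have h1 : √(2 * (3 * e) * e) ≤ 3 * e := by
      rw [Real.sqrt_le_left (by positivity)]; nlinarith
    have h2 : 3 * e * (κ / e) * Real.exp (3 * e) = 3 * κ * Real.exp (3 * e) := by field_simp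
    have h3 : 4 * (3 * e) * Real.exp (3 * e) * e * (κ / e) = 12 * e * Real.exp (3 * e) * κ := by
      field_simp; norm_num
    have h4 : Real.exp (3 * κ * Real.exp (3 * e)) ≤ 3 := by
      calc _ ≤ Real.exp 1 := Real.exp_le_exp.2 (by nlinarith)
        _ ≤ 3 := by linarith [Real.exp_one_lt_d9]
    have h5 : √(2 * (3 * e) * e) + 12 * e * Real.exp (3 * e) * κ ≤ 4 * e := by
      have : Real.exp (3 * e) * κ ≤ 3 * (1 / 36) := by gcongr
      nlinarith
    rw [hh, h2, h3]
    calc _ ≤ κ / e * 3 * (4 * e) * 3 := by gcongr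
      _ = 36 * κ := by field_simp; norm_num
  have hKe : K0 ≤ κ / e := by
    rw [le_div_iff₀ he0, he]
    rw [div_mul_eq_mul_div, div_le_one hκ] at hEK
    linarith
  obtain ⟨Λ, hΛ, hΛF, hΛB⟩ := close F g g1 n s f1 m t 1 (3 * e) (3 * e) F B (Int.fract α⁻¹) 0 (-1)
    δ e (κ / e) x0 h 1 a1 a1 hJ hKe hfr (Int.fract_lt_one _) hFB hFH ha1' le_rfl
    (fun x => by simp) hBx (fun x => rfl) hδ0 (fun x => hδ ▸ hx0 x) hδ.symm hFM
    (fun x => by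
      have : ∀ i, F (F^[i] x) = F^[i + 1] x := fun i => (Function.iterate_succ_apply' _ _ _).symm
      simp only [this]
      rw [Finset.sum_range_sub (fun i => F^[i] x)]
      exact hBlt x)
    (by
      have : 2 * (κ / e) * Real.exp (3 * e) * e = 2 * κ * Real.exp (3 * e) := by field_simp
      rw [this]; nlinarith)
    hh (by linarith)
    (Or.inr fun z hz => by
      have hz1 : z ∈ strip 1 := by
        rw [mem_ball_iff_norm] at hz
        have h1 := (Complex.abs_im_le_norm _).trans_lt hz
        rw [Complex.sub_im, Complex.ofReal_im, sub_zero] at h1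
        have : κ / e * δ ≤ κ := by
          rw [div_mul_eq_mul_div, div_le_iff₀ he0]; nlinarith
        show |z.im| < 1
        linarith
      have hz3 : z ∈ strip 3 := lt_trans (show |z.im| < 1 from hz1) (by norm_num)
      have h2 : dIter g g1 1 z = deriv g z := by
        rw [(hJ.jet z hz1).d1.deriv]; simp [dIter]
      rw [h2]
      refine (hd3 z hz3).trans ?_
      rw [div_div_eq_mul_div, le_div_iff₀ hκ]
      nlinarith)
  refine ⟨Λ * B⁻¹ * Λ⁻¹, κ / e / 20, hΛB, ?_, fun hlin => ?_⟩
  · rw [hEi, he]; field_simp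
  · rw [← hΛF] at hlin
    obtain ⟨u, hu, huF, huB⟩ := hlin.conj hΛ
    refine ⟨u, hu, ?_, huF⟩
    have e1 : tr 1 = B⁻¹ * F ^ (a1 : ℤ) := by
      have hc : Commute (F ^ (a1 : ℤ)) (tr 1) := (hrot.1.zpow_right _).symm
      rw [hB, mul_inv_rev, inv_inv, mul_assoc, inv_mul_cancel, mul_one]
    rw [e1]
    exact mul_mem huB (zpow_mem huF _)

/-- if the sequence defined by `Rcal` overtakes the Brjuno series, then a sufficiently large
initial height ensures linearizability -/
theorem exists_lin_of_Rcal : ∃ K : ℝ, ∀ (a R : ℕ → ℝ) (k : ℕ) (Δ : ℝ) (F : ℝ ≃o ℝ),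
    GaussSeq a → R 0 = 0 → (∀ n, R (n + 1) = Rcal (a n) (R n)) →
    BrjunoLE (fun n => a (k + n)) (R k) → K ≤ 2 * Real.pi * Δ → Good (a 0) Δ F →
    Lin (tr 1) F := by
  obtain ⟨C, hC, lin⟩ := exists_linear_step'
  obtain ⟨D, c, hc, ex⟩ := exists_exponential_step
  obtain ⟨C1, hC1, fin⟩ := exists_lin_of_brjunoLE
  obtain ⟨A, hA1, hA2, hA3, hA4⟩ : ∃ A : ℝ, 4 * (C + 1) ≤ A ∧ C1 ≤ A ∧ 8 * D ≤ A ∧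
      1 + 2 * A ≤ c * Real.exp (A / 8) := by
    have h1 : Tendsto (fun A : ℝ => Real.exp (A / 8) / (A / 8) ^ 2) atTop atTop :=
      (Real.tendsto_exp_div_pow_atTop 2).comp (tendsto_id.atTop_div_const (by norm_num))
    obtain ⟨A, h2, h3, h4, h5, h6⟩ := ((h1.eventually_ge_atTop (3 * 64 / c)).and
      ((eventually_ge_atTop (4 * (C + 1))).and ((eventually_ge_atTop C1).and
      ((eventually_ge_atTop (8 * D)).and (eventually_ge_atTop 1))))).exists
    refine ⟨A, h3, h4, h5, ?_⟩
    rw [div_le_div_iff₀ hc (by positivity)] at h2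
    nlinarith
  refine ⟨2 * A, fun a R k Δ F ha hR0 hRs hB hΔ hF => ?_⟩
  have hRnn : ∀ n, 0 ≤ R n := by
    intro n
    induction n with
    | zero => exact hR0.ge
    | succ n ih =>
      rw [hRs, Rcal]
      split_ifs with h
      · have := inv_pos.2 (ha.pos n)
        apply mul_nonneg this.le; linarith
      · exact (Real.exp_pos _).le
  have hind : ∀ n, ∃ (G : ℝ ≃o ℝ) (E : ℝ), Good (a n) E G ∧ (Lin (tr 1) G → Lin (tr 1) F) ∧
      R n + A * (1 + a n) ≤ 2 * Real.pi * E := by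
    intro n
    induction n with
    | zero => exact ⟨F, Δ, hF, id, by rw [hR0]; nlinarith [ha.lt_one 0]⟩
    | succ n ih =>
      obtain ⟨G, E, hG, hGF, hE⟩ := ih
      have h0 := ha.pos n
      have h1 := ha.lt_one n
      have h0' := ha.pos (n + 1)
      have h1' := ha.lt_one (n + 1)
      have hRn := hRnn n
      have hmul : a n * (1 + a (n + 1)) ≤ 1 := by
        have h2 : a (n + 1) ≤ (a n)⁻¹ - 1 := by
          have h3 : (1 : ℤ) ≤ ⌊(a n)⁻¹⌋ := Int.le_floor.2 (by
            push_cast; exact ((one_lt_inv₀ h0).2 h1).le)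
          have h4 : (1 : ℝ) ≤ (⌊(a n)⁻¹⌋ : ℝ) := by exact_mod_cast h3
          rw [ha.succ, Int.fract]; linarith
        have := mul_le_mul_of_nonneg_left h2 h0.le
        rw [mul_sub, mul_inv_cancel₀ h0.ne'] at this
        linarith
      have hA : 0 < A := by linarith
      have hmulA : A * (a n * (1 + a (n + 1))) ≤ A := by nlinarith
      have hmulA2 : A * (a n * (1 + a (n + 1))) ≤ A * (a n * 2) := by gcongr; linarith
      have hexp : a n * Real.exp (Real.log (a n)⁻¹) = 1 := by
        rw [Real.exp_log (inv_pos.2 h0), mul_inv_cancel₀ h0.ne']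
      by_cases hcase : Real.log (a n)⁻¹ ≤ R n + A / 4
      · obtain ⟨G', E', hG', hE', hL⟩ := lin (a n) E G h0 h1 hG (by nlinarith)
        refine ⟨G', E', ha.succ n ▸ hG', fun h => hGF (hL h), ?_⟩
        rw [hRs, Rcal]
        refine le_of_mul_le_mul_left ?_ h0
        rw [hE', mul_add]
        split_ifs with h
        · rw [← mul_assoc (a n), mul_inv_cancel₀ h0.ne', one_mul]
          rcases le_total (a n) (1 / 2) with h2 | h2
          · nlinarith [mul_le_mul_of_nonneg_left h2 hA.le]
          · nlinarith [mul_le_mul_of_nonneg_left h2 hA.le]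
        · have h3 : a n * Real.exp (R n) ≤ 1 := by
            rw [← hexp]; gcongr; exact (not_le.1 h).le
          rcases le_total (a n) (1 / 2) with h2 | h2
          · nlinarith [mul_le_mul_of_nonneg_left h2 hA.le]
          · nlinarith [mul_le_mul_of_nonneg_left h2 hA.le]
      · have hcase := not_le.1 hcase
        obtain ⟨E0, hE0⟩ : ∃ E0, 2 * Real.pi * E0 = R n + A / 8 :=
          ⟨(R n + A / 8) / (2 * Real.pi), by field_simp⟩
        obtain ⟨G', E', hG', hE', hL⟩ := ex (a n) E0 G h0 h1 (ha.succ n ▸ h0') (hG.mono (by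
          nlinarith [Real.pi_pos])) (by linarith) (by linarith)
        refine ⟨G', E', ha.succ n ▸ hG', fun h => hGF (hL h), ?_⟩
        rw [hE', hE0, hRs, Rcal, if_neg (by linarith), Real.exp_add]
        have h2 := Real.one_le_exp hRn
        nlinarith
  obtain ⟨G, E, hG, hGF, hE⟩ := hind k
  exact hGF (fin (fun n => a (k + n)) (R k) E G (ha.drop k) hB
    (by nlinarith [ha.pos k]) hG)

/-- the composition of an integer translation with an iterate of `f` -/
noncomputable def wd (f : ℝ ≃o ℝ) (p q : ℤ) : ℝ ≃o ℝ := tr 1 ^ p * f ^ q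

lemma wd_apply (f : ℝ ≃o ℝ) (p q : ℤ) (x : ℝ) : wd f p q x = (f ^ q) x + p := by
  rw [wd, tr_zpow, mul_apply', tr_apply, mul_one]

lemma wd_mul {f : ℝ ≃o ℝ} (hc : Commute (tr 1) f) (p q p' q' : ℤ) :
    wd f p q * wd f p' q' = wd f (p + p') (q + q') := by
  have h1 : Commute (f ^ q) (tr 1 ^ p') := (hc.zpow_zpow p' q).symm
  rw [wd, wd, wd, zpow_add, zpow_add, mul_assoc, ← mul_assoc (f ^ q), h1.eq]
  simp only [mul_assoc]

lemma wd_zpow {f : ℝ ≃o ℝ} (hc : Commute (tr 1) f) (p q m : ℤ) :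
    wd f p q ^ m = wd f (m * p) (m * q) := by
  rw [wd, (hc.zpow_zpow p q).mul_zpow, ← zpow_mul, ← zpow_mul, wd, mul_comm p, mul_comm q]

lemma wd_inv {f : ℝ ≃o ℝ} (hc : Commute (tr 1) f) (p q : ℤ) :
    (wd f p q)⁻¹ = wd f (-p) (-q) := by
  have := wd_zpow hc p q (-1)
  rwa [zpow_neg_one, neg_one_mul, neg_one_mul] at this

lemma RotPair.lt_wd {f : ℝ ≃o ℝ} {α : ℝ} (h : RotPair (tr 1) f α) {p q p' q' : ℤ}
    (hpq : (p : ℝ) + q * α < p' + q' * α) (x : ℝ) : wd f p q x < wd f p' q' x := by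
  have h1 := h.2 (p' - p) (q' - q) (by push_cast; linarith) (wd f p q x)
  rwa [← wd, ← mul_apply', wd_mul h.1, sub_add_cancel, sub_add_cancel] at h1

/-- two consecutive continued fraction convergents of `α`, with the ratio `ρ` of their errors -/
structure Cvg (α ρ : ℝ) (p q p' q' : ℤ) : Prop where
  pos : 0 < q
  le : q ≤ q'
  det : p * q' - p' * q = 1
  err_pos : 0 < (p : ℝ) + q * α
  err_eq : (p' : ℝ) + q' * α = -ρ * (p + q * α)

lemma Cvg.step {α ρ : ℝ} {p q p' q' : ℤ} (h : Cvg α ρ p q p' q') (hρ : 0 < ρ) (hρ1 : ρ < 1)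
    (hρ' : 0 < Int.fract ρ⁻¹) :
    ∃ p q'' p' q', Cvg α (Int.fract (Int.fract ρ⁻¹)⁻¹) p q'' p' q' ∧ q < q'' := by
  obtain ⟨σ, hσ⟩ : ∃ σ, σ = Int.fract ρ⁻¹ := ⟨_, rfl⟩
  rw [← hσ] at hρ' ⊢
  have hσ1 : σ < 1 := hσ ▸ Int.fract_lt_one _
  have ha : 1 ≤ ⌊ρ⁻¹⌋ := Int.le_floor.2 (by push_cast; exact (one_le_inv₀ hρ).2 hρ1.le)
  have hb : 1 ≤ ⌊σ⁻¹⌋ := Int.le_floor.2 (by push_cast; exact (one_le_inv₀ hρ').2 hσ1.le)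
  have ea : (⌊ρ⁻¹⌋ : ℝ) * ρ = 1 - σ * ρ := by
    rw [hσ, Int.fract, sub_mul, inv_mul_cancel₀ hρ.ne']; ring
  have eb : (⌊σ⁻¹⌋ : ℝ) * σ = 1 - Int.fract σ⁻¹ * σ := by
    rw [Int.fract, sub_mul, inv_mul_cancel₀ hρ'.ne']; ring
  obtain ⟨a, haa⟩ : ∃ a, a = ⌊ρ⁻¹⌋ := ⟨_, rfl⟩
  obtain ⟨b, hbb⟩ : ∃ b, b = ⌊σ⁻¹⌋ := ⟨_, rfl⟩
  rw [← haa] at ha ea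
  rw [← hbb] at hb eb
  have h1 := h.pos
  have h2 := h.le
  have e1 : ((p + a * p' : ℤ) : ℝ) + (q + a * q' : ℤ) * α = ρ * σ * (p + q * α) := by
    push_cast
    have : (p : ℝ) + a * p' + (q + a * q') * α = p + q * α + a * (p' + q' * α) := by ring
    rw [this, h.err_eq]
    linear_combination -(p + q * α) * ea
  have h3 : 0 < q + a * q' := by nlinarith
  refine ⟨p + a * p', q + a * q', p' + b * (p + a * p'), q' + b * (q + a * q'),
    ⟨h3, by nlinarith, ?_, ?_, ?_⟩, by nlinarith⟩
  · linear_combination h.det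
  · rw [e1]; have := h.err_pos; positivity
  · have : ((p' + b * (p + a * p') : ℤ) : ℝ) + (q' + b * (q + a * q') : ℤ) * α
        = p' + q' * α + b * (((p + a * p' : ℤ) : ℝ) + (q + a * q' : ℤ) * α) := by
      push_cast; ring
    rw [this, e1, h.err_eq]
    linear_combination ρ * (p + q * α) * eb

lemma GaussSeq.exists_cvg {a : ℕ → ℝ} (ha : GaussSeq a) (k : ℕ) :
    ∃ p q p' q', Cvg (a 0) (a (2 * k + 1)) p q p' q' ∧ (k : ℤ) < q := by
  induction k with
  | zero =>
    have h0 := ha.pos 0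
    refine ⟨0, 1, -1, ⌊(a 0)⁻¹⌋, ⟨one_pos, ?_, by ring, by push_cast; linarith, ?_⟩, by simp⟩
    · exact Int.le_floor.2 (by push_cast; exact (one_le_inv₀ h0).2 (ha.lt_one 0).le)
    · rw [show 2 * 0 + 1 = 0 + 1 from rfl, ha.succ, Int.fract]
      push_cast
      field_simp
      ring
  | succ k ih =>
    obtain ⟨p, q, p', q', h, hq⟩ := ih
    obtain ⟨P, Q, P', Q', H, HQ⟩ := h.step (ha.pos _) (ha.lt_one _)
      (by rw [← ha.succ]; exact ha.pos _)
    rw [← ha.succ, ← ha.succ] at H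
    exact ⟨P, Q, P', Q', H, by push_cast; omega⟩

namespace Cvg

variable {α ρ : ℝ} {p q p' q' : ℤ}

lemma eq_of_abs_le (h : Cvg α ρ p q p' q') (hρ : 0 < ρ) {k l : ℤ} (hl : 0 ≤ l) (hlq : l < q')
    (hkl : |(k : ℝ) + l * α| ≤ p + q * α) : (k = 0 ∧ l = 0) ∨ (k = p ∧ l = q) := by
  have h1 := h.pos
  have h2 := h.le
  have hd := h.det
  have hθ := h.err_pos
  obtain ⟨m, hm⟩ : ∃ m, m = k * q' - l * p' := ⟨_, rfl⟩
  obtain ⟨n, hn⟩ : ∃ n, n = l * p - k * q := ⟨_, rfl⟩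
  have ek : k = m * p + n * p' := by rw [hm, hn]; linear_combination -k * hd
  have el : l = m * q + n * q' := by rw [hm, hn]; linear_combination -l * hd
  have ev : (k : ℝ) + l * α = (m - n * ρ) * (p + q * α) := by
    rw [ek, el]; push_cast
    linear_combination (n : ℝ) * h.err_eq
  rw [ev, abs_mul, abs_of_pos hθ] at hkl
  have hmn : |(m : ℝ) - n * ρ| ≤ 1 := by
    by_contra hlt
    push Not at hlt
    nlinarith
  rw [abs_le] at hmn
  rcases lt_trichotomy n 0 with hn0 | hn0 | hn0
  · have hm1 : 1 ≤ m := by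
      by_contra hlt
      push Not at hlt
      have : m ≤ 0 := by omega
      nlinarith
    have : (1 : ℝ) ≤ m := by exact_mod_cast hm1
    have : (n : ℝ) < 0 := by exact_mod_cast hn0
    nlinarith
  · rw [hn0] at ek el hmn
    simp only [Int.cast_zero, zero_mul, sub_zero, add_zero] at ek el hmn
    have hm1 : m ≤ 1 := by exact_mod_cast hmn.2
    have hm0 : 0 ≤ m := by
      by_contra hlt
      push Not at hlt
      nlinarith
    have : m = 0 ∨ m = 1 := by omega
    rcases this with rfl | rfl
    · left; simp [ek, el]
    · right; simp [ek, el]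
  · have hm1 : m ≤ -1 := by
      by_contra hlt
      push Not at hlt
      have : 0 ≤ m := by omega
      nlinarith
    have : (m : ℝ) ≤ -1 := by exact_mod_cast hm1
    have : (0 : ℝ) < n := by exact_mod_cast hn0
    nlinarith

lemma rotPair (h : Cvg α ρ p q p' q') {f : ℝ ≃o ℝ} (hf : RotPair (tr 1) f α) :
    RotPair (wd f p q) (wd f p' q') (-ρ) := by
  have hc := hf.1
  refine ⟨?_, fun m n hmn x => ?_⟩
  · rw [commute_iff_eq, wd_mul hc, wd_mul hc, add_comm p, add_comm q]
  · rw [wd_zpow hc, wd_zpow hc, wd_mul hc]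
    apply hf.2
    have : ((m * p + n * p' : ℤ) : ℝ) + (m * q + n * q' : ℤ) * α
        = (m + n * -ρ) * (p + q * α) := by
      push_cast; linear_combination (n : ℝ) * h.err_eq
    rw [this]
    exact mul_pos hmn h.err_pos

lemma wd_ne (h : Cvg α ρ p q p' q') (hρ : 0 < ρ) {f : ℝ ≃o ℝ} (hf : RotPair (tr 1) f α)
    {u v : ℝ} (huv : v ≤ wd f p q u) {k l : ℤ} (hl : 0 ≤ l) (hlq : l < q')
    (h0 : ¬(k = 0 ∧ l = 0)) {y y' : ℝ} (hy : y ∈ Set.Ico u v) (hy' : y' ∈ Set.Ico u v) :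
    wd f k l y' ≠ y := by
  intro e
  have hA := (wd f p q).monotone
  have h1 : y < wd f p q y' := (hy.2.trans_le huv).trans_le (hA hy'.1)
  by_cases hle : |(k : ℝ) + l * α| ≤ p + q * α
  · rcases h.eq_of_abs_le hρ hl hlq hle with h2 | ⟨rfl, rfl⟩
    · exact h0 h2
    · exact h1.ne' e
  · push Not at hle
    rcases lt_abs.1 hle with h2 | h2
    · exact lt_asymm h1 (e ▸ hf.lt_wd h2 y')
    · have h3 := hf.lt_wd (p := p + k) (q := q + l) (p' := 0) (q' := 0)
        (by push_cast; linarith) y'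
      rw [← wd_mul hf.1, mul_apply', e, wd_apply f 0 0 y'] at h3
      simp only [zpow_zero, one_apply', Int.cast_zero, add_zero] at h3
      exact lt_asymm h3 ((hy'.2.trans_le huv).trans_le (hA hy.1))

lemma disjoint (h : Cvg α ρ p q p' q') (hρ : 0 < ρ) {f : ℝ ≃o ℝ} (hf : RotPair (tr 1) f α)
    {u v : ℝ} (huv : v ≤ wd f p q u) {i j k : ℤ} (hij : |i - j| < q') (h0 : ¬(k = 0 ∧ i = j)) :
    Disjoint (Set.Ico ((f ^ i) u) ((f ^ i) v)) (Set.Ico ((f ^ j) u + k) ((f ^ j) v + k)) := by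
  rw [Set.disjoint_left]
  intro w hw hw'
  have mem : ∀ {i k : ℤ}, w ∈ Set.Ico ((f ^ i) u + k) ((f ^ i) v + k) →
      wd f (-k) (-i) w ∈ Set.Ico u v := fun {i k} hw => by
    rw [← wd_apply, ← wd_apply] at hw
    rw [← wd_inv hf.1]
    have hm := ((wd f k i)⁻¹).strictMono
    constructor
    · have := hm.monotone hw.1
      rwa [inv_apply_self'] at this
    · have := hm hw.2
      rwa [inv_apply_self'] at this
  have m1 := mem (i := i) (k := 0) (by simpa using hw)
  have m2 := mem (i := j) (k := k) hw'
  rw [abs_lt] at hij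
  rcases le_total i j with hle | hle
  · refine h.wd_ne hρ hf huv (k := k) (l := j - i) (by omega) (by omega) (by omega) m1 m2 ?_
    rw [← mul_apply', wd_mul hf.1]
    congr 2 <;> ring
  · refine h.wd_ne hρ hf huv (k := -k) (l := i - j) (by omega) (by omega) (by omega) m2 m1 ?_
    rw [← mul_apply', wd_mul hf.1]
    congr 2 <;> ring

end Cvg

lemma sum_sub_le_one {u v : ℕ → ℝ} {Q : ℕ} (huv : ∀ i, u i ≤ v i)
    (hd : ∀ i < Q, ∀ j < Q, ∀ k : ℤ, ¬(k = 0 ∧ i = j) →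
      Disjoint (Set.Ico (u i) (v i)) (Set.Ico (u j + k) (v j + k))) :
    ∑ i ∈ Finset.range Q, (v i - u i) ≤ 1 := by
  by_contra hlt
  push Not at hlt
  obtain ⟨S, hS⟩ : ∃ S, S = ⋃ i ∈ Finset.range Q, Set.Ico (u i) (v i) := ⟨_, rfl⟩
  have hm : MeasurableSet S := hS ▸ Finset.measurableSet_biUnion _ fun _ _ => measurableSet_Ico
  have hvol : volume S = ENNReal.ofReal (∑ i ∈ Finset.range Q, (v i - u i)) := by
    rw [hS, measure_biUnion_finset _ fun _ _ => measurableSet_Ico,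
      ENNReal.ofReal_sum_of_nonneg fun i _ => sub_nonneg.2 (huv i)]
    · simp only [Real.volume_Ico]
    · intro i hi j hj hij
      have := hd i (by simpa using hi) j (by simpa using hj) 0 (by tauto)
      simpa using this
  obtain ⟨x, y, hxy, hn⟩ := exists_pair_mem_lattice_not_disjoint_vadd
    (isAddFundamentalDomain_Ioc one_pos 0 volume) hm.nullMeasurableSet (by
      rw [hvol, Real.volume_Ioc, ENNReal.ofReal_lt_ofReal_iff_of_nonneg] <;> linarith)
  apply hn
  obtain ⟨x, i, rfl⟩ := x
  obtain ⟨y, j, rfl⟩ := y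
  have hij : i ≠ j := fun h => hxy (by subst h; rfl)
  rw [Set.disjoint_left]
  rintro _ ⟨a, ha, rfl⟩ ⟨b, hb, hab⟩
  have hab' : (j : ℝ) + b = i + a := by simpa [AddSubgroup.vadd_def] using hab
  rw [hS, Set.mem_iUnion₂] at ha hb
  obtain ⟨l, hl, ha⟩ := ha
  obtain ⟨r, hr, hb⟩ := hb
  refine Set.disjoint_left.1 (hd l (by simpa using hl) r (by simpa using hr) (j - i) ?_) ha ?_
  · intro h; omega
  · push_cast
    exact ⟨by linarith [hb.1], by linarith [hb.2]⟩

namespace Cvg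

variable {α ρ : ℝ} {p q p' q' : ℤ}

lemma sum_le (h : Cvg α ρ p q p' q') (hρ : 0 < ρ) {f : ℝ ≃o ℝ} (hf : RotPair (tr 1) f α)
    {u v : ℝ} (huv0 : u ≤ v) (huv : v ≤ wd f p q u) {e : ℕ → ℤ} {Q : ℕ}
    (he : Function.Injective e) (heq : ∀ i < Q, ∀ j < Q, |e i - e j| < q') :
    ∑ i ∈ Finset.range Q, ((f ^ e i) v - (f ^ e i) u) ≤ 1 :=
  sum_sub_le_one (fun i => (f ^ e i).monotone huv0) fun i hi j hj _ hk =>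
    h.disjoint hρ hf huv (heq i hi j hj) fun h1 => hk ⟨h1.1, he h1.2⟩

lemma sum_iterate_le (h : Cvg α ρ p q p' q') (hρ : 0 < ρ) {f : ℝ ≃o ℝ}
    (hf : RotPair (tr 1) f α) {Q : ℕ} (hQ : (Q : ℤ) ≤ q') (x : ℝ) :
    ∑ i ∈ Finset.range Q, (f^[i] (wd f p q x) - f^[i] x) ≤ 1 := by
  have hx : x ≤ wd f p q x := by
    have := hf.2 p q h.err_pos x
    exact this.le
  have := h.sum_le hρ hf hx le_rfl (e := fun i => (i : ℤ)) (Q := Q) Nat.cast_injective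
    (fun i hi j hj => by rw [abs_lt]; omega)
  simpa only [zpow_natCast, pow_apply'] using this

end Cvg

lemma not_wandering {f : ℝ ≃o ℝ} {f1 m t : ℝ → ℝ} {a α : ℝ} (hJ : ∀ x, Jet f f1 m t x)
    (hpos : ∀ x, 0 < f1 x) (hm : ∀ x, |m x| ≤ a) (hf : RotPair (tr 1) f α) {u v : ℝ}
    (huv : u < v) (h : ∀ k : ℕ, ∃ ρ p q p' q', 0 < ρ ∧ Cvg α ρ p q p' q' ∧ (k : ℤ) < q ∧
      v ≤ wd f p q u) : False := by
  have ha0 : 0 ≤ a := (abs_nonneg _).trans (hm 0)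
  have lim : ∀ σ : ℤ, (σ = 1 ∨ σ = -1) →
      Tendsto (fun i : ℕ => (f ^ (σ * i)) v - (f ^ (σ * i)) u) atTop (𝓝 0) := by
    intro σ hσ
    refine Summable.tendsto_atTop_zero (summable_of_sum_range_le (c := 1) (fun i => ?_)
      fun k => ?_)
    · exact sub_nonneg.2 ((f ^ (σ * i)).monotone huv.le)
    · obtain ⟨ρ, p, q, p', q', hρ, hC, hk, hle⟩ := h k
      refine hC.sum_le hρ hf huv.le hle (e := fun i => σ * i) ?_ ?_
      · intro i j hij
        rcases hσ with rfl | rfl <;> simpa using hij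
      · intro i hi j hj
        have := hC.le
        rcases hσ with rfl | rfl <;> rw [abs_lt] <;> omega
  have hη : 0 < Real.exp (-a) * (v - u) := mul_pos (Real.exp_pos _) (sub_pos.2 huv)
  obtain ⟨k, hk⟩ := eventually_atTop.1 (((lim 1 (Or.inl rfl)).eventually_lt_const hη).and
    ((lim (-1) (Or.inr rfl)).eventually_lt_const hη))
  obtain ⟨ρ, p, q, p', q', hρ, hC, hkq, hle⟩ := h k
  obtain ⟨l, rfl⟩ : ∃ l : ℕ, q = l := ⟨q.toNat, by have := hC.pos; omega⟩
  have g1 := (hk l (by omega)).1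
  have g2 := (hk l (by omega)).2
  rw [one_mul, zpow_natCast, pow_apply', pow_apply'] at g1
  rw [neg_one_mul] at g2
  have hlog : ∀ x y, |Real.log (f1 y) - Real.log (f1 x)| ≤ a * |y - x| := fun x y => by
    have h1 : ∀ z, HasDerivAt (fun z => Real.log (f1 z)) (m z) z := fun z =>
      ((hJ z).d2.log (hpos z).ne').congr_deriv (by field_simp [(hpos z).ne'])
    have := convex_univ.norm_image_sub_le_of_norm_hasDerivWithin_le (f := fun z => Real.log (f1 z))
      (fun z _ => (h1 z).hasDerivWithinAt) (fun z _ => hm z) (Set.mem_univ x) (Set.mem_univ y)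
    simpa [Real.norm_eq_abs] using this
  have hder : ∀ x, HasDerivAt (f^[l]) (dIter f f1 l x) x := fun x =>
    hasDerivAt_iterate_dIter fun j _ => hJ _
  have hD0 : ∀ x, 0 < dIter f f1 l x := fun x => Finset.prod_pos fun j _ => hpos _
  have mvt : ∀ x y, x < y → ∃ c ∈ Set.Ioo x y, f^[l] y - f^[l] x = dIter f f1 l c * (y - x) :=
    fun x y hxy => by
    obtain ⟨c, hc, e⟩ := exists_hasDerivAt_eq_slope (f^[l]) (dIter f f1 l) hxy
      (fun x _ => (hder x).continuousAt.continuousWithinAt) fun x _ => hder x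
    exact ⟨c, hc, by rw [e, div_mul_cancel₀ _ (sub_pos.2 hxy).ne']⟩
  obtain ⟨A, hA⟩ : ∃ A, A = wd f p l := ⟨_, rfl⟩
  rw [← hA] at hle
  have hAx : ∀ x, A x = f^[l] x + p := fun x => by
    rw [hA, wd_apply, zpow_natCast, pow_apply']
  have hAi : ∀ x, A⁻¹ x = (f ^ (-(l : ℤ))) x - p := fun x => by
    rw [hA, wd_inv hf.1, wd_apply]; push_cast; ring
  obtain ⟨ξ, hξ, eξ⟩ := mvt u v huv
  obtain ⟨ζ, hζ, eζ⟩ := mvt (A⁻¹ u) (A⁻¹ v) (A⁻¹.strictMono huv)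
  have e1 : f^[l] (A⁻¹ v) - f^[l] (A⁻¹ u) = v - u := by
    have h1 := hAx (A⁻¹ v)
    have h2 := hAx (A⁻¹ u)
    rw [apply_inv_self'] at h1 h2
    linarith
  rw [e1, hAi, hAi, sub_sub_sub_cancel_right] at eζ
  rw [eξ] at g1
  have hlt1 : dIter f f1 l ξ < Real.exp (-a) := lt_of_mul_lt_mul_right g1 (sub_pos.2 huv).le
  have hlt2 : Real.exp a < dIter f f1 l ζ := by
    have h1 : v - u < dIter f f1 l ζ * (Real.exp (-a) * (v - u)) :=
      eζ.trans_lt (mul_lt_mul_of_pos_left g2 (hD0 _))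
    rw [← mul_assoc, Real.exp_neg] at h1
    have h2 : 1 < dIter f f1 l ζ * (Real.exp a)⁻¹ := by
      by_contra hcon
      push Not at hcon
      nlinarith
    rwa [← div_eq_mul_inv, one_lt_div (Real.exp_pos _)] at h2
  have hl1 : Real.log (dIter f f1 l ξ) < -a := (Real.log_lt_iff_lt_exp (hD0 _)).2 hlt1
  have hl2 : a < Real.log (dIter f f1 l ζ) := (Real.lt_log_iff_exp_lt (hD0 _)).2 hlt2
  obtain ⟨z, hz⟩ : ∃ z, z = A⁻¹ u := ⟨_, rfl⟩
  have hAz : A z = u := by rw [hz, apply_inv_self']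
  have hζu : ζ < ξ := by
    have : A⁻¹ v ≤ u := by
      have := A⁻¹.monotone hle
      rwa [inv_apply_self'] at this
    linarith [hζ.2, hξ.1]
  have hsum : ∑ i ∈ Finset.range l, (f^[i] ξ - f^[i] ζ) ≤ 2 := by
    have s1 := hC.sum_iterate_le hρ hf hC.le z
    have s2 := hC.sum_iterate_le hρ hf hC.le (A z)
    rw [← hA] at s1 s2
    have := add_le_add s1 s2
    rw [← Finset.sum_add_distrib] at this
    refine (Finset.sum_le_sum fun i _ => ?_).trans (this.trans (by norm_num))
    have hmono := (f.strictMono.iterate i).monotone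
    have m1 : f^[i] ξ ≤ f^[i] (A (A z)) := hmono (by rw [hAz]; exact hξ.2.le.trans hle)
    have m2 : f^[i] z ≤ f^[i] ζ := hmono (by rw [hz]; exact hζ.1.le)
    linarith
  have hdist : Real.log (dIter f f1 l ζ) - Real.log (dIter f f1 l ξ) ≤ a * 2 := by
    rw [dIter, dIter, Real.log_prod fun j _ => (hpos _).ne',
      Real.log_prod fun j _ => (hpos _).ne', ← Finset.sum_sub_distrib]
    refine le_trans (Finset.sum_le_sum fun i _ => ?_)
      ((Finset.mul_sum _ _ _).symm.le.trans (mul_le_mul_of_nonneg_left hsum ha0))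
    have h1 := hlog (f^[i] ξ) (f^[i] ζ)
    rw [abs_sub_comm (f^[i] ζ), abs_of_nonneg (sub_nonneg.2
      ((f.strictMono.iterate i).monotone hζu.le))] at h1
    exact (le_abs_self _).trans h1
  linarith

lemma exists_small_displacement {f : ℝ ≃o ℝ} {f1 m t : ℝ → ℝ} {a : ℝ} {α : ℕ → ℝ}
    (hJ : ∀ x, Jet f f1 m t x) (hpos : ∀ x, 0 < f1 x) (hm : ∀ x, |m x| ≤ a)
    (hα : GaussSeq α) (hf : RotPair (tr 1) f (α 0)) {ε : ℝ} (hε : 0 < ε) :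
    ∃ N p q p' q', Cvg (α 0) (α (2 * N + 1)) p q p' q' ∧ ∀ x, wd f p q x - x ≤ ε := by
  by_contra hcon
  push Not at hcon
  choose p q p' q' hC hq using hα.exists_cvg
  have hx : ∀ k, ∃ x ∈ Set.Icc (0 : ℝ) 1, ε < wd f (p k) (q k) x - x := fun k => by
    obtain ⟨x, hx⟩ := hcon k _ _ _ _ (hC k)
    refine ⟨Int.fract x, ⟨Int.fract_nonneg _, (Int.fract_lt_one _).le⟩, ?_⟩
    have h1 : Commute (wd f (p k) (q k)) (tr 1 ^ (-⌊x⌋)) :=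
      (((Commute.refl _).zpow_zpow _ _).mul_left ((hf.1.symm).zpow_zpow _ _))
    have h2 := DFunLike.congr_fun h1.eq x
    rw [tr_zpow, mul_apply', mul_apply', tr_apply, tr_apply] at h2
    have h3 : x + ((-⌊x⌋ : ℤ) : ℝ) * 1 = Int.fract x := by
      rw [Int.fract]; push_cast; ring
    rw [h3] at h2
    rw [h2, Int.fract]; push_cast; linarith
  choose x hx01 hxε using hx
  obtain ⟨y, -, φ, hφ, hlim⟩ := isCompact_Icc.tendsto_subseq hx01
  obtain ⟨n0, hn0⟩ := (Metric.tendsto_atTop.1 hlim) (ε / 4) (by positivity)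
  refine not_wandering hJ hpos hm hf (u := y + ε / 4) (v := y + 3 * ε / 4) (by linarith)
    fun k => ⟨α (2 * φ (max k n0) + 1), _, _, _, _, hα.pos _, hC _, lt_of_le_of_lt ?_ (hq _), ?_⟩
  · exact_mod_cast (le_max_left k n0).trans (hφ.id_le _)
  · have h1 := hn0 (max k n0) (le_max_right _ _)
    rw [Function.comp_apply, Real.dist_eq, abs_lt] at h1
    have h2 := (wd f (p (φ (max k n0))) (q (φ (max k n0)))).monotone
      (show x (φ (max k n0)) ≤ y + ε / 4 by linarith)
    have h3 := hxε (φ (max k n0))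
    linarith

lemma exists_good_of_holDiff {f : ℝ ≃o ℝ} {g g1 n s : ℂ → ℂ} {f1 m t : ℝ → ℝ} {ν a a' : ℝ}
    {α : ℕ → ℝ} (hJ : StripJet f g g1 n s f1 m t ν a a') (hν : 0 < ν) (hfH : HolDiff f)
    (hα : GaussSeq α) (hf : RotPair (tr 1) f (α 0)) (Δ : ℝ) :
    ∃ N G, Good (α N) Δ G ∧ (Lin (tr 1) G → Lin (tr 1) f) := by
  obtain ⟨K0, c, hK0, hc, close⟩ := exists_good_of_stripJet
  obtain ⟨K, hKK0, hKΔ⟩ : ∃ K, K0 ≤ K ∧ 20 * Δ ≤ K := ⟨_, le_max_left _ _, le_max_right _ _⟩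
  have hK : 0 < K := hK0.trans_le hKK0
  obtain ⟨M, ⟨hM1, hM2⟩, hM0⟩ : ∃ M, (2 * K * Real.exp a * M < ν ∧
      2 * (K * Real.exp a * (√(2 * a' * M) + 4 * a' * Real.exp a * M * K) *
      Real.exp (a * K * Real.exp a)) < min c (c / K)) ∧ 0 < M := by
    have c1 : Continuous fun M : ℝ => 2 * K * Real.exp a * M := by fun_prop
    have c2 : Continuous fun M : ℝ => 2 * (K * Real.exp a * (√(2 * a' * M) +
      4 * a' * Real.exp a * M * K) * Real.exp (a * K * Real.exp a)) := by fun_prop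
    have e1 := (c1.tendsto 0).eventually_lt_const (u := ν) (by simpa using hν)
    have e2 := (c2.tendsto 0).eventually_lt_const (u := min c (c / K)) (by
      have := lt_min hc (div_pos hc hK)
      simpa using this)
    exact (((e1.and e2).filter_mono nhdsWithin_le_nhds).and
      (self_mem_nhdsWithin : Set.Ioi (0 : ℝ) ∈ 𝓝[>] 0)).exists
  have ha : ∀ x, |m x| ≤ a := fun x => by
    have := hJ.norm_n x (strip_real hν x)
    rwa [hJ.real2, Complex.norm_real, Real.norm_eq_abs] at this
  obtain ⟨N, p, q, p', q', hC, hsm⟩ := exists_small_displacement (hJ.real_jet hν) hJ.pos ha hα hf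
    hM0
  have hρ := hα.pos (2 * N + 1)
  obtain ⟨l, rfl⟩ : ∃ l : ℕ, q = l := ⟨q.toNat, by have := hC.pos; omega⟩
  obtain ⟨l', rfl⟩ : ∃ l : ℕ, q' = l := ⟨q'.toNat, by have := hC.pos; have := hC.le; omega⟩
  have hc1 := hf.1
  have hAH : HolDiff (wd f p l) := ((holDiff_tr 1).zpow p).mul (hfH.zpow l)
  have hcT : ∀ x, wd f p l (x + 1) = wd f p l x + 1 := fun x => by
    have h1 : Commute (tr 1) (wd f p l) :=
      ((Commute.refl _).zpow_right _).mul_right (hc1.zpow_right _)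
    have := DFunLike.congr_fun h1.eq x
    simpa [mul_apply'] using this.symm
  have hcf : Commute (wd f p l) f :=
    (hc1.zpow_left _).mul_left ((Commute.refl _).zpow_left _)
  obtain ⟨x0, hx0⟩ := exists_min_displacement hAH.continuous hcT
  have hδ : 0 < wd f p l x0 - x0 := by
    have := hf.2 p l hC.err_pos x0
    exact sub_pos.2 this
  obtain ⟨Λ, hΛ, hΛA, hΛB⟩ := close f g g1 n s f1 m t ν a a' (wd f p l) (wd f p' l')
    (α (2 * N + 1)) p p' _ M K x0 _ l l' l' hJ hKK0 hρ (hα.lt_one _) (hC.rotPair hf) hAH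
    (by exact_mod_cast hC.le) le_rfl
    (fun x => by rw [wd_apply, zpow_natCast, pow_apply'])
    (fun x => by rw [wd_apply, zpow_natCast, pow_apply'])
    (fun x => DFunLike.congr_fun hcf.eq x) hδ hx0 rfl hsm
    (fun x => by
      have h1 := hC.sum_iterate_le hρ hf le_rfl x
      refine le_of_eq_of_le (Finset.sum_congr rfl fun i _ => ?_) h1
      have h2 := DFunLike.congr_fun (hcf.pow_right i).eq x
      rw [mul_apply', mul_apply', pow_apply', pow_apply'] at h2
      rw [h2])
    hM1 rfl (hM2.le.trans (min_le_left _ _)) (Or.inl (hM2.le.trans (min_le_right _ _)))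
  refine ⟨2 * N + 1, _, hΛB.mono (by linarith), fun hlin => ?_⟩
  rw [← hΛA] at hlin
  obtain ⟨u, hu, huA, huB⟩ := hlin.conj hΛ
  rw [inv_mem_iff] at huB
  have key : ∀ i j, wd f (i * p + j * p') (i * l + j * l') ∈ trSub u := fun i j => by
    rw [← wd_mul hc1, ← wd_zpow hc1, ← wd_zpow hc1]
    exact mul_mem (zpow_mem huA _) (zpow_mem huB _)
  have hd := hC.det
  refine ⟨u, hu, ?_, ?_⟩
  · have := key l' (-l)
    rw [show (l' : ℤ) * p + -l * p' = 1 by linear_combination hd,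
      show (l' : ℤ) * l + -l * l' = 0 by ring] at this
    simpa [wd] using this
  · have := key (-p') p
    rw [show -p' * p + p * p' = 0 by ring,
      show -p' * l + p * l' = 1 by linear_combination hd] at this
    simpa [wd] using this

/-- An injective holomorphic function has nonvanishing derivative. -/
lemma deriv_ne_zero_of_injOn {g : ℂ → ℂ} {U : Set ℂ} {z₀ : ℂ} (hg : AnalyticAt ℂ g z₀)
    (hU : U ∈ 𝓝 z₀) (hinj : Set.InjOn g U) : deriv g z₀ ≠ 0 := by
  intro hd
  have hg0 : AnalyticAt ℂ (fun z => g z - g z₀) z₀ := hg.sub analyticAt_const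
  have hne : ¬ ∀ᶠ z in 𝓝 z₀, g z - g z₀ = 0 := by
    intro h
    have h2 : ∀ᶠ z in 𝓝[≠] z₀, False := by
      filter_upwards [h.filter_mono nhdsWithin_le_nhds, nhdsWithin_le_nhds hU,
        self_mem_nhdsWithin] with z h1 h2 h3
      exact h3 (hinj h2 (mem_of_mem_nhds hU) (sub_eq_zero.1 h1))
    exact (NormedField.nhdsNE_neBot z₀).ne (by simpa using h2)
  obtain ⟨k, u, hu, hu0, hk⟩ := hg0.exists_eventuallyEq_pow_smul_nonzero_iff.2 hne
  have hk0 : k ≠ 0 := by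
    rintro rfl
    have := hk.self_of_nhds
    simp at this
    exact hu0 this.symm
  have hk1 : k ≠ 1 := by
    rintro rfl
    have h1 : HasDerivAt (fun z => (z - z₀) ^ 1 • u z) (u z₀) z₀ := by
      have h0 := ((hasDerivAt_id z₀).sub_const z₀).mul hu.differentiableAt.hasDerivAt
      refine (h0.congr_deriv (by simp)).congr_of_eventuallyEq (Eventually.of_forall fun z => ?_)
      simp
    have h2 : HasDerivAt (fun z => g z - g z₀) (u z₀) z₀ := h1.congr_of_eventuallyEq hk
    have h3 := (h2.add_const (g z₀)).deriv
    simp at h3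
    exact hu0 (h3.symm.trans hd)
  have hkC : (k : ℂ) ≠ 0 := by exact_mod_cast hk0
  have hq : AnalyticAt ℂ (fun z => Complex.log (u z / u z₀) / k) z₀ := by
    refine AnalyticAt.div (AnalyticAt.clog (hu.div analyticAt_const hu0) ?_) analyticAt_const hkC
    simp [div_self hu0]
  have hE : AnalyticAt ℂ (fun z => Complex.exp (Complex.log (u z / u z₀) / k)) z₀ := hq.cexp
  obtain ⟨ψ, hψ⟩ : ∃ ψ : ℂ → ℂ, ψ = fun z => (z - z₀) *
      Complex.exp (Complex.log (u z / u z₀) / k) := ⟨_, rfl⟩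
  have hψa : AnalyticAt ℂ ψ z₀ := by
    rw [hψ]; exact (analyticAt_id.sub analyticAt_const).mul hE
  have hψ1 : HasDerivAt ψ 1 z₀ := by
    have := ((hasDerivAt_id z₀).sub_const z₀).mul hE.differentiableAt.hasDerivAt
    rw [hψ]
    refine this.congr_deriv ?_
    simp [div_self hu0]
  have hmap : map ψ (𝓝 z₀) = 𝓝 0 := by
    have h := hψa.hasStrictDerivAt
    rw [hψ1.deriv] at h
    have h2 := h.map_nhds_eq one_ne_zero
    rwa [show ψ z₀ = 0 by simp [hψ]] at h2
  have hpow : ∀ᶠ z in 𝓝 z₀, g z - g z₀ = ψ z ^ k * u z₀ := by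
    have hune : ∀ᶠ z in 𝓝 z₀, u z ≠ 0 := hu.continuousAt.eventually_ne hu0
    filter_upwards [hk, hune] with z h1 h2
    rw [h1, hψ]
    simp only [smul_eq_mul]
    rw [mul_pow, ← Complex.exp_nat_mul, mul_div_cancel₀ _ hkC,
      Complex.exp_log (div_ne_zero h2 hu0)]
    field_simp
  have himg : ψ '' (U ∩ {z | g z - g z₀ = ψ z ^ k * u z₀}) ∈ 𝓝 (0 : ℂ) := by
    rw [← hmap]
    exact image_mem_map (inter_mem hU hpow)
  obtain ⟨ζ, hζ⟩ : ∃ ζ : ℂ, ζ = Complex.exp (2 * Real.pi * Complex.I / k) := ⟨_, rfl⟩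
  have hprim : IsPrimitiveRoot ζ k := hζ ▸ Complex.isPrimitiveRoot_exp k hk0
  have hζ1 : ζ ≠ 1 := hprim.ne_one (by omega)
  have himg2 : ∀ᶠ w in 𝓝 (0 : ℂ),
      ζ * w ∈ ψ '' (U ∩ {z | g z - g z₀ = ψ z ^ k * u z₀}) := by
    have : Tendsto (fun w : ℂ => ζ * w) (𝓝 0) (𝓝 0) := by
      have hc : Continuous fun w : ℂ => ζ * w := by fun_prop
      simpa using hc.tendsto 0
    exact this.eventually himg
  have hfin : ∀ᶠ w in 𝓝[≠] (0 : ℂ), False := by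
    filter_upwards [nhdsWithin_le_nhds himg, himg2.filter_mono nhdsWithin_le_nhds,
      self_mem_nhdsWithin] with w h1 h2 h3
    obtain ⟨x, ⟨hx, hx2⟩, hxw⟩ := h1
    obtain ⟨y, ⟨hy, hy2⟩, hyw⟩ := h2
    have : g x - g z₀ = g y - g z₀ := by
      rw [show g x - g z₀ = _ from hx2, show g y - g z₀ = _ from hy2, hxw, hyw, mul_pow,
        hprim.pow_eq_one, one_mul]
    have hxy := hinj hx hy (by simpa using this)
    rw [← hxy, hxw] at hyw
    have : (ζ - 1) * w = 0 := by linear_combination -hyw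
    rcases mul_eq_zero.1 this with h | h
    · exact hζ1 (sub_eq_zero.1 h)
    · exact h3 h
  exact (NormedField.nhdsNE_neBot (0 : ℂ)).ne (by simpa using hfin)


/-- A circle diffeomorphism of rotation number `ρ` generates a rotation pair. -/
lemma rotPair_of_isRotNumber {F : ℝ ≃o ℝ} (h1 : ∀ x, F (x + 1) = F x + 1) {ρ : ℝ}
    (hρ : IsRotNumber F ρ) : RotPair (tr 1) F ρ := by
  have hcomm : Commute (tr 1) F := by
    ext x; simp [mul_apply', h1]
  refine ⟨hcomm, ?_⟩
  -- iterates of a point that is not moved to the right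
  have key : ∀ (m n : ℤ) (x : ℝ), (tr 1 ^ m * F ^ n) x ≤ x → ∀ k : ℕ,
      (F ^ (n * k)) x ≤ x - m * k := by
    intro m n x hx k
    have e1 : ((tr 1 ^ m * F ^ n) ^ k) x ≤ x := by
      induction k with
      | zero => simp
      | succ k ih =>
        rw [pow_succ, mul_apply']
        exact ((OrderIso.monotone _) hx).trans ih
    have e2 : (tr 1 ^ m * F ^ n) ^ k = tr 1 ^ (m * k) * F ^ (n * k) := by
      rw [((hcomm.zpow_left m).zpow_right n).mul_pow, zpow_mul, zpow_mul, zpow_natCast,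
        zpow_natCast]
    rw [e2, mul_apply', tr_zpow, tr_apply] at e1
    push_cast at e1
    linarith
  have iter : ∀ (k : ℕ) (x : ℝ), (F ^ k) x = F^[k] x := fun k x => pow_apply' F k x
  intro m n hmn x
  by_contra hx
  have hx := key m n x (not_lt.1 hx)
  have hlim := hρ x
  rcases lt_trichotomy n 0 with hn | hn | hn
  · obtain ⟨p, rfl⟩ : ∃ p : ℕ, n = -p := ⟨n.natAbs, by omega⟩
    have hp : 0 < p := by omega
    have hp' : (0 : ℝ) < p := by exact_mod_cast hp
    -- iterate from the image point
    have h2 : ∀ k : ℕ, x + m * k ≤ F^[p * k] x := by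
      intro k
      have h3 := hx k
      have h4 := (F ^ (p * k)).monotone h3
      have h5 : (F ^ (p * k)) ((F ^ (-(p : ℤ) * k)) x) = x := by
        rw [← mul_apply', ← zpow_natCast, ← zpow_add]
        simp [one_apply']
      have h6 : (F ^ (p * k)) (x - m * k) = (F ^ (p * k)) x - m * k := by
        have hc : Commute (tr 1 ^ (-(m * k : ℤ))) (F ^ (p * k)) :=
          (hcomm.zpow_left _).pow_right _
        have := congrArg (fun G : ℝ ≃o ℝ => G x) hc.eq
        simp only [mul_apply', tr_zpow, tr_apply] at this
        push_cast at this
        rw [show x - m * k = x + -(m * k) * 1 by ring, ← this]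
        ring
      rw [h5, h6, iter] at h4
      linarith
    have hl2 : Tendsto (fun k : ℕ => (F^[p * k] x - x) / ((p * k : ℕ) : ℝ)) atTop (𝓝 ρ) :=
      hlim.comp (tendsto_id.const_mul_atTop' hp)
    have h7 : (m : ℝ) / p ≤ ρ := by
      refine ge_of_tendsto hl2 ?_
      filter_upwards [eventually_gt_atTop 0] with k hk
      have hk' : (0 : ℝ) < k := by exact_mod_cast hk
      push_cast
      rw [div_le_div_iff₀ hp' (by positivity)]
      nlinarith [h2 k]
    rw [div_le_iff₀ hp'] at h7
    push_cast at hmn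
    nlinarith
  · subst hn
    have := hx 1
    simp [one_apply'] at this
    simp at hmn
    have : (m : ℝ) ≤ 0 := by exact_mod_cast (by simpa using this)
    have : (0 : ℝ) < m := by exact_mod_cast hmn
    linarith
  · obtain ⟨p, rfl⟩ : ∃ p : ℕ, n = p := ⟨n.natAbs, by omega⟩
    have hp : 0 < p := by omega
    have hp' : (0 : ℝ) < p := by exact_mod_cast hp
    have hl2 : Tendsto (fun k : ℕ => (F^[p * k] x - x) / ((p * k : ℕ) : ℝ)) atTop (𝓝 ρ) :=
      hlim.comp (tendsto_id.const_mul_atTop' hp)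
    have h7 : ρ ≤ -(m : ℝ) / p := by
      refine le_of_tendsto hl2 ?_
      filter_upwards [eventually_gt_atTop 0] with k hk
      have hk' : (0 : ℝ) < k := by exact_mod_cast hk
      have h2 := hx k
      rw [show ((p : ℤ) * (k : ℤ)) = ((p * k : ℕ) : ℤ) by push_cast; ring, zpow_natCast,
        iter] at h2
      push_cast
      rw [div_le_div_iff₀ (by positivity) hp']
      nlinarith
    rw [le_div_iff₀ hp'] at h7
    push_cast at hmn
    nlinarith

lemma isRotNumber_sub_int {F : ℝ → ℝ} (h1 : ∀ x, F (x + 1) = F x + 1) {ρ : ℝ}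
    (hρ : IsRotNumber F ρ) (N : ℤ) : IsRotNumber (fun x => F x - N) (ρ - N) := by
  intro x
  have h_int : ∀ (x : ℝ) (j : ℤ), F (x + j) = F x + j := by
    have : ∀ (x : ℝ) (j : ℕ), F (x + j) = F x + j := by
      intro x j
      induction j with
      | zero => simp
      | succ j ih => push_cast; rw [← add_assoc, h1, ih, add_assoc]
    intro x j
    obtain ⟨p, rfl | rfl⟩ := j.eq_nat_or_neg
    · exact_mod_cast this x p
    · have := this (x + ((-(p : ℤ) : ℤ) : ℝ)) p
      push_cast at this ⊢
      rw [neg_add_cancel_right] at this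
      linarith
  have e : ∀ n : ℕ, (fun x => F x - N)^[n] x = F^[n] x - N * n := by
    intro n
    induction n with
    | zero => simp
    | succ n ih =>
      rw [Function.iterate_succ_apply', Function.iterate_succ_apply', ih]
      have := h_int (F^[n] x) (-(N * n))
      push_cast at this ⊢
      rw [← sub_eq_add_neg] at this
      rw [this]; ring
  refine ((hρ x).sub_const (N : ℝ)).congr' ?_
  filter_upwards [eventually_gt_atTop 0] with n hn
  have hn' : (n : ℝ) ≠ 0 := by exact_mod_cast hn.ne'
  rw [e]
  field_simp
  ring

/-- A strictly increasing continuous lift of a degree one circle map is an order isomorphism. -/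
lemma exists_orderIso_of_lift {F : ℝ → ℝ} (hF : StrictMono F) (hc : Continuous F)
    (h1 : ∀ x, F (x + 1) = F x + 1) : ∃ f : ℝ ≃o ℝ, ∀ x, f x = F x := by
  have hn : ∀ n : ℕ, F n = F 0 + n := by
    intro n
    induction n with
    | zero => simp
    | succ n ih => push_cast; rw [h1, ih]; ring
  have hn' : ∀ n : ℕ, F (-n) = F 0 - n := by
    intro n
    induction n with
    | zero => simp
    | succ n ih =>
      have := h1 (-((n + 1 : ℕ) : ℝ))
      rw [show -((n + 1 : ℕ) : ℝ) + 1 = -n by push_cast; ring, ih] at this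
      push_cast at this ⊢
      linarith
  have hs : Function.Surjective F := by
    refine hc.surjective ?_ ?_
    · refine tendsto_atTop_atTop.2 fun b => ?_
      obtain ⟨n, hb⟩ := exists_nat_ge (b - F 0)
      exact ⟨n, fun x hx => by linarith [hF.monotone hx, hn n]⟩
    · refine tendsto_atBot_atBot.2 fun b => ?_
      obtain ⟨n, hb⟩ := exists_nat_ge (F 0 - b)
      exact ⟨-n, fun x hx => by linarith [hF.monotone hx, hn' n]⟩
  exact ⟨hF.orderIsoOfSurjective F hs, fun x => rfl⟩

/-- A continuous function on a strip that is invariant under `z ↦ z + 1` is bounded on smaller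
strips. -/
lemma exists_norm_le_of_periodic {u : ℂ → ℂ} {ν : ℝ} (hν : 0 < ν) (hu : ContinuousOn u (strip ν))
    (h1 : ∀ z, u (z + 1) = u z) : ∃ C, ∀ z ∈ strip (ν / 2), ‖u z‖ ≤ C := by
  have hK : IsCompact (Set.Icc (0 : ℝ) 1 ×ℂ Set.Icc (-(ν / 2)) (ν / 2)) :=
    isCompact_Icc.reProdIm isCompact_Icc
  obtain ⟨C, hC⟩ := hK.exists_bound_of_continuousOn (f := u) (hu.mono fun z hz => by
    obtain ⟨h2, h3⟩ := (Complex.mem_reProdIm.1 hz).2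
    show |z.im| < ν
    rw [abs_lt]
    constructor <;> linarith)
  have hp : Function.Periodic u 1 := h1
  refine ⟨C, fun z hz => ?_⟩
  have hz : |z.im| < ν / 2 := hz
  have h3 := (hp.sub_zsmul_eq ⌊z.re⌋ : u (z - _) = u z)
  rw [← h3]
  refine hC _ (Complex.mem_reProdIm.2 ⟨?_, ?_⟩)
  · have a1 := Int.floor_le z.re
    have a2 := Int.lt_floor_add_one z.re
    have e : (z - ⌊z.re⌋ • (1 : ℂ)).re = z.re - ⌊z.re⌋ := by simp
    rw [e]
    constructor <;> linarith
  · have := abs_lt.1 hz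
    constructor <;> simp <;> linarith [this.1, this.2]

lemma HolDiff.of_stripJet {f : ℝ → ℝ} {g g1 n s : ℂ → ℂ} {f1 m t : ℝ → ℝ} {ν a a' : ℝ}
    (hν : 0 < ν) (h : StripJet f g g1 n s f1 m t ν a a') : HolDiff f := by
  intro x
  have hx : (x : ℂ) ∈ strip ν := by
    show |(x : ℂ).im| < ν
    simpa using hν
  have hd : DifferentiableOn ℂ g (strip ν) := fun z hz =>
    (h.jet z hz).d1.differentiableAt.differentiableWithinAt
  refine ⟨g, f1 x, h.pos x, hd.analyticAt ((isOpen_strip ν).mem_nhds hx), ?_,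
    Eventually.of_forall h.real0⟩
  rw [← h.real1 x]
  exact (h.jet x hx).d1

/-- An analytic circle diffeomorphism, normalised by an integer translation, as a rotation pair
with bounds on its nonlinearity and its Schwarzian derivative. -/
lemma exists_stripJet_of_diffeo {α ν : ℝ} (hν : 0 < ν) (f : AnalyticCircleDiffeo ν)
    (hρ : IsRotNumber (fun x : ℝ => (f.toFun x).re) α) :
    ∃ (F : ℝ ≃o ℝ) (g g1 n s : ℂ → ℂ) (f1 m t : ℝ → ℝ) (a a' : ℝ),
      StripJet F g g1 n s f1 m t (ν / 2) a a' ∧ RotPair (tr 1) F (Int.fract α) ∧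
      ∀ x : ℝ, f.toFun x = ((F x + ⌊α⌋ : ℝ) : ℂ) := by
  have hre : ∀ x : ℝ, f.toFun x = ((f.toFun x).re : ℂ) := fun x =>
    Complex.ext (by simp) (by simp [f.real_toFun x])
  have hsub : strip ν ⊆ {z : ℂ | |z.im| ≤ ν} := fun z hz => (show |z.im| < ν from hz).le
  have hd : DifferentiableOn ℂ f.toFun (strip ν) := f.diffOn.mono hsub
  have oU := isOpen_strip ν
  have hcont : Continuous fun x : ℝ => (f.toFun x).re := by
    refine Complex.continuous_re.comp (continuous_iff_continuousAt.2 fun x => ?_)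
    have hx : (x : ℂ) ∈ strip ν := by
      show |(x : ℂ).im| < ν
      simpa using hν
    exact ContinuousAt.comp (f := fun x : ℝ => (x : ℂ))
      (hd.differentiableAt (oU.mem_nhds hx)).continuousAt Complex.continuous_ofReal.continuousAt
  have hper : ∀ x : ℝ, (f.toFun ((x + 1 : ℝ) : ℂ)).re = (f.toFun x).re + 1 := by
    intro x
    push_cast
    rw [f.map_add_one]; simp
  obtain ⟨F, hF⟩ := exists_orderIso_of_lift (F := fun x : ℝ => (f.toFun x).re - ⌊α⌋)
    (fun x y h => by have := f.strictMono_real h; simp only at this ⊢; linarith)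
    (hcont.sub continuous_const) (fun x => by simp only [hper]; ring)
  have hF1 : ∀ x, F (x + 1) = F x + 1 := fun x => by simp only [hF, hper]; ring
  have hrot : IsRotNumber F (Int.fract α) := by
    have := isRotNumber_sub_int hper hρ ⌊α⌋
    rwa [← funext hF] at this
  obtain ⟨g, hg⟩ : ∃ g : ℂ → ℂ, g = fun z => f.toFun z - (⌊α⌋ : ℂ) := ⟨_, rfl⟩
  have hgd : DifferentiableOn ℂ g (strip ν) := by rw [hg]; exact hd.sub_const _
  have hgF : ∀ x : ℝ, g x = F x := fun x => by
    rw [hF, hg]; push_cast; rw [← hre]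
  have hg1 : ∀ z, g (z + 1) = g z + 1 := fun z => by simp only [hg, f.map_add_one]; ring
  have hginj : Set.InjOn g (strip ν) := fun z hz w hw h => by
    rw [hg] at h
    exact f.injOn (hsub hz) (hsub hw) (sub_left_injective h)
  have hne : ∀ z ∈ strip ν, deriv g z ≠ 0 := fun z hz =>
    deriv_ne_zero_of_injOn (hgd.analyticAt (oU.mem_nhds hz)) (oU.mem_nhds hz) hginj
  have hdp : ∀ u : ℂ → ℂ, (∀ z, u (z + 1) = u z) → ∀ z, deriv u (z + 1) = deriv u z := by
    intro u hu z
    rw [← deriv_comp_add_const]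
    simp only [hu]
  have hd1 : ∀ z, deriv g (z + 1) = deriv g z := by
    intro z
    rw [← deriv_comp_add_const]
    simp only [hg1, deriv_add_const]
  have hd2 := hdp _ hd1
  obtain ⟨n, hn⟩ : ∃ n : ℂ → ℂ, n = fun w => deriv (deriv g) w / deriv g w := ⟨_, rfl⟩
  have hn1 : ∀ z, n (z + 1) = n z := fun z => by simp only [hn, hd1, hd2]
  have hnd : DifferentiableOn ℂ n (strip ν) := by
    rw [hn]; exact ((hgd.deriv oU).deriv oU).div (hgd.deriv oU) hne
  have hn2 := hdp _ hn1
  obtain ⟨a, ha⟩ := exists_norm_le_of_periodic hν hnd.continuousOn hn1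
  obtain ⟨a', ha'⟩ := exists_norm_le_of_periodic (u := fun z => deriv n z - n z ^ 2 / 2) hν
    ((hnd.deriv oU).continuousOn.sub ((hnd.continuousOn.pow 2).div_const 2))
    (fun z => by simp only [hn1, hn2])
  have hsub2 : strip (ν / 2) ⊆ strip ν := fun z hz =>
    lt_trans (show |z.im| < ν / 2 from hz) (by linarith)
  rw [hn] at ha ha'
  obtain ⟨g1, n, s, f1, m, t, hJ⟩ := exists_stripJet (half_pos hν) (hgd.mono hsub2) hgF hg1
    (fun z hz => hne z (hsub2 hz)) ha ha'
  refine ⟨F, g, g1, n, s, f1, m, t, a, a', hJ, rotPair_of_isRotNumber hF1 hrot, fun x => ?_⟩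
  rw [hF, sub_add_cancel]
  exact hre x

lemma HolDiff.strictMono {h : ℝ → ℝ} (hh : HolDiff h) : StrictMono h :=
  strictMono_of_deriv_pos fun x => by
    obtain ⟨c, hc, hd⟩ := (hh x).hasDerivAt
    rwa [hd.deriv]

lemma apply_zpow_of_apply {h : ℝ → ℝ} {γ : ℝ ≃o ℝ} {t : ℝ} (hγ : ∀ x, h (γ x) = h x + t) (n : ℤ)
    (x : ℝ) : h ((γ ^ n) x) = h x + n * t := by
  have hnat : ∀ (n : ℕ) (x : ℝ), h ((γ ^ n) x) = h x + n * t := by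
    intro n
    induction n with
    | zero => simp [one_apply']
    | succ n ih => intro x; rw [pow_succ, mul_apply', ih, hγ]; push_cast; ring
  obtain ⟨p, rfl | rfl⟩ := n.eq_nat_or_neg
  · simpa using hnat p x
  · have h1 := hnat p ((γ ^ (-(p : ℤ))) x)
    rw [← mul_apply', ← zpow_natCast, ← zpow_add] at h1
    simp [one_apply'] at h1 ⊢
    linarith

/-- The ratio of the translations of a linearised rotation pair is its rotation number. -/
lemma RotPair.translation_eq {A B : ℝ ≃o ℝ} {ρ s t : ℝ} {h : ℝ → ℝ} (hr : RotPair A B ρ)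
    (hm : StrictMono h) (hs : ∀ x, h (A x) = h x + s) (ht : ∀ x, h (B x) = h x + t)
    (hs0 : 0 < s) : t = s * ρ := by
  have key : ∀ m n : ℤ, 0 < m + n * ρ → 0 < m * s + n * t := by
    intro m n hmn
    have h1 := hm (hr.2 m n hmn 0)
    rw [mul_apply', apply_zpow_of_apply hs, apply_zpow_of_apply ht] at h1
    linarith
  have bound : ∀ n : ℤ, n * (s * ρ - t) < s := by
    intro n
    have h1 := key (⌊-(n * ρ)⌋ + 1) n (by
      have := Int.lt_floor_add_one (-(n * ρ)); push_cast; linarith)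
    have h2 := Int.floor_le (-(n * ρ))
    push_cast at h1
    have : (⌊-(n * ρ)⌋ : ℝ) * s ≤ -(n * ρ) * s := mul_le_mul_of_nonneg_right h2 hs0.le
    nlinarith
  by_contra hne
  have hd : s * ρ - t ≠ 0 := fun h => hne (by linarith)
  rcases lt_or_gt_of_ne hd with h | h
  · obtain ⟨n, hn⟩ := exists_nat_gt (s / -(s * ρ - t))
    rw [div_lt_iff₀ (by linarith)] at hn
    have := bound (-n)
    push_cast at this
    linarith
  · obtain ⟨n, hn⟩ := exists_nat_gt (s / (s * ρ - t))
    rw [div_lt_iff₀ h] at hn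
    have := bound n
    push_cast at this
    linarith

/-- A holomorphic function whose derivative has positive real part on a convex open set is
injective. -/
lemma injOn_of_re_deriv_pos {H : ℂ → ℂ} {U : Set ℂ} (hU : IsOpen U) (hc : Convex ℝ U)
    (hH : DifferentiableOn ℂ H U) (hp : ∀ z ∈ U, 0 < (deriv H z).re) : Set.InjOn H U := by
  intro z hz w hw hzw
  by_contra hne
  have hmem : ∀ t ∈ Set.Icc (0 : ℝ) 1, z + t * (w - z) ∈ U := by
    intro t ht
    have := hc hz hw (show 0 ≤ 1 - t by linarith [ht.2]) ht.1 (by ring)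
    simp only [Complex.real_smul] at this
    convert this using 1
    push_cast; ring
  have hder : ∀ t ∈ Set.Icc (0 : ℝ) 1, HasDerivAt
      (fun t : ℝ => (H (z + t * (w - z)) * conj (w - z)).re)
      ((deriv H (z + t * (w - z))).re * ‖w - z‖ ^ 2) t := by
    intro t ht
    have h1 := (hH.differentiableAt (hU.mem_nhds (hmem t ht))).hasDerivAt
    have h2 : HasDerivAt (fun t : ℂ => z + t * (w - z)) (w - z) (t : ℂ) := by
      simpa using ((hasDerivAt_id (t : ℂ)).mul_const (w - z)).const_add z
    have h3 := ((h1.comp (t : ℂ) h2).mul_const (conj (w - z))).real_of_complex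
    refine h3.congr_deriv ?_
    rw [mul_assoc, Complex.mul_conj, Complex.re_mul_ofReal, Complex.normSq_eq_norm_sq]
  have hmono : StrictMonoOn (fun t : ℝ => (H (z + t * (w - z)) * conj (w - z)).re)
      (Set.Icc 0 1) := by
    refine strictMonoOn_of_deriv_pos (convex_Icc 0 1)
      (fun t ht => (hder t ht).continuousAt.continuousWithinAt) fun t ht => ?_
    rw [interior_Icc] at ht
    have ht' := Set.Ioo_subset_Icc_self ht
    rw [(hder t ht').deriv]
    have : 0 < ‖w - z‖ := norm_pos_iff.2 (sub_ne_zero.2 (Ne.symm hne))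
    have := hp _ (hmem t ht')
    positivity
  have := hmono (Set.left_mem_Icc.2 zero_le_one) (Set.right_mem_Icc.2 zero_le_one) zero_lt_one
  simp [hzw] at this

/-- Local holomorphic extensions with a uniform radius. -/
lemma HolDiff.exists_uniform {h : ℝ → ℝ} {s : ℝ} (hh : HolDiff h) (hs : ∀ x, h (x + 1) = h x + s) :
    ∃ δ > 0, ∀ x : ℝ, ∃ g : ℂ → ℂ, DifferentiableOn ℂ g (Metric.ball x δ) ∧
      ∀ y : ℝ, (y : ℂ) ∈ Metric.ball (x : ℂ) δ → g y = h y := by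
  have hloc : ∀ x : ℝ, ∃ g : ℂ → ℂ, ∃ r > 0, DifferentiableOn ℂ g (Metric.ball x r) ∧
      ∀ y : ℝ, (y : ℂ) ∈ Metric.ball (x : ℂ) r → g y = h y := by
    intro x
    obtain ⟨g, c, -, hga, -, he⟩ := hh x
    obtain ⟨r1, hr1, h1⟩ := Metric.eventually_nhds_iff_ball.1 hga.eventually_analyticAt
    obtain ⟨r2, hr2, h2⟩ := Metric.eventually_nhds_iff_ball.1 he
    refine ⟨g, min r1 r2, lt_min hr1 hr2, fun z hz => ?_, fun y hy => h2 y ?_⟩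
    · exact (h1 z (Metric.ball_subset_ball (min_le_left _ _) hz)).differentiableAt
        |>.differentiableWithinAt
    · have := Metric.ball_subset_ball (min_le_right r1 r2) hy
      rw [Metric.mem_ball, Complex.dist_eq] at this
      rw [Metric.mem_ball, Real.dist_eq]
      rwa [← Complex.ofReal_sub, Complex.norm_real] at this
  choose g r hr hgd hgh using hloc
  have hK : IsCompact ((fun x : ℝ => (x : ℂ)) '' Set.Icc 0 1) :=
    isCompact_Icc.image Complex.continuous_ofReal
  obtain ⟨δ, hδ, hL⟩ := lebesgue_number_lemma_of_metric hK
    (c := fun x : ℝ => Metric.ball (x : ℂ) (r x)) (fun x => Metric.isOpen_ball) (by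
      rintro _ ⟨x, -, rfl⟩
      exact Set.mem_iUnion.2 ⟨x, Metric.mem_ball_self (hr x)⟩)
  have hsn : ∀ (n : ℤ) (x : ℝ), h (x + n) = h x + n * s := by
    intro n x
    have := apply_zpow_of_apply (h := h) (γ := tr 1) (t := s) (fun x => by simpa using hs x) n x
    rwa [tr_zpow, tr_apply, mul_one] at this
  refine ⟨δ, hδ, fun x => ?_⟩
  obtain ⟨i, hi⟩ := hL (Int.fract x : ℝ)
    ⟨Int.fract x, ⟨Int.fract_nonneg x, (Int.fract_lt_one x).le⟩, rfl⟩
  have hmap : ∀ z ∈ Metric.ball (x : ℂ) δ, z - (⌊x⌋ : ℂ) ∈ Metric.ball (i : ℂ) (r i) := by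
    intro z hz
    refine hi ?_
    rw [Metric.mem_ball, Complex.dist_eq] at hz ⊢
    convert hz using 2
    rw [← Int.self_sub_floor]
    push_cast; ring
  refine ⟨fun z => g i (z - (⌊x⌋ : ℂ)) + ((⌊x⌋ * s : ℝ) : ℂ), fun z hz => ?_, fun y hy => ?_⟩
  · have h1 := (hgd i).differentiableAt (Metric.isOpen_ball.mem_nhds (hmap z hz))
    have h2 : DifferentiableAt ℂ (fun z : ℂ => z - (⌊x⌋ : ℂ)) z := by fun_prop
    exact ((h1.comp z h2).add_const _).differentiableWithinAt
  · have h1 := hgh i (y - ⌊x⌋) (by push_cast; exact hmap y hy)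
    have h2 := hsn ⌊x⌋ (y - ⌊x⌋)
    rw [sub_add_cancel] at h2
    push_cast at h1 ⊢
    rw [h1, h2]; push_cast; ring

/-- A commuting-with-translation local diffeomorphism extends holomorphically to a strip. -/
lemma HolDiff.exists_strip {h : ℝ → ℝ} {s : ℝ} (hh : HolDiff h) (hs : ∀ x, h (x + 1) = h x + s) :
    ∃ δ > 0, ∃ H : ℂ → ℂ, DifferentiableOn ℂ H (strip δ) ∧ (∀ x : ℝ, H x = h x) ∧
      ∀ z ∈ strip δ, H (z + 1) = H z + s := by
  obtain ⟨δ, hδ, hloc⟩ := hh.exists_uniform hs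
  choose g hgd hgh using hloc
  have hreal : ∀ x : ℝ, (x : ℂ) ∈ strip δ := fun x => by
    show |(x : ℂ).im| < δ
    simpa using hδ
  have hself : ∀ z ∈ strip δ, z ∈ Metric.ball (z.re : ℂ) δ := by
    intro z hz
    rw [Metric.mem_ball, Complex.dist_eq]
    have : z - z.re = z.im * Complex.I := by
      apply Complex.ext <;> simp
    rw [this]
    simpa using (show |z.im| < δ from hz)
  have hdiff : DifferentiableOn ℂ (fun z : ℂ => g z.re z) (strip δ) := by
    intro z hz
    have hzm := hself z hz
    have hev : (fun w : ℂ => g w.re w) =ᶠ[𝓝 z] g z.re := by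
      filter_upwards [Metric.isOpen_ball.mem_nhds hzm, (isOpen_strip δ).mem_nhds hz,
        Metric.ball_mem_nhds z hδ] with w hw hws hwz
      have hwre : (w.re : ℂ) ∈ Metric.ball (z.re : ℂ) δ := by
        rw [Metric.mem_ball, Complex.dist_eq] at hwz ⊢
        rw [← Complex.ofReal_sub, Complex.norm_real, ← Complex.sub_re]
        exact (Complex.abs_re_le_norm _).trans_lt hwz
      exact eqOn_of_real (Metric.isOpen_ball.inter Metric.isOpen_ball)
        ((convex_ball (w.re : ℂ) δ).inter (convex_ball (z.re : ℂ) δ))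
        ((hgd w.re).mono Set.inter_subset_left) ((hgd z.re).mono Set.inter_subset_right)
        (x0 := w.re) ⟨Metric.mem_ball_self hδ, hwre⟩
        (fun y hy => (hgh _ y hy.1).trans (hgh _ y hy.2).symm) ⟨hself w hws, hw⟩
    have h1 := (hgd z.re).differentiableAt (Metric.isOpen_ball.mem_nhds hzm)
    exact (h1.congr_of_eventuallyEq hev).differentiableWithinAt
  have hH : ∀ x : ℝ, g (x : ℂ).re x = h x := fun x => hgh _ x (hself x (hreal x))
  refine ⟨δ, hδ, fun z => g z.re z, hdiff, hH, ?_⟩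
  have h1mem : ∀ z ∈ strip δ, z + 1 ∈ strip δ := fun z hz => by
    show |(z + 1).im| < δ
    simpa using (show |z.im| < δ from hz)
  refine eqOn_of_real (f := fun z => g (z + 1).re (z + 1)) (g := fun z => g z.re z + s)
    (isOpen_strip δ) (convex_strip δ) ?_ (hdiff.add_const _) (hreal 0) fun x _ => ?_
  · exact hdiff.comp (by fun_prop) h1mem
  · have h1 := hH (x + 1)
    rw [hs] at h1
    rw [hH]
    push_cast at h1
    exact h1

lemma exists_diffeo_of_strip {h : ℝ → ℝ} {s δ : ℝ} {H : ℂ → ℂ} (hh : HolDiff h) (hs : 0 < s)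
    (hδ : 0 < δ) (hH : DifferentiableOn ℂ H (strip δ)) (hr : ∀ x : ℝ, H x = h x)
    (h1 : ∀ z ∈ strip δ, H (z + 1) = H z + s) :
    ∃ ν > (0 : ℝ), ∃ k : AnalyticCircleDiffeo ν, ∀ x : ℝ, k.toFun x = ((h x / s : ℝ) : ℂ) := by
  have hs' : (s : ℂ) ≠ 0 := by exact_mod_cast hs.ne'
  have oU := isOpen_strip δ
  have hreal : ∀ x : ℝ, (x : ℂ) ∈ strip δ := fun x => by
    show |(x : ℂ).im| < δ
    simpa using hδ
  have h1mem : ∀ z ∈ strip δ, z + 1 ∈ strip δ := fun z hz => by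
    show |(z + 1).im| < δ
    simpa using (show |z.im| < δ from hz)
  obtain ⟨k, hk⟩ : ∃ k : ℂ → ℂ, k = fun z => H z / s := ⟨_, rfl⟩
  have hkd : DifferentiableOn ℂ k (strip δ) := hk ▸ hH.div_const _
  have hkr : ∀ x : ℝ, k x = ((h x / s : ℝ) : ℂ) := fun x => by
    rw [hk]; push_cast; rw [← hr]
  have hk1 : ∀ z ∈ strip δ, k (z + 1) = k z + 1 := fun z hz => by
    simp only [hk]; rw [h1 z hz, add_div, div_self hs']
  have hdk1 : ∀ z ∈ strip δ, deriv k (z + 1) = deriv k z := by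
    intro z hz
    rw [← deriv_comp_add_const]
    have : (fun w => k (w + 1)) =ᶠ[𝓝 z] fun w => k w + 1 := by
      filter_upwards [oU.mem_nhds hz] with w hw using hk1 w hw
    rw [this.deriv_eq, deriv_add_const]
  have hpos : ∀ x : ℝ, 0 < (deriv k x).re := by
    intro x
    obtain ⟨c, hc, hd⟩ := (hh x).hasDerivAt
    have h2 := (hkd.differentiableAt (oU.mem_nhds (hreal x))).hasDerivAt.real_of_complex
    simp only [hkr, Complex.ofReal_re] at h2
    rw [h2.unique (hd.div_const s)]
    positivity
  obtain ⟨ε, hε, hsub⟩ := (isCompact_Icc.image Complex.continuous_ofReal :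
      IsCompact ((fun x : ℝ => (x : ℂ)) '' Set.Icc 0 1)).exists_thickening_subset_open
    (((hkd.deriv oU).continuousOn).isOpen_inter_preimage oU
      (isOpen_lt continuous_const Complex.continuous_re : IsOpen {w : ℂ | 0 < w.re})) (by
        rintro _ ⟨x, -, rfl⟩
        exact ⟨hreal x, hpos x⟩)
  have hsn : ∀ z ∈ strip δ, ∀ n : ℕ, deriv k (z + n) = deriv k z := by
    intro z hz n
    induction n with
    | zero => simp
    | succ n ih =>
      push_cast
      rw [← add_assoc, hdk1, ih]
      show |(z + n).im| < δ
      simpa using (show |z.im| < δ from hz)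
  have hsz : ∀ z ∈ strip δ, ∀ n : ℤ, deriv k (z - n) = deriv k z := by
    intro z hz n
    have hm : z - n ∈ strip δ := by
      show |(z - n).im| < δ
      simpa using (show |z.im| < δ from hz)
    obtain ⟨p, rfl | rfl⟩ := n.eq_nat_or_neg
    · have := hsn _ hm p
      push_cast at this ⊢
      rw [← this, sub_add_cancel]
    · have := hsn _ hz p
      push_cast
      rwa [sub_neg_eq_add]
  obtain ⟨ν, hν, hνδ, hνε⟩ : ∃ ν > 0, ν ≤ δ ∧ ν ≤ ε :=
    ⟨min δ ε, lt_min hδ hε, min_le_left _ _, min_le_right _ _⟩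
  have hνsub : strip ν ⊆ strip δ := fun z hz => lt_of_lt_of_le (show |z.im| < ν from hz) hνδ
  have hpos' : ∀ z ∈ strip ν, 0 < (deriv k z).re := by
    intro z hz
    rw [← hsz z (hνsub hz) ⌊z.re⌋]
    refine (hsub (Metric.mem_thickening_iff.2 ⟨((Int.fract z.re : ℝ) : ℂ),
      ⟨_, ⟨Int.fract_nonneg _, (Int.fract_lt_one _).le⟩, rfl⟩, ?_⟩)).2
    rw [Complex.dist_eq]
    have : z - (⌊z.re⌋ : ℂ) - ((Int.fract z.re : ℝ) : ℂ) = z.im * Complex.I := by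
      rw [← Int.self_sub_floor]
      apply Complex.ext <;> simp
    rw [this]
    simpa using lt_of_lt_of_le (show |z.im| < ν from hz) hνε
  have hinj := injOn_of_re_deriv_pos (isOpen_strip ν) (convex_strip ν) (hkd.mono hνsub) hpos'
  obtain ⟨K, hK1, hK2⟩ : ∃ K : ℂ → ℂ, (∀ z ∈ strip ν, K z = k z) ∧ ∀ z ∉ strip ν, K z = z := by
    classical
    exact ⟨fun z => if z ∈ strip ν then k z else z, fun z hz => if_pos hz, fun z hz => if_neg hz⟩
  have hrealν : ∀ x : ℝ, (x : ℂ) ∈ strip ν := fun x => by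
    show |(x : ℂ).im| < ν
    simpa using hν
  have hKr : ∀ x : ℝ, K x = ((h x / s : ℝ) : ℂ) := fun x => by rw [hK1 _ (hrealν x), hkr]
  have hcl : {z : ℂ | |z.im| ≤ ν / 2} ⊆ strip ν := fun z hz =>
    lt_of_le_of_lt (show |z.im| ≤ ν / 2 from hz) (by linarith)
  refine ⟨ν / 2, half_pos hν, ⟨K, ?_, ?_, ?_, ?_, ?_⟩, hKr⟩
  · exact ((hkd.mono hνsub).congr fun z hz => hK1 z hz).mono hcl
  · intro z hz w hw hzw
    rw [hK1 z (hcl hz), hK1 w (hcl hw)] at hzw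
    exact hinj (hcl hz) (hcl hw) hzw
  · intro x; rw [hKr]; simp
  · intro z
    have hiff : z + 1 ∈ strip ν ↔ z ∈ strip ν := by
      show |(z + 1).im| < ν ↔ |z.im| < ν
      simp
    by_cases hz : z ∈ strip ν
    · rw [hK1 z hz, hK1 _ (hiff.2 hz), hk1 z (hνsub hz)]
    · rw [hK2 z hz, hK2 _ (fun h => hz (hiff.1 h))]
  · intro x y hxy
    simp only [hKr, Complex.ofReal_re]
    exact div_lt_div_of_pos_right (hh.strictMono hxy) hs

lemma exists_diffeo_of_lin {F : ℝ ≃o ℝ} {ρ : ℝ} (hl : Lin (tr 1) F) (hr : RotPair (tr 1) F ρ) :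
    ∃ ν > (0 : ℝ), ∃ k : AnalyticCircleDiffeo ν,
      ∀ x : ℝ, k.toFun (F x : ℝ) = k.toFun x + ρ := by
  obtain ⟨h, hh, ⟨s, hs⟩, t, ht⟩ := hl
  have hs1 : ∀ x, h (x + 1) = h x + s := fun x => by rw [← hs]; simp
  have hs0 : 0 < s := by
    have := hh.strictMono (zero_lt_one (α := ℝ))
    have h2 := hs1 0
    rw [zero_add] at h2
    linarith
  have htρ := hr.translation_eq hh.strictMono hs ht hs0
  obtain ⟨δ, hδ, H, hH, hHr, hH1⟩ := hh.exists_strip hs1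
  obtain ⟨ν, hν, k, hk⟩ := exists_diffeo_of_strip hh hs0 hδ hH hHr hH1
  refine ⟨ν, hν, k, fun x => ?_⟩
  rw [hk, hk, ht, htρ, ← Complex.ofReal_add, add_div, mul_div_cancel_left₀ _ hs0.ne']

lemma AnalyticCircleDiffeo.map_add_int {ν : ℝ} (k : AnalyticCircleDiffeo ν) (n : ℤ) (z : ℂ) :
    k.toFun (z + n) = k.toFun z + n := by
  have hnat : ∀ (n : ℕ) (z : ℂ), k.toFun (z + n) = k.toFun z + n := by
    intro n z
    induction n with
    | zero => simp
    | succ n ih => push_cast; rw [← add_assoc, k.map_add_one, ih, add_assoc]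
  obtain ⟨p, rfl | rfl⟩ := n.eq_nat_or_neg
  · exact_mod_cast hnat p z
  · have := hnat p (z + ((-(p : ℤ) : ℤ) : ℂ))
    push_cast at this ⊢
    rw [neg_add_cancel_right] at this
    rw [this]; ring

lemma irrational_gaussIter {α : ℝ} (h : Irrational α) (n : ℕ) : Irrational (gaussIter α n) := by
  have hf : ∀ x : ℝ, Irrational x → Irrational (Int.fract x) := fun x hx => by
    rw [← Int.self_sub_floor]
    exact hx.sub_intCast _
  induction n with
  | zero => exact hf _ h
  | succ n ih => exact hf _ ih.inv

lemma gaussSeq_gaussIter {α : ℝ} (h : Irrational α) : GaussSeq (gaussIter α) where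
  pos n := by
    have h0 : 0 ≤ gaussIter α n := by cases n <;> exact Int.fract_nonneg _
    exact h0.lt_of_ne (irrational_gaussIter h n).ne_zero.symm
  lt_one n := by cases n <;> exact Int.fract_lt_one _
  succ n := rfl

lemma gaussIter_gaussIter {α : ℝ} (m n : ℕ) :
    gaussIter (gaussIter α m) n = gaussIter α (m + n) := by
  induction n with
  | zero =>
    show Int.fract _ = gaussIter α m
    refine Int.fract_eq_self.2 ?_
    cases m <;> exact ⟨Int.fract_nonneg _, Int.fract_lt_one _⟩
  | succ n ih =>
    show Int.fract _ = Int.fract _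
    rw [ih]
    rfl

lemma brjunoLE_of_brjunoFunction_le {α r : ℝ} (h : Irrational α)
    (hr : brjunoFunction α ≤ ENNReal.ofReal r) (hr0 : 0 ≤ r) :
    BrjunoLE (gaussIter α) r := by
  have hG := gaussSeq_gaussIter h
  intro n
  have h1 : ∑ i ∈ Finset.range n, ENNReal.ofReal ((∏ k ∈ Finset.range i, gaussIter α k) *
      Real.log (gaussIter α i)⁻¹) ≤ ENNReal.ofReal r := (ENNReal.sum_le_tsum _).trans hr
  rw [← ENNReal.ofReal_sum_of_nonneg fun i _ => ?_] at h1
  · exact (ENNReal.ofReal_le_ofReal_iff hr0).1 h1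
  · exact mul_nonneg (Finset.prod_nonneg fun k _ => (hG.pos k).le)
      (Real.log_nonneg ((one_le_inv₀ (hG.pos i)).2 (hG.lt_one i).le))

lemma Rseq_nonneg {α : ℝ} (h : Irrational α) (n : ℕ) : 0 ≤ Rseq α n := by
  cases n with
  | zero => exact le_rfl
  | succ n =>
    show 0 ≤ Rcal _ _
    unfold Rcal
    split_ifs with h1
    · exact mul_nonneg (inv_nonneg.2 ((gaussSeq_gaussIter h).pos n).le) (by linarith)
    · exact (Real.exp_pos _).le

end CircleLin

/-- **Yoccoz's global analytic theorem.** If `α` satisfies condition `𝓗`, then every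
orientation-preserving analytic circle diffeomorphism with rotation number `α` is
analytically linearizable. -/
theorem yoccoz_condH_linearizable (α : ℝ) (hirr : Irrational α)
    (hH : SatisfiesCondH α) (ν : ℝ) (hν : 0 < ν) (f : AnalyticCircleDiffeo ν)
    (hρ : IsRotNumber (fun x : ℝ => (f.toFun x).re) α) :
    ∃ ν' > (0 : ℝ), ∃ h : AnalyticCircleDiffeo ν',
      ∀ x : ℝ, h.toFun (f.toFun x) = h.toFun x + α := by
  open CircleLin in
  obtain ⟨F, g, g1, n, s, f1, m, t, a, a', hJ, hrot, hfF⟩ := exists_stripJet_of_diffeo hν f hρ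
  obtain ⟨K, hK⟩ := exists_lin_of_Rcal
  obtain ⟨N, G, hG, hlin⟩ := exists_good_of_holDiff hJ (half_pos hν)
    (HolDiff.of_stripJet (half_pos hν) hJ) (gaussSeq_gaussIter hirr) hrot (K / (2 * Real.pi))
  obtain ⟨k, hk⟩ := hH.2 N
  have hi := irrational_gaussIter hirr N
  have hBr := brjunoLE_of_brjunoFunction_le (irrational_gaussIter hirr (N + k)) hk
    (Rseq_nonneg hi k)
  have hLinG : Lin (tr 1) G := by
    refine hK (gaussIter (gaussIter α N)) (Rseq (gaussIter α N)) k (K / (2 * Real.pi)) G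
      (gaussSeq_gaussIter hi) rfl (fun _ => rfl) ?_ ?_ ?_
    · have e : (fun n => gaussIter (gaussIter α N) (k + n)) = gaussIter (gaussIter α (N + k)) := by
        funext n
        rw [gaussIter_gaussIter, gaussIter_gaussIter, add_assoc]
      rwa [e]
    · rw [mul_div_cancel₀ _ Real.two_pi_pos.ne']
    · rwa [gaussIter_gaussIter]
  obtain ⟨ν', hν', h, hh⟩ := exists_diffeo_of_lin (hlin hLinG) hrot
  refine ⟨ν', hν', h, fun x => ?_⟩
  rw [hfF, Complex.ofReal_add, Complex.ofReal_intCast, AnalyticCircleDiffeo.map_add_int, hh,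
    add_assoc]
  congr 1
  have := Int.fract_add_floor α
  exact_mod_cast this
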